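/- For every α > 0 there exists β = β(α) > 0 with the following property. Let μ be an (α,3)-Hölder asymptotically uniform Radon measure on ℝ⁴ and let x ∈ Σ = supp μ be a nonflat point. Then there exist a KP cone C based at 0, open neighborhoods U of 0 and U′ of x in ℝ⁴, and a C^{1,β} diffeomorphism φ : U → U′ such that φ(C ∩ U) = Σ ∩ U′, φ(0) = x, and D₀φ = Id. -/

import Mathlib

open Metric Set MeasureTheory Filter Module
open scoped RealInnerProductSpace Topology Pointwise ENNReal

noncomputable section

/-- `ℝⁿ` as a Euclidean space. -/
abbrev E (n : ℕ) : Type := EuclideanSpace ℝ (Fin n)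

/-- `d(A,B) = sup_{a ∈ A} inf_{b ∈ B} |a - b|`. -/
def setD {n : ℕ} (A B : Set (E n)) : ℝ := ⨆ a ∈ A, Metric.infDist a B

/-- `d^{x,r}(A,B) = (1/r) d(A ∩ B(x,r), B ∩ B(x,r))`. -/
def dxr {n : ℕ} (x : E n) (r : ℝ) (A B : Set (E n)) : ℝ :=
  (1 / r) * setD (A ∩ closedBall x r) (B ∩ closedBall x r)

/-- `D^{x,r}(A,B) = max(d^{x,r}(A,B), d^{x,r}(B,A))`. -/
def Dxr {n : ℕ} (x : E n) (r : ℝ) (A B : Set (E n)) : ℝ :=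
  max (dxr x r A B) (dxr x r B A)

/-- `d̃^{x,r}(A,B) = (1/r) d(A ∩ B(x,r), B)`. -/
def dtxr {n : ℕ} (x : E n) (r : ℝ) (A B : Set (E n)) : ℝ :=
  (1 / r) * setD (A ∩ closedBall x r) B

/-- `D̃^{x,r}(A,B) = max(d̃^{x,r}(A,B), d̃^{x,r}(B,A))`. -/
def Dtxr {n : ℕ} (x : E n) (r : ℝ) (A B : Set (E n)) : ℝ :=
  max (dtxr x r A B) (dtxr x r B A)

/-- `C` is a cone based at `y`: `y ∈ C` and `s • (C − y) = C − y` for all `s > 0`. -/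
def IsConeAt {n : ℕ} (y : E n) (C : Set (E n)) : Prop :=
  y ∈ C ∧ ∀ s : ℝ, 0 < s → s • {z : E n | y + z ∈ C} = {z : E n | y + z ∈ C}

/-- The standard KP cone `{x₄² = x₁² + x₂² + x₃²}` in `ℝⁿ`, `n ≥ 4`. -/
def stdKP (n : ℕ) (hn : 4 ≤ n) : Set (E n) :=
  {x : E n | (x ⟨3, by omega⟩) ^ 2 =
    (x ⟨0, by omega⟩) ^ 2 + (x ⟨1, by omega⟩) ^ 2 + (x ⟨2, by omega⟩) ^ 2}

/-- `C` is a KP cone based at `y`: in some orthonormal coordinates centered at the origin,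
`C − y` is the standard KP cone. -/
def IsKPCone {n : ℕ} (hn : 4 ≤ n) (y : E n) (C : Set (E n)) : Prop :=
  ∃ f : E n ≃ₗᵢ[ℝ] E n, {z : E n | y + z ∈ C} = f ⁻¹' stdKP n hn

/-- `θ^P_Σ(x,r)` : best approximation of `S` in `B(x,r)` by affine `m`-planes through `x`. -/
def thetaP {n : ℕ} (m : ℕ) (S : Set (E n)) (x : E n) (r : ℝ) : ℝ :=
  ⨅ L : {L : AffineSubspace ℝ (E n) // x ∈ L ∧ Module.finrank ℝ L.direction = m},
    Dxr x r S (L.1 : Set (E n))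

/-- `θ^C_Σ(x,r)` : best approximation of `S` in `B(x,r)` by KP cones based at `x`. -/
def thetaC {n : ℕ} (hn : 4 ≤ n) (S : Set (E n)) (x : E n) (r : ℝ) : ℝ :=
  ⨅ C : {C : Set (E n) // IsKPCone hn x C}, Dxr x r S C.1

/-- `ϑ^C_Σ(x,r)` : best approximation of `S` in `B(x,r)` by KP cones containing `x`. -/
def varthetaC {n : ℕ} (hn : 4 ≤ n) (S : Set (E n)) (x : E n) (r : ℝ) : ℝ :=
  ⨅ C : {C : Set (E n) // (∃ y, IsKPCone hn y C) ∧ x ∈ C}, Dxr x r S C.1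

/-- The angle `∠(P₁,P₂) = arcsin Γ(P₁,P₂)` between two affine planes. -/
def planeAngle {n : ℕ} (P₁ P₂ : AffineSubspace ℝ (E n)) : ℝ :=
  Real.arcsin (dxr (0 : E n) 1 (P₁.direction : Set (E n)) (P₂.direction : Set (E n)))

/-- The support of a measure. -/
def msupp {n : ℕ} (μ : Measure (E n)) : Set (E n) :=
  {x : E n | ∀ r : ℝ, 0 < r → 0 < μ (closedBall x r)}

/-- Weak convergence of a sequence of measures in the sense of Radon measures. -/
def VagueTendsto {n : ℕ} (μs : ℕ → Measure (E n)) (ν : Measure (E n)) : Prop :=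
  ∀ f : E n → ℝ, Continuous f → HasCompactSupport f →
    Tendsto (fun i => ∫ y, f y ∂(μs i)) atTop (nhds (∫ y, f y ∂ν))

/-- `ν` is a tangent measure of `μ` at `x`: `ν ≠ 0` and for some `rᵢ ↓ 0`, `cᵢ > 0`,
`cᵢ (T_{x,rᵢ})₊μ → ν` weakly. -/
def IsTangentMeasure {n : ℕ} (μ ν : Measure (E n)) (x : E n) : Prop :=
  ν ≠ 0 ∧ ∃ r c : ℕ → ℝ, (∀ i, 0 < r i) ∧ Tendsto r atTop (nhds 0) ∧ (∀ i, 0 < c i) ∧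
    VagueTendsto (fun i => ENNReal.ofReal (c i) • Measure.map (fun y => (r i)⁻¹ • (y - x)) μ) ν

/-- `μ` is `m`-asymptotically optimally doubling. -/
def AOD {n : ℕ} (m : ℕ) (μ : Measure (E n)) : Prop :=
  ∀ K : Set (E n), K ⊆ msupp μ → IsCompact K → ∀ δ : ℝ, 0 < δ →
    ∃ r₀ : ℝ, 0 < r₀ ∧ ∀ x ∈ K, ∀ r : ℝ, 0 < r → r ≤ r₀ →
      ∀ τ : ℝ, τ ∈ Set.Icc (1/2 : ℝ) 1 →
        |(μ (closedBall x (τ * r))).toReal / (μ (closedBall x r)).toReal - τ ^ m| < δ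

/-- `ν` is `m`-flat: `m`-dimensional Hausdorff measure restricted to an affine `m`-plane. -/
def IsFlatMeasure {n : ℕ} (m : ℕ) (ν : Measure (E n)) : Prop :=
  ∃ L : AffineSubspace ℝ (E n), (L : Set (E n)).Nonempty ∧
    Module.finrank ℝ L.direction = m ∧
    ν = (Measure.hausdorffMeasure (m : ℝ)).restrict (L : Set (E n))

/-- Volume of the unit ball in `ℝᵐ`. -/
def unitBallVol (m : ℕ) : ℝ := (volume (Metric.ball (0 : EuclideanSpace ℝ (Fin m)) 1)).toReal

/-- `ω₃`, the volume of the unit `3`-ball. -/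
def omega3 : ℝ := unitBallVol 3

/-- The second moment `Q_{0,r}` of a measure on `ℝ⁴`. -/
def Qmom (μ : Measure (E 4)) (r : ℝ) (z : E 4) : ℝ :=
  (5 / (omega3 * r ^ 5)) * ∫ w in closedBall (0 : E 4) r, ⟪z, w⟫ ^ 2 ∂μ

/-- Entries `q_{ij}` of the second moment matrix in given directions. -/
def qmom (μ : Measure (E 4)) (r : ℝ) (u v : E 4) : ℝ :=
  (5 / (omega3 * r ^ 5)) * ∫ w in closedBall (0 : E 4) r, ⟪u, w⟫ * ⟪v, w⟫ ∂μ

/-- `μ` is `(α,m)`-Hölder asymptotically uniform. -/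
def HolderAsympUniform {n : ℕ} (α : ℝ) (m : ℕ) (μ : Measure (E n)) : Prop :=
  ∀ K : Set (E n), K ⊆ msupp μ → IsCompact K →
    ∃ C r₀ : ℝ, 0 < r₀ ∧ ∀ x ∈ K, ∀ r : ℝ, 0 < r → r ≤ r₀ →
      |(μ (closedBall x r)).toReal / (unitBallVol m * r ^ m) - 1| ≤ C * r ^ α

/-- `φ` is a `C^{1,β}` diffeomorphism from `U` onto `U'`: a continuously differentiable bijection
with `β`-Hölder derivative whose inverse is also `C^{1,β}`. -/
def IsC1HolderDiffeoOn (β : ℝ) (U U' : Set (E 4)) (φ : E 4 → E 4) : Prop :=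
  Set.BijOn φ U U' ∧
  (∀ x ∈ U, HasFDerivAt φ (fderiv ℝ φ x) x) ∧
  (∃ M : ℝ, ∀ x ∈ U, ∀ y ∈ U, ‖fderiv ℝ φ x - fderiv ℝ φ y‖ ≤ M * ‖x - y‖ ^ β) ∧
  ∃ ψ : E 4 → E 4, Set.BijOn ψ U' U ∧
    (∀ x ∈ U, ψ (φ x) = x) ∧ (∀ y ∈ U', φ (ψ y) = y) ∧
    (∀ y ∈ U', HasFDerivAt ψ (fderiv ℝ ψ y) y) ∧
    (∃ M : ℝ, ∀ x ∈ U', ∀ y ∈ U', ‖fderiv ℝ ψ x - fderiv ℝ ψ y‖ ≤ M * ‖x - y‖ ^ β)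

section
abbrev V := E 4
local instance : NormedAddCommGroup V := inferInstance
local instance : SeminormedAddCommGroup V := inferInstance
local instance : InnerProductSpace ℝ V := inferInstance
local instance : NormedSpace ℝ V := inferInstance
local instance : AddCommGroup V := inferInstance
local instance : AddCommMonoid V := inferInstance
local instance : Module ℝ V := inferInstance
local instance : TopologicalSpace V := inferInstance
local instance : IsTopologicalAddGroup V := inferInstance
local instance : ContinuousSMul ℝ V := inferInstance
local instance : ContinuousAdd V := inferInstance
local instance : Norm V := inferInstance
local instance : SMul ℝ V := inferInstance
local instance : Sub V := inferInstance
local instance : Add V := inferInstance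
local instance : Neg V := inferInstance
local instance : Zero V := inferInstance
local instance : Inner ℝ V := inferInstance
local instance : AddCommGroup (V →L[ℝ] V) := inferInstance
local instance : AddCommMonoid (V →L[ℝ] V) := inferInstance
local instance : Module ℝ (V →L[ℝ] V) := inferInstance
local instance : SeminormedAddCommGroup (V →L[ℝ] V) := inferInstance
local instance : NormedAddCommGroup (V →L[ℝ] V) := inferInstance
local instance : NormedSpace ℝ (V →L[ℝ] V) := inferInstance
local instance : TopologicalSpace (V →L[ℝ] V) := inferInstance
local instance : AddMonoidHomClass (V →L[ℝ] V) V V := inferInstance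
local instance : SMul ℝ (V →L[ℝ] V) := inferInstance
local instance : AddGroup (V →L[ℝ] V) := inferInstance
local instance : IsScalarTower ℝ ℝ V := inferInstance
local instance : AddRightMono ℝ := inferInstance
local instance : AddLeftMono ℝ := inferInstance
local instance : CharZero ℝ := inferInstance
local instance : AddGroup V := inferInstance
local instance : Norm (V →L[ℝ] V) := inferInstance
local instance : FiniteDimensional ℝ V := inferInstance
local instance : T2Space V := inferInstance
def om : ℝ := unitBallVol 3
lemma om_pos : 0 < om := ENNReal.toReal_pos (measure_ball_pos _ _ one_pos).ne' measure_ball_lt_top.ne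

structure AU (m : Measure V) (S : Set V) (ε L : ℝ) : Prop where
  fin : IsFiniteMeasure m
  cl : IsClosed S
  nul : m Sᶜ = 0
  up : ∀ p t, 0 < t → m.real (closedBall p t) ≤ 16 * om * t ^ 3
  two : ∀ p ∈ S, ‖p‖ ≤ L → ∀ t, 0 < t →
    |m.real (closedBall p t) - om * t ^ 3| ≤ ε * t ^ 3 * (1 + t)

lemma LC {k g : ℝ → ℝ} (hk : IntegrableOn k (Ioi 0)) (hg : ∀ t, 0 ≤ t → ∫ u in Ioi t, k u = g t)
    (m : Measure V) [IsFiniteMeasure m] (p : V) :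
    ∫ x, g ‖x - p‖ ∂m = ∫ u in Ioi 0, k u * m.real (closedBall p u) := by
  have h1 : ∀ x : V, g ‖x - p‖ = ∫ u in Ioi (0:ℝ), {q : V × ℝ | ‖q.1 - p‖ ≤ q.2}.indicator (fun q => k q.2) (x, u) := by
    intro x
    rw [← hg _ (norm_nonneg _), ← integral_Ici_eq_integral_Ioi, ← integral_Ici_eq_integral_Ioi (x := 0)]
    have : (fun u => {q : V × ℝ | ‖q.1 - p‖ ≤ q.2}.indicator (fun q => k q.2) (x, u)) = (Ici ‖x-p‖).indicator k := by
      ext u; simp [indicator]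
    rw [this, setIntegral_indicator measurableSet_Ici]
    congr 2; ext u; simp
  have hms : MeasurableSet {q : V × ℝ | ‖q.1 - p‖ ≤ q.2} :=
    measurableSet_le (by fun_prop) (by fun_prop)
  simp_rw [h1]
  rw [integral_integral_swap (f := fun x u => {q : V × ℝ | ‖q.1 - p‖ ≤ q.2}.indicator (fun q => k q.2) (x, u))]
  · refine integral_congr_ae (.of_forall fun u => ?_)
    have : (fun x => {q : V × ℝ | ‖q.1 - p‖ ≤ q.2}.indicator (fun q => k q.2) (x, u)) = (closedBall p u).indicator (fun _ => k u) := by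
      ext x; simp [indicator, dist_eq_norm]
    simp only [this]
    rw [integral_indicator_const _ measurableSet_closedBall, smul_eq_mul, mul_comm]
  · exact (Integrable.comp_snd hk m).indicator hms

lemma gk (n : ℕ) : IntegrableOn (fun u : ℝ => u ^ n * Real.exp (-u^2)) (Ioi 0) ∧
    ∫ u in Ioi (0:ℝ), u ^ n * Real.exp (-u^2) = 1/2 * Real.Gamma ((n+1)/2) := by
  have h := integrableOn_rpow_mul_exp_neg_rpow (p := 2) (s := n) (by linarith [(Nat.cast_nonneg n : (0:ℝ) ≤ n)]) (by norm_num)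
  have h2 := integral_rpow_mul_exp_neg_rpow (p := 2) (q := n) (by norm_num) (by linarith [(Nat.cast_nonneg n : (0:ℝ) ≤ n)])
  simp only [Real.rpow_natCast, Real.rpow_ofNat] at h h2
  exact ⟨h, h2⟩

lemma gk0 (n : ℕ) : Tendsto (fun u : ℝ => u ^ n * Real.exp (-u^2)) atTop (𝓝 0) := by
  have h := Real.tendsto_pow_mul_exp_neg_atTop_nhds_zero n
  refine squeeze_zero' ?_ ?_ h
  · filter_upwards [eventually_ge_atTop 0] with u hu; positivity
  · filter_upwards [eventually_ge_atTop 1] with u hu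
    gcongr; nlinarith

lemma hk1 (t : ℝ) (ht : 0 ≤ t) : ∫ u in Ioi t, 2 * (u^1 * Real.exp (-u^2)) = Real.exp (-t^2) := by
  have := integral_Ioi_of_hasDerivAt_of_tendsto' (a := t) (f := fun u => -Real.exp (-u^2)) (m := 0)
    (f' := fun u => 2 * (u^1 * Real.exp (-u^2))) (fun x _ => by
      have := ((hasDerivAt_pow 2 x).fun_neg.exp).fun_neg
      convert this using 1; push_cast; ring)
    (IntegrableOn.mono_set ((gk 1).1.const_mul 2) (Ioi_subset_Ioi ht)) (by simpa using (gk0 0).neg)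
  simpa using this

lemma hk2 (t : ℝ) (ht : 0 ≤ t) : ∫ u in Ioi t, 2 * (u^3 * Real.exp (-u^2)) = (t^2+1) * Real.exp (-t^2) := by
  have := integral_Ioi_of_hasDerivAt_of_tendsto' (a := t) (f := fun u => -((u^2+1) * Real.exp (-u^2))) (m := 0)
    (f' := fun u => 2 * (u^3 * Real.exp (-u^2))) (fun x _ => by
      have := (((hasDerivAt_pow 2 x).add_const 1).fun_mul ((hasDerivAt_pow 2 x).fun_neg.exp)).fun_neg
      convert this using 1; push_cast; ring)
    (IntegrableOn.mono_set ((gk 3).1.const_mul 2) (Ioi_subset_Ioi ht)) (by simpa [add_mul] using ((gk0 2).add (gk0 0)).neg)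
  simpa using this

def c3 : ℝ := om * Real.Gamma (5/2)
lemma c3_pos : 0 < c3 := mul_pos om_pos (Real.Gamma_pos_of_pos (by norm_num))

/-- generic estimate -/
lemma LCb {m : Measure V} {S : Set V} {ε L : ℝ} (h : AU m S ε L) {p : V} (hp : p ∈ S) (hL : ‖p‖ ≤ L) (n : ℕ) :
    |(∫ u in Ioi (0:ℝ), 2 * (u^n * Real.exp (-u^2)) * m.real (closedBall p u))
      - om * Real.Gamma ((n+4)/2)| ≤ ε * (Real.Gamma ((n+4)/2) + Real.Gamma ((n+5)/2)) := by
  have := h.fin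
  have e3 := gk (n+3); have e4 := gk (n+4)
  have r3 : ((n+3:ℕ):ℝ)+1 = n+4 := by push_cast; ring
  have r4 : ((n+4:ℕ):ℝ)+1 = n+5 := by push_cast; ring
  rw [r3] at e3; rw [r4] at e4
  have i1 : IntegrableOn (fun u : ℝ => 2 * (u^n * Real.exp (-u^2)) * m.real (closedBall p u)) (Ioi 0) := by
    refine Integrable.mul_bdd (c := m.real univ) ((gk n).1.const_mul 2) ?_ ?_
    · have : Monotone (fun u => m.real (closedBall p u)) := fun a b hab =>
        measureReal_mono (closedBall_subset_closedBall hab) 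
      exact this.measurable.aestronglyMeasurable
    · refine .of_forall fun u => ?_
      rw [Real.norm_of_nonneg measureReal_nonneg]; exact measureReal_mono (subset_univ _)
  have e : om * Real.Gamma ((n+4)/2) = ∫ u in Ioi (0:ℝ), om * 2 * (u^(n+3) * Real.exp (-u^2)) := by
    rw [integral_const_mul, e3.2]; ring
  rw [e, ← integral_sub i1 (e3.1.const_mul _), ← Real.norm_eq_abs]
  refine (norm_integral_le_of_norm_le (g := fun u => (2*ε) * (u^(n+3) * Real.exp (-u^2)) + (2*ε)*(u^(n+4) * Real.exp (-u^2))) ((e3.1.const_mul _).add (e4.1.const_mul _)) ?_).trans ?_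
  · refine (ae_restrict_iff' measurableSet_Ioi).2 (.of_forall fun u hu => ?_)
    have h0 : (0:ℝ) < u := hu
    have h1 := h.two p hp hL u hu
    have : 2 * (u ^ n * Real.exp (-u ^ 2)) * m.real (closedBall p u) - om * 2 * (u ^ (n + 3) * Real.exp (-u ^ 2)) = 2 * (u ^ n * Real.exp (-u ^ 2)) * (m.real (closedBall p u) - om * u^3) := by ring
    rw [this, norm_mul, Real.norm_of_nonneg (by positivity), Real.norm_eq_abs]
    calc _ ≤ 2 * (u ^ n * Real.exp (-u ^ 2)) * (ε * u^3*(1+u)) := by gcongr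
      _ = _ := by ring
  · rw [integral_add (e3.1.const_mul _) (e4.1.const_mul _), integral_const_mul, integral_const_mul, e3.2, e4.2]
    apply le_of_eq; ring

lemma H0 {m : Measure V} {S : Set V} {ε L : ℝ} (h : AU m S ε L) {p : V} (hp : p ∈ S) (hL : ‖p‖ ≤ L) :
    |(∫ x, Real.exp (-‖x-p‖^2) ∂m) - c3| ≤ 4 * ε := by
  have := h.fin
  rw [LC (g := fun t => Real.exp (-t^2)) ((gk 1).1.const_mul 2) hk1]
  have := LCb h hp hL 1
  have e1 : Real.Gamma (((1:ℕ)+4)/2) = Real.Gamma (5/2) := by norm_num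
  have e2 : Real.Gamma (((1:ℕ)+5)/2) = 2 := by
    rw [show (((1:ℕ):ℝ)+5)/2 = (2:ℕ)+1 by norm_num, Real.Gamma_nat_eq_factorial]; norm_num
  have e3 : Real.Gamma (5/2) ≤ 2 := by
    rw [show (5/2:ℝ) = 3/2+1 by norm_num, Real.Gamma_add_one (by norm_num), show (3/2:ℝ) = 1/2+1 by norm_num, Real.Gamma_add_one (by norm_num), Real.Gamma_one_half_eq]
    have : √Real.pi ≤ 2 := by rw [Real.sqrt_le_left (by norm_num)]; linarith [Real.pi_le_four]
    linarith
  rw [e1, e2] at this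
  have e0 : 0 ≤ ε := by have := h.two p hp hL 1 one_pos; linarith [abs_nonneg (m.real (closedBall p 1) - om * 1 ^ 3)]
  refine this.trans ?_
  nlinarith only [e3, e0]

lemma H2 {m : Measure V} {S : Set V} {ε L : ℝ} (h : AU m S ε L) (h0 : (0:V) ∈ S) (hL : 0 ≤ L) :
    |(∫ x, ‖x‖^2 * Real.exp (-‖x‖^2) ∂m) - 3/2 * c3| ≤ 15 * ε := by
  have := h.fin
  have a := LC (g := fun t => (t^2+1) * Real.exp (-t^2)) ((gk 3).1.const_mul 2) hk2 m 0
  have b := H0 h h0 (by simpa using hL)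
  have := LCb h h0 (by simpa using hL) 3
  rw [← a] at this
  have i1 : Integrable (fun x : V => Real.exp (-‖x‖^2)) m := by
    refine Integrable.of_bound (by fun_prop) 1 (.of_forall fun x => ?_)
    rw [Real.norm_of_nonneg (by positivity)]; simp
  have i2 : Integrable (fun x : V => ‖x‖^2 * Real.exp (-‖x‖^2)) m := by
    refine Integrable.of_bound (by fun_prop) 1 (.of_forall fun x => ?_)
    rw [Real.norm_of_nonneg (by positivity), Real.exp_neg, mul_inv_le_iff₀ (Real.exp_pos _)]
    linarith [Real.add_one_le_exp (‖x‖^2)]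
  simp only [sub_zero, add_mul, one_mul] at this b
  rw [integral_add i2 i1] at this
  have e1 : Real.Gamma (((3:ℕ)+4)/2) = 5/2 * Real.Gamma (5/2) := by
    rw [show (((3:ℕ):ℝ)+4)/2 = 5/2+1 by norm_num, Real.Gamma_add_one (by norm_num)]
  have e2 : Real.Gamma (((3:ℕ)+5)/2) = 6 := by
    rw [show (((3:ℕ):ℝ)+5)/2 = (3:ℕ)+1 by norm_num, Real.Gamma_nat_eq_factorial]; norm_num [Nat.factorial]
  have e3 : Real.Gamma (5/2) ≤ 2 := by
    rw [show (5/2:ℝ) = 3/2+1 by norm_num, Real.Gamma_add_one (by norm_num), show (3/2:ℝ) = 1/2+1 by norm_num, Real.Gamma_add_one (by norm_num), Real.Gamma_one_half_eq]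
    have : √Real.pi ≤ 2 := by rw [Real.sqrt_le_left (by norm_num)]; linarith [Real.pi_le_four]
    linarith
  rw [e1, e2] at this
  have e0 : 0 ≤ ε := by have := h.two 0 h0 (by simpa using hL) 1 one_pos; linarith only [this, abs_nonneg (m.real (closedBall (0:V) 1) - om * 1 ^ 3)]
  unfold c3 at *
  rw [abs_le] at *
  constructor <;> nlinarith

lemma Hexp {m : Measure V} {S : Set V} {ε L : ℝ} (h : AU m S ε L) (p : V) :
    Integrable (fun x => Real.exp (-‖x-p‖)) m ∧ ∫ x, Real.exp (-‖x-p‖) ∂m ≤ 96 * om := by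
  have := h.fin
  have hk : ∀ t, 0 ≤ t → ∫ u in Ioi t, Real.exp (-u) = Real.exp (-t) := fun t _ => integral_exp_neg_Ioi t
  have hi : IntegrableOn (fun u => Real.exp (-u)) (Ioi (0:ℝ)) := by simpa using exp_neg_integrableOn_Ioi 0 one_pos
  refine ⟨?_, ?_⟩
  · refine Integrable.of_bound (by fun_prop) 1 (.of_forall fun x => ?_)
    rw [Real.norm_of_nonneg (by positivity)]; simp
  rw [LC (g := fun t => Real.exp (-t)) hi hk]
  have hG := Real.GammaIntegral_convergent (s := 4) (by norm_num)
  have hG2 := Real.Gamma_eq_integral (s := 4) (by norm_num)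
  norm_num at hG hG2
  have h6 : Real.Gamma 4 = 6 := by
    rw [show (4:ℝ) = (3:ℕ)+1 by norm_num, Real.Gamma_nat_eq_factorial]; norm_num [Nat.factorial]
  have : 96 * om = ∫ u in Ioi (0:ℝ), 16 * om * (Real.exp (-u) * u^3) := by
    rw [integral_const_mul, ← hG2]; ring
  rw [this]
  refine integral_mono_of_nonneg (.of_forall fun u => by positivity) (hG.const_mul _) ?_
  refine (ae_restrict_iff' measurableSet_Ioi).2 (.of_forall fun u hu => ?_)
  have := h.up p u hu
  have := mul_le_mul_of_nonneg_left this (Real.exp_pos (-u)).le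
  simp only; linarith
def wt (x : V) : ℝ := Real.exp (-‖x‖^2)
lemma wt_pos (x : V) : 0 < wt x := Real.exp_pos _
lemma wt_cont : Continuous wt := by unfold wt; fun_prop
lemma exp_rem (u : ℝ) (n : ℕ) : |Real.exp u - ∑ k ∈ Finset.range n, u^k / k.factorial| ≤ |u|^n * Real.exp |u| := by
  have := Complex.norm_exp_sub_sum_le_norm_mul_exp (u:ℂ) n
  simpa [← Complex.ofReal_exp, ← Complex.ofReal_pow, ← Complex.ofReal_natCast, ← Complex.ofReal_div, ← Complex.ofReal_sum, ← Complex.ofReal_sub, Complex.norm_real] using this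
/-- `t^n e^{at} e^{-t²} ≤ C e^{-t}` -/
lemma pgb (n : ℕ) (a t : ℝ) (ht : 0 ≤ t) :
    t^n * Real.exp (a*t) * Real.exp (-t^2) ≤ n.factorial * Real.exp ((a+2)^2/4) * Real.exp (-t) := by
  have h := Real.pow_div_factorial_le_exp t ht n
  rw [div_le_iff₀ (by positivity)] at h
  calc _ ≤ (Real.exp t * n.factorial) * Real.exp (a*t) * Real.exp (-t^2) := by gcongr
    _ = n.factorial * Real.exp (t + a*t - t^2) := by rw [sub_eq_add_neg, Real.exp_add, Real.exp_add]; ring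
    _ ≤ n.factorial * Real.exp ((a+2)^2/4 + -t) := by
      gcongr; linarith only [sq_nonneg (t - (a+2)/2)]
    _ = _ := by rw [Real.exp_add]; ring
lemma pgb0 (n : ℕ) (x : V) : ‖x‖^n * wt x ≤ n.factorial * 3 * Real.exp (-‖x-0‖) := by
  have := pgb n 0 ‖x‖ (norm_nonneg _)
  have h3 : Real.exp ((0+2)^2/4) ≤ 3 := by norm_num; linarith [Real.exp_one_lt_d9]
  simp only [zero_mul, Real.exp_zero, mul_one, sub_zero] at *
  refine this.trans (by gcongr)
/-- integrals dominated by `e^{-|x|}` -/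
lemma domI {F : Type*} [NormedAddCommGroup F] [NormedSpace ℝ F] {m : Measure V} {S : Set V} {ε L : ℝ} (h : AU m S ε L)
    {f : V → F} (hf : Continuous f) {C : ℝ} (hC : 0 ≤ C) (hb : ∀ x, ‖f x‖ ≤ C * Real.exp (-‖x-0‖)) :
    Integrable f m ∧ ‖∫ x, f x ∂m‖ ≤ C * (96*om) := by
  have ⟨i, b⟩ := Hexp h 0
  have j : Integrable f m := (i.const_mul C).mono' hf.aestronglyMeasurable (.of_forall hb)
  refine ⟨j, (norm_integral_le_of_norm_le (i.const_mul C) (.of_forall hb)).trans ?_⟩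
  rw [integral_const_mul]; gcongr
def bG (m : Measure V) : V := c3⁻¹ • ∫ x, wt x • x ∂m
def FG (m : Measure V) : V →L[ℝ] V := (2/c3) • (∫ x, wt x • (innerSL ℝ x).smulRight x ∂m) - ContinuousLinearMap.id ℝ V
def K0 : ℝ := 96*om/c3
lemma K0_pos : 0 < K0 := by have := om_pos; have := c3_pos; unfold K0; positivity
section
variable {m : Measure V} {S : Set V} {ε L : ℝ} (h : AU m S ε L)
include h
lemma bG_int : Integrable (fun x : V => wt x • x) m ∧ ‖∫ x, wt x • x ∂m‖ ≤ 3*(96*om) := by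
  have := wt_cont
  refine domI h (by fun_prop) (by norm_num) fun x => ?_
  rw [norm_smul, Real.norm_of_nonneg (wt_pos x).le]
  have := pgb0 1 x; simp at this ⊢; linarith
lemma FG_int : Integrable (fun x : V => wt x • (innerSL ℝ x).smulRight x) m ∧ ‖∫ x, wt x • (innerSL ℝ x).smulRight x ∂m‖ ≤ 6*(96*om) := by
  have := wt_cont
  have hc : Continuous fun x : V => (innerSL ℝ x).smulRight x :=
    ((ContinuousLinearMap.smulRightL ℝ V V).continuous₂).comp ((innerSL ℝ (E := V)).continuous.prodMk continuous_id)
  refine domI h (by fun_prop) (by norm_num) fun x => ?_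
  rw [norm_smul, Real.norm_of_nonneg (wt_pos x).le, ContinuousLinearMap.norm_smulRight_apply, innerSL_apply_norm]
  have := pgb0 2 x; simp [Nat.factorial] at this ⊢; linarith
lemma inner_bG (z : V) : ⟪bG m, z⟫ = c3⁻¹ * ∫ x, wt x * ⟪x, z⟫ ∂m := by
  rw [bG, real_inner_smul_left, real_inner_comm, ← integral_inner (bG_int h).1]
  simp only [real_inner_smul_right, real_inner_comm]
lemma inner_FG (z w : V) : ⟪FG m z, w⟫ = (2/c3) * (∫ x, wt x * (⟪x, z⟫ * ⟪x, w⟫) ∂m) - ⟪z, w⟫ := by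
  have i := (FG_int h).1
  simp only [FG, _root_.sub_apply, _root_.smul_apply, inner_sub_left, real_inner_smul_left, ContinuousLinearMap.id_apply]
  rw [ContinuousLinearMap.integral_apply i, real_inner_comm, ← integral_inner (i.apply_continuousLinearMap z)]
  simp [real_inner_smul_right, real_inner_comm]
lemma nbG : ‖bG m‖ ≤ 3*K0 := by
  have := (bG_int h).2; have c := c3_pos
  rw [bG, norm_smul, norm_inv, Real.norm_of_nonneg c.le, inv_mul_le_iff₀ c]
  unfold K0; rw [mul_div_assoc', mul_div_cancel₀ _ c.ne']; exact this
lemma nFG : ‖FG m‖ ≤ 12*K0+1 := by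
  have := (FG_int h).2; have c := c3_pos
  refine (norm_sub_le _ _).trans (add_le_add ?_ ContinuousLinearMap.norm_id_le)
  rw [norm_smul, norm_div, Real.norm_of_nonneg c.le, Real.norm_ofNat, div_mul_eq_mul_div, div_le_iff₀ c]
  unfold K0; rw [mul_div_assoc', div_mul_cancel₀ _ c.ne']; linarith
lemma FG_sym (z w : V) : ⟪FG m z, w⟫ = ⟪z, FG m w⟫ := by
  rw [real_inner_comm (FG m w), inner_FG h, inner_FG h, real_inner_comm z w]; simp only [mul_comm]
lemma FG_ge (z : V) : -‖z‖^2 ≤ ⟪FG m z, z⟫ := by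
  rw [inner_FG h, real_inner_self_eq_norm_sq]
  have : 0 ≤ ∫ x, wt x * (⟪x, z⟫ * ⟪x, z⟫) ∂m := integral_nonneg fun x => mul_nonneg (wt_pos x).le (mul_self_nonneg _)
  have := mul_nonneg (div_nonneg zero_le_two c3_pos.le) this
  linarith
lemma FG_qint (z w : V) : Integrable (fun x => wt x * (⟪x, z⟫ * ⟪x, w⟫)) m := by
  have := (((FG_int h).1.apply_continuousLinearMap z).inner_const w (𝕜 := ℝ))
  refine this.congr (.of_forall fun x => ?_)
  simp [real_inner_smul_left]
lemma FG_tr (h0 : (0:V) ∈ S) (hL : 0 ≤ L) (e : OrthonormalBasis (Fin 4) ℝ V) :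
    |∑ i, ⟪FG m (e i), e i⟫ + 1| ≤ 30/c3 * ε := by
  have : ∑ i, ⟪FG m (e i), e i⟫ + 1 = (2/c3) * ((∫ x, ‖x‖^2 * Real.exp (-‖x‖^2) ∂m) - 3/2*c3) := by
    simp only [inner_FG h, Finset.sum_sub_distrib, ← Finset.mul_sum]
    rw [← integral_finsetSum _ fun i _ => FG_qint h _ _]
    have e1 : ∀ x : V, ∑ i, wt x * (⟪x, e i⟫ * ⟪x, e i⟫) = ‖x‖^2 * Real.exp (-‖x‖^2) := by
      intro x; rw [← Finset.mul_sum, mul_comm]; unfold wt; congr 1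
      rw [← e.sum_sq_norm_inner_left x]; simp [pow_two]
    simp only [e1]
    have := c3_pos.ne'
    simp; field_simp; ring
  rw [this, abs_mul, abs_of_pos (div_pos two_pos c3_pos)]
  have := H2 h h0 hL
  calc _ ≤ 2/c3 * (15*ε) := by have := c3_pos; gcongr
    _ = _ := by ring
def KS : ℝ := 48 * Real.exp 4 * K0 + 3 + 15/c3
lemma STAR (h0 : (0:V) ∈ S) (hL : 1 ≤ L) {z : V} (hz : z ∈ S) (hz1 : ‖z‖ ≤ 1) :
    |2 * ⟪bG m, z⟫ + ⟪FG m z, z⟫| ≤ KS * (‖z‖^3 + ε) := by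
  have c := c3_pos
  have := wt_cont
  have a0 := H0 h h0 (by simp; linarith)
  have az := H0 h hz (hz1.trans hL)
  simp only [sub_zero] at a0
  set A := ∫ x, Real.exp (-‖x‖^2) ∂m
  set B := ∫ x, Real.exp (-‖x-z‖^2) ∂m
  set R : V → ℝ := fun x => wt x * (Real.exp (2*⟪x,z⟫) - (1 + 2*⟪x,z⟫ + 2*(⟪x,z⟫*⟪x,z⟫))) with hR
  have rb : ∀ x, ‖R x‖ ≤ (48 * Real.exp 4 * ‖z‖^3) * Real.exp (-‖x-0‖) := by
    intro x
    have h1 := exp_rem (2*⟪x,z⟫) 3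
    simp only [Finset.sum_range_succ, Finset.sum_range_zero, Nat.factorial] at h1
    norm_num at h1
    have h2 : 1 + 2 * ⟪x,z⟫ + (2 * ⟪x,z⟫)^2/2 = (1 + 2*⟪x,z⟫ + 2*(⟪x,z⟫*⟪x,z⟫)) := by ring
    rw [h2] at h1
    have h3 := abs_real_inner_le_norm x z
    rw [hR, norm_mul, Real.norm_of_nonneg (wt_pos x).le, Real.norm_eq_abs]
    have h4 : ‖x‖*‖z‖ ≤ ‖x‖ := mul_le_of_le_one_right (norm_nonneg _) hz1
    have h5 := pgb 3 2 ‖x‖ (norm_nonneg _)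
    norm_num [Nat.factorial] at h5
    calc _ ≤ wt x * ((2*|⟪x,z⟫|)^3 * Real.exp (2*|⟪x,z⟫|)) := by
            gcongr; exact (wt_pos x).le
      _ ≤ wt x * ((2*(‖x‖*‖z‖))^3 * Real.exp (2*‖x‖)) := by
            gcongr; exact (wt_pos x).le; exact h3.trans h4
      _ = 8*‖z‖^3 * (‖x‖^3 * Real.exp (2*‖x‖) * Real.exp (-‖x‖^2)) := by unfold wt; ring
      _ ≤ 8*‖z‖^3 * (6 * Real.exp 4 * Real.exp (-‖x‖)) := by gcongr
      _ = _ := by rw [sub_zero]; ring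
  have ⟨ri, rn⟩ := domI h (f := R) (by rw [hR]; fun_prop) (by positivity) rb
  have i1 : Integrable (fun x => wt x) m := by
    refine (domI h (f := wt) wt_cont (C := 3) (by norm_num) fun x => ?_).1
    have := pgb0 0 x; simpa [abs_of_pos (wt_pos x)] using this
  have i2 : Integrable (fun x => wt x * ⟪x,z⟫) m := by
    have := (bG_int h).1.inner_const z (𝕜 := ℝ)
    simpa only [real_inner_smul_left] using this
  have i3 := FG_qint h z z
  have key : ∫ x, R x ∂m = Real.exp (‖z‖^2) * B - A - 2*(c3 * ⟪bG m, z⟫) - c3 * (⟪FG m z, z⟫ + ‖z‖^2) := by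
    have e1 : ∀ x, R x = Real.exp (‖z‖^2) * Real.exp (-‖x-z‖^2) - wt x - 2*(wt x * ⟪x,z⟫) - 2*(wt x * (⟪x,z⟫*⟪x,z⟫)) := by
      intro x
      have : Real.exp (‖z‖^2) * Real.exp (-‖x-z‖^2) = wt x * Real.exp (2*⟪x,z⟫) := by
        unfold wt; rw [← Real.exp_add, ← Real.exp_add, norm_sub_sq_real]; ring_nf
      rw [this]; simp only [hR]; ring
    have := h.fin
    have i0 : Integrable (fun x => Real.exp (-‖x-z‖^2)) m :=
      Integrable.of_bound (by fun_prop) 1 (.of_forall fun x => by rw [Real.norm_of_nonneg (by positivity)]; simp)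
    simp only [e1]
    have j0 := i0.const_mul (Real.exp (‖z‖^2))
    have j1 : Integrable (fun x => Real.exp (‖z‖^2) * Real.exp (-‖x-z‖^2) - wt x) m := j0.sub i1
    have j2 : Integrable (fun x => Real.exp (‖z‖^2) * Real.exp (-‖x-z‖^2) - wt x - 2*(wt x * ⟪x,z⟫)) m := j1.sub (i2.const_mul _)
    rw [integral_sub j2 (i3.const_mul _), integral_sub j1 (i2.const_mul _), integral_sub j0 i1, integral_const_mul,
      integral_const_mul, integral_const_mul, inner_bG h, inner_FG h, real_inner_self_eq_norm_sq]
    simp only [wt, A, B]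
    field_simp; ring
  have e0 : 0 ≤ ε := by linarith [abs_nonneg (A - c3)]
  have he : |Real.exp (‖z‖^2) - 1 - ‖z‖^2| ≤ 3 * ‖z‖^3 := by
    have h1 := exp_rem (‖z‖^2) 2
    simp [Finset.sum_range_succ, Nat.factorial] at h1
    have h2 : Real.exp (‖z‖^2) ≤ 3 := by
      refine (Real.exp_le_exp.2 (pow_le_one₀ (norm_nonneg _) hz1 : ‖z‖^2 ≤ 1)).trans ?_
      linarith [Real.exp_one_lt_d9]
    have h3 : (‖z‖^2)^2 ≤ ‖z‖^3 := by
      rw [← pow_mul]; exact pow_le_pow_of_le_one (norm_nonneg _) hz1 (by norm_num)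
    rw [show Real.exp (‖z‖^2) - 1 - ‖z‖^2 = Real.exp (‖z‖^2) - (1 + ‖z‖^2) by ring]
    nlinarith only [h1, h3, h2]
  have h2 : Real.exp (‖z‖^2) ≤ 2.75 := by
    refine (Real.exp_le_exp.2 (pow_le_one₀ (norm_nonneg _) hz1 : ‖z‖^2 ≤ 1)).trans ?_
    linarith [Real.exp_one_lt_d9]
  have ident : c3 * (2 * ⟪bG m, z⟫ + ⟪FG m z, z⟫) =
      Real.exp (‖z‖^2) * (B - c3) - (A - c3) + c3 * (Real.exp (‖z‖^2) - 1 - ‖z‖^2) - ∫ x, R x ∂m := by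
    rw [key]; ring
  have fin : |c3 * (2 * ⟪bG m, z⟫ + ⟪FG m z, z⟫)| ≤ 2.75*(4*ε) + 4*ε + c3*(3*‖z‖^3) + 48 * Real.exp 4 * ‖z‖^3 * (96*om) := by
    rw [ident]
    have t1 : |Real.exp (‖z‖^2) * (B - c3)| ≤ 2.75*(4*ε) := by
      rw [abs_mul, abs_of_pos (Real.exp_pos _)]; gcongr
    have t2 : |c3 * (Real.exp (‖z‖^2) - 1 - ‖z‖^2)| ≤ c3*(3*‖z‖^3) := by
      rw [abs_mul, abs_of_pos c]; gcongr
    rw [Real.norm_eq_abs] at rn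
    rw [abs_le] at *
    constructor <;> linarith [t1.1, t1.2, t2.1, t2.2, rn.1, rn.2, a0.1, a0.2]
  rw [abs_mul, abs_of_pos c] at fin
  rw [← mul_le_mul_iff_right₀ c]
  refine fin.trans ?_
  have hk : c3 * KS = 48 * Real.exp 4 * (96*om) + 3*c3 + 15 := by
    unfold KS K0; field_simp
  have : c3 * (KS * (‖z‖^3 + ε)) = (48 * Real.exp 4 * (96*om) + 3*c3 + 15) * (‖z‖^3+ε) := by rw [← hk]; ring
  rw [this]
  have := om_pos
  have : 0 ≤ (48 * Real.exp 4 * (96*om) + 3*c3) * ε := by positivity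
  linarith only [this, pow_nonneg (norm_nonneg z) 3]
end
def rs (y : V) (l : ℝ) (m : Measure V) : Measure V := ENNReal.ofReal ((l^3)⁻¹) • m.map (fun z => l⁻¹ • (z - y))
def rS (y : V) (l : ℝ) (S : Set V) : Set V := {z | y + l • z ∈ S}
lemma rs_real {y : V} {l : ℝ} (hl : 0 < l) {m : Measure V} {p : V} {t : ℝ} :
    (rs y l m).real (closedBall p t) = (l^3)⁻¹ * m.real (closedBall (y + l • p) (l*t)) := by
  have : (fun z => l⁻¹ • (z - y)) ⁻¹' closedBall p t = closedBall (y + l • p) (l*t) := by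
    ext z; simp only [mem_preimage, mem_closedBall, dist_eq_norm]
    have : z - (y + l • p) = l • (l⁻¹ • (z - y) - p) := by
      rw [smul_sub, smul_inv_smul₀ hl.ne']; abel
    rw [this, norm_smul, Real.norm_of_nonneg hl.le, mul_le_mul_iff_right₀ hl]
  rw [rs, measureReal_ennreal_smul_apply, ENNReal.toReal_ofReal (by positivity), measureReal_def,
    Measure.map_apply (by fun_prop) measurableSet_closedBall, this, measureReal_def]
lemma AU.rs {m : Measure V} {S : Set V} {ε L : ℝ} (h : AU m S ε L) {y : V} {l L' : ℝ} (hl : 0 < l) (hl1 : l ≤ 1)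
    (he : 0 ≤ ε) (hL : ‖y‖ + l * L' ≤ L) : AU (rs y l m) (rS y l S) ε L' where
  fin := by
    have := h.fin
    exact ⟨by rw [_root_.rs, Measure.smul_apply, smul_eq_mul]; exact ENNReal.mul_lt_top ENNReal.ofReal_lt_top (measure_lt_top _ _)⟩
  cl := h.cl.preimage (by fun_prop)
  nul := by
    rw [_root_.rs, Measure.smul_apply, Measure.map_apply (by fun_prop) (show MeasurableSet (rS y l S)ᶜ from ((h.cl.preimage (by fun_prop : Continuous fun z : V => y + l • z)).isOpen_compl.measurableSet))]
    have : (fun z => l⁻¹ • (z - y)) ⁻¹' (rS y l S)ᶜ = Sᶜ := by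
      ext z; simp [rS, smul_inv_smul₀ hl.ne']
    rw [this, h.nul, smul_zero]
  up p t ht := by
    rw [rs_real hl, inv_mul_le_iff₀ (by positivity)]
    have := h.up (y + l • p) (l*t) (by positivity)
    rw [mul_pow] at this; linarith
  two p hp hpL t ht := by
    rw [rs_real hl]
    have := h.two (y + l • p) hp ((norm_add_le _ _).trans ((add_le_add_right (by rw [norm_smul, Real.norm_of_nonneg hl.le]; gcongr) _).trans hL)) (l*t) (by positivity)
    have e : (l^3)⁻¹ * m.real (closedBall (y + l • p) (l*t)) - om * t^3 = (l^3)⁻¹ * (m.real (closedBall (y + l • p) (l*t)) - om * (l*t)^3) := by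
      field_simp
    rw [e, abs_mul, abs_of_pos (by positivity), inv_mul_le_iff₀ (by positivity)]
    refine this.trans ?_
    have : l*t ≤ t := by nlinarith only [hl1, ht]
    calc ε * (l*t)^3 * (1+l*t) ≤ ε * (l*t)^3 * (1+t) := by gcongr
      _ = _ := by ring
def KE : ℝ := 6272 * om
lemma E2 {m : Measure V} {S : Set V} {ε L : ℝ} (h : AU m S ε L) (p : V) {R η : ℝ} (hR : 0 < R) (hη : 0 < η) (hη1 : η ≤ 1)
    {u n : V} (hu : ‖u‖ = 1) (hn : ‖n‖ = 1) (hun : ⟪u, n⟫ = 0) :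
    m.real {z | z ∈ closedBall p R ∧ |⟪z - p, u⟫| ≤ η*R ∧ |⟪z - p, n⟫| ≤ η*R} ≤ KE * η * R^3 := by
  have := h.fin
  obtain ⟨e, he⟩ := Orthonormal.exists_orthonormalBasis_extension_of_card_eq (ι := Fin 4) (𝕜 := ℝ) (E := V) (by simp)
    (v := ![u, n, 0, 0]) (s := {0, 1}) (by
      constructor
      · rintro ⟨i, hi⟩; rcases hi with rfl | rfl <;> simp [hu, hn]
      · rintro ⟨i, hi⟩ ⟨j, hj⟩ hij
        rcases hi with rfl | rfl <;> rcases hj with rfl | rfl <;> simp_all [real_inner_comm])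
  have e0 : e 0 = u := he 0 (by simp)
  have e1 : e 1 = n := he 1 (by simp)
  set N : ℤ := ⌈1/η⌉ + 1
  set I : Finset (ℤ × ℤ) := Finset.Icc (-N) N ×ˢ Finset.Icc (-N) N
  set c : ℤ × ℤ → V := fun q => p + ((q.1:ℝ) * (η*R)) • e 2 + ((q.2:ℝ)*(η*R)) • e 3
  have hr : 0 < η*R := by positivity
  have cov : {z | z ∈ closedBall p R ∧ |⟪z - p, u⟫| ≤ η*R ∧ |⟪z - p, n⟫| ≤ η*R} ⊆ ⋃ q ∈ I, closedBall (c q) (2*(η*R)) := by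
    rintro z ⟨hz, h1, h2⟩
    rw [mem_closedBall, dist_eq_norm] at hz
    simp only [mem_iUnion]
    have fl : ∀ w : V, ‖w‖ = 1 → ⌊⟪z-p, w⟫/(η*R)⌋ ∈ Finset.Icc (-N) N := by
      intro w hw
      have a : |⟪z-p, w⟫| ≤ R := (abs_real_inner_le_norm (z-p) w).trans (by rw [hw, mul_one]; exact hz)
      rw [abs_le] at a
      have b : ⟪z-p, w⟫/(η*R) ≤ 1/η := by rw [div_le_div_iff₀ hr hη]; nlinarith only [hη, a]
      have b' : -(1/η) ≤ ⟪z-p, w⟫/(η*R) := by rw [← neg_div, div_le_div_iff₀ hη hr]; nlinarith only [hη, a]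
      have c1 := Int.le_ceil (1/η)
      rw [Finset.mem_Icc]; constructor
      · rw [Int.le_floor]; push_cast [N]; linarith
      · have := Int.floor_le (⟪z-p, w⟫/(η*R))
        have : (⌊⟪z-p, w⟫/(η*R)⌋:ℝ) ≤ (⌈1/η⌉:ℤ) := by linarith
        have := Int.cast_le.1 this
        omega
    refine ⟨(⌊⟪z-p, e 2⟫/(η*R)⌋, ⌊⟪z-p, e 3⟫/(η*R)⌋), Finset.mem_product.2 ⟨fl _ (e.norm_eq_one 2), fl _ (e.norm_eq_one 3)⟩, ?_⟩
    rw [mem_closedBall, dist_eq_norm]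
    refine abs_le_of_sq_le_sq' ?_ (by positivity) |>.2
    rw [← e.sum_sq_norm_inner_left]
    have rem : ∀ x : ℝ, |x - ⌊x/(η*R)⌋ * (η*R)| ≤ η*R := by
      intro x
      have a := Int.floor_le (x/(η*R)); have b := Int.lt_floor_add_one (x/(η*R))
      rw [le_div_iff₀ hr] at a; rw [div_lt_iff₀ hr] at b
      rw [abs_le]; constructor <;> linarith
    have r2 := rem ⟪z-p, e 2⟫; have r3 := rem ⟪z-p, e 3⟫
    rw [← e0] at h1; rw [← e1] at h2
    have o := e.inner_eq_ite
    have t : z - c (⌊⟪z-p, e 2⟫/(η*R)⌋, ⌊⟪z-p, e 3⟫/(η*R)⌋) = (z-p) - ((⌊⟪z-p, e 2⟫/(η*R)⌋:ℝ) * (η*R)) • e 2 - ((⌊⟪z-p, e 3⟫/(η*R)⌋:ℝ)*(η*R)) • e 3 := by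
      simp only [c]; abel
    rw [t]
    have sq : ∀ x : ℝ, |x| ≤ η*R → x^2 ≤ (η*R)^2 := fun x hx => sq_le_sq' (abs_le.1 hx).1 (abs_le.1 hx).2
    have s0 := sq _ h1; have s1 := sq _ h2; have s2 := sq _ r2; have s3 := sq _ r3
    simp only [Fin.sum_univ_four, inner_sub_left (𝕜 := ℝ) (_ - _) _ _, inner_sub_left (𝕜 := ℝ) (z-p) _ _, real_inner_smul_left, o, Real.norm_eq_abs, sq_abs]
    simp only [Fin.reduceEq, if_true, if_false, mul_one, mul_zero, sub_zero]
    linarith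
  calc _ ≤ m.real (⋃ q ∈ I, closedBall (c q) (2*(η*R))) := measureReal_mono cov (measure_ne_top _ _)
    _ ≤ ∑ q ∈ I, m.real (closedBall (c q) (2*(η*R))) := measureReal_biUnion_finset_le _ _
    _ ≤ ∑ q ∈ I, 16*om*(2*(η*R))^3 := Finset.sum_le_sum fun q _ => h.up _ _ (by positivity)
    _ = (I.card:ℝ) * (16*om*(2*(η*R))^3) := by simp
    _ ≤ (49/η^2) * (16*om*(2*(η*R))^3) := by
      have := om_pos
      gcongr
      have hN : 0 ≤ N := by
        have : (0:ℝ) ≤ 1/η := by positivity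
        have := Int.ceil_nonneg this; omega
      have : (I.card:ℝ) = (2*N+1:ℝ)^2 := by
        rw [Finset.card_product, Int.card_Icc]
        have : ((N + 1 - -N).toNat:ℝ) = 2*N+1 := by
          have : ((N + 1 - -N).toNat:ℤ) = 2*N+1 := by omega
          exact_mod_cast this
        push_cast; rw [this]; ring
      rw [this]
      have c1 := Int.ceil_lt_add_one (1/η)
      have : (2*N+1:ℝ) ≤ 7/η := by
        have : (1:ℝ) ≤ 1/η := by rw [le_div_iff₀ hη]; linarith
        have e : 7/η = 7*(1/η) := by ring
        push_cast [N]; rw [e]; linarith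
      have h0 : (0:ℝ) ≤ 2*N+1 := by have : (0:ℝ) ≤ N := by exact_mod_cast hN
                                    linarith only [this]
      calc _ ≤ (7/η)^2 := by gcongr
        _ = _ := by rw [div_pow]; norm_num
    _ = _ := by unfold KE; field_simp; ring
def KN : ℝ := 30000
lemma noslab {m : Measure V} {S : Set V} {ε L : ℝ} (h : AU m S ε L) {p : V} (hp : p ∈ S) (hpL : ‖p‖ ≤ L) {R σ : ℝ}
    (hR : 0 < R) (hσ : 0 < σ) (he : ε * (1+R) ≤ om/2) {n b : V} (hn : ‖n‖ = 1) (hb : ‖b‖ ≤ 1)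
    (hs : ∀ z ∈ S, ‖z - p‖ ≤ R → |⟪z - p, n⟫| ≤ σ*R ∧ |⟪z - p, b⟫| ≤ σ*R) : ‖b - ⟪b, n⟫ • n‖ ≤ KN * σ := by
  have := h.fin
  by_contra! hc
  set b' := b - ⟪b, n⟫ • n
  have hb0 : 0 < ‖b'‖ := lt_trans (by unfold KN; positivity) hc
  have hbn : |⟪b, n⟫| ≤ 1 := (abs_real_inner_le_norm b n).trans (by rw [hn, mul_one]; exact hb)
  have hb'n : ⟪b', n⟫ = 0 := by
    simp [b', inner_sub_left, real_inner_smul_left, hn]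
  have hb1 : ‖b'‖ ≤ 1 := by
    have : ‖b‖^2 = ‖b'‖^2 + ⟪b,n⟫^2 := by
      have : b = b' + ⟪b,n⟫ • n := by simp [b']
      conv_lhs => rw [this]
      rw [norm_add_sq_real, real_inner_smul_right, hb'n, norm_smul, hn]; simp
    nlinarith only [hb, this, norm_nonneg b]
  set u := ‖b'‖⁻¹ • b'
  have hu : ‖u‖ = 1 := by simp [u, norm_smul, hb0.ne']
  have hun : ⟪u, n⟫ = 0 := by simp [u, real_inner_smul_left, hb'n]
  set η := 2*σ/‖b'‖ with hηd
  have hη : 0 < η := by positivity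
  have hη1 : η < 1/15000 := by
    rw [hηd, div_lt_div_iff₀ hb0 (by norm_num)]; unfold KN at hc; linarith
  have hση : σ ≤ η := by
    rw [hηd, le_div_iff₀ hb0]; nlinarith only [hσ, hb1]
  have E := E2 h p hR hη (by linarith) hu hn hun
  have sub : closedBall p R ⊆ {z | z ∈ closedBall p R ∧ |⟪z - p, u⟫| ≤ η*R ∧ |⟪z - p, n⟫| ≤ η*R} ∪ Sᶜ := by
    intro z hz
    by_cases hzS : z ∈ S
    · left
      have := hs z hzS (by rwa [mem_closedBall, dist_eq_norm] at hz)
      refine ⟨hz, ?_, this.1.trans (by gcongr)⟩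
      have e1 : ⟪z-p, u⟫ = ‖b'‖⁻¹ * (⟪z-p, b⟫ - ⟪b,n⟫ * ⟪z-p, n⟫) := by
        simp [u, b', real_inner_smul_right, inner_sub_right]
      rw [e1, abs_mul, abs_of_pos (by positivity), inv_mul_le_iff₀ hb0]
      have : |⟪b,n⟫ * ⟪z-p, n⟫| ≤ 1 * (σ*R) := by rw [abs_mul]; gcongr; exact this.1
      calc _ ≤ |⟪z-p, b⟫| + |⟪b,n⟫ * ⟪z-p, n⟫| := abs_sub _ _
        _ ≤ σ*R + 1*(σ*R) := by gcongr; tauto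
        _ = _ := by rw [hηd]; field_simp; ring
    · right; exact hzS
  have lo := h.two p hp hpL R hR
  have up : m.real (closedBall p R) ≤ KE * η * R^3 :=
    (measureReal_mono sub).trans ((measureReal_union_le _ _).trans (by
      rw [measureReal_def (s := Sᶜ), h.nul]; simpa using E))
  have := (abs_le.1 lo).1
  have omp := om_pos
  have h3 : ε * R^3 * (1+R) ≤ om/2 * R^3 := by nlinarith only [he, pow_pos hR 3]
  have h4 : KE * η * R^3 < om/2 * R^3 := by
    have : KE * η < om/2 := by unfold KE; nlinarith only [omp, hη1]
    exact mul_lt_mul_of_pos_right this (by positivity)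
  linarith
lemma AU.mono {m : Measure V} {S : Set V} {ε ε' L L' : ℝ} (h : AU m S ε L) (he : ε ≤ ε') (hL : L' ≤ L) : AU m S ε' L' :=
  ⟨h.fin, h.cl, h.nul, h.up, fun p hp hpL t ht => (h.two p hp (hpL.trans hL) t ht).trans (by gcongr)⟩
set_option maxHeartbeats 1000000 in
lemma bvneg : ∃ ε0 c : ℝ, 0 < ε0 ∧ ε0 ≤ 1 ∧ 0 < c ∧ ∀ (m : Measure V) (S : Set V), AU m S ε0 1 → (0:V) ∈ S → ∀ n v : V, ‖n‖ = 1 → ‖v‖ = 1 →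
    |⟪n, v⟫| ≤ ε0 → (∀ z ∈ S, ‖z‖ ≤ 1 → |⟪n, z⟫| ≤ ε0) → (∀ z ∈ S, ⟪v, z⟫ ≤ ε0 * ‖z‖^2) → ⟪bG m, v⟫ ≤ - c := by
  have omp := om_pos; have c3p := c3_pos
  set κ : ℝ := 1/200000 with hκ
  set K := 6 * (96 * om) with hK
  set c := c3⁻¹ * (κ * Real.exp (-1) * (om/8)) with hc
  have e1 := Real.exp_pos (-1)
  have hKp : 0 < K := by positivity
  refine ⟨min κ (κ * Real.exp (-1) * (om/8) / K), c, by positivity, (min_le_left _ _).trans (by norm_num [hκ]), by positivity, ?_⟩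
  set ε0 := min κ (κ * Real.exp (-1) * (om/8) / K) with hε
  have hε0 : 0 < ε0 := by positivity
  have ε1 : ε0 ≤ κ := min_le_left _ _
  have ε2 : ε0 * K ≤ κ * Real.exp (-1) * (om/8) := by rw [← le_div_iff₀ hKp]; exact min_le_right _ _
  intro m S h h0 n v hn hv hnv hs hc1
  have := h.fin
  set G : Set V := {x | x ∈ closedBall 0 1 ∧ κ < |⟪x, v⟫|} with hG
  have hGm : MeasurableSet G := measurableSet_closedBall.inter (measurableSet_lt measurable_const (by fun_prop : Continuous fun x : V => |⟪x, v⟫|).measurable)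
  have hGmass : om/4 ≤ m.real G := by
    set v' := v - ⟪v, n⟫ • n with hv'
    have hv'n : ⟪v', n⟫ = 0 := by simp [v', inner_sub_left, real_inner_smul_left, hn]
    have hvn : |⟪v, n⟫| ≤ κ := by rw [real_inner_comm]; linarith only [ε1, hnv]
    have hv2 : 1/2 ≤ ‖v'‖ := by
      have := norm_sub_norm_le v (⟪v, n⟫ • n)
      rw [norm_smul, hv, hn, Real.norm_eq_abs] at this
      change _ ≤ ‖v'‖ at this
      rw [hκ] at hvn; linarith only [hvn, this]
    have hv0 : 0 < ‖v'‖ := by linarith only [hv2]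
    set u := ‖v'‖⁻¹ • v'
    have hu : ‖u‖ = 1 := by simp [u, norm_smul, hv0.ne']
    have hun : ⟪u, n⟫ = 0 := by simp [u, real_inner_smul_left, hv'n]
    have EE := E2 h 0 (R := 1) (η := 4*κ) one_pos (by positivity) (by norm_num [hκ]) hu hn hun
    have sub : closedBall (0:V) 1 ⊆ (G ∪ {z | z ∈ closedBall (0:V) 1 ∧ |⟪z - 0, u⟫| ≤ 4*κ*1 ∧ |⟪z - 0, n⟫| ≤ 4*κ*1}) ∪ Sᶜ := by
      intro z hz
      by_cases hzS : z ∈ S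
      · left
        by_cases hzG : z ∈ G
        · exact Or.inl hzG
        right
        have hz1 : |⟪z, v⟫| ≤ κ := by by_contra! hh; exact hzG ⟨hz, hh⟩
        have hzn : |⟪z, n⟫| ≤ κ := by rw [real_inner_comm]; exact (hs z hzS (by simpa using hz)).trans ε1
        refine ⟨hz, ?_, ?_⟩
        · have e1 : ⟪z-0, u⟫ = ‖v'‖⁻¹ * (⟪z, v⟫ - ⟪v,n⟫ * ⟪z, n⟫) := by
            simp [u, v', real_inner_smul_right, inner_sub_right]
          rw [e1, abs_mul, abs_of_pos (by positivity), inv_mul_le_iff₀ hv0]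
          have q1 : |⟪v,n⟫ * ⟪z, n⟫| ≤ 1 * κ := by rw [abs_mul]; gcongr; exact hvn.trans (by norm_num [hκ])
          have := abs_sub ⟪z, v⟫ (⟪v,n⟫ * ⟪z, n⟫)
          nlinarith only [hz1, q1, this, hv2, show 0 < κ by positivity]
        · rw [sub_zero]; linarith only [hzn, show 0 < κ by positivity]
      · right; exact hzS
    have up := (measureReal_mono sub (measure_ne_top m _)).trans ((measureReal_union_le _ _).trans (add_le_add_left (measureReal_union_le _ _) _))
    rw [measureReal_def (s := Sᶜ), h.nul] at up
    have lo := (abs_le.1 (h.two 0 h0 (by simp) 1 one_pos)).1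
    simp only [ENNReal.toReal_zero, add_zero] at up
    have : KE * (4*κ) * 1^3 ≤ om/4 := by unfold KE; rw [hκ]; linarith only [omp]
    have e3 : ε0 ≤ om / 8 := by
      have q1 : Real.exp (-1) ≤ 1 := by rw [Real.exp_le_one_iff]; norm_num
      have k1 : κ * Real.exp (-1) ≤ 1 := by rw [hκ]; linarith only [q1]
      have : ε0 * K ≤ 1 * (om/8) := ε2.trans (by gcongr)
      have o3 : (1:ℝ) ≤ om := by
        rw [om, unitBallVol]
        have := EuclideanSpace.volume_ball_fin_three (0 : EuclideanSpace ℝ (Fin 3)) 1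
        rw [this]; simp; rw [ENNReal.toReal_ofReal (by positivity)]; linarith only [Real.pi_gt_three]
      nlinarith only [ε2, q1, o3]
    clear sub hun hu hv0 hv2 hvn hv'n
    have up2 := up.trans (add_le_add_right (EE.trans this) _)
    norm_num at lo
    linarith only [hε0, e3, up2, lo]
  clear_value κ
  rw [inner_bG h]
  have i1 := domI h (f := fun x => wt x * ⟪x, v⟫) (C := 3) (by have := wt_cont; fun_prop) (by norm_num) (fun x => by
    have := pgb0 1 x
    rw [norm_mul, Real.norm_of_nonneg (wt_pos x).le, Real.norm_eq_abs]
    have b := abs_real_inner_le_norm x v; rw [hv, mul_one] at b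
    simp at this
    calc _ ≤ wt x * ‖x‖ := by gcongr; exact (wt_pos x).le
      _ ≤ _ := by simpa [mul_comm] using this)
  have i2 := domI h (f := fun x => ‖x‖^2 * wt x) (C := 6) (by have := wt_cont; fun_prop) (by norm_num) (fun x => by
    have := pgb0 2 x
    rw [Real.norm_of_nonneg (by have := wt_pos x; positivity)]
    refine this.trans (by norm_num [Nat.factorial]))
  have hle : ∀ᵐ x ∂m, wt x * ⟪x, v⟫ ≤ ε0 * (‖x‖^2 * wt x) - G.indicator (fun _ => κ * Real.exp (-1)) x := by
    have : ∀ᵐ x ∂m, x ∈ S := by rw [ae_iff]; exact h.nul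
    filter_upwards [this] with x hx
    have w := wt_pos x
    have a := hc1 x hx; rw [real_inner_comm] at a
    by_cases hg : x ∈ G
    · rw [indicator_of_mem hg]
      have hx1 : ‖x‖ ≤ 1 := by simpa using hg.1
      have w1 : Real.exp (-1) ≤ wt x := by unfold wt; gcongr; nlinarith only [hx1, norm_nonneg x]
      have q1 : ⟪x, v⟫ ≤ -κ := by
        rcases lt_abs.1 hg.2 with h | h
        · exfalso; have : ε0 * ‖x‖^2 ≤ ε0 * 1 := by gcongr; nlinarith only [hx1, norm_nonneg x]
          linarith only [ε1, a, h, this]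
        · linarith only [h]
      have k0 : 0 < κ := by positivity
      have : 0 ≤ ε0 * (‖x‖^2 * wt x) := by positivity
      nlinarith only [w1, this, w, hε0, ε1, q1]
    · rw [indicator_of_notMem hg]; have := mul_le_mul_of_nonneg_left a w.le; linarith only [this]
  have I : ∫ x, wt x * ⟪x, v⟫ ∂m ≤ ε0 * (∫ x, ‖x‖^2 * wt x ∂m) - m.real G * (κ * Real.exp (-1)) := by
    refine (integral_mono_ae i1.1 ((i2.1.const_mul _).sub ((integrable_const _).indicator hGm)) hle).trans_eq ?_
    rw [integral_sub' (i2.1.const_mul _) ((integrable_const _).indicator hGm), integral_const_mul, integral_indicator_const _ hGm]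
    simp
  have i3 := (le_abs_self _).trans i2.2
  rw [hc, ← mul_neg]
  gcongr
  have q1 : ε0 * (∫ x, ‖x‖^2 * wt x ∂m) ≤ ε0 * K := by gcongr
  have : om/4 * (κ * Real.exp (-1)) ≤ m.real G * (κ * Real.exp (-1)) := by gcongr
  linarith only [ε2, I, q1, this]
lemma FILL0 : ∃ ε0 : ℝ, 0 < ε0 ∧ ε0 ≤ 1 ∧ ∀ (m : Measure V) (S : Set V), AU m S ε0 1 → (0:V) ∈ S → ∀ n v : V, ‖n‖ = 1 → ‖v‖ = 1 →
    |⟪n, v⟫| ≤ ε0 → (∀ z ∈ S, ‖z‖ ≤ 1 → |⟪n, z⟫| ≤ ε0) → (∀ z ∈ S, ⟪v, z⟫ ≤ ε0 * ‖z‖^2) → False := by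
  obtain ⟨ε1, c, hε1, hε1', hc, H⟩ := bvneg
  have omp := om_pos; have k0p := K0_pos
  set M := 3*K0 + 1
  set K := 12*K0 + 1 + 2*|KS|
  set θ := min 1 (c / (4 * M * KN * (1+K)))
  have KNp : 0 < KN := by norm_num [KN]
  have hθ : 0 < θ := by positivity
  have hθ1 : θ ≤ 1 := min_le_left _ _
  have hθ2 : M * (KN * ((1+K)*θ)) ≤ c/4 := by
    have : θ ≤ c / (4 * M * KN * (1+K)) := min_le_right _ _
    rw [le_div_iff₀ (by positivity)] at this; linarith
  set ε0 := min (min ε1 (c / (4*M))) (min (θ^2) (om/4))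
  have hε0 : 0 < ε0 := by positivity
  have a1 : ε0 ≤ ε1 := (min_le_left _ _).trans (min_le_left _ _)
  have a2 : ε0 * M ≤ c/4 := by
    have : ε0 ≤ c / (4*M) := (min_le_left _ _).trans (min_le_right _ _)
    rw [le_div_iff₀ (by positivity)] at this; linarith
  have a3 : ε0 ≤ θ^2 := (min_le_right _ _).trans (min_le_left _ _)
  have a4 : ε0 ≤ om/4 := (min_le_right _ _).trans (min_le_right _ _)
  refine ⟨ε0, hε0, a1.trans hε1', ?_⟩
  intro m S h h0 n v hn hv hnv hs hc1
  have b1 := H m S (h.mono a1 le_rfl) h0 n v hn hv (hnv.trans a1) (fun z hz hz1 => (hs z hz hz1).trans a1)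
    (fun z hz => (hc1 z hz).trans (by gcongr))
  set b := bG m
  have hbM : ‖b‖ ≤ M := (nbG h).trans (by simp [M])
  have nos := noslab h h0 (by simp) hθ (σ := (1+K)*θ) (by positivity) (n := n) (b := M⁻¹ • b) (by nlinarith only [a4, omp, hθ1, hθ]) hn
    (by rw [norm_smul, norm_inv, Real.norm_of_nonneg (by positivity), inv_mul_le_iff₀ (by positivity)]; linarith only [hbM]) (fun z hz hzθ => by
      rw [sub_zero] at *
      have hz1 := hzθ.trans hθ1
      have t2 : ‖z‖^2 ≤ θ^2 := by gcongr
      constructor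
      · rw [real_inner_comm]
        have q1 := hs z hz hz1
        have : 0 ≤ K * θ^2 := by positivity
        linarith only [a3, q1, this]
      · rw [real_inner_smul_right, abs_mul, abs_of_pos (by positivity), inv_mul_le_iff₀ (by positivity), real_inner_comm]
        have st := STAR h h0 le_rfl hz hz1
        have f1 : |⟪FG m z, z⟫| ≤ (12*K0+1) * ‖z‖^2 := by
          have := nFG h
          calc _ ≤ ‖FG m z‖ * ‖z‖ := abs_real_inner_le_norm _ _
            _ ≤ (12*K0+1) * ‖z‖ * ‖z‖ := by gcongr; exact (FG m).le_of_opNorm_le this z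
            _ = _ := by ring
        have f2 : KS*(‖z‖^3+ε0) ≤ |KS| * (2*θ^2) := by
          have : ‖z‖^3 ≤ θ^2 := by nlinarith only [hθ1, hzθ, norm_nonneg z, sq_nonneg ‖z‖]
          calc _ ≤ |KS| * (‖z‖^3+ε0) := by gcongr; exact le_abs_self _
            _ ≤ _ := by gcongr; linarith only [a3, this]
        have : |2*⟪b, z⟫| ≤ K * θ^2 := by
          calc |2*⟪b, z⟫| = |(2*⟪b, z⟫ + ⟪FG m z, z⟫) - ⟪FG m z, z⟫| := by ring_nf
            _ ≤ _ := abs_sub _ _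
            _ ≤ |KS| * (2*θ^2) + (12*K0+1) * θ^2 := add_le_add (st.trans f2) (f1.trans (by gcongr))
            _ = _ := by ring
        rw [abs_mul, abs_two] at this
        have hM1 : 1 ≤ M := by simp [M, k0p.le]
        have q2 : 0 ≤ (1+K) * θ * θ := by positivity
        nlinarith only [this, k0p, abs_nonneg ⟪b, z⟫])
  have e : M⁻¹ • b - ⟪M⁻¹ • b, n⟫ • n = M⁻¹ • (b - ⟪b, n⟫ • n) := by
    rw [smul_sub, real_inner_smul_left, smul_smul]
  rw [e, norm_smul, norm_inv, Real.norm_of_nonneg (by positivity : 0 ≤ M), inv_mul_le_iff₀ (by positivity)] at nos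
  have l1 := abs_real_inner_le_norm (b - ⟪b, n⟫ • n) v
  rw [hv, mul_one, inner_sub_left, real_inner_smul_left] at l1
  have l2 : |⟪b, n⟫ * ⟪n, v⟫| ≤ M * ε0 := by
    rw [abs_mul]; gcongr
    exact (abs_real_inner_le_norm _ _).trans (by rw [hn, mul_one]; exact hbM)
  have q1 := (abs_le.1 l1).1; have := (abs_le.1 l2).1
  linarith only [hc, hθ2, a2, b1, nos, q1, this]
lemma FILL (η : ℝ) (hη : 0 < η) : ∃ ε : ℝ, 0 < ε ∧ ε ≤ 1 ∧ ∀ (m : Measure V) (S : Set V), AU m S ε 4 → (0:V) ∈ S → ∀ n : V, ‖n‖ = 1 →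
    (∀ z ∈ S, ‖z‖ ≤ 3 → |⟪n, z⟫| ≤ ε) → ∀ w : V, ⟪n, w⟫ = 0 → ‖w‖ ≤ 1 → ∃ z ∈ S, ‖z - w‖ ≤ η := by
  obtain ⟨ε0, hε0, hε01, H⟩ := FILL0
  set r := min 1 (ε0 * η)
  have hr : 0 < r := by positivity
  have hr1 : r ≤ 1 := min_le_left _ _
  have hr2 : r ≤ ε0 * η := min_le_right _ _
  refine ⟨ε0 * (r * min 1 η) / 2, by positivity, ?_, ?_⟩
  · have : r * min 1 η ≤ 1 := mul_le_one₀ hr1 (by positivity) (min_le_left _ _)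
    nlinarith only [hε01, hε0, this]
  intro m S h h0 n hn hs w hw hw1
  by_contra! hc
  obtain ⟨p, hp, hd⟩ := h.cl.exists_infDist_eq_dist ⟨0, h0⟩ w
  have hmin : ∀ z ∈ S, dist w p ≤ dist w z := fun z hz => hd ▸ infDist_le_dist_of_mem hz
  set d := dist w p
  have hdη : η < d := by have := hc p hp; rwa [← dist_eq_norm, dist_comm] at this
  have hd0 : 0 < d := hη.trans hdη
  have hd1 : d ≤ 1 := (hmin 0 h0).trans (by simpa using hw1)
  have hdn : ‖w - p‖ = d := (dist_eq_norm _ _).symm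
  have hp2 : ‖p‖ ≤ 2 := by
    have := norm_sub_norm_le p w; rw [norm_sub_rev, hdn] at this; linarith
  set ε := ε0 * (r * min 1 η) / 2 with hε
  have mη : 0 < min 1 η := by positivity
  have εr : 2*ε/r ≤ ε0 := by
    rw [div_le_iff₀ hr, hε]; nlinarith only [min_le_left 1 η, mul_pos hε0 hr]
  have εη : ε ≤ ε0 * η := by
    have : r * min 1 η ≤ 1 * η := mul_le_mul hr1 (min_le_right _ _) mη.le one_pos.le
    nlinarith only [hr, hr2, hε, hε0, this]
  have ε3 : ε ≤ ε0 := by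
    have : r * min 1 η ≤ 1 := mul_le_one₀ hr1 (by positivity) (min_le_left _ _)
    nlinarith only [εη, hε0, hdη, hd1]
  set v := d⁻¹ • (w - p)
  have hv : ‖v‖ = 1 := by simp [v, norm_smul, hdn, abs_of_pos hd0, hd0.ne']
  have hpn := hs p hp (by linarith only [hp2])
  refine H (rs p r m) (rS p r S) ((h.rs hr hr1 (by positivity) (L' := 1) (by linarith only [hr1, hp2])).mono ε3 le_rfl) (by simpa [rS]) n v hn hv ?_ ?_ ?_
  · rw [real_inner_smul_right, inner_sub_right, hw, zero_sub, abs_mul, abs_neg, abs_of_pos (by positivity), inv_mul_le_iff₀ hd0]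
    nlinarith only [εη, hpn, hε0, hdη]
  · intro z hz hz1
    have a := hs (p + r • z) hz ((norm_add_le _ _).trans (by rw [norm_smul, Real.norm_of_nonneg hr.le]; nlinarith only [hε01, hr2, hp2, hε0, hdη, hd1, hr, hz1]))
    rw [inner_add_right, real_inner_smul_right] at a
    have : |r * ⟪n, z⟫| ≤ 2*ε := by
      have := abs_sub (⟪n,p⟫ + r * ⟪n, z⟫) ⟪n,p⟫
      rw [add_sub_cancel_left] at this; linarith only [hpn, a, this]
    rw [abs_mul, abs_of_pos hr] at this
    refine le_trans ?_ εr
    rw [le_div_iff₀ hr]; linarith only [this]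
  · intro z hz
    have a := hmin _ hz
    have e : w - (p + r • z) = (w - p) - r • z := by abel
    rw [dist_eq_norm, e] at a
    have a2 : d^2 ≤ ‖w - p - r • z‖^2 := by gcongr
    rw [norm_sub_sq_real, hdn, real_inner_smul_right, norm_smul, Real.norm_of_nonneg hr.le] at a2
    rw [real_inner_smul_left, inv_mul_le_iff₀ hd0]
    have q1 : 2 * ⟪w - p, z⟫ ≤ r * ‖z‖^2 := by
      have : r * (2 * ⟪w - p, z⟫) ≤ r * (r * ‖z‖^2) := by linarith only [a2]
      exact le_of_mul_le_mul_left this hr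
    have : r * ‖z‖^2 ≤ ε0 * d * ‖z‖^2 := by gcongr; nlinarith only [hr2, hε0, hdη]
    linarith only [q1, this, mul_nonneg (mul_nonneg hε0.le hd0.le) (sq_nonneg ‖z‖)]
abbrev OB := OrthonormalBasis (Fin 4) ℝ V
lemma inner_exp (e : OB) (x y : V) : ⟪x, y⟫ = ⟪x, e 0⟫*⟪y, e 0⟫ + ⟪x, e 1⟫*⟪y, e 1⟫ + ⟪x, e 2⟫*⟪y, e 2⟫ + ⟪x, e 3⟫*⟪y, e 3⟫ := by
  rw [← e.sum_inner_mul_inner x y, Fin.sum_univ_four]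
  simp only [real_inner_comm y]
lemma norm_exp (e : OB) (x : V) : ‖x‖^2 = ⟪x, e 0⟫^2 + ⟪x, e 1⟫^2 + ⟪x, e 2⟫^2 + ⟪x, e 3⟫^2 := by
  rw [← real_inner_self_eq_norm_sq, inner_exp e x x]; ring
lemma coord_le (e : OB) (x : V) (i : Fin 4) : |⟪x, e i⟫| ≤ ‖x‖ := by
  simpa using abs_real_inner_le_norm x (e i)
lemma ob_ext (n : V) (hn : ‖n‖ = 1) : ∃ e : OB, e 0 = n := by
  obtain ⟨e, he⟩ := Orthonormal.exists_orthonormalBasis_extension_of_card_eq (ι := Fin 4) (𝕜 := ℝ) (E := V) (by simp)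
    (v := fun _ => n) (s := {0}) (by
      constructor
      · rintro ⟨i, hi⟩; simp [hn]
      · rintro ⟨i, hi⟩ ⟨j, hj⟩ hij
        exact (hij (Subtype.ext ((mem_singleton_iff.1 hi).trans (mem_singleton_iff.1 hj).symm))).elim)
  exact ⟨e, he 0 (by simp)⟩
lemma ob_inner (e : OB) (i j : Fin 4) : ⟪e i, e j⟫ = if i = j then 1 else 0 := e.inner_eq_ite i j
lemma diag (F : V →L[ℝ] V) (hF : ∀ z w, ⟪F z, w⟫ = ⟪z, F w⟫) :
    ∃ (e : OB) (l : Fin 4 → ℝ), (∀ i, F (e i) = l i • e i) ∧ ∀ i, l 0 ≤ l i := by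
  have hS : (F : V →ₗ[ℝ] V).IsSymmetric := fun z w => hF z w
  have hn : Module.finrank ℝ V = 4 := by simp
  obtain ⟨i, hi⟩ := Finite.exists_min (hS.eigenvalues hn)
  refine ⟨(hS.eigenvectorBasis hn).reindex (Equiv.swap 0 i), fun j => hS.eigenvalues hn (Equiv.swap 0 i j), fun j => ?_, fun j => ?_⟩
  · have := hS.apply_eigenvectorBasis hn (Equiv.swap 0 i j)
    rw [OrthonormalBasis.reindex_apply, Equiv.symm_swap]; exact this
  · simpa using hi _
lemma quad_exp {F : V →L[ℝ] V} {e : OB} {l : Fin 4 → ℝ} (hF : ∀ z w, ⟪F z, w⟫ = ⟪z, F w⟫) (he : ∀ i, F (e i) = l i • e i) (z : V) :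
    ⟪F z, z⟫ = l 0 * ⟪z, e 0⟫^2 + l 1 * ⟪z, e 1⟫^2 + l 2 * ⟪z, e 2⟫^2 + l 3 * ⟪z, e 3⟫^2 := by
  have h : ∀ i, ⟪F z, e i⟫ = l i * ⟪z, e i⟫ := fun i => by rw [hF, he, real_inner_smul_right]
  rw [inner_exp e, h, h, h, h]; ring
def KF : ℝ := 12*K0+1
lemma KF_ge : 1 ≤ KF := by have := K0_pos; unfold KF; linarith
lemma quad_le {F : V →L[ℝ] V} (hF : ‖F‖ ≤ KF) (z w : V) : |⟪F z, w⟫| ≤ KF * ‖z‖ * ‖w‖ :=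
  (abs_real_inner_le_norm _ _).trans (by gcongr; exact F.le_of_opNorm_le hF z)
structure QD (S : Set V) (b : V) (F : V →L[ℝ] V) (τ : ℝ) : Prop where
  sym : ∀ z w, ⟪F z, w⟫ = ⟪z, F w⟫
  ge : ∀ z, -‖z‖^2 ≤ ⟪F z, z⟫
  tr : ∀ e : OB, |⟪F (e 0), e 0⟫ + ⟪F (e 1), e 1⟫ + ⟪F (e 2), e 2⟫ + ⟪F (e 3), e 3⟫ + 1| ≤ τ
  nf : ‖F‖ ≤ KF
lemma quad_diff {F : V →L[ℝ] V} (hF : ‖F‖ ≤ KF) (hs : ∀ z w, ⟪F z, w⟫ = ⟪z, F w⟫) {z w : V} {θ : ℝ} (hw : ‖w‖ ≤ 1) (h : ‖z - w‖ ≤ θ) (hθ : θ ≤ 1) :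
    |⟪F z, z⟫ - ⟪F w, w⟫| ≤ 3*KF*θ := by
  have e : ⟪F z, z⟫ - ⟪F w, w⟫ = ⟪F (z-w), z-w⟫ + 2*⟪F (z - w), w⟫ := by
    simp only [map_sub, inner_sub_left, inner_sub_right, hs w z, real_inner_comm (F z) w]; ring
  rw [e]
  have k := KF_ge
  have a := quad_le hF (z-w) (z-w); have b := quad_le hF (z-w) w
  have n0 := norm_nonneg (z-w)
  have θ0 := n0.trans h
  calc _ ≤ |⟪F (z-w), z-w⟫| + |2*⟪F (z - w), w⟫| := abs_add_le _ _
    _ ≤ KF * ‖z-w‖*‖z-w‖ + 2*(KF * ‖z-w‖ * ‖w‖) := by rw [abs_mul, abs_two]; gcongr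
    _ ≤ KF * θ * 1 + 2*(KF*θ*1) := by gcongr; exact h.trans hθ
    _ = _ := by ring
lemma TANG {b : V} {F : V →L[ℝ] V} {τ θ M : ℝ} (hs : ∀ z w, ⟪F z, w⟫ = ⟪z, F w⟫) (hF : ‖F‖ ≤ KF) (hb : ‖b‖ ≤ M) (hθ : θ ≤ 1) {w z z' : V} (hw : ‖w‖ ≤ 1)
    (h1 : ‖z - w‖ ≤ θ) (h2 : ‖z' + w‖ ≤ θ) (e1 : |2*⟪b, z⟫ + ⟪F z, z⟫| ≤ τ) (e2 : |2*⟪b, z'⟫ + ⟪F z', z'⟫| ≤ τ) :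
    |⟪F w, w⟫| ≤ τ + (2*M + 3*KF)*θ := by
  have a1 := abs_le.1 (quad_diff hF hs hw h1 hθ)
  have a2 := quad_diff hF hs (z := z') (w := -w) (by rwa [norm_neg]) (by rwa [sub_neg_eq_add]) hθ
  rw [map_neg, inner_neg_neg] at a2
  have a2 := abs_le.1 a2
  have a3 : |⟪b, z + z'⟫| ≤ M * (2*θ) := by
    refine (abs_real_inner_le_norm _ _).trans (mul_le_mul hb ?_ (norm_nonneg _) ((norm_nonneg _).trans hb))
    calc ‖z + z'‖ = ‖(z - w) + (z' + w)‖ := by congr 1; abel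
      _ ≤ _ := (norm_add_le _ _).trans (by linarith)
  rw [inner_add_right] at a3
  have a3 := abs_le.1 a3; have e1 := abs_le.1 e1; have e2 := abs_le.1 e2
  rw [abs_le]; constructor <;> linarith [a1.1, a1.2, a2.1, a2.2, a3.1, a3.2, e1.1, e1.2, e2.1, e2.2]
/-- tangential smallness forces the normal eigenvalue -/
lemma FNN {S : Set V} {b : V} {F : V →L[ℝ] V} {τ t : ℝ} (q : QD S b F τ) {n : V} (hn : ‖n‖ = 1)
    (ht : ∀ w, ⟪n, w⟫ = 0 → ‖w‖ ≤ 1 → |⟪F w, w⟫| ≤ t) : ⟪F n, n⟫ ≤ -1 + τ + 3*t := by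
  obtain ⟨e, rfl⟩ := ob_ext n hn
  have := (abs_le.1 (q.tr e)).2
  have h : ∀ i, i ≠ 0 → -t ≤ ⟪F (e i), e i⟫ := fun i hi => (abs_le.1 (ht (e i) (by simp [ob_inner, hi.symm]) (by simp))).1
  linarith [h 1 (by decide), h 2 (by decide), h 3 (by decide)]
lemma FNM {S : Set V} {b : V} {F : V →L[ℝ] V} {τ t g : ℝ} (q : QD S b F τ) (hg : 0 < g) (hg1 : g ≤ 1) {n m' : V} (hn : ‖n‖ = 1) {a : ℝ} (ha : |a| ≤ 1)
    (hnm : ⟪n, m'⟫ = 0) (hm1 : ‖m'‖ ≤ 1) (h1 : ⟪F n, n⟫ ≤ -1 + g^2) (ht : |⟪F m', m'⟫| ≤ t) (htg : t ≤ g^2)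
    (hl : ⟪F (a • n + m'), a • n + m'⟫ ≤ -1 + g^2) : 1 - a^2 ≤ 5*g := by
  have hn1 := q.ge n
  rw [hn] at hn1
  have key : ∀ s : ℝ, -1 - s^2*‖m'‖^2 ≤ ⟪F n, n⟫ + 2*s*⟪F n, m'⟫ + s^2*⟪F m', m'⟫ := by
    intro s
    have := q.ge (n + s • m')
    rw [norm_add_sq_real, hn, real_inner_smul_right, hnm, norm_smul, mul_pow, Real.norm_eq_abs, sq_abs] at this
    simp only [map_add, map_smul, inner_add_left, inner_add_right, real_inner_smul_left, real_inner_smul_right, q.sym m' n, real_inner_comm (F n) m'] at this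
    linarith
  have t2 := abs_le.1 ht
  have m2 : ‖m'‖^2 ≤ 1 := by nlinarith only [hm1, norm_nonneg m']
  have g2 : g^2 ≤ 1 := by nlinarith only [hg1, hg]
  have p1 := key g; have p2 := key (-g)
  have ub : g^2*⟪F m', m'⟫ ≤ g^2*1 := by gcongr; linarith [t2.2]
  have ub2 : g^2*‖m'‖^2 ≤ g^2*1 := by gcongr
  have b1 : |⟪F n, m'⟫| ≤ 3/2*g := by
    rw [abs_le]; constructor <;> nlinarith
  simp only [map_add, map_smul, inner_add_left, inner_add_right, real_inner_smul_left, real_inner_smul_right, q.sym m' n, real_inner_comm (F n) m'] at hl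
  have c1 : |a * ⟪F n, m'⟫| ≤ 1*(3/2*g) := by rw [abs_mul]; gcongr
  have c2 := abs_le.1 c1
  have a2 : a^2 ≤ 1 := by rw [← sq_abs]; nlinarith only [ha, abs_nonneg a]
  have c3 : -a^2 ≤ a*(a*⟪F n, n⟫) := by nlinarith only [hn1]
  have : g^2 ≤ g := by nlinarith only [hg, hg1]
  linarith only [htg, hl, c3, this, t2.1, c2.1]
lemma slin {β l x y η : ℝ} (hy : |y| ≤ 1) (hη : η ≤ 1) (h : |x - y| ≤ η) : |(2*β*x + l*x^2) - (2*β*y + l*y^2)| ≤ 3*η*(|β| + |l|) := by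
  have e : (2*β*x + l*x^2) - (2*β*y + l*y^2) = 2*β*(x-y) + l*((x-y)*((x-y)+2*y)) := by ring
  have η0 := (abs_nonneg _).trans h
  have h2 : |(x-y) + 2*y| ≤ 3 := (abs_add_le _ _).trans (by rw [abs_mul, abs_two]; linarith)
  rw [e]
  calc _ ≤ |2*β*(x-y)| + |l*((x-y)*((x-y)+2*y))| := abs_add_le _ _
    _ ≤ 2 * |β| * η + |l| * (η*3) := by rw [abs_mul, abs_mul, abs_mul, abs_mul, abs_two]; gcongr
    _ ≤ _ := by linarith only [mul_nonneg (abs_nonneg β) η0]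
/-- core linear algebra: `N` bound -/
lemma Nbound {c l0 τ : ℝ} {β l : Fin 3 → ℝ} (h0 : 0 ≤ τ) (hl0 : -1 ≤ l0) (hl1 : l0 ≤ -1/2) (htr : |l0 + (l 0 + l 1 + l 2) + 1| ≤ τ)
    (hd : ∀ y : Fin 3 → ℝ, (∀ i, |y i| ≤ 1) → (y 0)^2 + (y 1)^2 + (y 2)^2 ≤ 1 → ∃ (s : ℝ) (x : Fin 3 → ℝ), (∀ i, |x i - y i| ≤ 1/48) ∧
      |2*c*s + l0*s^2 + ((2*β 0*x 0 + l 0*(x 0)^2) + (2*β 1*x 1 + l 1*(x 1)^2) + (2*β 2*x 2 + l 2*(x 2)^2))| ≤ τ) :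
    (|β 0| + |l 0|) + (|β 1| + |l 1|) + (|β 2| + |l 2|) ≤ 24*τ + 32*c^2 := by
  set N := (|β 0| + |l 0|) + (|β 1| + |l 1|) + (|β 2| + |l 2|) with hN
  set X := τ + 2*c^2 + N/16 with hX
  have low : ∀ y : Fin 3 → ℝ, (∀ i, |y i| ≤ 1) → (y 0)^2 + (y 1)^2 + (y 2)^2 ≤ 1 →
      -X ≤ (2*β 0*y 0 + l 0*(y 0)^2) + (2*β 1*y 1 + l 1*(y 1)^2) + (2*β 2*y 2 + l 2*(y 2)^2) := by
    intro y hy hy2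
    obtain ⟨s, x, hx, hE⟩ := hd y hy hy2
    have d := fun i => abs_le.1 (slin (β := β i) (l := l i) (hy i) (by norm_num) (hx i))
    have hE := (abs_le.1 hE).1
    have : 2*c*s + l0*s^2 ≤ 2*c^2 := by nlinarith only [hl1, sq_nonneg (s - 2*c)]
    linarith [(d 0).2, (d 1).2, (d 2).2]
  have single : ∀ (i : Fin 3), 2*|β i| - X ≤ l i := by
    intro i
    have a : ∀ t : ℝ, t^2 = 1 → -X ≤ 2*β i*t + l i := by
      intro t ht
      have t1 : |t| ≤ 1 := by rw [← sq_le_one_iff_abs_le_one]; exact ht.le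
      have := low (fun j => if j = i then t else 0) (fun j => by split_ifs <;> simp [t1]) (by fin_cases i <;> simp [ht])
      fin_cases i <;> simpa [ht] using this
    have a1 := a 1 (by norm_num); have a2 := a (-1) (by norm_num)
    rcases abs_cases (β i) with h | h <;> linarith
  have s0 := single 0; have s1 := single 1; have s2 := single 2
  have t := (abs_le.1 htr).2
  have p0 := abs_nonneg (β 0); have p1 := abs_nonneg (β 1); have p2 := abs_nonneg (β 2)
  have L : ∀ i, l i ≤ τ + 2*X → |l i| ≤ τ + 2*X := by
    intro i hi
    have := single i; have := abs_nonneg (β i)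
    have : 0 ≤ X := by positivity
    rw [abs_le]; constructor <;> linarith
  have l0' := L 0 (by linarith); have l1' := L 1 (by linarith); have l2' := L 2 (by linarith only [hl0, s0, s1, t, p0, p1])
  have : N ≤ 4*τ + 8*X := by linarith
  linarith only [h0, hl0, hX, s0, s1, s2, t, p0, p1, p2, l0', l1', l2']
set_option maxHeartbeats 1000000 in
lemma ALG : ∃ η0 : ℝ, 0 < η0 ∧ η0 ≤ 1 ∧ ∀ (m : Measure V) (S : Set V) (b : V) (F : V →L[ℝ] V) (τ : ℝ), AU m S η0 4 → (0:V) ∈ S → QD S b F τ → ‖b‖ ≤ 1 →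
    0 ≤ τ → τ ≤ η0 → (∀ z ∈ S, ‖z‖ ≤ 4 → |2*⟪b, z⟫ + ⟪F z, z⟫| ≤ τ) → ∀ n : V, ‖n‖ = 1 → (∀ z ∈ S, ‖z‖ ≤ 4 → |⟪n, z⟫| ≤ η0) →
    ∃ u : V, ‖u‖ = 1 ∧ 0 ≤ ⟪b, u⟫ ∧ (∀ z ∈ S, ‖z‖ ≤ 1 → |⟪z, u⟫ * (2*⟪b, u⟫ - ⟪z, u⟫)| ≤ τ + 200*(⟪b, u⟫^2 + τ)*‖z‖) ∧
      (∀ z, |⟪F z, z⟫| ≤ 2*⟪z, u⟫^2 + 200*(⟪b, u⟫^2 + τ)*‖z‖^2) := by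
  obtain ⟨εF, hεF, hεF1, HF⟩ := FILL (1/48) (by norm_num)
  have kF := KF_ge
  set h := εF/6 with hh
  set g := h^2/5 with hg
  have hh0 : 0 < h := by positivity
  have hh1 : h ≤ 1 := by rw [hh]; linarith only [hεF1]
  have hg0 : 0 < g := by positivity
  have hg1 : g ≤ 1/2 := by rw [hg]; have := pow_le_one₀ (n := 2) hh0.le hh1; linarith
  set t1 := g^2/4 with ht1
  have ht10 : 0 < t1 := by positivity
  have ht11 : t1 ≤ 1 := by rw [ht1]; have := pow_le_pow_left₀ hg0.le hg1 2; linarith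
  set θ := t1/(2*(2*1+3*KF)) with hθ
  have hθ0 : 0 < θ := by positivity
  have hθm : (2*1+3*KF)*θ = t1/2 := by rw [hθ]; field_simp
  have hθ1 : θ ≤ 1 := by
    have : 1*θ ≤ (2*1+3*KF)*θ := by gcongr; linarith only [kF]
    linarith only [ht11, hθm, this]
  obtain ⟨εθ, hεθ, hεθ1, Hθ⟩ := FILL θ hθ0
  set η0 := min (min εθ (εF/2)) (t1/2) with hη0
  have e1 : η0 ≤ εθ := (min_le_left _ _).trans (min_le_left _ _)
  have e2 : η0 ≤ εF/2 := (min_le_left _ _).trans (min_le_right _ _)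
  have e3 : η0 ≤ t1/2 := min_le_right _ _
  refine ⟨η0, by positivity, by linarith only [ht11, e3], ?_⟩
  intro m S b F τ hA h0 q hb τ0 τ1 hE n hn hs
  have T : ∀ w, ⟪n, w⟫ = 0 → ‖w‖ ≤ 1 → |⟪F w, w⟫| ≤ t1 := by
    intro w hw hw1
    have HH := Hθ m S (hA.mono e1 le_rfl) h0 n hn (fun z hz hz3 => (hs z hz (by linarith only [hz3])).trans e1)
    obtain ⟨z, hz, hzw⟩ := HH w hw hw1
    obtain ⟨z', hz', hzw'⟩ := HH (-w) (by simp [hw]) (by simpa using hw1)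
    rw [sub_neg_eq_add] at hzw'
    have n1 : ‖z‖ ≤ 4 := by have := norm_sub_norm_le z w; linarith only [hθ1, hw1, hzw, this]
    have n2 : ‖z'‖ ≤ 4 := by have := norm_sub_norm_le z' (-w); rw [norm_neg, sub_neg_eq_add] at this; linarith only [hθ1, hw1, hzw', this]
    have := TANG q.sym q.nf hb hθ1 hw1 hzw hzw' (hE z hz n1) (hE z' hz' n2)
    linarith only [hθm, e3, τ1, this]
  have hFn := FNN q hn T
  have hFn2 : ⟪F n, n⟫ ≤ -1 + g^2 := by linarith only [ht1, ht10, e3, τ1, hFn]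
  obtain ⟨e, l, he, hl⟩ := diag F q.sym
  have lF : ∀ i, ⟪F (e i), e i⟫ = l i := fun i => by rw [he, real_inner_smul_left, ob_inner]; simp
  have l0le : l 0 ≤ -1 + g^2 := by
    refine le_trans ?_ hFn2
    have q1 := quad_exp q.sym he n
    have q2 := norm_exp e n
    rw [hn] at q2; rw [q1]
    have q3 : l 0 * 1^2 = l 0 * (⟪n, e 0⟫^2 + ⟪n, e 1⟫^2 + ⟪n, e 2⟫^2 + ⟪n, e 3⟫^2) := by rw [q2]
    linarith only [q3, mul_le_mul_of_nonneg_right (hl 1) (sq_nonneg ⟪n, e 1⟫), mul_le_mul_of_nonneg_right (hl 2) (sq_nonneg ⟪n, e 2⟫), mul_le_mul_of_nonneg_right (hl 3) (sq_nonneg ⟪n, e 3⟫)]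
  set a := ⟪n, e 0⟫ with ha
  set m' := e 0 - a • n with hm'
  have hem : e 0 = a • n + m' := by simp [hm']
  have hnm : ⟪n, m'⟫ = 0 := by simp [hm', inner_sub_right, real_inner_smul_right, hn, ha]
  have hm2 : ‖m'‖^2 = 1 - a^2 := by
    have : ‖e 0‖^2 = a^2 + ‖m'‖^2 := by
      rw [hem, norm_add_sq_real, real_inner_smul_left, hnm, norm_smul, hn, mul_one, Real.norm_eq_abs, sq_abs]; ring
    rw [e.norm_eq_one] at this; linarith only [this]
  have ha1 : |a| ≤ 1 := by rw [← sq_le_one_iff_abs_le_one]; linarith only [hm2, sq_nonneg ‖m'‖]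
  have hm1 : ‖m'‖ ≤ 1 := by rw [← abs_norm, ← sq_le_one_iff_abs_le_one]; linarith only [hm2, sq_nonneg a]
  have A5 := FNM q hg0 (by linarith only [hg1]) hn ha1 hnm hm1 hFn2 (T m' hnm hm1) (by linarith only [ht1, ht10]) (by rw [← hem, lF]; exact l0le)
  have hmh : ‖m'‖ ≤ h := by
    refine abs_le_of_sq_le_sq' ?_ hh0.le |>.2
    rw [hm2]; linarith only [hg, A5]
  have HF' := HF m S (hA.mono (by linarith only [hh, hh0, e2]) le_rfl) h0 (e 0) (by simp) (fun z hz hz3 => by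
    rw [hem, inner_add_left, real_inner_smul_left]
    have b1 := hs z hz (by linarith only [hz3])
    have b2 := abs_real_inner_le_norm m' z
    calc _ ≤ |a * ⟪n, z⟫| + |⟪m', z⟫| := abs_add_le _ _
      _ ≤ 1 * (εF/2) + h*3 := by
        rw [abs_mul]; gcongr
        · linarith only [e2, b1]
        · exact b2.trans (by gcongr)
      _ = _ := by rw [hh]; ring)
  have lge : -1 ≤ l 0 := by have := q.ge (e 0); rw [lF] at this; simpa using this
  have g2 : g^2 ≤ 1/4 := (pow_le_pow_left₀ hg0.le hg1 2).trans (by norm_num)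
  set c := ⟪b, e 0⟫ with hc
  have exq : ∀ z, 2*⟪b, z⟫ + ⟪F z, z⟫ = 2*c*⟪z, e 0⟫ + l 0*⟪z, e 0⟫^2 + ((2*⟪b, e 1⟫*⟪z, e 1⟫ + l 1*⟪z, e 1⟫^2) + (2*⟪b, e 2⟫*⟪z, e 2⟫ + l 2*⟪z, e 2⟫^2) + (2*⟪b, e 3⟫*⟪z, e 3⟫ + l 3*⟪z, e 3⟫^2)) := by
    intro z; rw [quad_exp q.sym he, inner_exp e b z]; ring
  have tr := q.tr e
  simp only [lF] at tr
  have NB := Nbound (c := c) (l0 := l 0) (τ := τ) (β := ![⟪b, e 1⟫, ⟪b, e 2⟫, ⟪b, e 3⟫]) (l := ![l 1, l 2, l 3]) τ0 lge (by linarith only [l0le, g2])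
    (by simp; convert tr using 2; ring) (fun y hy hy2 => by
      have iw : ∀ i, ⟪y 0 • e 1 + y 1 • e 2 + y 2 • e 3, e i⟫ = ![0, y 0, y 1, y 2] i := by
        intro i; simp only [inner_add_left, real_inner_smul_left, ob_inner]; fin_cases i <;> simp
      obtain ⟨z, hz, hzw⟩ := HF' (y 0 • e 1 + y 1 • e 2 + y 2 • e 3) (by rw [real_inner_comm, iw]; rfl) (by
        rw [← abs_norm, ← sq_le_one_iff_abs_le_one, norm_exp e]; simp only [iw]; simpa using hy2)
      have n1 : ‖z‖ ≤ 4 := by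
        have := norm_sub_norm_le z (y 0 • e 1 + y 1 • e 2 + y 2 • e 3)
        have : ‖y 0 • e 1 + y 1 • e 2 + y 2 • e 3‖ ≤ 1 := by
          rw [← abs_norm, ← sq_le_one_iff_abs_le_one, norm_exp e]; simp only [iw]; simpa using hy2
        linarith
      refine ⟨⟪z, e 0⟫, ![⟪z, e 1⟫, ⟪z, e 2⟫, ⟪z, e 3⟫], ?_, ?_⟩
      · have cl := fun i => (coord_le e (z - (y 0 • e 1 + y 1 • e 2 + y 2 • e 3)) i).trans hzw
        simp only [inner_sub_left, iw] at cl
        intro i; fin_cases i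
        · exact cl 1
        · exact cl 2
        · exact cl 3
      · have := hE z hz n1; rw [exq] at this; simpa using this)
  simp at NB
  have ab1 : |l 0 + 1| ≤ 25*τ + 32*c^2 := by
    have e' : l 0 + 1 = (l 0 + l 1 + l 2 + l 3 + 1) - l 1 - l 2 - l 3 := by ring
    have := abs_sub (l 0 + l 1 + l 2 + l 3 + 1 - l 1 - l 2) (l 3)
    have := abs_sub (l 0 + l 1 + l 2 + l 3 + 1 - l 1) (l 2)
    have := abs_sub (l 0 + l 1 + l 2 + l 3 + 1) (l 1)
    rw [e']; linarith [abs_nonneg ⟪b, e 1⟫, abs_nonneg ⟪b, e 2⟫, abs_nonneg ⟪b, e 3⟫]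
  have sqle : ∀ (z : V) (i : Fin 4) (L : ℝ), |L * ⟪z, e i⟫^2| ≤ |L| * ‖z‖^2 := by
    intro z i L; rw [abs_mul, abs_of_nonneg (sq_nonneg ⟪z, e i⟫), ← sq_abs ⟪z, e i⟫]; gcongr; exact coord_le e z i
  have R1 : ∀ z ∈ S, ‖z‖ ≤ 1 → |⟪z, e 0⟫ * (2*c - ⟪z, e 0⟫)| ≤ τ + 200*(c^2 + τ)*‖z‖ := by
    intro z hz hz1
    have E1 := hE z hz (by linarith only [hz1])
    rw [exq] at E1
    have z2 : ‖z‖^2 ≤ ‖z‖ := pow_le_of_le_one (norm_nonneg z) hz1 two_ne_zero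
    have lin : ∀ i, |2*⟪b, e i⟫*⟪z, e i⟫ + l i*⟪z, e i⟫^2| ≤ 2*(|⟪b, e i⟫| + |l i|)*‖z‖ := by
      intro i
      calc _ ≤ |2*⟪b, e i⟫*⟪z, e i⟫| + |l i*⟪z, e i⟫^2| := abs_add_le _ _
        _ ≤ 2 * |⟪b, e i⟫| * ‖z‖ + |l i| * ‖z‖ := by
          gcongr
          · rw [abs_mul, abs_mul, abs_two]; gcongr; exact coord_le e z i
          · exact (sqle z i _).trans (by gcongr)
        _ ≤ _ := by linarith only [mul_nonneg (abs_nonneg (l i)) (norm_nonneg z)]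
    have l0s : |(l 0 + 1)*⟪z, e 0⟫^2| ≤ (25*τ + 32*c^2)*‖z‖ :=
      (sqle z 0 _).trans (mul_le_mul ab1 z2 (sq_nonneg _) (by positivity))
    have NBz := mul_le_mul_of_nonneg_right NB (norm_nonneg z)
    have x0 := abs_le.1 E1; have x1 := abs_le.1 (lin 1); have x2 := abs_le.1 (lin 2); have x3 := abs_le.1 (lin 3); have x4 := abs_le.1 l0s
    have P : 0 ≤ c^2*‖z‖ := by positivity
    have P' : 0 ≤ τ*‖z‖ := by positivity
    rw [abs_le]; constructor <;> linarith [x0.1, x0.2, x1.1, x1.2, x2.1, x2.2, x3.1, x3.2, x4.1, x4.2]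
  have R2 : ∀ z, |⟪F z, z⟫| ≤ 2*⟪z, e 0⟫^2 + 200*(c^2 + τ)*‖z‖^2 := by
    intro z
    rw [quad_exp q.sym he]
    have x1 := abs_le.1 (sqle z 1 (l 1)); have x2 := abs_le.1 (sqle z 2 (l 2)); have x3 := abs_le.1 (sqle z 3 (l 3))
    have NBz := mul_le_mul_of_nonneg_right NB (sq_nonneg ‖z‖)
    have y0 := mul_le_mul_of_nonneg_right lge (sq_nonneg ⟪z, e 0⟫)
    have y1 := mul_le_mul_of_nonneg_right (show l 0 ≤ 1 by linarith only [l0le, g2]) (sq_nonneg ⟪z, e 0⟫)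
    have P : 0 ≤ c^2*‖z‖^2 := by positivity
    have P' : 0 ≤ τ*‖z‖^2 := by positivity
    have Q : ∀ i, 0 ≤ |⟪b, e i⟫| * ‖z‖^2 := fun i => by positivity
    rw [abs_le]; constructor <;> linarith [x1.1, x1.2, x2.1, x2.2, x3.1, x3.2, Q 1, Q 2, Q 3, sq_nonneg ⟪z, e 0⟫]
  rcases le_total 0 c with hc0 | hc0
  · exact ⟨e 0, by simp, hc0, R1, R2⟩
  · refine ⟨-e 0, by simp, by rw [inner_neg_right]; linarith only [hc0], fun z hz hz1 => ?_, fun z => ?_⟩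
    · have := R1 z hz hz1
      simp only [inner_neg_right]
      rw [show -⟪z, e 0⟫ * (2 * -⟪b, e 0⟫ - -⟪z, e 0⟫) = ⟪z, e 0⟫ * (2*c - ⟪z, e 0⟫) by ring, neg_sq]; exact this
    · simp only [inner_neg_right, neg_sq]; exact R2 z
lemma zero_rS {S : Set V} {y : V} (l : ℝ) (hy : y ∈ S) : (0:V) ∈ rS y l S := by simpa [rS]
lemma AU.QD {m : Measure V} {S : Set V} {ε L τ : ℝ} (h : AU m S ε L) (h0 : (0:V) ∈ S) (hL : 0 ≤ L) (hτ : 30/c3*ε ≤ τ) (b : V) (S' : Set V) : QD S' b (FG m) τ :=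
  ⟨FG_sym h, FG_ge h, fun e => by have := FG_tr h h0 hL e; rw [Fin.sum_univ_four] at this; exact this.trans hτ, nFG h⟩
/-- rescaled STAR -/
lemma STARr {m : Measure V} {S : Set V} {ε L : ℝ} (h : AU m S ε L) (h0 : (0:V) ∈ S) (hL : 1 ≤ L) {ρ : ℝ} (hρ : 0 < ρ) {z : V} (hz : ρ • z ∈ S) (hz1 : ρ * ‖z‖ ≤ 1) :
    |2*⟪ρ⁻¹ • bG m, z⟫ + ⟪FG m z, z⟫| ≤ |KS| * (ρ*‖z‖^3 + ε/ρ^2) := by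
  have n : ‖ρ • z‖ = ρ * ‖z‖ := by rw [norm_smul, Real.norm_of_nonneg hρ.le]
  have s := STAR h h0 hL hz (by rw [n]; exact hz1)
  have hε : 0 ≤ ε := by
    have := (abs_nonneg _).trans (h.two 0 h0 (by simp; linarith) 1 one_pos)
    linarith
  have e : 2*⟪bG m, ρ • z⟫ + ⟪FG m (ρ • z), ρ • z⟫ = ρ^2 * (2*⟪ρ⁻¹ • bG m, z⟫ + ⟪FG m z, z⟫) := by
    simp only [map_smul, real_inner_smul_left, real_inner_smul_right]; field_simp
  rw [e, abs_mul, abs_of_pos (by positivity : 0 < ρ^2), n] at s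
  have : ρ^2 * |2*⟪ρ⁻¹ • bG m, z⟫ + ⟪FG m z, z⟫| ≤ ρ^2 * (|KS| * (ρ*‖z‖^3 + ε/ρ^2)) := by
    refine s.trans ((mul_le_mul_of_nonneg_right (le_abs_self KS) (by positivity)).trans_eq ?_)
    field_simp
  exact le_of_mul_le_mul_left this (by positivity)
lemma massH {m : Measure V} {S : Set V} {ε L A : ℝ} (h : AU m S ε L) {p u : V} (hp : p ∈ S) (hpA : ‖p‖ ≤ A) (hAL : A ≤ L) (hu : ‖u‖ = 1) (hpu : 1 ≤ ⟪p, u⟫)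
    (hε : ε ≤ om/4) : (2/c3) * (om/16 * (Real.exp (-(A+1)^2)/4)) ≤ ⟪FG m u, u⟫ + 1 := by
  have := h.fin; have omp := om_pos; have c3p := c3_pos
  rw [inner_FG h, real_inner_self_eq_norm_sq, hu]
  have I := FG_qint h u u
  have key : om/16 * (Real.exp (-(A+1)^2)/4) ≤ ∫ x, wt x * (⟪x, u⟫ * ⟪x, u⟫) ∂m := by
    have m1 : om/16 ≤ m.real (closedBall p (1/2)) := by
      have := (abs_le.1 (h.two p hp (hpA.trans hAL) (1/2) (by norm_num))).1
      norm_num at this; linarith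
    have i2 : Integrable ((closedBall p (1/2)).indicator fun _ => Real.exp (-(A+1)^2)/4) m := (integrable_const _).indicator measurableSet_closedBall
    calc _ ≤ m.real (closedBall p (1/2)) * (Real.exp (-(A+1)^2)/4) := by gcongr
      _ = ∫ x, (closedBall p (1/2)).indicator (fun _ => Real.exp (-(A+1)^2)/4) x ∂m := by rw [integral_indicator_const _ measurableSet_closedBall]; simp
      _ ≤ _ := by
        refine integral_mono i2 I fun x => ?_
        have w := wt_pos x
        by_cases hx : x ∈ closedBall p (1/2)
        · rw [indicator_of_mem hx]
          rw [mem_closedBall, dist_eq_norm] at hx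
          have n1 : ‖x‖ ≤ A + 1 := by have := norm_sub_norm_le x p; linarith
          have n2 : 1/2 ≤ ⟪x, u⟫ := by
            have := abs_le.1 (abs_real_inner_le_norm (x-p) u)
            rw [hu, mul_one, inner_sub_left] at this; linarith [this.1]
          have w1 : Real.exp (-(A+1)^2) ≤ wt x := by unfold wt; gcongr
          have : 1/4 ≤ ⟪x, u⟫ * ⟪x, u⟫ := by nlinarith only [n2]
          calc _ = Real.exp (-(A+1)^2) * (1/4) := by ring
            _ ≤ _ := by gcongr
        · rw [indicator_of_notMem hx]; exact mul_nonneg w.le (mul_self_nonneg _)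
  have : (2/c3) * (om/16 * (Real.exp (-(A+1)^2)/4)) ≤ (2/c3) * ∫ x, wt x * (⟪x, u⟫ * ⟪x, u⟫) ∂m := by gcongr
  linarith
/-- a flat slab at unit scale makes the tangential part of `F` small -/
lemma TSM (t : ℝ) (ht : 0 < t) : ∃ ξ : ℝ, 0 < ξ ∧ ξ ≤ 1 ∧ ∀ (m : Measure V) (S : Set V), AU m S ξ 4 → (0:V) ∈ S → ∀ u : V, ‖u‖ = 1 →
    (∀ z ∈ S, ‖z‖ ≤ 1 → |⟪u, z⟫| ≤ ξ) → ∀ w, ⟪u, w⟫ = 0 → ‖w‖ ≤ 1 → |⟪FG m w, w⟫| ≤ t := by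
  have k0 := K0_pos; have kf := KF_ge
  set ρ := min (1/3) (t/(32*(|KS|+1))) with hρ
  have hρ0 : 0 < ρ := by positivity
  have hρ1 : ρ ≤ 1/3 := min_le_left _ _
  have hρ2 : |KS| * (8*ρ) ≤ t/4 := by
    have : ρ ≤ t/(32*(|KS|+1)) := min_le_right _ _
    rw [le_div_iff₀ (by positivity)] at this
    linarith
  set M := 3*K0/ρ with hM
  have hM0 : 0 < M := by positivity
  set θ := min 1 (t/(4*(2*M+3*KF))) with hθ
  have hθ0 : 0 < θ := by positivity
  have hθ2 : (2*M+3*KF)*θ ≤ t/4 := by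
    have : θ ≤ t/(4*(2*M+3*KF)) := min_le_right _ _
    rw [le_div_iff₀ (by positivity)] at this; linarith
  obtain ⟨εθ, hε, hε1, H⟩ := FILL θ hθ0
  set ξ := min (ρ*εθ) (t*ρ^2/(4*(|KS|+1))) with hξ
  have x1 : ξ ≤ ρ*εθ := min_le_left _ _
  have x2 : |KS| * (ξ/ρ^2) ≤ t/4 := by
    have : ξ ≤ t*ρ^2/(4*(|KS|+1)) := min_le_right _ _
    rw [le_div_iff₀ (by positivity)] at this
    have hx0 : 0 < ξ := by positivity
    rw [← mul_div_assoc, div_le_iff₀ (by positivity)]; linarith only [this, hx0]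
  have x3 : ρ*εθ ≤ εθ := by nlinarith only [hε, hρ1]
  refine ⟨ξ, by positivity, by linarith only [hε1, x1, x3], fun m S h h0 u hu hs w hw hw1 => ?_⟩
  have hx0 : 0 < ξ := by positivity
  have hr := h.rs (y := 0) (l := ρ) (L' := 4) hρ0 (by linarith only [hρ1]) hx0.le (by simp; linarith only [hρ1])
  have HH := H _ _ (hr.mono (x1.trans x3) le_rfl) (zero_rS ρ h0) u hu (fun z hz hz3 => by
    have := hs (0 + ρ • z) hz (by rw [zero_add, norm_smul, Real.norm_of_nonneg hρ0.le]; nlinarith only [hρ1, hρ0, hz3])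
    rw [zero_add, real_inner_smul_right, abs_mul, abs_of_pos hρ0] at this
    exact le_of_mul_le_mul_left (this.trans x1) hρ0)
  have st : ∀ z, z ∈ rS 0 ρ S → ‖z‖ ≤ 2 → |2*⟪ρ⁻¹ • bG m, z⟫ + ⟪FG m z, z⟫| ≤ t/2 := by
    intro z hz hz2
    refine (STARr h h0 (by norm_num) hρ0 (by simpa [rS] using hz) (by nlinarith only [hρ1, hρ0, hz2])).trans ?_
    have : ‖z‖^3 ≤ 8 := (pow_le_pow_left₀ (norm_nonneg z) hz2 3).trans (by norm_num)
    have : |KS| * (ρ*‖z‖^3) ≤ |KS| * (8*ρ) := mul_le_mul_of_nonneg_left (by nlinarith only [hρ0, this]) (abs_nonneg _)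
    linarith
  obtain ⟨z, hz, hzw⟩ := HH w hw hw1
  obtain ⟨z', hz', hzw'⟩ := HH (-w) (by simp [hw]) (by simpa using hw1)
  rw [sub_neg_eq_add] at hzw'
  have t1 : θ ≤ 1 := min_le_left _ _
  have n1 : ‖z‖ ≤ 2 := by have := norm_sub_norm_le z w; linarith only [hw1, hzw, t1, this]
  have n2 : ‖z'‖ ≤ 2 := by have := norm_sub_norm_le z' (-w); rw [norm_neg, sub_neg_eq_add] at this; linarith only [hw1, hzw', t1, this]
  have := TANG (FG_sym h) (nFG h) (b := ρ⁻¹ • bG m) (M := M) (by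
    rw [norm_smul, norm_inv, Real.norm_of_nonneg hρ0.le, hM, div_eq_inv_mul]; gcongr; exact nbG h) t1 hw1 hzw hzw' (st z hz n1) (st z' hz' n2)
  linarith only [ht, hθ2, this]
lemma SH2 (A : ℝ) (hA : 4 ≤ A) : ∃ ξ : ℝ, 0 < ξ ∧ ξ ≤ 1 ∧ ∀ (m : Measure V) (S : Set V), AU m S ξ A → (0:V) ∈ S → ∀ u p : V, ‖u‖ = 1 →
    (∀ z ∈ S, ‖z‖ ≤ 1 → |⟪u, z⟫| ≤ ξ) → p ∈ S → ‖p‖ ≤ A → 1 ≤ ⟪p, u⟫ → False := by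
  have omp := om_pos; have c3p := c3_pos
  set c := (2/c3) * (om/16 * (Real.exp (-(A+1)^2)/4)) with hc
  have c0 : 0 < c := by positivity
  obtain ⟨ξ1, h1, h1', H⟩ := TSM (c/12) (by positivity)
  set ξ := min (min ξ1 (om/4)) (c*c3/120) with hξ
  have x1 : ξ ≤ ξ1 := (min_le_left _ _).trans (min_le_left _ _)
  have x2 : ξ ≤ om/4 := (min_le_left _ _).trans (min_le_right _ _)
  have x3 : 30/c3*ξ ≤ c/4 := by
    have : ξ ≤ c*c3/120 := min_le_right _ _
    rw [div_mul_eq_mul_div, div_le_iff₀ c3p]; linarith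
  refine ⟨ξ, by positivity, x1.trans h1', fun m S h h0 u p hu hs hp hpA hpu => ?_⟩
  have T := H m S (h.mono x1 hA) h0 u hu (fun z hz hz1 => (hs z hz hz1).trans x1)
  have := FNN (h.QD h0 (by linarith only [hA]) x3 0 S) hu T
  have := massH h hp hpA le_rfl hu hpu x2
  linarith
lemma abs_inner_le_of_norm {u z : V} (hu : ‖u‖ = 1) : |⟪u, z⟫| ≤ ‖z‖ := by
  have := abs_real_inner_le_norm u z; rwa [hu, one_mul] at this
lemma mem_rS {y z : V} {l : ℝ} {S : Set V} : z ∈ rS y l S ↔ y + l • z ∈ S := Iff.rfl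
lemma rS_inv {y q : V} {l : ℝ} (hl : l ≠ 0) {S : Set V} (hq : q ∈ S) : l⁻¹ • (q - y) ∈ rS y l S := by
  rw [mem_rS, smul_inv_smul₀ hl]; simpa
lemma nsm {d c : ℝ} {z : V} (hd : 0 ≤ d) (hz : ‖z‖ ≤ c) : ‖d • z‖ ≤ d*c := by
  rw [norm_smul, Real.norm_of_nonneg hd]; exact mul_le_mul_of_nonneg_left hz hd
lemma nsm_eq {d : ℝ} {z : V} (hd : 0 ≤ d) : ‖d • z‖ = d*‖z‖ := by
  rw [norm_smul, Real.norm_of_nonneg hd]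
set_option maxHeartbeats 1000000 in
lemma EXC : ∃ ξ A : ℝ, 0 < ξ ∧ ξ ≤ 1/4 ∧ 4 ≤ A ∧ ∀ (m : Measure V) (S : Set V) (u : V) (b0 R : ℝ), AU m S ξ 8 → (0:V) ∈ S → ‖u‖ = 1 →
    0 < b0 → (A+5)*b0 ≤ 1 → b0 ≤ R/4 → R ≤ 1 →
    (∀ z ∈ S, ‖z‖ ≤ R → (⟪u, z⟫ ≤ b0 ∧ |⟪u, z⟫| ≤ ξ*b0) ∨ (b0 ≤ ⟪u, z⟫ ∧ |⟪u, z⟫ - 2*b0| ≤ ξ*b0)) →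
    ∀ z ∈ S, ‖z‖ ≤ R/40 → ⟪u, z⟫ ≤ b0 := by
  obtain ⟨ε, e0, e1, FI⟩ := FILL (1/10) (by norm_num)
  set A := max 60 (3/ε) with hA
  have A1 : 60 ≤ A := le_max_left _ _
  have A2 : 3 ≤ A*ε := by rw [← div_le_iff₀ e0]; exact le_max_right _ _
  obtain ⟨ξ0, x0, x1, SH⟩ := SH2 A (by linarith)
  set ξ := min (1/4) (min (ξ0/2) ε) with hξ
  have xa : ξ ≤ 1/4 := min_le_left _ _
  have xb : ξ ≤ ξ0/2 := (min_le_right _ _).trans (min_le_left _ _)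
  have xc : ξ ≤ ε := (min_le_right _ _).trans (min_le_right _ _)
  have xp : 0 < ξ := by positivity
  refine ⟨ξ, A, xp, xa, by linarith, fun m S u b0 R h h0 hu hb hAb hbR hR two z0 hz0 hz0R => ?_⟩
  by_contra! hc
  have Rp : 0 < R := by linarith
  let P : Set (V × V) := ((S ∩ closedBall 0 (R/2)) ∩ {p | ⟪u, p⟫ ≤ b0}) ×ˢ ((S ∩ closedBall 0 (R/2)) ∩ {p | b0 ≤ ⟪u, p⟫})
  have cB : IsCompact (S ∩ closedBall 0 (R/2)) := (isCompact_closedBall 0 (R/2)).inter_left h.cl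
  have c1 : IsClosed {p : V | ⟪u, p⟫ ≤ b0} := isClosed_le (by fun_prop) (by fun_prop)
  have c2 : IsClosed {p : V | b0 ≤ ⟪u, p⟫} := isClosed_le (by fun_prop) (by fun_prop)
  have Pc : IsCompact P := (cB.inter_right c1).prod (cB.inter_right c2)
  have Pn : ((0:V), z0) ∈ P := by
    refine ⟨⟨⟨h0, by simp; linarith⟩, by simp; linarith⟩, ⟨hz0, by simp; linarith⟩, hc.le⟩
  obtain ⟨⟨p, p'⟩, hP, hmin⟩ := Pc.exists_isMinOn ⟨_, Pn⟩ (f := fun q : V × V => ‖q.2 - q.1‖ + ‖q.1‖/10) (by fun_prop)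
  have hm : ∀ q q' : V, (q, q') ∈ P → ‖p' - p‖ + ‖p‖/10 ≤ ‖q' - q‖ + ‖q‖/10 := fun q q' hq => isMinOn_iff.1 hmin (q, q') hq
  have f0 := hm 0 z0 Pn
  simp only [sub_zero, norm_zero, zero_div, add_zero] at f0
  obtain ⟨⟨⟨pS, pR⟩, pb⟩, ⟨pS', pR'⟩, pb'⟩ := hP
  simp only [mem_closedBall, dist_zero_right, mem_ofPred_eq] at pR pb pR' pb'
  set d := ‖p' - p‖ with hd
  have np := norm_nonneg p
  have pR4 : ‖p‖ ≤ R/4 := by have := norm_nonneg (p' - p); linarith only [hz0R, f0, this]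
  have dR : d ≤ R/40 := by linarith
  have xb0 : ξ*b0 ≤ b0/4 := (mul_le_mul_of_nonneg_right xa hb.le).trans_eq (by ring)
  have sp : |⟪u, p⟫| ≤ ξ*b0 := by
    rcases two p pS (by linarith only [hb, hbR, pR4]) with h | h
    · exact h.2
    · have := abs_le.1 h.2; linarith only [hb, pb, xb0, this]
  have sp' : |⟪u, p'⟫ - 2*b0| ≤ ξ*b0 := by
    rcases two p' pS' (by linarith only [hb, hbR, pR']) with h | h
    · have := abs_le.1 h.2; linarith only [hb, pb', xb0, this]
    · exact h.2
  have Ab : 60*b0 ≤ A*b0 := mul_le_mul_of_nonneg_right A1 hb.le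
  have Ab1 : A*b0 ≤ 1 := by linarith only [hb, hAb]
  clear_value A ξ d
  have a1 := abs_le.1 sp
  have a2 := abs_le.1 sp'
  have sd : ⟪u, p' - p⟫ = ⟪u, p'⟫ - ⟪u, p⟫ := inner_sub_right _ _ _
  have dp : 3/2*b0 ≤ d := by
    have := (le_abs_self _).trans (abs_inner_le_of_norm (z := p' - p) hu)
    rw [sd] at this; linarith
  have d0 : 0 < d := by linarith only [hb, dp]
  by_cases hdA : d ≤ A*b0
  · have hr := h.rs (y := p) (l := b0) (L' := A) hb (by linarith only [hAb, Ab]) xp.le (by linarith only [hb, hAb, hR, hz0R, f0, dp])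
    refine SH _ _ (hr.mono (by linarith only [xb, xp]) le_rfl) (zero_rS b0 pS) u (b0⁻¹ • (p' - p)) hu ?_ (rS_inv hb.ne' pS') ?_ ?_
    · intro z hz hz1
      have n1 : ‖b0 • z‖ ≤ b0 := (nsm hb.le hz1).trans_eq (mul_one _)
      have ex : ⟪u, p + b0 • z⟫ = ⟪u, p⟫ + b0 * ⟪u, z⟫ := by rw [inner_add_right, real_inner_smul_right]
      have i1 := abs_le.1 ((abs_inner_le_of_norm (z := z) hu).trans hz1)
      have i2 : b0 * ⟪u, z⟫ ≤ b0 := mul_le_of_le_one_right hb.le i1.2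
      rcases two _ hz ((norm_add_le _ _).trans (by linarith)) with h | h
      · rw [ex] at h
        have h2 := abs_le.1 h.2
        have : b0 * |⟪u, z⟫| ≤ b0 * (2*ξ) := by
          rw [← abs_of_pos hb, ← abs_mul, abs_of_pos hb, abs_le]; constructor <;> linarith
        have := le_of_mul_le_mul_left this hb
        linarith only [xb, this]
      · rw [ex] at h
        have h2 := abs_le.1 h.2
        linarith only [hb, xb0, a1, i2, h2]
    · rw [norm_smul, norm_inv, Real.norm_of_nonneg hb.le, inv_mul_le_iff₀ hb]; linarith only [hd, hdA]
    · rw [real_inner_comm, real_inner_smul_right, sd, ← div_eq_inv_mul, le_div_iff₀ hb]; linarith only [xb0, a1, a2]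
  · push Not at hdA
    have hr := h.rs (y := p) (l := d) (L' := 4) d0 (by linarith only [hR, hz0R, f0, np]) xp.le (by linarith only [hb, hR, hz0R, f0, Ab, hdA])
    have bd : 3*b0 ≤ ε*d := by have := mul_le_mul_of_nonneg_right A2 hb.le; have := mul_le_mul_of_nonneg_left hdA.le e0.le; linarith
    have bd2 : 3*b0 ≤ d/20 := by linarith only [Ab, hdA]
    set v := d⁻¹ • (p' - p) with hv
    have nv : ‖v‖ = 1 := by rw [hv, norm_smul, norm_inv, Real.norm_of_nonneg d0.le, ← hd, inv_mul_cancel₀ d0.ne']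
    have dv : d • v = p' - p := smul_inv_smul₀ d0.ne' _
    have iv : |⟪u, v⟫| ≤ 1/20 := by
      rw [hv, real_inner_smul_right, sd, abs_mul, abs_of_pos (inv_pos.2 d0), inv_mul_le_iff₀ d0, abs_le]; constructor <;> linarith
    clear_value v
    set w := (1/2:ℝ) • (v - ⟪u, v⟫ • u) with hw
    have uu : ⟪u, u⟫ = 1 := by rw [real_inner_self_eq_norm_sq, hu]; norm_num
    have w0 : ⟪u, w⟫ = 0 := by rw [hw, real_inner_smul_right, inner_sub_right, real_inner_smul_right _ u, uu]; ring
    have nw : ‖w - (1/2:ℝ) • v‖ ≤ 1/40 := by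
      have : w - (1/2:ℝ) • v = (-(1/2) * ⟪u, v⟫) • u := by rw [hw]; module
      rw [this, norm_smul, hu, mul_one, norm_mul, Real.norm_eq_abs, Real.norm_eq_abs]; norm_num; linarith only [iv]
    have nhv : ‖(1/2:ℝ) • v‖ = 1/2 := by rw [norm_smul, nv]; norm_num
    obtain ⟨z, hz, hzw⟩ := FI _ _ (hr.mono xc le_rfl) (zero_rS d pS) u hu (fun z hz hz3 => by
      have n1 : ‖d • z‖ ≤ 3*d := (nsm d0.le hz3).trans_eq (mul_comm _ _)
      have ex : ⟪u, p + d • z⟫ = ⟪u, p⟫ + d * ⟪u, z⟫ := by rw [inner_add_right, real_inner_smul_right]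
      have : d * |⟪u, z⟫| ≤ d * ε := by
        rw [← abs_of_pos d0, ← abs_mul, abs_of_pos d0, abs_le]
        rcases two _ hz ((norm_add_le _ _).trans (by linarith only [hb, hz0R, f0, np, Ab, hdA, n1])) with h | h <;>
        · rw [ex] at h
          have h2 := abs_le.1 h.2
          constructor <;> linarith
      exact le_of_mul_le_mul_left this d0) w w0 (by
        have := norm_sub_norm_le w ((1/2:ℝ) • v); linarith only [nw, nhv, this])
    have z1 : ‖z‖ ≤ 13/20 := by
      have : z = (z - w) + (w - (1/2:ℝ) • v) + (1/2:ℝ) • v := by module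
      rw [this]; refine (norm_add₃_le).trans ?_; linarith only [nw, nhv, hzw]
    have z2 : ‖z - v‖ ≤ 13/20 := by
      have : z - v = (z - w) + (w - (1/2:ℝ) • v) + -((1/2:ℝ) • v) := by module
      rw [this]; refine (norm_add₃_le).trans ?_; rw [norm_neg]; linarith only [nw, nhv, hzw]
    have q1 : ‖d • z‖ ≤ 13/20*d := (nsm d0.le z1).trans_eq (mul_comm _ _)
    have q2 : ‖p' - (p + d • z)‖ ≤ 13/20*d := by
      have : p' - (p + d • z) = -(d • (z - v)) := by rw [smul_sub, dv]; abel
      rw [this, norm_neg]; exact (nsm d0.le z2).trans_eq (mul_comm _ _)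
    have q3 : ‖p + d • z‖ ≤ ‖p‖ + 13/20*d := (norm_add_le _ _).trans (by linarith only [q1])
    rcases le_total ⟪u, p + d • z⟫ b0 with hq | hq
    · have := hm (p + d • z) p' ⟨⟨⟨hz, by simp only [mem_closedBall, dist_zero_right]; linarith only [hb, hz0R, f0, np, Ab, hdA, q3]⟩, hq⟩, ⟨pS', by simpa using pR'⟩, pb'⟩
      linarith only [hb, Ab, hdA, q2, q3, this]
    · have := hm p (p + d • z) ⟨⟨⟨pS, by simpa using pR⟩, pb⟩, ⟨hz, by simp only [mem_closedBall, dist_zero_right]; linarith only [hb, hz0R, f0, np, Ab, hdA, q3]⟩, hq⟩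
      rw [add_sub_cancel_left] at this
      linarith only [hb, Ab, hdA, q1, this]
lemma unit_of {b : V} (hb : 0 < ‖b‖) : ‖(‖b‖⁻¹ • b : V)‖ = 1 := by
  rw [norm_smul, norm_inv, norm_norm, inv_mul_cancel₀ hb.ne']
lemma bhat_le {b z : V} {c : ℝ} (hb : 0 < ‖b‖) (h : |2*⟪b, z⟫| ≤ 2*‖b‖*c) : |⟪(‖b‖⁻¹ • b : V), z⟫| ≤ c := by
  rw [real_inner_smul_left, abs_mul, abs_of_pos (inv_pos.2 hb), inv_mul_le_iff₀ hb]
  rw [abs_mul, abs_two] at h; linarith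
lemma pow5 {l : ℝ} (h0 : 0 < l) (h1 : l ≤ 1) : l^5 ≤ l^4 ∧ l^4 ≤ l^3 ∧ l^3 ≤ l^2 ∧ l^2 ≤ l :=
  ⟨pow_le_pow_of_le_one h0.le h1 (by norm_num), pow_le_pow_of_le_one h0.le h1 (by norm_num), pow_le_pow_of_le_one h0.le h1 (by norm_num), (pow_le_pow_of_le_one h0.le h1 (show 1 ≤ 2 by norm_num)).trans_eq (pow_one l)⟩
set_option maxHeartbeats 1000000 in
lemma FST : ∃ η0 K l0 : ℝ, 0 < η0 ∧ η0 ≤ 1 ∧ 1 ≤ K ∧ 0 < l0 ∧ l0 ≤ 1 ∧ ∀ (m : Measure V) (S : Set V) (b : V) (F : V →L[ℝ] V) (τ l : ℝ), AU m S η0 8 → (0:V) ∈ S →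
    QD S b F τ → 0 ≤ τ → (∀ z ∈ S, ‖z‖ ≤ 4 → |2*⟪b, z⟫ + ⟪F z, z⟫| ≤ τ) → ∀ n : V, ‖n‖ = 1 → (∀ z ∈ S, ‖z‖ ≤ 4 → |⟪n, z⟫| ≤ η0) →
    0 < l → l ≤ l0 → τ ≤ l^5 → ∃ n' : V, ‖n'‖ = 1 ∧ ∀ z ∈ S, ‖z‖ ≤ l → |⟪n', z⟫| ≤ K*l^2 := by
  obtain ⟨ξ, A, x0, x1, A4, EX⟩ := EXC
  obtain ⟨η, e0, e1, AL⟩ := ALG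
  have kf := KF_ge; have k0 := K0_pos
  have kf0 : 0 < KF := by linarith
  set l1 := ξ/401 with hl1
  have l10 : 0 < l1 := by positivity
  set κ := l1/(4*(A+5)) with hκ
  have κ0 : 0 < κ := by positivity
  have κ1 : (A+5)*κ = l1/4 := by rw [hκ]; field_simp
  have κ2 : 9*κ ≤ l1/4 := by rw [← κ1]; exact mul_le_mul_of_nonneg_right (by linarith) κ0.le
  have l11 : 401*l1 = ξ := by rw [hl1]; ring
  set K := max (350000:ℝ) ((1+KF)/(2*κ)) with hK
  have K1 : 350000 ≤ K := le_max_left _ _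
  have K2 : 1+KF ≤ 2*κ*K := by have := le_max_right (350000:ℝ) ((1+KF)/(2*κ)); rwa [div_le_iff₀' (by positivity)] at this
  refine ⟨min ξ η, K, min (min η l1) (l1/40), by positivity, (min_le_right _ _).trans e1, by linarith only [K1], by positivity, (min_le_left _ _).trans ((min_le_left _ _).trans e1),
    fun m S b F τ l h h0 q hτ eq n hn hs hl hl0 hτl => ?_⟩
  have l_1 : l ≤ η := hl0.trans ((min_le_left _ _).trans (min_le_left _ _))
  have l_2 : l ≤ l1 := hl0.trans ((min_le_left _ _).trans (min_le_right _ _))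
  have l_3 : l ≤ l1/40 := hl0.trans (min_le_right _ _)
  have ll1 : l ≤ 1 := by linarith
  obtain ⟨p1, p2, p3, p4⟩ := pow5 hl ll1
  clear_value K κ l1
  clear hK hκ hl1
  have l2p : 0 < l^2 := by positivity
  by_cases hbκ : κ ≤ ‖b‖
  · have b0 : 0 < ‖b‖ := κ0.trans_le hbκ
    refine ⟨_, unit_of b0, fun z hz hzl => bhat_le b0 ?_⟩
    have q1 := abs_le.1 (eq z hz (by linarith))
    have q2 : |⟪F z, z⟫| ≤ KF*l^2 := by
      refine (abs_real_inner_le_norm _ _).trans ?_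
      calc ‖F z‖*‖z‖ ≤ (KF*l)*l := by
            gcongr; exact (F.le_opNorm z).trans (mul_le_mul q.nf hzl (norm_nonneg _) kf0.le)
        _ = _ := by ring
    have q3 := abs_le.1 q2
    have q4 : (1+KF)*l^2 ≤ 2*‖b‖*(K*l^2) := by
      have : 2*κ*K ≤ 2*‖b‖*K := by gcongr
      have := mul_le_mul_of_nonneg_right (K2.trans this) l2p.le
      linarith only [this]
    rw [abs_le]; constructor <;> linarith
  · push Not at hbκ
    obtain ⟨u, hu, bu, A1, A2⟩ := AL m S b F τ (h.mono (min_le_right _ _) (by norm_num)) h0 q (by linarith) hτ (by linarith) eq n hn (fun z hz h4 => (hs z hz h4).trans (min_le_right _ _))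
    set b0 := ⟪b, u⟫ with hb0
    have bb : b0 ≤ ‖b‖ := by have := real_inner_le_norm b u; rwa [hu, mul_one] at this
    clear_value b0
    by_cases hbl : b0 ≤ l^2
    · refine ⟨u, hu, fun z hz hzl => ?_⟩
      have a := A1 z hz (by linarith)
      rw [real_inner_comm] at a
      set s := ⟪u, z⟫
      have bq : b0^2 ≤ l^4 := (pow_le_pow_left₀ bu hbl 2).trans_eq (by ring)
      have a' : |s| * |2*b0-s| ≤ 601*l^4 := by
        rw [← abs_mul]; refine a.trans ?_
        have : 200*(b0^2+τ)*‖z‖ ≤ 200*(l^4+l^4)*1 := by gcongr <;> linarith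
        linarith
      by_contra! hc
      have c1 : 50*l^2 < |s| := lt_of_le_of_lt (by gcongr; linarith only [K1]) hc
      have c2 : 48*l^2 ≤ |2*b0-s| := by
        have := abs_sub_abs_le_abs_sub s (2*b0)
        rw [abs_sub_comm s, abs_of_nonneg (by linarith : 0 ≤ 2*b0)] at this; linarith only [hbl, c1, this]
      have := mul_le_mul c1.le c2 (by positivity) (abs_nonneg s)
      have q : 0 < l^4 := by positivity
      linarith only [this, q, a']
    · push Not at hbl
      have b0p : 0 < b0 := by linarith
      have hb : 0 < ‖b‖ := by linarith
      have bq : l^4 ≤ b0^2 := (by ring : l^4 = (l^2)^2).trans_le (pow_le_pow_left₀ l2p.le hbl.le 2)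
      have τb : τ ≤ b0^2*l := hτl.trans (by have := mul_le_mul_of_nonneg_right bq hl.le; linarith)
      have bl : b0^2*l ≤ b0^2 := mul_le_of_le_one_right (sq_nonneg _) ll1
      have prod : ∀ z ∈ S, ∀ t, l ≤ t → t ≤ 1 → ‖z‖ ≤ t → |⟪u, z⟫| * |2*b0 - ⟪u, z⟫| ≤ b0*(401*t*b0) := by
        intro z hz t ht ht1 hzt
        have a := A1 z hz (by linarith)
        rw [real_inner_comm, abs_mul] at a
        have : 200*(b0^2+τ)*‖z‖ ≤ 200*(b0^2+b0^2)*t := by gcongr; linarith only [hτl, p1, bq]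
        have : b0^2*l ≤ b0^2*t := by gcongr
        refine a.trans ?_
        linarith
      have bκ : b0 ≤ κ := by linarith
      have sh := EX m S u b0 l1 (h.mono (min_le_left _ _) le_rfl) h0 hu b0p (by
        have := mul_le_mul_of_nonneg_left bκ (by linarith only [A4] : 0 ≤ A+5); linarith only [x1, κ1, l11, this]) (by linarith) (by linarith) (fun z hz hz1 => by
          have pr := prod z hz l1 l_2 (by linarith only [x1, l11]) hz1
          rw [l11] at pr
          rcases le_total ⟪u, z⟫ b0 with c | c
          · refine Or.inl ⟨c, ?_⟩
            have : b0 ≤ |2*b0 - ⟪u, z⟫| := le_trans (by linarith) (le_abs_self _)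
            have := (mul_le_mul_of_nonneg_left this (abs_nonneg ⟪u, z⟫)).trans pr
            rw [mul_comm] at this
            exact le_of_mul_le_mul_left this b0p
          · refine Or.inr ⟨c, ?_⟩
            rw [abs_sub_comm]
            have : b0 ≤ |⟪u, z⟫| := c.trans (le_abs_self _)
            have := (mul_le_mul_of_nonneg_right this (abs_nonneg (2*b0-⟪u, z⟫))).trans pr
            exact le_of_mul_le_mul_left this b0p)
      refine ⟨_, unit_of hb, fun z hz hzl => bhat_le hb ?_⟩
      have c := sh z hz (hzl.trans l_3)
      have pr := prod z hz l le_rfl ll1 hzl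
      have : b0 ≤ |2*b0 - ⟪u, z⟫| := le_trans (by linarith) (le_abs_self _)
      have := (mul_le_mul_of_nonneg_left this (abs_nonneg ⟪u, z⟫)).trans pr
      rw [mul_comm] at this
      have s1 := le_of_mul_le_mul_left this b0p
      have s2 : ⟪u, z⟫^2 ≤ (401*l*b0)^2 := by rw [← sq_abs]; exact pow_le_pow_left₀ (abs_nonneg _) s1 2
      have q1 := abs_le.1 (eq z hz (by linarith))
      have f := A2 z
      rw [real_inner_comm u z] at f
      have f2 : 200*(b0^2+τ)*‖z‖^2 ≤ 200*(b0^2+b0^2)*l^2 := by gcongr; linarith only [hτl, p1, bq]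
      have f3 := abs_le.1 (f.trans (add_le_add (mul_le_mul_of_nonneg_left s2 zero_le_two) f2))
      have g1 : b0^2*l^2 ≤ b0*l^2 := mul_le_mul_of_nonneg_right (by rw [sq]; exact mul_le_of_le_one_right b0p.le (by linarith only [x1, κ2, l11, hbκ, bb])) l2p.le
      have g2 : τ ≤ b0*l^2 := hτl.trans (by
        have := mul_le_mul_of_nonneg_right hbl.le l2p.le
        have e : l^4 = l^2*l^2 := by ring
        linarith only [p1, this])
      have g3 : 2*b0*(350000*l^2) ≤ 2*‖b‖*(K*l^2) := by gcongr
      have e : (401*l*b0)^2 = 160801*(b0^2*l^2) := by ring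
      rw [e] at f3
      rw [abs_le]; constructor <;> linarith
structure HA (m : Measure V) (S : Set V) (C a R : ℝ) : Prop where
  au0 : AU m S 0 (-1)
  zero : (0:V) ∈ S
  ha : 0 < a
  ha1 : a ≤ 1
  hC : 1 ≤ C
  hR : 0 < R
  hR1 : R ≤ 1
  two : ∀ p ∈ S, ‖p‖ ≤ R → ∀ t, 0 < t → |m.real (closedBall p t) - om*t^3| ≤ C*t^3*t^a
lemma HA.au {m : Measure V} {S : Set V} {C a R : ℝ} (h : HA m S C a R) {y : V} {r L : ℝ} (hr : 0 < r) (hr1 : r ≤ 1) (hL : ‖y‖ + r*L ≤ R) :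
    AU (rs y r m) (rS y r S) (C*r^a) L := by
  have h' : AU (rs y r m) (rS y r S) 0 (-(1+‖y‖)/r) := h.au0.rs hr hr1 le_rfl (by
    have : r*(-(1+‖y‖)/r) = -(1+‖y‖) := by field_simp
    linarith)
  refine ⟨h'.fin, h'.cl, h'.nul, h'.up, fun p hp hpL t ht => ?_⟩
  rw [rs_real hr]
  have := h.two (y + r • p) hp ((norm_add_le _ _).trans ((add_le_add_right (nsm hr.le hpL) _).trans hL)) (r*t) (by positivity)
  have e : (r^3)⁻¹ * m.real (closedBall (y + r • p) (r*t)) - om * t^3 = (r^3)⁻¹ * (m.real (closedBall (y + r • p) (r*t)) - om * (r*t)^3) := by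
    field_simp
  rw [e, abs_mul, abs_of_pos (by positivity), inv_mul_le_iff₀ (by positivity)]
  refine this.trans ?_
  have hC := h.hC
  have ta : t^a ≤ 1+t := by
    rcases le_total t 1 with h1 | h1
    · have := Real.rpow_le_one ht.le h1 h.ha.le; linarith only [ht, this]
    · have := Real.rpow_le_rpow_of_exponent_le h1 h.ha1; rw [Real.rpow_one] at this; linarith
  rw [Real.mul_rpow hr.le ht.le]
  calc C*(r*t)^3*(r^a*t^a) ≤ C*(r*t)^3*(r^a*(1+t)) := by gcongr
    _ = _ := by ring
/-- slab -/
def SL (S : Set V) (y : V) (s η : ℝ) : Prop := ∃ n : V, ‖n‖ = 1 ∧ ∀ z ∈ S, ‖z - y‖ ≤ s → |⟪n, z - y⟫| ≤ η*s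
lemma AU.eps {m : Measure V} {S : Set V} {ε L : ℝ} (h : AU m S ε L) (h0 : (0:V) ∈ S) (hL : 0 ≤ L) : 0 ≤ ε := by
  have := (abs_nonneg _).trans (h.two 0 h0 (by simpa) 1 one_pos)
  linarith
lemma FS : ∃ η0 K K1 l0 : ℝ, 0 < η0 ∧ η0 ≤ 1 ∧ 1 ≤ K ∧ 1 ≤ K1 ∧ 0 < l0 ∧ l0 ≤ 1 ∧ ∀ (m : Measure V) (S : Set V) (ε δ l : ℝ), AU m S ε 8 → (0:V) ∈ S →
    0 < δ → ε ≤ δ^3 → 0 < l → l ≤ l0 → K1*δ ≤ l^5 → SL S 0 (4*δ) (η0/4) → SL S 0 (l*δ) (K*l) := by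
  obtain ⟨η0, K, l0, a1, a2, a3, a4, a5, FF⟩ := FST
  have c3p := c3_pos
  set K1 := 4 + 65*|KS| + 30/c3 with hK1
  have k1 : 4 ≤ K1 := by have := abs_nonneg KS; have : 0 < 30/c3 := by positivity
                         linarith
  refine ⟨η0, K, K1, min l0 η0, a1, a2, a3, by linarith, by positivity, (min_le_left _ _).trans a5, fun m S ε δ l h h0 hδ hε hl hl0 hK ⟨n, hn, hs⟩ => ?_⟩
  have l1 : l ≤ 1 := hl0.trans ((min_le_left _ _).trans a5)
  have e0 := h.eps h0 (by norm_num)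
  have l5 : l^5 ≤ l := (pow_le_pow_of_le_one hl.le l1 (show 1 ≤ 5 by norm_num)).trans_eq (pow_one l)
  have d4 : 4*δ ≤ l := (mul_le_mul_of_nonneg_right k1 hδ.le).trans (hK.trans l5)
  have dp := pow5 hδ (by linarith)
  have hr := h.rs (y := 0) (l := δ) (L' := 8) hδ (by linarith) e0 (by simp; linarith only [l1, d4])
  have eη : ε ≤ η0 := by have := hl0.trans (min_le_right _ _); linarith
  have ed : ε/δ^2 ≤ δ := by rw [div_le_iff₀ (by positivity)]; exact hε.trans_eq (by ring)
  have t0 : 0 ≤ |KS| := abs_nonneg _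
  have t1 : |KS| * (δ*64+ε/δ^2) ≤ |KS| * (65*δ) := mul_le_mul_of_nonneg_left (by linarith) t0
  have t2 : 30/c3*ε ≤ 30/c3*δ := by gcongr; linarith only [hε, dp]
  have t3 : K1*δ = 4*δ + |KS| * (65*δ) + 30/c3*δ := by rw [hK1]; ring
  have t4 : 0 ≤ 30/c3*ε := by positivity
  have t5 : 0 ≤ |KS| * (65*δ) := by positivity
  obtain ⟨n', hn', H⟩ := FF _ _ (δ⁻¹ • bG m) (FG m) (K1*δ) l (hr.mono eη le_rfl) (zero_rS δ h0) (h.QD h0 (by norm_num) (by linarith) _ _) (by positivity) (fun z hz hz4 => by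
    refine (STARr h h0 (by norm_num) hδ (by simpa [rS] using hz) ((mul_le_mul_of_nonneg_left hz4 hδ.le).trans (by linarith only [l1, d4]))).trans ?_
    have : δ*‖z‖^3 ≤ δ*64 := mul_le_mul_of_nonneg_left ((pow_le_pow_left₀ (norm_nonneg z) hz4 3).trans (by norm_num)) hδ.le
    have := mul_le_mul_of_nonneg_left this t0
    linarith only [hδ, t1, t2, t4, this]) n hn (fun z hz hz4 => by
      have := hs (0 + δ • z) hz (by rw [sub_zero, zero_add, mul_comm]; exact nsm hδ.le hz4)
      rw [sub_zero, zero_add, real_inner_smul_right, abs_mul, abs_of_pos hδ] at this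
      exact le_of_mul_le_mul_left (this.trans_eq (by ring)) hδ) hl (hl0.trans (min_le_left _ _)) hK
  refine ⟨n', hn', fun z hz hzl => ?_⟩
  rw [sub_zero] at hzl ⊢
  have := H (δ⁻¹ • z) (by simpa using rS_inv (y := 0) hδ.ne' hz) (by rw [nsm_eq (by positivity), inv_mul_le_iff₀ hδ]; linarith only [hzl])
  rw [real_inner_smul_right, abs_mul, abs_of_pos (inv_pos.2 hδ), inv_mul_le_iff₀ hδ] at this
  exact this.trans_eq (by ring)
lemma SL_rS {S : Set V} {y : V} {r s η : ℝ} (hr : 0 < r) : SL (rS y r S) 0 s η ↔ SL S y (r*s) η := by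
  constructor
  · rintro ⟨n, hn, h⟩
    refine ⟨n, hn, fun z hz hzs => ?_⟩
    have := h (r⁻¹ • (z - y)) (rS_inv hr.ne' hz) (by rw [sub_zero, nsm_eq (by positivity), inv_mul_le_iff₀ hr]; exact hzs)
    rw [sub_zero, real_inner_smul_right, abs_mul, abs_of_pos (inv_pos.2 hr), inv_mul_le_iff₀ hr] at this
    exact this.trans_eq (by ring)
  · rintro ⟨n, hn, h⟩
    refine ⟨n, hn, fun z hz hzs => ?_⟩
    rw [sub_zero] at hzs ⊢
    have := h (y + r • z) hz (by rw [add_sub_cancel_left]; exact nsm hr.le hzs)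
    rw [add_sub_cancel_left, real_inner_smul_right, abs_mul, abs_of_pos hr] at this
    exact le_of_mul_le_mul_left (this.trans_eq (by ring)) hr
/-- one step, in HA terms -/
lemma FS' : ∃ η0 K K1 l0 : ℝ, 0 < η0 ∧ η0 ≤ 1 ∧ 1 ≤ K ∧ 1 ≤ K1 ∧ 0 < l0 ∧ l0 ≤ 1 ∧ ∀ (m : Measure V) (S : Set V) (C a R r δ l : ℝ) (y : V), HA m S C a R → y ∈ S →
    0 < r → ‖y‖ + r*8 ≤ R → 0 < δ → C*r^a ≤ δ^3 → 0 < l → l ≤ l0 → K1*δ ≤ l^5 → SL S y (4*δ*r) η0 → SL S y (l*δ*r) (K*l) := by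
  obtain ⟨η0, K, K1, l0, a1, a2, a3, a4, a5, a6, H⟩ := FS
  refine ⟨η0/4, K, K1, l0, by positivity, by linarith, a3, a4, a5, a6, fun m S C a R r δ l y h hy hr hR hδ hC hl hl0 hK hs => ?_⟩
  have r1 : r ≤ 1 := by have := h.hR1; have := norm_nonneg y; linarith
  have := H _ _ _ δ l (h.au hr r1 hR) (zero_rS r hy) hδ hC hl hl0 hK ((SL_rS hr).2 (by rwa [mul_comm r]))
  rw [SL_rS hr, mul_comm r] at this
  exact this
def et : ℝ := FS'.choose
lemma FSx : ∃ K K1 l0 : ℝ, 0 < et ∧ et ≤ 1 ∧ 1 ≤ K ∧ 1 ≤ K1 ∧ 0 < l0 ∧ l0 ≤ 1 ∧ ∀ (m : Measure V) (S : Set V) (C a R r δ l : ℝ) (y : V), HA m S C a R → y ∈ S →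
    0 < r → ‖y‖ + r*8 ≤ R → 0 < δ → C*r^a ≤ δ^3 → 0 < l → l ≤ l0 → K1*δ ≤ l^5 → SL S y (4*δ*r) et → SL S y (l*δ*r) (K*l) := FS'.choose_spec
lemma et_pos : 0 < et := by obtain ⟨_, _, _, h, _⟩ := FSx; exact h
lemma SL.mono {S : Set V} {y : V} {s η η' : ℝ} (h : SL S y s η) (hs : 0 ≤ s) (hη : η ≤ η') : SL S y s η' := by
  obtain ⟨n, hn, h⟩ := h
  exact ⟨n, hn, fun z hz hzs => (h z hz hzs).trans (mul_le_mul_of_nonneg_right hη hs)⟩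
/-- flatness persists at smaller scales -/
lemma FL : ∃ q : ℝ, 0 < q ∧ q ≤ 1 ∧ ∀ (m : Measure V) (S : Set V) (C a R : ℝ), HA m S C a R → ∃ s1, 0 < s1 ∧ ∀ y ∈ S, ‖y‖ ≤ R/2 → ∀ s, 0 < s → s ≤ s1 → SL S y s et →
    ∀ σ, 0 < σ → σ ≤ q*s → SL S y σ et := by
  obtain ⟨K, K1, l0, e0, e1, k, k1, l0p, l01, H⟩ := FSx
  set l := min l0 (et/K) with hl
  have lp : 0 < l := by positivity
  have ll0 : l ≤ l0 := min_le_left _ _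
  have lK : K*l ≤ et := by have : l ≤ et/K := min_le_right _ _
                           rwa [le_div_iff₀' (by positivity)] at this
  set q := l/4 with hq
  have qp : 0 < q := by positivity
  have q1 : q ≤ 1/4 := by linarith
  refine ⟨q, qp, by linarith, fun m S C a R h => ?_⟩
  have hC := h.hC; have hR := h.hR; have ha := h.ha
  set δ := (4*q^2)^5/K1 with hδ
  have δp : 0 < δ := by positivity
  set r1 := min (R/16) ((δ^3/C)^(1/a)) with hr1
  have r1p : 0 < r1 := by positivity
  have step : ∀ y ∈ S, ‖y‖ ≤ R/2 → ∀ s, 0 < s → s ≤ 4*δ*r1 → SL S y s et → ∀ σ, q^2*s ≤ σ → σ ≤ q*s → SL S y σ et := by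
    intro y hy hyR s sp hs hsl σ hσ1 hσ2
    have l'p : 0 < 4*σ/s := by have : 0 < σ := lt_of_lt_of_le (by positivity) hσ1
                               positivity
    have l'l : 4*σ/s ≤ l := by rw [div_le_iff₀ sp, show l = 4*q by rw [hq]; ring]; linarith only [hσ2]
    have l'q : 4*q^2 ≤ 4*σ/s := by rw [le_div_iff₀ sp]; linarith only [hσ1]
    have rp : 0 < s/(4*δ) := by positivity
    have rr : s/(4*δ) ≤ r1 := by rw [div_le_iff₀' (by positivity)]; exact hs
    have := H m S C a R (s/(4*δ)) δ (4*σ/s) y h hy rp (by have := rr.trans (min_le_left _ _); linarith only [hyR, this]) δp (by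
      have := Real.rpow_le_rpow rp.le (rr.trans (min_le_right _ _)) ha.le
      rw [← Real.rpow_mul (by positivity), one_div_mul_cancel ha.ne', Real.rpow_one] at this
      rwa [le_div_iff₀' (by positivity)] at this) l'p (l'l.trans ll0) (by
      have : K1*δ = (4*q^2)^5 := by rw [hδ]; field_simp
      rw [this]; gcongr) (by
      have : 4*δ*(s/(4*δ)) = s := by field_simp
      rwa [this])
    have e : 4*σ/s*δ*(s/(4*δ)) = σ := by field_simp
    rw [e] at this
    exact this.mono (lt_of_lt_of_le (by positivity) hσ1).le (le_trans (by gcongr) lK)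
  refine ⟨4*δ*r1, by positivity, fun y hy hyR s sp hs hsl σ hσ hσq => ?_⟩
  have hk : ∀ k : ℕ, SL S y (q^k*s) et := by
    intro k
    induction k with
    | zero => simpa using hsl
    | succ k ih =>
      have : 0 < q^k*s := by positivity
      refine step y hy hyR (q^k*s) this (le_trans (mul_le_of_le_one_left sp.le (pow_le_one₀ qp.le (by linarith))) hs) ih _ ?_ (by rw [pow_succ]; exact le_of_eq (by ring))
      rw [show q^(k+1)*s = q*(q^k*s) by ring]
      exact mul_le_mul_of_nonneg_right (by nlinarith only [l01, ll0, lp, hq]) this.le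
  obtain ⟨k, k1, k2⟩ := exists_nat_pow_near_of_lt_one (x := σ/(q*s)) (y := q) (by positivity) (by rw [div_le_iff₀ (by positivity)]; linarith) qp (by linarith)
  rw [lt_div_iff₀ (by positivity)] at k1
  rw [div_le_iff₀ (by positivity)] at k2
  have : 0 < q^k*s := by positivity
  refine step y hy hyR (q^k*s) this (le_trans (mul_le_of_le_one_left sp.le (pow_le_one₀ qp.le (by linarith))) hs) (hk k) σ ?_ ?_
  · rw [pow_succ] at k1; linarith only [k1]
  · linarith
lemma FP {m : Measure V} {S : Set V} {C a R c : ℝ} (h : HA m S C a R) (hc : c = a/30) : ∃ K2 κ s1 : ℝ, 1 ≤ K2 ∧ 0 < κ ∧ κ ≤ 1 ∧ 0 < s1 ∧ s1 ≤ 1 ∧ ∀ y ∈ S, ‖y‖ ≤ R/2 → ∀ s, 0 < s → s ≤ s1 → SL S y s et →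
    ∀ σ, 0 < σ → σ ≤ κ*s^(1+2*c) → SL S y σ (K2*σ^c) := by
  obtain ⟨q, q0, q1, G⟩ := FL
  obtain ⟨s0, s0p, G⟩ := G m S C a R h
  obtain ⟨K, K1, l0, e0, e1, k, k1, l0p, l01, H⟩ := FSx
  have hC := h.hC; have hR := h.hR; have ha := h.ha; have ha1 := h.ha1; have hR1 := h.hR1
  have c0 : 0 < c := by rw [hc]; positivity
  have c1 : c ≤ 1/30 := by rw [hc]; linarith
  set A := C*K1^4 with hA
  have A1 : 1 ≤ A := one_le_mul_of_one_le_of_one_le hC (one_le_pow₀ k1)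
  have Ap : 0 < A := by linarith
  set s1 := min (min s0 1) (min ((R/(16*K1))^2) ((l0/A)^(1/c))) with hs1
  have s1p : 0 < s1 := by positivity
  have sa : s1 ≤ s0 := (min_le_left _ _).trans (min_le_left _ _)
  have sb : s1 ≤ 1 := (min_le_left _ _).trans (min_le_right _ _)
  have sc : s1 ≤ (R/(16*K1))^2 := (min_le_right _ _).trans (min_le_left _ _)
  have sd : s1 ≤ (l0/A)^(1/c) := (min_le_right _ _).trans (min_le_right _ _)
  refine ⟨K*A, (q/4)^2, s1, one_le_mul_of_one_le_of_one_le k A1, by positivity, ?_, s1p, sb, fun y hy hyR s sp hss hsl σ σp hσ => ?_⟩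
  · exact pow_le_one₀ (by positivity) (by linarith only [q1])
  clear_value s1
  have s_1 : s ≤ 1 := hss.trans sb
  have σs : σ ≤ s := by
    refine hσ.trans ?_
    have : s^(1+2*c) ≤ s^(1:ℝ) := Real.rpow_le_rpow_of_exponent_ge sp s_1 (by linarith)
    rw [Real.rpow_one] at this
    have q2 : (q/4)^2 ≤ 1 := pow_le_one₀ (by positivity) (by linarith only [q1])
    exact (mul_le_of_le_one_left (by positivity) q2).trans this
  have σ1 : σ ≤ 1 := σs.trans s_1
  set x := σ^c with hx
  have xp : 0 < x := by positivity
  have xA : A*x ≤ l0 := by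
    have := Real.rpow_le_rpow σp.le (σs.trans (hss.trans sd)) c0.le
    rw [← Real.rpow_mul (by positivity), one_div_mul_cancel c0.ne', Real.rpow_one] at this
    rwa [le_div_iff₀' Ap] at this
  set l := A*x with hl
  have lp : 0 < l := by positivity
  have xn : ∀ n : ℕ, x^n = σ^(c*n) := fun n => by rw [hx, ← Real.rpow_natCast, ← Real.rpow_mul σp.le]
  set δ := l^5/K1 with hδ
  have δp : 0 < δ := by positivity
  set r := σ/(l*δ) with hr
  have rp : 0 < r := by positivity
  have e1 : l*δ*r = σ := by rw [hr]; field_simp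
  have e2 : 4*δ*r = 4*σ/l := by rw [hr]; field_simp
  have rle : r ≤ K1*σ^(1-6*c) := by
    have : r = K1*σ/(A^6*x^6) := by rw [hr, hδ, hl]; field_simp
    rw [this, div_le_iff₀ (by positivity), Real.rpow_sub σp, Real.rpow_one]
    have x6 := xn 6
    push_cast at x6
    rw [mul_comm 6 c, ← x6]
    have : K1*(σ/x^6)*(A^6*x^6) = A^6*(K1*σ) := by field_simp
    rw [this]
    exact le_mul_of_one_le_left (by positivity) (one_le_pow₀ A1)
  have h1 := H m S C a R r δ l y h hy rp (by
      have : σ^(1-6*c) ≤ σ^(1/2:ℝ) := Real.rpow_le_rpow_of_exponent_ge σp σ1 (by linarith only [hc, ha1])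
      have h2 := Real.rpow_le_rpow σp.le (σs.trans (hss.trans sc)) (by norm_num : (0:ℝ) ≤ 1/2)
      rw [← Real.sqrt_eq_rpow ((R/(16*K1))^2), Real.sqrt_sq (by positivity)] at h2
      have h3 : K1*(R/(16*K1)) = R/16 := by field_simp
      have := mul_le_mul_of_nonneg_left (this.trans h2) (by linarith only [k1] : 0 ≤ K1)
      linarith only [hyR, rle, h3, this]) δp (by
      have h1 := Real.rpow_le_rpow rp.le rle ha.le
      rw [Real.mul_rpow (by positivity) (by positivity), ← Real.rpow_mul σp.le] at h1
      have h2 : K1^a ≤ K1 := by have := Real.rpow_le_rpow_of_exponent_le k1 ha1; rwa [Real.rpow_one] at this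
      have h3 : σ^((1-6*c)*a) ≤ x^15 := by
        rw [xn]; refine Real.rpow_le_rpow_of_exponent_ge σp σ1 ?_
        push_cast; rw [hc]; nlinarith only [ha, ha1]
      have h4 : r^a ≤ K1*x^15 := h1.trans (by gcongr)
      have h5 : δ^3 = A^15*x^15/K1^3 := by rw [hδ, hl]; field_simp
      rw [h5, le_div_iff₀ (by positivity)]
      calc C*r^a*K1^3 ≤ C*(K1*x^15)*K1^3 := by gcongr
        _ = A*x^15 := by rw [hA]; ring
        _ ≤ A^15*x^15 := by gcongr; exact le_self_pow₀ A1 (by norm_num)) lp xA (by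
      rw [hδ]; apply le_of_eq; field_simp) (by
      rw [e2]
      refine G y hy hyR s sp (hss.trans sa) hsl _ (by positivity) ?_
      rw [div_le_iff₀ lp]
      have xl : x ≤ l := le_mul_of_one_le_left xp.le A1
      have h1 : σ^(1-c) ≤ q/4*s := by
        have := Real.rpow_le_rpow σp.le hσ (by linarith only [hc, ha1] : 0 ≤ 1-c)
        rw [Real.mul_rpow (by positivity) (by positivity), ← Real.rpow_mul sp.le] at this
        refine this.trans ?_
        have a1 : s^((1+2*c)*(1-c)) ≤ s := by
          have := Real.rpow_le_rpow_of_exponent_ge sp s_1 (show (1:ℝ) ≤ (1+2*c)*(1-c) by nlinarith only [hc, ha, ha1])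
          rwa [Real.rpow_one] at this
        have a2 : ((q/4)^2)^(1-c) ≤ q/4 := by
          have q2 : (q/4)^2 ≤ 1 := pow_le_one₀ (by positivity) (by linarith only [q1])
          have := Real.rpow_le_rpow_of_exponent_ge (by positivity) q2 (show (1/2:ℝ) ≤ 1-c by linarith only [hc, ha1])
          rwa [← Real.sqrt_eq_rpow, Real.sqrt_sq (by positivity)] at this
        gcongr
      have h2 : σ = σ^(1-c)*x := by rw [hx, ← Real.rpow_add σp]; simp
      calc 4*σ = 4*(σ^(1-c)*x) := by rw [← h2]
        _ ≤ 4*((q/4*s)*l) := by gcongr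
        _ = _ := by ring)
  rw [e1] at h1
  exact h1.mono σp.le (by rw [hl]; exact le_of_eq (by ring))
def FlatAt (S : Set V) (x : V) : Prop := ∀ ε, 0 < ε → ∃ σ0, 0 < σ0 ∧ ∀ σ, 0 < σ → σ ≤ σ0 → ∃ n : V, ‖n‖ = 1 ∧ (∀ z ∈ S, ‖z - x‖ ≤ σ → |⟪n, z - x⟫| ≤ ε*σ) ∧
  ∀ w : V, ⟪n, w⟫ = 0 → ‖w‖ ≤ σ → ∃ z ∈ S, ‖z - x‖ ≤ σ ∧ ‖x + w - z‖ ≤ ε*σ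
lemma setD_le {A B : Set V} {c : ℝ} (hc : 0 ≤ c) (h : ∀ a ∈ A, infDist a B ≤ c) : setD A B ≤ c :=
  Real.iSup_le (fun a => Real.iSup_le (fun ha => h a ha) hc) hc
lemma setD_nn {A B : Set V} : 0 ≤ setD A B := Real.iSup_nonneg fun _ => Real.iSup_nonneg fun _ => infDist_nonneg
lemma proj_le {n z : V} (hn : ‖n‖ = 1) : ‖z - ⟪n, z⟫ • n‖ ≤ ‖z‖ ∧ ⟪n, z - ⟪n, z⟫ • n⟫ = 0 := by
  have nn : ⟪n, n⟫ = 1 := by rw [real_inner_self_eq_norm_sq, hn]; norm_num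
  refine ⟨?_, by rw [inner_sub_right, real_inner_smul_right, nn]; ring⟩
  have e : ‖z - ⟪n, z⟫ • n‖^2 = ‖z‖^2 - ⟪n, z⟫^2 := by
    rw [norm_sub_sq_real, norm_smul, hn, real_inner_smul_right, real_inner_comm z n, Real.norm_eq_abs, mul_one, sq_abs]; ring
  exact le_of_sq_le_sq (by rw [e]; linarith [sq_nonneg ⟪n, z⟫]) (norm_nonneg _)
lemma thetaP_flat {S : Set V} {x : V} (hx : x ∈ S) (h : FlatAt S x) : Tendsto (fun r => thetaP 3 S x r) (𝓝[>] 0) (𝓝 0) := by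
  rw [Metric.tendsto_nhdsWithin_nhds]
  intro ε hε
  obtain ⟨σ0, s0, H⟩ := h (ε/2) (by positivity)
  refine ⟨σ0, s0, fun {σ} hσ hd => ?_⟩
  rw [mem_Ioi] at hσ
  rw [dist_zero_right, Real.norm_of_nonneg hσ.le] at hd
  obtain ⟨n, hn, h1, h2⟩ := H σ hσ hd.le
  have nn : ∀ L : {L : AffineSubspace ℝ (E 4) // x ∈ L ∧ Module.finrank ℝ L.direction = 3}, 0 ≤ Dxr x σ S (L.1 : Set (E 4)) := fun L =>
    le_max_of_le_left (mul_nonneg (by positivity) setD_nn)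
  have t0 : 0 ≤ thetaP 3 S x σ := Real.iInf_nonneg nn
  rw [dist_zero_right, Real.norm_of_nonneg t0]
  let L : AffineSubspace ℝ (E 4) := AffineSubspace.mk' x (ℝ ∙ n)ᗮ
  have fr : Module.finrank ℝ L.direction = 3 := by
    rw [AffineSubspace.direction_mk']
    have : Fact (Module.finrank ℝ V = 3 + 1) := ⟨by simp⟩
    exact Submodule.finrank_orthogonal_span_singleton (by rintro rfl; simp at hn)
  have mL : ∀ z, z ∈ (L : Set V) ↔ ⟪n, z - x⟫ = 0 := fun z => by
    rw [SetLike.mem_coe, AffineSubspace.mem_mk', Submodule.mem_orthogonal_singleton_iff_inner_right, vsub_eq_sub]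
  refine lt_of_le_of_lt (ciInf_le ⟨0, by rintro _ ⟨L, rfl⟩; exact nn L⟩ ⟨L, AffineSubspace.self_mem_mk' _ _, fr⟩) (lt_of_le_of_lt ?_ (half_lt_self hε))
  have B : ∀ A B : Set V, setD A B ≤ ε/2*σ → 1/σ*setD A B ≤ ε/2 := fun A B h => by
    rw [one_div, inv_mul_le_iff₀ hσ]; linarith
  refine max_le (B _ _ (setD_le (by positivity) ?_)) (B _ _ (setD_le (by positivity) ?_))
  · rintro z ⟨hz, hzb⟩
    rw [mem_closedBall, dist_eq_norm] at hzb
    have p := proj_le (z := z - x) hn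
    have hm : x + (z - x - ⟪n, z - x⟫ • n) ∈ (L : Set V) ∩ closedBall x σ := by
      refine ⟨(mL _).2 ?_, ?_⟩
      · rw [add_sub_cancel_left]; exact p.2
      · rw [mem_closedBall, dist_eq_norm, add_sub_cancel_left]; exact p.1.trans hzb
    refine (infDist_le_dist_of_mem hm).trans ?_
    rw [dist_eq_norm]
    have : z - (x + (z - x - ⟪n, z - x⟫ • n)) = ⟪n, z - x⟫ • n := by abel
    rw [this, norm_smul, hn, mul_one]; exact h1 z hz hzb
  · rintro z ⟨hz, hzb⟩
    rw [mem_closedBall, dist_eq_norm] at hzb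
    obtain ⟨z', hz', a, b⟩ := h2 (z - x) ((mL _).1 hz) hzb
    have hm : z' ∈ S ∩ closedBall x σ := ⟨hz', by rwa [mem_closedBall, dist_eq_norm]⟩
    refine (infDist_le_dist_of_mem hm).trans ?_
    rw [dist_eq_norm]; rwa [add_sub_cancel] at b
/-- if `0` is not a flat point there is no slab at small scales -/
lemma NF {m : Measure V} {S : Set V} {C a R : ℝ} (h : HA m S C a R) (hnf : ¬ FlatAt S 0) : ∃ s0, 0 < s0 ∧ ∀ s, 0 < s → s ≤ s0 → ¬ SL S 0 s et := by
  obtain ⟨K2, κ, s1, k2, κ0, κ1, s1p, s11, H⟩ := FP h rfl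
  refine ⟨s1, s1p, fun s sp hs hsl => hnf fun ε hε => ?_⟩
  set c := a/30 with hc
  have c0 : 0 < c := by have := h.ha; positivity
  have hR := h.hR; have hC := h.hC; have ha := h.ha; have hR1 := h.hR1
  have H := H 0 h.zero (by simp; positivity) s sp hs hsl
  set η := min (1/2) (ε/3) with hη
  have ηp : 0 < η := by positivity
  obtain ⟨ε', e0, e1, FI⟩ := FILL η ηp
  have T1 : ∀ᶠ σ in 𝓝[>] (0:ℝ), 3*K2*(3*σ)^c < min ε' ε := by
    have : Tendsto (fun σ : ℝ => 3*K2*(3*σ)^c) (𝓝 0) (𝓝 (3*K2*(3*0)^c)) := by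
      refine ContinuousAt.tendsto (f := fun σ : ℝ => 3*K2*(3*σ)^c) ?_
      exact (continuousAt_const.mul ((continuousAt_const.mul continuousAt_id).rpow_const (Or.inr c0.le)))
    rw [mul_zero, Real.zero_rpow c0.ne', mul_zero] at this
    exact (this.mono_left nhdsWithin_le_nhds).eventually (gt_mem_nhds (by positivity))
  have T2 : ∀ᶠ σ in 𝓝[>] (0:ℝ), C*σ^a < ε' := by
    have : Tendsto (fun σ : ℝ => C*σ^a) (𝓝 0) (𝓝 (C*0^a)) := by
      refine ContinuousAt.tendsto (f := fun σ : ℝ => C*σ^a) ?_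
      exact (continuousAt_const.mul (continuousAt_id.rpow_const (Or.inr ha.le)))
    rw [Real.zero_rpow ha.ne', mul_zero] at this
    exact (this.mono_left nhdsWithin_le_nhds).eventually (gt_mem_nhds (by positivity))
  have T3 : ∀ᶠ σ in 𝓝[>] (0:ℝ), σ < min (κ*s^(1+2*c)/3) (R/4) := nhdsWithin_le_nhds (gt_mem_nhds (by positivity))
  obtain ⟨σ0, s0, hσ0⟩ := (mem_nhdsGT_iff_exists_Ioc_subset (a := (0:ℝ))).1 ((T1.and T2).and T3)
  refine ⟨σ0, s0, fun σ σp hσ => ?_⟩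
  obtain ⟨⟨t1, t2⟩, t3⟩ := hσ0 ⟨σp, hσ⟩
  have t3a := lt_min_iff.1 t3
  have t1a := lt_min_iff.1 t1
  obtain ⟨n, hn, hs⟩ := H (3*σ) (by positivity) (by linarith [t3a.1])
  have σ1 : σ ≤ 1 := by linarith [t3a.2]
  have FF := FI _ _ ((h.au (y := 0) (L := 4) σp σ1 (by simp; linarith only [t3a.2])).mono t2.le le_rfl) (zero_rS σ h.zero) n hn (fun z hz hz3 => by
    have := hs (0 + σ • z) hz (by rw [zero_add, sub_zero, mul_comm 3]; exact nsm σp.le hz3)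
    rw [zero_add, sub_zero, real_inner_smul_right, abs_mul, abs_of_pos σp] at this
    refine le_of_mul_le_mul_left (this.trans ?_) σp
    have := mul_le_mul_of_nonneg_left t1a.1.le σp.le
    linarith)
  refine ⟨n, hn, fun z hz hzs => ?_, fun w hw hws => ?_⟩
  · refine (hs z hz (by linarith)).trans ?_
    have := mul_le_mul_of_nonneg_right t1a.2.le σp.le
    linarith
  · have η1 : η ≤ 1/2 := min_le_left _ _
    have ws : ‖(σ⁻¹ • w : V)‖ ≤ 1 := by rw [nsm_eq (by positivity), inv_mul_le_iff₀ σp]; linarith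
    obtain ⟨z, hz, hzw⟩ := FF ((1-η) • σ⁻¹ • w) (by simp [real_inner_smul_right, hw]) ((nsm (by linarith only [η1]) ws).trans (by linarith only [ηp]))
    have nz : ‖z‖ ≤ 1 := by
      have h1 := norm_sub_norm_le z ((1-η) • σ⁻¹ • w)
      have h2 := nsm (d := 1-η) (by linarith only [η1]) ws
      linarith
    rw [mem_rS, zero_add] at hz
    refine ⟨_, hz, by rw [sub_zero]; exact (nsm σp.le nz).trans_eq (mul_one _), ?_⟩
    have e : 0 + w - σ • z = σ • (η • σ⁻¹ • w - (z - (1-η) • σ⁻¹ • w)) := by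
      have : w = σ • σ⁻¹ • w := (smul_inv_smul₀ σp.ne' w).symm
      nth_rw 1 [this]; module
    rw [e, mul_comm ε]
    refine nsm σp.le ((norm_sub_le _ _).trans ?_)
    have := nsm ηp.le ws
    have : η ≤ ε/3 := min_le_right _ _
    linarith
def pd (b n : V) : ℝ := ‖b - ⟪b, n⟫ • n‖
lemma pd_tri {a b n : V} (ha : ‖a‖ = 1) (hb : ‖b‖ = 1) (hn : ‖n‖ = 1) : pd a n ≤ pd a b + pd b n := by
  have e : a - ⟪a, n⟫ • n = (a - ⟪a, b⟫ • b) - ⟪n, a - ⟪a, b⟫ • b⟫ • n + ⟪a, b⟫ • (b - ⟪b, n⟫ • n) := by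
    rw [inner_sub_right, real_inner_smul_right, real_inner_comm a n, real_inner_comm b n]; module
  have i : |⟪a, b⟫| ≤ 1 := (abs_real_inner_le_norm a b).trans (by rw [ha, hb, one_mul])
  unfold pd; rw [e]
  refine (norm_add_le _ _).trans (add_le_add (proj_le hn).1 ?_)
  rw [norm_smul, Real.norm_eq_abs]; exact mul_le_of_le_one_left (norm_nonneg _) i
lemma pd_inner {b n z : V} (hb : ‖b‖ = 1) (hn : ‖n‖ = 1) : |⟪b, z⟫| ≤ pd b n * ‖z‖ + |⟪n, z⟫| := by
  have e : ⟪b, z⟫ = ⟪b - ⟪b, n⟫ • n, z⟫ + ⟪b, n⟫ * ⟪n, z⟫ := by rw [inner_sub_left, real_inner_smul_left]; ring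
  have i : |⟪b, n⟫| ≤ 1 := (abs_real_inner_le_norm b n).trans (by rw [hn, hb, one_mul])
  rw [e]; refine (abs_add_le _ _).trans (add_le_add (abs_real_inner_le_norm _ _) ?_)
  rw [abs_mul]; exact mul_le_of_le_one_left (abs_nonneg _) i
lemma KN_pos : 0 < KN := by unfold KN; norm_num
/-- comparing normals at the same scale -/
lemma NCMP {m : Measure V} {S : Set V} {C a R : ℝ} (h : HA m S C a R) : ∃ s, 0 < s ∧ s ≤ R/4 ∧ ∀ y ∈ S, ‖y‖ ≤ R/2 → ∀ σ, 0 < σ → σ ≤ s → ∀ q, 0 < q → ∀ n b : V, ‖n‖ = 1 → ‖b‖ = 1 →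
    (∀ z ∈ S, ‖z - y‖ ≤ σ → |⟪n, z - y⟫| ≤ q*σ) → (∀ z ∈ S, ‖z - y‖ ≤ σ → |⟪b, z - y⟫| ≤ q*σ) → pd b n ≤ KN*q := by
  have hR := h.hR; have hC := h.hC; have ha := h.ha; have hR1 := h.hR1; have omp := om_pos
  refine ⟨min (R/4) ((om/(4*C))^(1/a)), by positivity, min_le_left _ _, fun y hy hyR σ σp hσ q qp n b hn hb h1 h2 => ?_⟩
  have s1 := hσ.trans (min_le_left _ _)
  have s2 := Real.rpow_le_rpow σp.le (hσ.trans (min_le_right _ _)) ha.le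
  rw [← Real.rpow_mul (by positivity), one_div_mul_cancel ha.ne', Real.rpow_one, le_div_iff₀ (by positivity)] at s2
  refine noslab (h.au (y := y) (L := 1) σp (by linarith) (by linarith)) (zero_rS σ hy) (by simp) one_pos qp (by linarith) hn hb.le fun z hz hz1 => ?_
  rw [sub_zero] at hz1 ⊢
  have k : ∀ n : V, (∀ z ∈ S, ‖z - y‖ ≤ σ → |⟪n, z - y⟫| ≤ q*σ) → |⟪z, n⟫| ≤ q*1 := fun n h => by
    have := h _ hz (by rw [add_sub_cancel_left]; exact (nsm σp.le hz1).trans_eq (mul_one _))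
    rw [add_sub_cancel_left, real_inner_smul_right, abs_mul, abs_of_pos σp, real_inner_comm] at this
    exact le_of_mul_le_mul_left (this.trans_eq (by ring)) σp
  exact ⟨k n h1, k b h2⟩
lemma NY {m : Measure V} {S : Set V} {C a R : ℝ} (h : HA m S C a R) {K2 c : ℝ} (hK : 1 ≤ K2) (hc : 0 < c) (hc1 : c ≤ 1) : ∃ K3 s, 1 ≤ K3 ∧ 0 < s ∧ s ≤ R/4 ∧ ∀ y ∈ S, ‖y‖ ≤ R/2 → ∀ σ, 0 < σ → σ ≤ s →
    (∀ t, 0 < t → t ≤ σ → SL S y t (K2*t^c)) → ∃ n : V, ‖n‖ = 1 ∧ ∀ z ∈ S, ‖z - y‖ ≤ σ → |⟪n, z - y⟫| ≤ K3*‖z - y‖^c*‖z - y‖ := by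
  obtain ⟨s, sp, sR, N⟩ := NCMP h
  have kn := KN_pos
  set ρ := (1/2:ℝ)^c with hρ
  have ρ0 : 0 < ρ := by positivity
  have ρ1 : ρ < 1 := Real.rpow_lt_one (by norm_num) (by norm_num) hc
  set D := 2*KN*K2 with hD
  have D0 : 0 < D := by positivity
  have r1 : 0 < 1-ρ := by linarith
  refine ⟨2*(D/(1-ρ)+2*K2), s, ?_, sp, sR, fun y hy hyR σ σp hσ hsl => ?_⟩
  · have : 0 < D/(1-ρ) := by positivity
    linarith
  set t : ℕ → ℝ := fun k => σ*(1/2)^k with ht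
  have tp : ∀ k, 0 < t k := fun k => by positivity
  have tσ : ∀ k, t k ≤ σ := fun k => mul_le_of_le_one_right σp.le (pow_le_one₀ (by norm_num) (by norm_num))
  have ts : ∀ k, t k = 2*t (k+1) := fun k => by simp only [ht, pow_succ]; ring
  have tc : ∀ k, (t (k+1))^c = ρ*(t k)^c := fun k => by
    rw [show t (k+1) = 1/2*t k by rw [ts k]; ring, Real.mul_rpow (by norm_num) (tp k).le]
  choose n hn hs using fun k => hsl (t k) (tp k) (tσ k)
  have st : ∀ k, pd (n (k+1)) (n k) ≤ D*(t k)^c := by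
    intro k
    have x0 : 0 < (t k)^c := Real.rpow_pos_of_pos (tp k) c
    have := N y hy hyR (t (k+1)) (tp _) ((tσ _).trans hσ) (2*K2*(t k)^c) (by positivity) (n k) (n (k+1)) (hn _) (hn _) (fun z hz hzt => by
      refine (hs k z hz (hzt.trans (by rw [ts k]; linarith [tp (k+1)]))).trans_eq ?_
      rw [ts k]; ring) (fun z hz hzt => by
      refine (hs (k+1) z hz hzt).trans ?_
      rw [tc]
      have : ρ*(t k)^c ≤ 2*(t k)^c := mul_le_mul_of_nonneg_right (by linarith) x0.le
      have := mul_le_mul_of_nonneg_left this (by linarith : 0 ≤ K2)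
      exact mul_le_mul_of_nonneg_right (by linarith) (tp _).le)
    exact this.trans_eq (by rw [hD]; ring)
  have ch : ∀ j k, pd (n (k+j)) (n k) ≤ D/(1-ρ)*(t k)^c := by
    intro j
    induction j with
    | zero =>
      intro k
      have x0 : 0 < (t k)^c := Real.rpow_pos_of_pos (tp k) c
      have : pd (n (k+0)) (n k) = 0 := by
        unfold pd; rw [add_zero, real_inner_self_eq_norm_sq, hn]; simp
      rw [this]; positivity
    | succ j ih =>
      intro k
      have h1 := pd_tri (hn (k+(j+1))) (hn (k+1)) (hn k)
      have h2 := ih (k+1)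
      rw [show k+1+j = k+(j+1) by ring, tc] at h2
      have e : D/(1-ρ)*(t k)^c = D/(1-ρ)*(ρ*(t k)^c) + D*(t k)^c := by field_simp; ring
      rw [e]; linarith [st k]
  obtain ⟨N0, hN0, φ, hφ, hlim⟩ := (isCompact_sphere (0:V) 1).tendsto_subseq (x := n) (fun k => by simp [hn])
  rw [mem_sphere, dist_zero_right] at hN0
  have lim : ∀ k, pd N0 (n k) ≤ D/(1-ρ)*(t k)^c := by
    intro k
    have cont : Continuous fun b : V => pd b (n k) := by unfold pd; fun_prop
    refine le_of_tendsto ((cont.tendsto N0).comp hlim) ?_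
    filter_upwards [hφ.tendsto_atTop.eventually_ge_atTop k] with j hj
    have := ch (φ j - k) k
    rwa [Nat.add_sub_cancel' hj] at this
  refine ⟨N0, hN0, fun z hz hzσ => ?_⟩
  rcases (norm_nonneg (z - y)).eq_or_lt with h0 | h0
  · have : z - y = 0 := norm_eq_zero.1 h0.symm
    simp [this]
  obtain ⟨k, k1, k2⟩ := exists_nat_pow_near_of_lt_one (x := ‖z - y‖/σ) (y := (1/2:ℝ)) (by positivity) (by rw [div_le_iff₀ σp]; linarith) (by norm_num) (by norm_num)
  rw [lt_div_iff₀ σp, mul_comm] at k1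
  rw [div_le_iff₀ σp, mul_comm] at k2
  change t (k+1) < ‖z - y‖ at k1
  change ‖z - y‖ ≤ t k at k2
  have x0 : 0 < (t k)^c := Real.rpow_pos_of_pos (tp k) c
  have xz : (t k)^c ≤ 2*‖z - y‖^c := by
    have : (t k)^c ≤ (2*‖z - y‖)^c := Real.rpow_le_rpow (tp k).le (by rw [ts k]; linarith) hc.le
    rw [Real.mul_rpow (by norm_num) h0.le] at this
    refine this.trans (mul_le_mul_of_nonneg_right ?_ (by positivity))
    have := Real.rpow_le_rpow_of_exponent_le (x := 2) (by norm_num) hc1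
    rwa [Real.rpow_one] at this
  have h1 := pd_inner (z := z - y) hN0 (hn k)
  have h2 := mul_le_mul_of_nonneg_right (lim k) h0.le
  have h3 := hs k z hz k2
  have h4 : K2*(t k)^c*t k ≤ K2*(t k)^c*(2*‖z - y‖) := by gcongr; rw [ts k]; linarith only [k1]
  have h5 : (D/(1-ρ)+2*K2)*‖z - y‖*(t k)^c ≤ (D/(1-ρ)+2*K2)*‖z - y‖*(2*‖z - y‖^c) := by gcongr
  linarith
lemma quad_bd {F : V →L[ℝ] V} {K : ℝ} (hF : ‖F‖ ≤ K) {z : V} {t : ℝ} (hz : ‖z‖ ≤ t) : |⟪F z, z⟫| ≤ K*t^2 := by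
  have hK : 0 ≤ K := (norm_nonneg F).trans hF
  refine (abs_real_inner_le_norm _ _).trans ?_
  calc ‖F z‖*‖z‖ ≤ (K*t)*t := by
        gcongr
        · exact mul_nonneg hK ((norm_nonneg z).trans hz)
        · exact (F.le_opNorm z).trans (mul_le_mul hF hz (norm_nonneg _) hK)
    _ = _ := by ring
lemma ZF1 : ∃ K : ℝ, 1 ≤ K ∧ ∀ (m : Measure V) (S : Set V) (ε l : ℝ), AU m S ε 8 → (0:V) ∈ S → 0 < l → l ≤ 1/2 → ε ≤ l^6 →
    ¬ SL S 0 (4*l^3) et → ∀ z ∈ S, ‖z‖ ≤ 4*l^2 → |⟪FG m z, z⟫| ≤ K*l^5 := by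
  have ep := et_pos; have kf := KF_ge; have k0 := K0_pos
  have ks := abs_nonneg KS
  set A := 9*|KS| + 16*KF + 1 with hA
  have Ap : 0 < A := by positivity
  have hAe : 0 < A/et := by positivity
  refine ⟨1+33*|KS| + A/et, by linarith, fun m S ε l h h0 lp l2 hε hsl z hz hz4 => ?_⟩
  have l1 : l ≤ 1 := by linarith
  have p9 : l^9 ≤ l^7 := pow_le_pow_of_le_one lp.le l1 (by norm_num)
  have p7 : l^7 ≤ l^6 := pow_le_pow_of_le_one lp.le l1 (by norm_num)
  have p6 : l^6 ≤ l^5*(1/2) := by rw [pow_succ]; gcongr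
  have l6 : 0 < l^6 := by positivity
  have ll : 4*l^2 ≤ 1 := by nlinarith only [l2, lp]
  have star : ∀ z ∈ S, ∀ t, ‖z‖ ≤ t → t ≤ 1 → |2*⟪bG m, z⟫ + ⟪FG m z, z⟫| ≤ |KS| * (t^3 + l^6) := fun z hz t hzt ht => by
    have hε0 := h.eps h0 (by norm_num)
    refine (STAR h h0 (by norm_num) hz (hzt.trans ht)).trans ((mul_le_mul_of_nonneg_right (le_abs_self KS) (by positivity)).trans ?_)
    gcongr
  have nb : ‖bG m‖ ≤ A/(8*et)*l^3 := by
    by_contra! hc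
    have b0 : 0 < ‖bG m‖ := lt_trans (by positivity) hc
    refine hsl ⟨_, unit_of b0, fun z hz hz3 => bhat_le b0 ?_⟩
    rw [sub_zero] at hz3 ⊢
    have t0 : l^3 ≤ l^2 := pow_le_pow_of_le_one lp.le l1 (by norm_num)
    have t1 : 4*l^3 ≤ 1 := by linarith
    have q1 := abs_le.1 (star z hz _ hz3 t1)
    have q2 := abs_le.1 (quad_bd (nFG h) hz3)
    have e1 : (4*l^3)^3 = 64*l^9 := by ring
    have e2 : (4*l^3)^2 = 16*l^6 := by ring
    rw [e1] at q1; rw [e2] at q2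
    have p9' : 64*l^9 ≤ 8*l^6 := by
      have : l^9 = l^6*l^3 := by ring
      have q : l^3 ≤ 1/8 := (pow_le_pow_left₀ lp.le l2 3).trans (by norm_num)
      rw [this]; linarith only [mul_le_mul_of_nonneg_left q (pow_nonneg lp.le 6)]
    have q3 : |KS| * (64*l^9+l^6) ≤ 9*|KS| * l^6 := by
      have := mul_le_mul_of_nonneg_left p9' ks; linarith
    have q4 : A*l^6 ≤ 2*‖bG m‖*(et*(4*l^3)) := by
      have : A/(8*et)*l^3*(8*et*l^3) = A*l^6 := by field_simp
      have := mul_le_mul_of_nonneg_right hc.le (by positivity : 0 ≤ 8*et*l^3)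
      linarith
    have q5 : A*l^6 = 9*|KS| * l^6 + KF*(16*l^6) + l^6 := by rw [hA]; ring
    have kfe : (12*K0+1) = KF := rfl
    rw [kfe] at q2
    rw [abs_le]; constructor <;> linarith
  have q1 := abs_le.1 (star z hz _ hz4 ll)
  have e1 : (4*l^2)^3 = 64*l^6 := by ring
  rw [e1] at q1
  have q2 : |⟪bG m, z⟫| ≤ A/(2*et)*l^5 := by
    refine (abs_real_inner_le_norm _ _).trans ((mul_le_mul nb hz4 (norm_nonneg _) (by positivity)).trans_eq ?_)
    field_simp; ring
  have q2' := abs_le.1 q2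
  have q3 : |KS| * (64*l^6+l^6) ≤ 33*|KS| * l^5 := by
    have := mul_le_mul_of_nonneg_left p6 ks
    have : 0 ≤ |KS| * l^5 := by positivity
    linarith
  have e : 2*(A/(2*et)*l^5) = A/et*l^5 := by field_simp
  have : 0 < l^5 := by positivity
  rw [abs_le]; constructor <;> linarith
lemma ZF : ∃ K : ℝ, 1 ≤ K ∧ ∀ (m : Measure V) (S : Set V) (C a R s0 : ℝ), HA m S C a R → (∀ s, 0 < s → s ≤ s0 → ¬ SL S 0 s et) → ∀ r l, 0 < r → r*8 ≤ R → r ≤ s0 → 0 < l → l ≤ 1/2 →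
    C*r^a ≤ l^6 → ∀ z ∈ S, ‖z‖ ≤ 4*l^2*r → |⟪FG (rs 0 r m) z, z⟫| ≤ K*l^5*r^2 := by
  obtain ⟨K, K1, H⟩ := ZF1
  refine ⟨K, K1, fun m S C a R s0 h hsl r l rp hR hs lp l2 hl z hz hz4 => ?_⟩
  have hR1 := h.hR1
  have := H _ _ _ l (h.au (y := 0) rp (by linarith) (by simpa using hR)) (zero_rS r h.zero) lp l2 hl (by
    rw [SL_rS rp]
    refine hsl _ (by positivity) (le_trans ?_ hs)
    have : l^3 ≤ 1/8 := (pow_le_pow_left₀ lp.le l2 3).trans (by norm_num)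
    nlinarith only [rp, this]) (r⁻¹ • z) (by simpa using rS_inv (y := 0) rp.ne' hz) (by rw [nsm_eq (by positivity), inv_mul_le_iff₀ rp]; linarith)
  rw [map_smul, real_inner_smul_left, real_inner_smul_right, ← mul_assoc, abs_mul, abs_of_pos (by positivity : 0 < r⁻¹*r⁻¹)] at this
  have e : r⁻¹*r⁻¹ = (r^2)⁻¹ := by rw [sq, mul_inv]
  rw [e, inv_mul_le_iff₀ (by positivity)] at this
  linarith
def PGs : Submodule ℝ (V → ℝ) where
  carrier := {f | Continuous f ∧ ∃ K c : ℝ, 0 ≤ K ∧ 0 ≤ c ∧ ∀ x, |f x| ≤ K * Real.exp (c*‖x‖)}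
  zero_mem' := ⟨continuous_const, 0, 0, le_rfl, le_rfl, fun x => by simp⟩
  add_mem' := by
    rintro f g ⟨hf, K, c, K0, c0, h⟩ ⟨hg, K', c', K0', c0', h'⟩
    refine ⟨hf.add hg, K+K', c+c', by positivity, by positivity, fun x => (abs_add_le _ _).trans ?_⟩
    rw [add_mul]
    have n := norm_nonneg x
    refine add_le_add ((h x).trans ?_) ((h' x).trans ?_) <;> gcongr <;> linarith
  smul_mem' := by
    rintro s f ⟨hf, K, c, K0, c0, h⟩
    refine ⟨hf.const_smul s, |s| * K, c, by positivity, c0, fun x => ?_⟩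
    simp only [Pi.smul_apply, smul_eq_mul, abs_mul, mul_assoc]
    gcongr; exact h x
lemma PGs_mul {f g : V → ℝ} (hf : f ∈ PGs) (hg : g ∈ PGs) : f * g ∈ PGs := by
  obtain ⟨hf, K, c, K0, c0, h⟩ := hf
  obtain ⟨hg, K', c', K0', c0', h'⟩ := hg
  refine ⟨hf.mul hg, K*K', c+c', by positivity, by positivity, fun x => ?_⟩
  rw [Pi.mul_apply, abs_mul, add_mul, Real.exp_add]
  calc _ ≤ (K * Real.exp (c*‖x‖)) * (K' * Real.exp (c'*‖x‖)) := mul_le_mul (h x) (h' x) (abs_nonneg _) (by positivity)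
    _ = _ := by ring
lemma PGs_pow {f : V → ℝ} (hf : f ∈ PGs) (n : ℕ) : f ^ n ∈ PGs := by
  induction n with
  | zero => exact ⟨by rw [pow_zero]; exact continuous_const, 1, 0, by norm_num, le_rfl, fun x => by simp⟩
  | succ n ih => rw [pow_succ]; exact PGs_mul ih hf
def ln (y : V) : V → ℝ := fun x => ⟪x, y⟫
lemma PGs_ln (y : V) : ln y ∈ PGs := by
  refine ⟨by unfold ln; fun_prop, ‖y‖, 1, norm_nonneg _, zero_le_one, fun x => (abs_real_inner_le_norm _ _).trans ?_⟩
  rw [mul_comm, one_mul]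
  have := Real.add_one_le_exp ‖x‖
  gcongr; linarith
lemma PGs_exp (y : V) : (fun x : V => Real.exp (2*⟪x, y⟫)) ∈ PGs := by
  refine ⟨by fun_prop, 1, 2*‖y‖, zero_le_one, by positivity, fun x => ?_⟩
  rw [one_mul, Real.abs_exp, Real.exp_le_exp]
  have := real_inner_le_norm x y; linarith
lemma PGs_max {f : V → ℝ} (hf : f ∈ PGs) : (fun x => max (f x) 0) ∈ PGs := by
  obtain ⟨hf, K, c, K0, c0, h⟩ := hf
  refine ⟨by fun_prop, K, c, K0, c0, fun x => le_trans ?_ (h x)⟩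
  rw [abs_of_nonneg (le_max_right _ _)]
  exact max_le (le_abs_self _) (abs_nonneg _)
lemma wtb {f : ℝ} {x : V} {K c : ℝ} (hK : 0 ≤ K) (h : |f| ≤ K * Real.exp (c*‖x‖)) : ‖wt x * f‖ ≤ K*Real.exp ((c+2)^2/4) * Real.exp (-‖x-0‖) := by
  rw [norm_mul, Real.norm_of_nonneg (wt_pos x).le, Real.norm_eq_abs]
  have := pgb 0 c ‖x‖ (norm_nonneg _)
  simp only [pow_zero, one_mul, Nat.factorial_zero, Nat.cast_one] at this
  rw [sub_zero]
  calc wt x * |f| ≤ wt x * (K * Real.exp (c*‖x‖)) := mul_le_mul_of_nonneg_left h (wt_pos x).le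
    _ = K * (Real.exp (c*‖x‖) * Real.exp (-‖x‖^2)) := by unfold wt; ring
    _ ≤ _ := by rw [mul_assoc]; gcongr
def IG (m : Measure V) (r : ℝ) (f : V → ℝ) : ℝ := ∫ x, wt x * f x ∂(rs 0 r m)
lemma ulim {U : Ultrafilter ℝ} {X : Type*} [NormedAddCommGroup X] [ProperSpace X] {f : ℝ → X} {K : ℝ} (hb : ∀ᶠ r in (U : Filter ℝ), ‖f r‖ ≤ K) : ∃ x, Tendsto f U (𝓝 x) := by
  obtain ⟨x, -, hx⟩ := (isCompact_closedBall (0:X) K).ultrafilter_le_nhds (U.map f) (by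
    rw [le_principal_iff]; exact hb.mono fun r hr => by simpa using hr)
  exact ⟨x, hx⟩
section
variable {m : Measure V} {S : Set V} {C a R : ℝ} (h : HA m S C a R) {U : Ultrafilter ℝ} (hU : (U : Filter ℝ) ≤ 𝓝[>] 0)
include hU
lemma ev_lt {δ : ℝ} (hδ : 0 < δ) : ∀ᶠ r in (U : Filter ℝ), 0 < r ∧ r < δ :=
  hU (Ioo_mem_nhdsGT hδ)
include h
lemma ev_eps {δ : ℝ} (hδ : 0 < δ) : ∀ᶠ r in (U : Filter ℝ), C*r^a ≤ δ := by
  have : Tendsto (fun r : ℝ => C*r^a) (𝓝 0) (𝓝 (C*0^a)) := ((Real.continuousAt_rpow_const 0 a (Or.inr h.ha.le)).tendsto).const_mul C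
  rw [Real.zero_rpow h.ha.ne', mul_zero] at this
  filter_upwards [hU (mem_nhdsWithin_of_mem_nhds (this.eventually_lt_const hδ))] with r hr using hr.le
lemma ev_au (L : ℝ) : ∀ᶠ r in (U : Filter ℝ), AU (rs 0 r m) (rS 0 r S) (C*r^a) L := by
  have := h.hR
  filter_upwards [ev_lt hU one_pos, ev_lt hU (show 0 < R/(|L|+1) by positivity)] with r h1 h2
  refine h.au h1.1 h1.2.le ?_
  rw [lt_div_iff₀ (by positivity)] at h2
  have := mul_le_mul_of_nonneg_left (le_abs_self L) h1.1.le
  simp; linarith [h1.1]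
lemma IG_bd {f : V → ℝ} {K c : ℝ} (hf : Continuous f) (hK : 0 ≤ K) (hb : ∀ x, |f x| ≤ K * Real.exp (c*‖x‖)) :
    ∀ᶠ r in (U : Filter ℝ), Integrable (fun x => wt x * f x) (rs 0 r m) ∧ ‖IG m r f‖ ≤ K*Real.exp ((c+2)^2/4)*(96*om) := by
  filter_upwards [ev_au h hU 0] with r hr
  exact domI hr (wt_cont.mul hf) (by positivity) fun x => wtb hK (hb x)
lemma LAM : ∃ Λ : (V → ℝ) →ₗ[ℝ] ℝ, ∀ f ∈ PGs, Tendsto (fun r => IG m r f) U (𝓝 (Λ f)) := by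
  have H : ∀ f : PGs, ∃ l, Tendsto (fun r => IG m r f.1) U (𝓝 l) := by
    rintro ⟨f, hf, K, c, K0, c0, hb⟩
    exact ulim ((IG_bd h hU hf K0 hb).mono fun r hr => hr.2)
  choose l hl using H
  have hI : ∀ f : PGs, ∀ᶠ r in (U : Filter ℝ), Integrable (fun x => wt x * f.1 x) (rs 0 r m) := by
    rintro ⟨f, hf, K, c, K0, c0, hb⟩
    exact (IG_bd h hU hf K0 hb).mono fun r hr => hr.1
  obtain ⟨g, hg⟩ := LinearMap.exists_extend (p := PGs) (⟨⟨l, fun f g => by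
    refine tendsto_nhds_unique (hl _) (((hl f).add (hl g)).congr' ?_)
    filter_upwards [hI f, hI g] with r h1 h2
    simp only [IG]; rw [← integral_add h1 h2]
    simp [mul_add]⟩, fun s f => by
    refine tendsto_nhds_unique (hl _) (((hl f).const_mul s).congr fun r => ?_)
    simp only [IG]; rw [← integral_const_mul]
    simp [mul_left_comm]⟩ : PGs →ₗ[ℝ] ℝ)
  refine ⟨g, fun f hf => ?_⟩
  have := congrArg (fun q => q ⟨f, hf⟩) hg
  simp at this
  rw [this]; exact hl ⟨f, hf⟩
/-- vanishing -/
lemma VAN {f : ℝ → V → ℝ} {K c : ℝ} (hK : 0 ≤ K) (hb : ∀ᶠ r in (U : Filter ℝ), ∀ x, |f r x| ≤ K * Real.exp (c*‖x‖))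
    (hv : ∀ A η : ℝ, 0 < η → ∀ᶠ r in (U : Filter ℝ), ∀ z ∈ rS 0 r S, ‖z‖ ≤ A → |f r z| ≤ η) : Tendsto (fun r => IG m r (f r)) U (𝓝 0) := by
  have omp := om_pos
  have key : ∀ δ : ℝ, 0 < δ → ∀ᶠ r in (U : Filter ℝ), ‖IG m r (f r)‖ ≤ δ*(96*om) := by
    intro δ hδ
    set D := K*Real.exp ((c+1+2)^2/4) with hD
    have hD0 : 0 ≤ D := by positivity
    clear_value D
    obtain ⟨A, hA⟩ : ∃ A : ℝ, D * Real.exp (-A) ≤ δ := by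
      have : Tendsto (fun A : ℝ => D * Real.exp (-A)) atTop (𝓝 (D*0)) := (Real.tendsto_exp_neg_atTop_nhds_zero).const_mul D
      rw [mul_zero] at this
      exact (this.eventually_le_const hδ).exists
    filter_upwards [hb, hv A (δ*Real.exp (-A)) (by positivity), ev_au h hU 0] with r h1 h2 h3
    have i := (Hexp h3 0)
    have bd : ∀ᵐ x ∂(rs 0 r m), ‖wt x * f r x‖ ≤ δ * Real.exp (-‖x-0‖) := by
      have : ∀ᵐ x ∂(rs 0 r m), x ∈ rS 0 r S := mem_ae_iff.2 h3.nul
      filter_upwards [this] with x hx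
      rcases le_total ‖x‖ A with hA' | hA'
      · have w1 : wt x ≤ 1 := by unfold wt; rw [Real.exp_le_one_iff]; simp
        rw [norm_mul, Real.norm_of_nonneg (wt_pos x).le, sub_zero]
        calc wt x * ‖f r x‖ ≤ 1 * (δ * Real.exp (-A)) := mul_le_mul w1 (h2 x hx hA') (norm_nonneg _) zero_le_one
          _ ≤ _ := by rw [one_mul]; gcongr
      · have e : |f r x| * Real.exp ‖x‖ ≤ K * Real.exp ((c+1)*‖x‖) := by
          rw [add_mul, Real.exp_add, ← mul_assoc, one_mul]; gcongr; exact h1 x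
        have := wtb (f := |f r x| * Real.exp ‖x‖) hK (by rwa [abs_of_nonneg (by positivity)])
        rw [norm_mul, norm_mul, Real.norm_of_nonneg (Real.exp_pos _).le, Real.norm_eq_abs |_|, abs_abs, ← hD] at this
        have e2 : ‖wt x * f r x‖ = (‖wt x‖ * (|f r x| * Real.exp ‖x‖)) * Real.exp (-‖x‖) := by
          rw [mul_assoc, mul_assoc, ← Real.exp_add, add_neg_cancel, Real.exp_zero, mul_one, norm_mul, Real.norm_eq_abs (f r x)]
        rw [e2]
        calc _ ≤ D * Real.exp (-‖x-0‖) * Real.exp (-A) := by gcongr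
          _ = D * Real.exp (-A) * Real.exp (-‖x-0‖) := by ring
          _ ≤ _ := by gcongr
    calc ‖IG m r (f r)‖ ≤ ∫ x, δ * Real.exp (-‖x-0‖) ∂(rs 0 r m) := norm_integral_le_of_norm_le (i.1.const_mul δ) bd
      _ ≤ _ := by rw [integral_const_mul]; gcongr; exact i.2
  rw [Metric.tendsto_nhds]
  intro η hη
  filter_upwards [key (η/(2*(96*om))) (by positivity)] with r hr
  rw [dist_zero_right]
  have : η/(2*(96*om))*(96*om) = η/2 := by field_simp
  rw [this] at hr; linarith
end
def TU (S : Set V) (U : Ultrafilter ℝ) : Set V := {y | ∀ ε : ℝ, 0 < ε → ∀ᶠ r in (U : Filter ℝ), ∃ z ∈ rS 0 r S, ‖z - y‖ < ε}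
lemma TU_lim {S : Set V} {U : Ultrafilter ℝ} {z : ℝ → V} {y : V} (hz : ∀ᶠ r in (U : Filter ℝ), z r ∈ rS 0 r S) (hy : Tendsto z U (𝓝 y)) : y ∈ TU S U := by
  intro ε hε
  filter_upwards [hz, Metric.tendsto_nhds.1 hy ε hε] with r h1 h2
  exact ⟨z r, h1, by rwa [dist_eq_norm] at h2⟩
lemma TU_seq {S : Set V} {U : Ultrafilter ℝ} {A : ℝ} {P : ℝ → V → Prop} (hn : ¬ ∀ᶠ r in (U : Filter ℝ), ∀ z ∈ rS 0 r S, ‖z‖ ≤ A → P r z) :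
    ∃ (z : ℝ → V) (y : V), (∀ᶠ r in (U : Filter ℝ), z r ∈ rS 0 r S ∧ ‖z r‖ ≤ A ∧ ¬ P r (z r)) ∧ Tendsto z U (𝓝 y) ∧ y ∈ TU S U := by
  rw [← Ultrafilter.eventually_not] at hn
  have : ∃ z : ℝ → V, ∀ᶠ r in (U : Filter ℝ), z r ∈ rS 0 r S ∧ ‖z r‖ ≤ A ∧ ¬ P r (z r) := by
    classical
    refine ⟨fun r => if hr : ∃ z ∈ rS 0 r S, ‖z‖ ≤ A ∧ ¬ P r z then hr.choose else 0, ?_⟩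
    filter_upwards [hn] with r hr
    push Not at hr
    rw [dif_pos hr]; exact hr.choose_spec
  obtain ⟨z, hz⟩ := this
  obtain ⟨y, hy⟩ := ulim (f := z) (hz.mono fun r hr => hr.2.1)
  exact ⟨z, y, hz, hy, TU_lim (hz.mono fun r hr => hr.1) hy⟩
lemma TU_near (S : Set V) (U : Ultrafilter ℝ) (A : ℝ) {η : ℝ} (hη : 0 < η) : ∀ᶠ r in (U : Filter ℝ), ∀ z ∈ rS 0 r S, ‖z‖ ≤ A → ∃ y ∈ TU S U, ‖z - y‖ < η := by
  by_contra hn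
  obtain ⟨z, y, h1, h2, h3⟩ := TU_seq hn
  obtain ⟨r, hr, hr'⟩ := (h1.and (Metric.tendsto_nhds.1 h2 η hη)).exists
  exact hr.2.2 ⟨y, h3, by rwa [dist_eq_norm] at hr'⟩
lemma TU_closed (S : Set V) (U : Ultrafilter ℝ) : IsClosed (TU S U) := by
  refine isClosed_of_closure_subset fun y hy ε hε => ?_
  obtain ⟨w, hw, hd⟩ := Metric.mem_closure_iff.1 hy (ε/2) (by positivity)
  filter_upwards [hw (ε/2) (by positivity)] with r ⟨z, hz, hzw⟩
  refine ⟨z, hz, ?_⟩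
  rw [dist_comm, dist_eq_norm] at hd
  have := norm_add_le (z-w) (w-y)
  rw [sub_add_sub_cancel] at this; linarith
lemma abs_exp_sub {a b M : ℝ} (ha : a ≤ M) (hb : b ≤ M) : |Real.exp a - Real.exp b| ≤ Real.exp M * |a-b| := by
  have k : ∀ a b : ℝ, a ≤ M → Real.exp a - Real.exp b ≤ Real.exp M * |a-b| := fun a b ha => by
    have e : Real.exp b = Real.exp a * Real.exp (b-a) := by rw [← Real.exp_add]; ring_nf
    have h1 := mul_le_mul_of_nonneg_left (Real.add_one_le_exp (b-a)) (Real.exp_pos a).le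
    have h2 : Real.exp a * (a-b) ≤ Real.exp M * |a-b| := (mul_le_mul_of_nonneg_left (le_abs_self _) (Real.exp_pos a).le).trans (mul_le_mul_of_nonneg_right (Real.exp_le_exp.2 ha) (abs_nonneg _))
    linarith
  have h1 := k a b ha
  have h2 := k b a hb
  rw [abs_sub_comm b a] at h2
  exact abs_le.2 ⟨by linarith, h1⟩
lemma small0 {a K : ℝ} (h : ∀ t : ℝ, 0 < t → t ≤ 1 → |a| ≤ K*t) : a = 0 := by
  have : Tendsto (fun t : ℝ => K*t) (𝓝[>] 0) (𝓝 (K*0)) := (tendsto_id.const_mul K).mono_left nhdsWithin_le_nhds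
  have h2 : |a| ≤ K*0 := ge_of_tendsto this (by
    filter_upwards [Ioc_mem_nhdsGT (zero_lt_one' ℝ)] with t ht using h t ht.1 ht.2)
  rw [mul_zero] at h2
  exact abs_eq_zero.1 (le_antisymm h2 (abs_nonneg _))
lemma poly4 {a b c d e K : ℝ} (h : ∀ t : ℝ, 0 < t → t ≤ 1 → |a+b*t+c*t^2+d*t^3+e*t^4| ≤ K*t^5) : a = 0 ∧ b = 0 ∧ c = 0 ∧ d = 0 ∧ e = 0 := by
  have step : ∀ (a : ℝ) (g : ℝ → ℝ) (G K : ℝ) (n : ℕ), (∀ t : ℝ, 0 < t → t ≤ 1 → |g t| ≤ G) → (∀ t : ℝ, 0 < t → t ≤ 1 → |t^n*(a + t*g t)| ≤ K*t^(n+1)) → a = 0 := by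
    intro a g G K n hg hh
    refine small0 (K := K+G) fun t t0 t1 => ?_
    have h1 := hh t t0 t1
    rw [abs_mul, abs_of_pos (pow_pos t0 n), pow_succ, ← mul_assoc, mul_comm K, mul_assoc, mul_le_mul_iff_right₀ (pow_pos t0 n)] at h1
    have h2 : |t*g t| ≤ t*G := by rw [abs_mul, abs_of_pos t0]; exact mul_le_mul_of_nonneg_left (hg t t0 t1) t0.le
    have := abs_sub_abs_le_abs_sub (a+t*g t) (t*g t)
    have h3 := abs_sub (a+t*g t) (t*g t)
    rw [add_sub_cancel_right] at h3
    linarith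
  have bd : ∀ (n : ℕ) (c t : ℝ), 0 < t → t ≤ 1 → |c*t^n| ≤ |c| := fun n c t t0 t1 => by
    rw [abs_mul, abs_of_pos (pow_pos t0 n)]; exact mul_le_of_le_one_right (abs_nonneg _) (pow_le_one₀ t0.le t1)
  have K0 : 0 ≤ K := by have := (abs_nonneg _).trans (h 1 one_pos le_rfl); linarith
  have pw : ∀ (n : ℕ) (t : ℝ), 0 < t → t ≤ 1 → n ≤ 5 → K*t^5 ≤ K*t^n := fun n t t0 t1 hn => mul_le_mul_of_nonneg_left (pow_le_pow_of_le_one t0.le t1 hn) K0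
  have ha : a = 0 := step a (fun t => b+c*t+d*t^2+e*t^3) (|b|+|c|+|d|+|e|) K 0 (fun t t0 t1 => by
      have := abs_add_le (b+c*t+d*t^2) (e*t^3); have := abs_add_le (b+c*t) (d*t^2); have := abs_add_le b (c*t)
      have := bd 1 c t t0 t1; have := bd 2 d t t0 t1; have := bd 3 e t t0 t1; simp only [pow_one] at *; linarith) fun t t0 t1 => by
    refine le_of_eq_of_le (congrArg abs ?_) ((h t t0 t1).trans (pw 1 t t0 t1 (by norm_num))); ring
  subst ha
  have hb : b = 0 := step b (fun t => c+d*t+e*t^2) (|c|+|d|+|e|) K 1 (fun t t0 t1 => by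
      have := abs_add_le (c+d*t) (e*t^2); have := abs_add_le c (d*t)
      have := bd 1 d t t0 t1; have := bd 2 e t t0 t1; simp only [pow_one] at *; linarith) fun t t0 t1 => by
    refine le_of_eq_of_le (congrArg abs ?_) ((h t t0 t1).trans (pw 2 t t0 t1 (by norm_num))); ring
  subst hb
  have hc : c = 0 := step c (fun t => d+e*t) (|d|+|e|) K 2 (fun t t0 t1 => by
      have := abs_add_le d (e*t); have := bd 1 e t t0 t1; simp only [pow_one] at *; linarith) fun t t0 t1 => by
    refine le_of_eq_of_le (congrArg abs ?_) ((h t t0 t1).trans (pw 3 t t0 t1 (by norm_num))); ring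
  subst hc
  have hd : d = 0 := step d (fun _ => e) (|e|) K 3 (fun t _ _ => le_rfl) fun t t0 t1 => by
    refine le_of_eq_of_le (congrArg abs ?_) ((h t t0 t1).trans (pw 4 t t0 t1 (by norm_num))); ring
  subst hd
  have he : e = 0 := step e (fun t => 0) 0 K 4 (fun t t0 t1 => by simp) fun t t0 t1 => by
    refine le_of_eq_of_le (congrArg abs ?_) ((h t t0 t1)); ring
  exact ⟨rfl, rfl, rfl, rfl, he⟩
section
variable {m : Measure V} {S : Set V} {C a R : ℝ} (h : HA m S C a R) {U : Ultrafilter ℝ} (hU : (U : Filter ℝ) ≤ 𝓝[>] 0)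
include h
lemma rS_closed (r : ℝ) : IsClosed (rS 0 r S) := h.au0.cl.preimage (f := fun z : V => (0:V) + r • z) (by fun_prop)
lemma TU_choose {y : V} (hy : y ∈ TU S U) : ∃ z : ℝ → V, (∀ r, z r ∈ rS 0 r S) ∧ Tendsto z U (𝓝 y) := by
  have : ∀ r, ∃ z ∈ rS 0 r S, infDist y (rS 0 r S) = dist y z := fun r => (rS_closed h r).exists_infDist_eq_dist ⟨0, zero_rS r h.zero⟩ y
  choose z hz hd using this
  refine ⟨z, hz, Metric.tendsto_nhds.2 fun ε hε => ?_⟩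
  filter_upwards [hy ε hε] with r ⟨w, hw, hwy⟩
  rw [dist_comm, ← hd]
  exact (infDist_le_dist_of_mem hw).trans_lt (by rwa [dist_comm, dist_eq_norm])
include hU
variable {Λ : (V → ℝ) →ₗ[ℝ] ℝ} (hΛ : ∀ f ∈ PGs, Tendsto (fun r => IG m r f) U (𝓝 (Λ f)))
include hΛ
lemma Lam_bd {f : V → ℝ} {K c : ℝ} (hf : f ∈ PGs) (hK : 0 ≤ K) (hb : ∀ x, |f x| ≤ K * Real.exp (c*‖x‖)) : |Λ f| ≤ K*Real.exp ((c+2)^2/4)*(96*om) :=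
  le_of_tendsto (hΛ f hf).norm ((IG_bd h hU hf.1 hK hb).mono fun r hr => hr.2)
lemma Lam_zero {f : V → ℝ} (hf : f ∈ PGs) (h0 : ∀ y ∈ TU S U, f y = 0) : Λ f = 0 := by
  have ⟨hc, K, c, K0, c0, hb⟩ := hf
  refine tendsto_nhds_unique (hΛ f hf) (VAN h hU (f := fun _ => f) K0 (.of_forall fun _ => hb) fun A η hη => ?_)
  by_contra hn
  obtain ⟨z, y, h1, h2, h3⟩ := TU_seq hn
  have := ((hc.tendsto y).comp h2).abs
  rw [h0 y h3, abs_zero] at this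
  obtain ⟨r, hr, hr'⟩ := (h1.and (this.eventually_le_const hη)).exists
  exact hr.2.2 hr'
lemma Lam_nn {f : V → ℝ} (hf : f ∈ PGs) (h0 : ∀ y ∈ TU S U, 0 ≤ f y) : 0 ≤ Λ f := by
  have e : f = (fun x => max (f x) 0) - (fun x => max ((-f) x) 0) := by
    funext x; simp only [Pi.sub_apply, Pi.neg_apply]
    rcases le_total 0 (f x) with h | h
    · rw [max_eq_left h, max_eq_right (by linarith)]; ring
    · rw [max_eq_right h, max_eq_left (by linarith)]; ring
  have h2 : Λ (fun x => max ((-f) x) 0) = 0 := Lam_zero h hU hΛ (PGs_max (neg_mem hf)) fun y hy => by simpa using h0 y hy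
  rw [e, map_sub, h2, sub_zero]
  exact ge_of_tendsto (hΛ _ (PGs_max hf)) (.of_forall fun _ => integral_nonneg fun x => mul_nonneg (wt_pos x).le (le_max_right _ _))
lemma Lam_exp {y : V} (hy : y ∈ TU S U) : Λ (fun x => Real.exp (2*⟪x, y⟫)) = c3 * Real.exp (‖y‖^2) := by
  obtain ⟨z, hz, hzy⟩ := TU_choose h hy
  have hb : ∀ᶠ r in (U : Filter ℝ), ‖z r‖ ≤ ‖y‖+1 := (hzy.norm.eventually_le_const (by linarith))
  have hi := fun y => IG_bd h hU (PGs_exp y).1 (K := 1) (c := 2*‖y‖) zero_le_one (fun x => by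
    rw [one_mul, Real.abs_exp, Real.exp_le_exp]; have := real_inner_le_norm x y; linarith)
  have key : ∀ r z, IG m r (fun x => Real.exp (2*⟪x, z⟫)) = Real.exp (‖z‖^2) * ∫ x, Real.exp (-‖x-z‖^2) ∂(rs 0 r m) := fun r z => by
    rw [IG, ← integral_const_mul]; congr 1; ext x
    rw [wt, ← Real.exp_add, ← Real.exp_add, norm_sub_sq_real]; congr 1; ring
  have t1 : Tendsto (fun r => IG m r (fun x => Real.exp (2*⟪x, z r⟫))) U (𝓝 (Real.exp (‖y‖^2) * c3)) := by
    simp only [key]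
    refine ((Real.continuous_exp.tendsto _).comp (hzy.norm.pow 2)).mul ?_
    rw [Metric.tendsto_nhds]; intro ε hε
    filter_upwards [ev_au h hU (‖y‖+1), hb, ev_eps h hU (show 0 < ε/8 by positivity)] with r h1 h2 h3
    rw [Real.dist_eq]
    have := H0 h1 (hz r) h2; linarith
  have t2 := VAN h hU (f := fun r x => Real.exp (2*⟪x, z r⟫) - Real.exp (2*⟪x, y⟫)) (K := 2) (c := 2*(‖y‖+1)) zero_le_two (by
    filter_upwards [hb] with r hr x
    have e : ∀ w : V, ‖w‖ ≤ ‖y‖+1 → Real.exp (2*⟪x, w⟫) ≤ Real.exp (2*(‖y‖+1)*‖x‖) := fun w hw => by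
      rw [Real.exp_le_exp]; have := real_inner_le_norm x w
      have := mul_le_mul_of_nonneg_left hw (norm_nonneg x); linarith
    have := e _ hr; have := e y (by linarith)
    rw [abs_le]; constructor <;> linarith [Real.exp_pos (2*⟪x, z r⟫), Real.exp_pos (2*⟪x, y⟫)]) (by
    intro A η hη
    have ht : Tendsto (fun r => Real.exp (2*(A*(‖y‖+1)))*(2*(A*‖z r - y‖))) U (𝓝 (Real.exp (2*(A*(‖y‖+1)))*(2*(A*‖y - y‖)))) :=
      (((hzy.sub_const y).norm.const_mul A).const_mul 2).const_mul _
    simp only [sub_self, norm_zero, mul_zero] at ht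
    filter_upwards [hb, ht.eventually_le_const hη] with r hr h1 x _ hA
    have e : ∀ w : V, ‖w‖ ≤ ‖y‖+1 → 2*⟪x, w⟫ ≤ 2*(A*(‖y‖+1)) := fun w hw => by
      have := real_inner_le_norm x w
      have := mul_le_mul hA hw (norm_nonneg w) ((norm_nonneg x).trans hA); linarith
    refine (abs_exp_sub (e _ hr) (e y (by linarith))).trans (le_trans ?_ h1)
    gcongr
    rw [← mul_sub, ← inner_sub_right, abs_mul, abs_of_pos two_pos]
    gcongr
    exact (abs_real_inner_le_norm _ _).trans (mul_le_mul_of_nonneg_right hA (norm_nonneg _)))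
  have t3 : Tendsto (fun r => IG m r (fun x => Real.exp (2*⟪x, z r⟫)) - IG m r (fun x => Real.exp (2*⟪x, y⟫))) U (𝓝 0) := by
    refine t2.congr' ?_
    filter_upwards [hi y, ev_au h hU 0] with r h1 h2
    have h3 : Integrable (fun x => wt x * Real.exp (2*⟪x, z r⟫)) (rs 0 r m) := (domI h2 (wt_cont.mul (PGs_exp (z r)).1) (by positivity) fun x => wtb (K := 1) (c := 2*‖z r‖) zero_le_one (by
      rw [one_mul, Real.abs_exp, Real.exp_le_exp]; have := real_inner_le_norm x (z r); linarith)).1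
    simp only [IG]; rw [← integral_sub h3 h1.1]; simp only [mul_sub]
  have := t1.sub t3
  simp only [sub_sub_cancel, sub_zero] at this
  rw [tendsto_nhds_unique (hΛ _ (PGs_exp y)) this, mul_comm]
lemma RAY {y : V} (hy : ∀ t : ℝ, 0 < t → t ≤ 1 → t • y ∈ TU S U) : Λ (ln y) = 0 ∧ Λ (ln y ^ 2) = 1/2*c3*‖y‖^2 ∧ Λ (ln y ^ 4) = 3/4*c3*‖y‖^4 := by
  have omp := om_pos; have c3p := c3_pos
  set D := Real.exp ((4*‖y‖+2)^2/4)*(96*om) with hD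
  have h1 : ∀ t : ℝ, 0 < t → t ≤ 1 → |c3 * Real.exp (t^2*‖y‖^2) - (Λ 1 + 2*t*Λ (ln y) + 2*t^2*Λ (ln y^2) + 4/3*t^3*Λ (ln y^3) + 2/3*t^4*Λ (ln y^4))| ≤ 3840*‖y‖^0*t^5*D := by
    intro t t0 t1
    have e0 := Lam_exp h hU hΛ (hy t t0 t1)
    rw [norm_smul, Real.norm_of_nonneg t0.le, mul_pow] at e0
    set f : V → ℝ := (fun x => Real.exp (2*⟪x, t • y⟫)) - ((1:V → ℝ) + (2*t) • ln y + (2*t^2) • ln y^2 + (4/3*t^3) • ln y^3 + (2/3*t^4) • ln y^4) with hf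
    have hm : f ∈ PGs := by
      have p := fun n => PGs_pow (PGs_ln y) n
      have p1 : (1 : V → ℝ) ∈ PGs := by simpa using p 0
      exact sub_mem (PGs_exp _) (add_mem (add_mem (add_mem (add_mem p1 (Submodule.smul_mem _ _ (PGs_ln y))) (Submodule.smul_mem _ _ (p 2))) (Submodule.smul_mem _ _ (p 3))) (Submodule.smul_mem _ _ (p 4)))
    have e1 : Λ f = c3 * Real.exp (t^2*‖y‖^2) - (Λ 1 + 2*t*Λ (ln y) + 2*t^2*Λ (ln y^2) + 4/3*t^3*Λ (ln y^3) + 2/3*t^4*Λ (ln y^4)) := by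
      rw [hf]; simp only [map_sub, map_add, map_smul, smul_eq_mul, e0]
    rw [← e1]
    have := Lam_bd h hU hΛ (K := 3840*t^5/32) (c := 4*‖y‖) hm (by positivity) fun x => by
      set u := 2*⟪x, t • y⟫ with hu
      have hfx : f x = Real.exp u - ∑ k ∈ Finset.range 5, u^k / k.factorial := by
        simp only [hf, Finset.sum_range_succ, Finset.sum_range_zero, Pi.sub_apply, Pi.add_apply, Pi.smul_apply, Pi.pow_apply, Pi.one_apply, ln, smul_eq_mul, hu, real_inner_smul_right, Nat.factorial]
        push_cast; ring
      rw [hfx]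
      refine (exp_rem u 5).trans ?_
      have u1 : |u| ≤ t*(2*‖y‖*‖x‖) := by
        rw [hu, real_inner_smul_right, abs_mul, abs_mul, abs_of_pos t0, abs_of_pos two_pos]
        have := mul_le_mul_of_nonneg_left (abs_real_inner_le_norm x y) t0.le; linarith only [this]
      have w0 : 0 ≤ 2*‖y‖*‖x‖ := by positivity
      have u2 : |u| ≤ 2*‖y‖*‖x‖ := u1.trans (mul_le_of_le_one_left w0 t1)
      have u3 := Real.pow_div_factorial_le_exp (2*‖y‖*‖x‖) w0 5
      rw [div_le_iff₀ (by positivity)] at u3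
      have u4 : ((Nat.factorial 5 : ℕ) : ℝ) = 120 := by norm_num [Nat.factorial]
      rw [u4] at u3
      calc |u|^5 * Real.exp |u| ≤ (t*(2*‖y‖*‖x‖))^5 * Real.exp (2*‖y‖*‖x‖) := by gcongr
        _ = t^5*((2*‖y‖*‖x‖)^5 * Real.exp (2*‖y‖*‖x‖)) := by ring
        _ ≤ t^5*((Real.exp (2*‖y‖*‖x‖)*120) * Real.exp (2*‖y‖*‖x‖)) := by gcongr
        _ = 3840*t^5/32 * Real.exp (2*‖y‖*‖x‖+2*‖y‖*‖x‖) := by rw [Real.exp_add]; ring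
        _ = _ := by ring_nf
    refine this.trans ?_
    have : 0 ≤ t^5*D := by positivity
    have e : 3840*t^5/32*Real.exp ((4*‖y‖+2)^2/4)*(96*om) = 120*(t^5*D) := by rw [hD]; ring
    rw [e]; simp only [pow_zero]; linarith only [this]
  have h2 := poly4 (a := Λ 1 - c3) (b := 2*Λ (ln y)) (c := 2*Λ (ln y^2) - c3*‖y‖^2) (d := 4/3*Λ (ln y^3)) (e := 2/3*Λ (ln y^4) - c3*‖y‖^4/2)
    (K := 3840*D + c3*(‖y‖^6*Real.exp (‖y‖^2))) fun t t0 t1 => by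
      have q := h1 t t0 t1
      have e3 := exp_rem (t^2*‖y‖^2) 3
      simp only [Finset.sum_range_succ, Finset.sum_range_zero, Nat.factorial] at e3
      rw [abs_of_nonneg (by positivity : 0 ≤ t^2*‖y‖^2)] at e3
      have t2 : t^2 ≤ 1 := pow_le_one₀ t0.le t1
      have e4 : (t^2*‖y‖^2)^3*Real.exp (t^2*‖y‖^2) ≤ t^5*(‖y‖^6*Real.exp (‖y‖^2)) := by
        have : t^6 ≤ t^5 := pow_le_pow_of_le_one t0.le t1 (by norm_num)
        have : Real.exp (t^2*‖y‖^2) ≤ Real.exp (‖y‖^2) := Real.exp_le_exp.2 (mul_le_of_le_one_left (by positivity) t2)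
        calc (t^2*‖y‖^2)^3*Real.exp (t^2*‖y‖^2) = t^6*(‖y‖^6*Real.exp (t^2*‖y‖^2)) := by ring
          _ ≤ _ := by gcongr
      have e5 := mul_le_mul_of_nonneg_left (e3.trans e4) c3p.le
      rw [← abs_of_pos c3p, ← abs_mul, abs_of_pos c3p] at e5
      have e5' := abs_le.1 e5
      have q' := abs_le.1 q
      push_cast at e5'; simp only [pow_zero] at q'
      rw [abs_le]; constructor <;> linarith
  obtain ⟨-, a1, a2, -, a4⟩ := h2
  refine ⟨by linarith only [a1], by linarith only [a2], by linarith⟩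
end
structure TD (F : V →L[ℝ] V) (T : Set V) (ε : ℝ) : Prop where
  cl : IsClosed T
  sym : ∀ z w, ⟪F z, w⟫ = ⟪z, F w⟫
  tr : ∀ e : OB, ∑ i, ⟪F (e i), e i⟫ = -1
  zero : ∀ z ∈ T, ⟪F z, z⟫ = 0
  slab : ∀ n : V, ‖n‖ = 1 → ∃ z ∈ T, ⟪n, z⟫ ≠ 0
  ep : 0 < ε
  ep1 : ε ≤ 1
  fill : ∀ p ∈ T, ∀ s : ℝ, 0 < s → ∀ n : V, ‖n‖ = 1 → (∀ z ∈ T, ‖z - p‖ ≤ 4*s → |⟪n, z - p⟫| ≤ ε*s) →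
    ∀ w : V, ⟪n, w⟫ = 0 → ‖w‖ ≤ s → ∃ q ∈ T, ‖q - (p + w)‖ ≤ s/4
lemma TD.reg {F : V →L[ℝ] V} {T : Set V} {ε : ℝ} (h : TD F T ε) {y : V} (hy : y ∈ T) (hF : F y ≠ 0) :
    ∃ ρ : ℝ, 0 < ρ ∧ ∀ z, ⟪F z, z⟫ = 0 → ‖z - y‖ < ρ → z ∈ T := by
  have ep := h.ep; have ep1 := h.ep1
  set N := ‖F‖+1 with hN
  have Np : 0 < N := by positivity
  have kp : 0 < ‖F y‖ := norm_pos_iff.2 hF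
  set κ := ‖F y‖ with hκ
  set ρ := κ*ε/(16*N) with hρ
  have ρp : 0 < ρ := by positivity
  have e1 : 16*N*ρ = κ*ε := by rw [hρ]; field_simp
  have e2 : κ*ε ≤ κ := mul_le_of_le_one_right kp.le ep1
  clear_value ρ
  refine ⟨ρ, ρp, fun z hz hzy => ?_⟩
  obtain ⟨p, hp, hd⟩ := h.cl.exists_infDist_eq_dist ⟨y, hy⟩ z
  have hnear : ∀ q ∈ T, ‖z - p‖ ≤ ‖z - q‖ := fun q hq => by
    rw [← dist_eq_norm, ← dist_eq_norm, ← hd]; exact infDist_le_dist_of_mem hq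
  by_contra hzT
  have d0 : 0 < ‖z - p‖ := norm_pos_iff.2 (sub_ne_zero.2 fun e => hzT (e ▸ hp))
  set d := ‖z - p‖ with hd'
  have dρ : d < ρ := (hnear y hy).trans_lt hzy
  have py : ‖y - p‖ ≤ 2*ρ := by
    have := norm_add_le (y - z) (z - p); rw [sub_add_sub_cancel, norm_sub_rev y z] at this; linarith
  have Fp : κ/2 ≤ ‖F p‖ := by
    have := norm_add_le (F (y-p)) (F p); rw [← map_add, sub_add_cancel] at this
    have h1 := F.le_opNorm (y-p)
    have h2 : ‖F‖*‖y-p‖ ≤ N*(2*ρ) := mul_le_mul (by linarith) py (norm_nonneg _) Np.le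
    linarith
  have Fp0 : 0 < ‖F p‖ := by linarith
  have key : ∀ w, ⟪F w, w⟫ = 0 → |⟪‖F p‖⁻¹ • F p, w - p⟫| ≤ N*‖w-p‖^2/κ := fun w hw => by
    have q := quad_bd (F := F) (K := N) (by linarith) (le_refl ‖w-p‖)
    have : ⟪F (w-p), w-p⟫ = -2*⟪F p, w-p⟫ := by
      have s := h.sym w p
      simp only [map_sub, inner_sub_left, inner_sub_right, hw, h.zero p hp] at *
      rw [s, real_inner_comm w]; ring
    rw [this, abs_mul] at q
    rw [real_inner_smul_left, abs_mul, abs_of_pos (by positivity), inv_mul_le_iff₀ Fp0]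
    have : N*‖w-p‖^2/2 ≤ ‖F p‖*(N*‖w-p‖^2/κ) := by
      calc N*‖w-p‖^2/2 = κ/2*(N*‖w-p‖^2/κ) := by field_simp
        _ ≤ _ := by gcongr
    norm_num at q; linarith
  have nu : ‖‖F p‖⁻¹ • F p‖ = 1 := by rw [nsm_eq (by positivity)]; exact inv_mul_cancel₀ Fp0.ne'
  have kz := key z hz
  set n := ‖F p‖⁻¹ • F p with hn
  clear_value n
  have b1 : N*d^2/κ ≤ d*ε/16 := by
    rw [div_le_iff₀ kp]
    have := mul_le_mul_of_nonneg_left dρ.le (by positivity : 0 ≤ N*d)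
    calc N*d^2 = N*d*d := by ring
      _ ≤ N*d*ρ := this
      _ = d*(16*N*ρ)/16 := by ring
      _ = _ := by rw [e1]; ring
  have ⟨pl, po⟩ := proj_le nu (z := z - p)
  obtain ⟨q, hq, hqd⟩ := h.fill p hp d d0 n nu (fun w hw hw4 => (key w (h.zero w hw)).trans (by
    have : N*‖w-p‖^2/κ ≤ N*(4*d)^2/κ := by gcongr
    have e : N*(4*d)^2/κ = 16*(N*d^2/κ) := by ring
    linarith)) _ po pl
  have h1 := hnear q hq
  have e3 : z - q = ⟪n, z-p⟫ • n - (q - (p + (z - p - ⟪n, z-p⟫ • n))) := by abel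
  have h2 := norm_sub_le (⟪n, z-p⟫ • n) (q - (p + (z - p - ⟪n, z-p⟫ • n)))
  rw [← e3, norm_smul, nu, mul_one, Real.norm_eq_abs] at h2
  have : d*ε ≤ d := mul_le_of_le_one_right d0.le ep1
  linarith
lemma TD.path {F : V →L[ℝ] V} {T : Set V} {ε : ℝ} (h : TD F T ε) {γ : ℝ → V} (hc : Continuous γ) (hz : ∀ t, 0 ≤ t → t ≤ 1 → ⟪F (γ t), γ t⟫ = 0)
    (hr : ∀ t, 0 ≤ t → t ≤ 1 → F (γ t) ≠ 0) (h0 : γ 0 ∈ T) : γ 1 ∈ T := by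
  have hγ : Continuous fun t : unitInterval => γ t := hc.comp continuous_subtype_val
  have : IsClopen {t : unitInterval | γ t ∈ T} := by
    refine ⟨h.cl.preimage hγ, isOpen_iff_mem_nhds.2 fun t ht => ?_⟩
    obtain ⟨ρ, ρp, H⟩ := h.reg ht (hr _ t.2.1 t.2.2)
    filter_upwards [Metric.tendsto_nhds.1 (hγ.tendsto t) ρ ρp] with s hs
    exact H _ (hz _ s.2.1 s.2.2) (by rwa [← dist_eq_norm])
  have e := this.eq_univ ⟨0, by simpa using h0⟩
  have : (1 : unitInterval) ∈ {t : unitInterval | γ t ∈ T} := by rw [e]; trivial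
  simpa using this
def mkv (e : OB) (c : Fin 4 → ℝ) : V := c 0 • e 0 + c 1 • e 1 + c 2 • e 2 + c 3 • e 3
lemma mk_inner (e : OB) (c : Fin 4 → ℝ) (i : Fin 4) : ⟪mkv e c, e i⟫ = c i := by
  unfold mkv
  fin_cases i <;> simp [inner_add_left, real_inner_smul_left]
lemma mk_eq (e : OB) {c : Fin 4 → ℝ} {z : V} (hc : ∀ i, c i = ⟪z, e i⟫) : mkv e c = z := by
  refine InnerProductSpace.ext_inner_right_basis e.toBasis fun i => ?_
  rw [OrthonormalBasis.coe_toBasis, mk_inner, hc]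
section
variable {F : V →L[ℝ] V} {T : Set V} {ε : ℝ} (h : TD F T ε) {e : OB} {l : Fin 4 → ℝ} (he : ∀ i, F (e i) = l i • e i)
include h he
lemma F_crd (z : V) (i : Fin 4) : ⟪F z, e i⟫ = l i * ⟪z, e i⟫ := by rw [h.sym, he, real_inner_smul_right]
lemma reg_iff (z : V) : F z ≠ 0 ↔ ∃ i, l i * ⟪z, e i⟫ ≠ 0 := by
  constructor
  · intro hz; by_contra! hc
    exact hz (InnerProductSpace.ext_inner_right_basis e.toBasis fun i => by rw [OrthonormalBasis.coe_toBasis, F_crd h he, hc, inner_zero_left])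
  · rintro ⟨i, hi⟩ hz
    rw [← F_crd h he, hz, inner_zero_left] at hi; exact hi rfl
lemma TD.P {y z : V} (hy : y ∈ T) (hFy : F y ≠ 0) (hz : ⟪F z, z⟫ = 0) (hFz : F z ≠ 0) (hs : ∀ i, 0 ≤ ⟪y, e i⟫ * ⟪z, e i⟫) : z ∈ T := by
  classical
  set s : Fin 4 → ℝ := fun i => if 0 ≤ ⟪y, e i⟫ ∧ 0 ≤ ⟪z, e i⟫ then 1 else -1 with hsd
  have ss : ∀ i, s i^2 = 1 := fun i => by simp only [hsd]; split_ifs <;> norm_num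
  have sy : ∀ i, s i * |⟪y, e i⟫| = ⟪y, e i⟫ ∧ s i * |⟪z, e i⟫| = ⟪z, e i⟫ := fun i => by
    have := hs i
    simp only [hsd]; split_ifs with hc
    · rw [abs_of_nonneg hc.1, abs_of_nonneg hc.2]; simp
    · have : ⟪y, e i⟫ ≤ 0 ∧ ⟪z, e i⟫ ≤ 0 := by
        by_contra hn
        rw [not_and_or] at hc hn
        push Not at hc hn
        rcases hc with hc | hc <;> rcases hn with hn | hn <;> nlinarith
      rw [abs_of_nonpos this.1, abs_of_nonpos this.2]; simp
  clear_value s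
  set γ : ℝ → V := fun t => mkv e fun i => s i * √((1-t)*⟪y, e i⟫^2 + t*⟪z, e i⟫^2) with hγ
  have g1 : γ 1 = z := mk_eq e fun i => by simp [Real.sqrt_sq_eq_abs, (sy i).2]
  have g0 : γ 0 = y := mk_eq e fun i => by simp [Real.sqrt_sq_eq_abs, (sy i).1]
  have gi : ∀ t i, ⟪γ t, e i⟫ = s i * √((1-t)*⟪y, e i⟫^2 + t*⟪z, e i⟫^2) := fun t i => mk_inner _ _ _
  have gs : ∀ t, 0 ≤ t → t ≤ 1 → ∀ i, ⟪γ t, e i⟫^2 = (1-t)*⟪y, e i⟫^2 + t*⟪z, e i⟫^2 := fun t t0 t1 i => by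
    have : 0 ≤ 1-t := by linarith
    rw [gi, mul_pow, ss, one_mul, Real.sq_sqrt (by positivity)]
  rw [← g1]
  refine h.path (by simp only [hγ, mkv]; fun_prop) (fun t t0 t1 => ?_) (fun t t0 t1 => ?_) (by rwa [g0])
  · have hy0 := h.zero y hy
    rw [quad_exp h.sym he] at hy0 hz ⊢
    simp only [gs t t0 t1]; linear_combination (1-t)*hy0 + t*hz
  · rcases t1.eq_or_lt with rfl | t1'
    · rwa [g1]
    · rw [reg_iff h he] at hFy ⊢
      obtain ⟨i, hi⟩ := hFy
      refine ⟨i, mul_ne_zero (left_ne_zero_of_mul hi) fun h0 => ?_⟩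
      have g := gs t t0 t1 i
      have : 0 < (1-t)*⟪y, e i⟫^2 := mul_pos (by linarith) (by have := right_ne_zero_of_mul hi; positivity)
      rw [h0] at g
      have := mul_nonneg t0 (sq_nonneg ⟪z, e i⟫)
      linarith
lemma TD.ray {y : V} (hy : y ∈ T) (hFy : F y ≠ 0) {t : ℝ} (ht : 0 < t) : t • y ∈ T := by
  refine h.P he hy hFy ?_ ?_ fun i => ?_
  · rw [map_smul, real_inner_smul_left, real_inner_smul_right, h.zero y hy]; simp
  · rw [map_smul]; exact smul_ne_zero ht.ne' hFy
  · rw [real_inner_smul_left]; have := mul_nonneg ht.le (mul_self_nonneg ⟪y, e i⟫); linarith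
omit h he in
lemma Zneg {z : V} (hz : ⟪F z, z⟫ = 0) : ⟪F (-z), -z⟫ = 0 := by rw [map_neg, inner_neg_neg, hz]
lemma edge {p q : Fin 4} (hpq : l p * l q < 0) {σ τ : ℝ} (hσ : σ^2 = 1) (hτ : τ^2 = 1) : ∃ v : V, ⟪F v, v⟫ = 0 ∧ F v ≠ 0 ∧ 0 < σ*⟪v, e p⟫ ∧ 0 < τ*⟪v, e q⟫ ∧
    ∀ i, i ≠ p → i ≠ q → ⟪v, e i⟫ = 0 := by
  classical
  have ne : p ≠ q := by rintro rfl; linarith only [hpq, mul_self_nonneg (l p)]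
  have lp : l p ≠ 0 := by rintro h; rw [h] at hpq; simp at hpq
  have lq : l q ≠ 0 := by rintro h; rw [h] at hpq; simp at hpq
  set c : Fin 4 → ℝ := fun i => if i = p then σ*√|l q| else if i = q then τ*√|l p| else 0 with hc
  have cp : c p = σ*√|l q| := by simp [hc]
  have cq : c q = τ*√|l p| := by simp [hc, ne.symm]
  have ci : ∀ i, i ≠ p → i ≠ q → c i = 0 := fun i h1 h2 => by simp [hc, h1, h2]
  clear_value c
  have sp := Real.sq_sqrt (abs_nonneg (l p)); have sq := Real.sq_sqrt (abs_nonneg (l q))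
  have np : 0 < √|l p| := Real.sqrt_pos.2 (abs_pos.2 lp); have nq : 0 < √|l q| := Real.sqrt_pos.2 (abs_pos.2 lq)
  refine ⟨mkv e c, ?_, ?_, ?_, ?_, fun i h1 h2 => by rw [mk_inner]; exact ci i h1 h2⟩
  · have : ⟪F (mkv e c), mkv e c⟫ = ∑ i, l i * c i^2 := by
      rw [quad_exp h.sym he, Fin.sum_univ_four]; simp only [mk_inner]
    rw [this, Finset.sum_eq_add p q ne (fun i _ hi => by rw [ci i hi.1 hi.2]; simp) (by simp) (by simp), cp, cq, mul_pow, mul_pow, hσ, hτ, sp, sq]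
    rcases mul_neg_iff.1 hpq with hh | hh
    · rw [abs_of_pos hh.1, abs_of_neg hh.2]; ring
    · rw [abs_of_neg hh.1, abs_of_pos hh.2]; ring
  · rw [reg_iff h he]; refine ⟨p, mul_ne_zero lp ?_⟩
    rw [mk_inner, cp]; exact mul_ne_zero (by rintro rfl; norm_num at hσ) nq.ne'
  · rw [mk_inner, cp, ← mul_assoc, ← pow_two, hσ, one_mul]; exact nq
  · rw [mk_inner, cq, ← mul_assoc, ← pow_two, hτ, one_mul]; exact np
end
def Ed (F : V →L[ℝ] V) (T : Set V) (e : OB) (p : Fin 4) (σ : ℝ) (q : Fin 4) (τ : ℝ) : Prop := ∀ z, ⟪F z, z⟫ = 0 → F z ≠ 0 → 0 ≤ σ*⟪z, e p⟫ → 0 ≤ τ*⟪z, e q⟫ → z ∈ T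
lemma sgn_ex {x : ℝ} (hx : x ≠ 0) : ∃ σ : ℝ, σ^2 = 1 ∧ 0 < σ*x := by
  rcases lt_or_gt_of_ne hx with h | h
  · exact ⟨-1, by norm_num, by linarith⟩
  · exact ⟨1, by norm_num, by linarith⟩
section
variable {F : V →L[ℝ] V} {T : Set V} {ε : ℝ} (h : TD F T ε) {e : OB} {l : Fin 4 → ℝ} (he : ∀ i, F (e i) = l i • e i)
include h he
omit h he in
lemma sgn_mul {σ a b : ℝ} (hσ : σ^2 = 1) (ha : 0 ≤ σ*a) (hb : 0 ≤ σ*b) : 0 ≤ a*b := by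
  have := mul_nonneg ha hb
  have e : σ*a*(σ*b) = σ^2*(a*b) := by ring
  rwa [e, hσ, one_mul] at this
lemma Ed_of {p q : Fin 4} (hpq : l p * l q < 0) {σ τ : ℝ} (hσ : σ^2 = 1) (hτ : τ^2 = 1) {y : V} (hy : y ∈ T) (hFy : F y ≠ 0) (h1 : 0 ≤ σ*⟪y, e p⟫) (h2 : 0 ≤ τ*⟪y, e q⟫) : Ed F T e p σ q τ := by
  obtain ⟨v, v0, v1, v2, v3, v4⟩ := edge h he hpq hσ hτ
  have hv : v ∈ T := h.P he hy hFy v0 v1 fun i => by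
    by_cases ip : i = p
    · subst ip; exact sgn_mul hσ h1 v2.le
    by_cases iq : i = q
    · subst iq; exact sgn_mul hτ h2 v3.le
    rw [v4 i ip iq, mul_zero]
  intro z z0 z1 z2 z3
  refine h.P he hv v1 z0 z1 fun i => ?_
  by_cases ip : i = p
  · subst ip; exact sgn_mul hσ v2.le z2
  by_cases iq : i = q
  · subst iq; exact sgn_mul hτ v3.le z3
  rw [v4 i ip iq, zero_mul]
omit h he in
lemma Ed_sym {p q : Fin 4} {σ τ : ℝ} (hE : Ed F T e p σ q τ) : Ed F T e q τ p σ := fun z a b c d => hE z a b d c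
lemma Ed_move {p q p' : Fin 4} {σ τ σ' : ℝ} (hE : Ed F T e p σ q τ) (hpq : l p * l q < 0) (hpq' : l p' * l q < 0) (hσ' : σ'^2 = 1) (hτ : τ^2 = 1) (hp : p ≠ p') : Ed F T e p' σ' q τ := by
  have ne : p ≠ q := by rintro rfl; nlinarith [mul_self_nonneg (l p)]
  obtain ⟨v, v0, v1, v2, v3, v4⟩ := edge h he hpq' hσ' hτ
  exact Ed_of h he hpq' hσ' hτ (hE v v0 v1 (by rw [v4 p hp ne]; simp) v3.le) v1 v2.le v3.le
lemma Ed_any {p q p' r : Fin 4} {σ τ σ' : ℝ} (hE : Ed F T e p σ q τ) (hpq : l p * l q < 0) (hpq' : l p' * l q < 0) (hr : l r * l q < 0) (hrp : r ≠ p) (hσ' : σ'^2 = 1) (hτ : τ^2 = 1) : Ed F T e p' σ' q τ := by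
  by_cases hp : p = p'
  · subst hp
    exact Ed_move h he (Ed_move h he hE hpq hr (one_pow 2) hτ hrp.symm) hr hpq hσ' hτ hrp
  · exact Ed_move h he hE hpq hpq' hσ' hτ hp
lemma Z_signs {z : V} (hz : ⟪F z, z⟫ = 0) (hFz : F z ≠ 0) : ∃ p q, 0 < l p ∧ l q < 0 ∧ ⟪z, e p⟫ ≠ 0 ∧ ⟪z, e q⟫ ≠ 0 := by
  have hs : ∑ i, l i * ⟪z, e i⟫^2 = 0 := by rw [Fin.sum_univ_four, ← quad_exp h.sym he, hz]
  obtain ⟨i, hi⟩ := (reg_iff h he z).1 hFz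
  have ne : l i * ⟪z, e i⟫^2 ≠ 0 := by rw [pow_two, ← mul_assoc]; exact mul_ne_zero hi (right_ne_zero_of_mul hi)
  obtain ⟨p, -, hp⟩ := Finset.exists_pos_of_sum_zero_of_exists_nonzero _ hs ⟨i, Finset.mem_univ _, ne⟩
  obtain ⟨q, -, hq⟩ := Finset.exists_pos_of_sum_zero_of_exists_nonzero (fun i => -(l i * ⟪z, e i⟫^2)) (by rw [Finset.sum_neg_distrib, hs, neg_zero]) ⟨i, Finset.mem_univ _, neg_ne_zero.2 ne⟩
  have np : ⟪z, e p⟫ ≠ 0 := fun h0 => by rw [h0] at hp; simp at hp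
  have nq : ⟪z, e q⟫ ≠ 0 := fun h0 => by rw [h0] at hq; simp at hq
  refine ⟨p, q, ?_, ?_, np, nq⟩
  · exact pos_of_mul_pos_left hp (sq_nonneg _)
  · have : 0 < ⟪z, e q⟫^2 := by positivity
    by_contra! hc
    have := mul_nonneg hc this.le; linarith
lemma PM' {p q r : Fin 4} {σ τ : ℝ} (hE : Ed F T e p σ q τ) (hpq : l p * l q < 0) (hr : l r * l q < 0) (hrp : r ≠ p) (hτ : τ^2 = 1) {z : V} (hz : ⟪F z, z⟫ = 0) (hFz : F z ≠ 0) :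
    z ∈ T ∨ -z ∈ T := by
  obtain ⟨p', q', h1, h2, np, nq⟩ : ∃ p' q', l p' * l q < 0 ∧ l p' * l q' < 0 ∧ ⟪z, e p'⟫ ≠ 0 ∧ ⟪z, e q'⟫ ≠ 0 := by
    obtain ⟨a, b, ha, hb, na, nb⟩ := Z_signs h he hz hFz
    have hab : l a * l b < 0 := mul_neg_of_pos_of_neg ha hb
    rcases lt_or_gt_of_ne (show l q ≠ 0 by rintro h; rw [h] at hpq; simp at hpq) with hq | hq
    · exact ⟨a, b, mul_neg_of_pos_of_neg ha hq, hab, na, nb⟩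
    · exact ⟨b, a, mul_neg_of_neg_of_pos hb hq, by rwa [mul_comm], nb, na⟩
  have main : ∀ z : V, ⟪F z, z⟫ = 0 → F z ≠ 0 → ⟪z, e p'⟫ ≠ 0 → ⟪z, e q'⟫ ≠ 0 → (q' ≠ q ∨ 0 ≤ τ*⟪z, e q⟫) → z ∈ T := by
    intro z hz hFz np nq hcase
    obtain ⟨σ', s1, s2⟩ := sgn_ex np
    obtain ⟨τ', t1, t2⟩ := sgn_ex nq
    have E1 := Ed_any h he (p' := p') (σ' := σ') hE hpq h1 hr hrp s1 hτ
    rcases hcase with hc | hc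
    · exact Ed_sym (Ed_move h he (p' := q') (σ' := τ') (Ed_sym E1) (by rwa [mul_comm]) (by rwa [mul_comm]) t1 s1 hc.symm) z hz hFz s2.le t2.le
    · exact E1 z hz hFz s2.le hc
  by_cases hc : q' ≠ q ∨ 0 ≤ τ*⟪z, e q⟫
  · exact Or.inl (main z hz hFz np nq hc)
  · push Not at hc
    refine Or.inr (main (-z) (Zneg hz) (by rwa [map_neg, neg_ne_zero]) (by rwa [inner_neg_left, neg_ne_zero]) (by rwa [inner_neg_left, neg_ne_zero]) (Or.inr ?_))
    rw [inner_neg_left]; linarith [hc.2]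
lemma PM {y : V} (hy : y ∈ T) (hFy : F y ≠ 0) (h3 : ∀ p q, ∃ r, r ≠ p ∧ r ≠ q ∧ l r ≠ 0) {z : V} (hz : ⟪F z, z⟫ = 0) (hFz : F z ≠ 0) : z ∈ T ∨ -z ∈ T := by
  obtain ⟨p, q, lp, lq, np, nq⟩ := Z_signs h he (h.zero y hy) hFy
  obtain ⟨σ, s1, s2⟩ := sgn_ex np
  obtain ⟨τ, t1, t2⟩ := sgn_ex nq
  have hpq := mul_neg_of_pos_of_neg lp lq
  have E0 := Ed_of h he hpq s1 t1 hy hFy s2.le t2.le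
  obtain ⟨r, rp, rq, lr⟩ := h3 p q
  rcases lt_or_gt_of_ne lr with hr | hr
  · exact PM' h he (Ed_sym E0) (by rwa [mul_comm]) (mul_neg_of_neg_of_pos hr lp) rq s1 hz hFz
  · exact PM' h he E0 hpq (mul_neg_of_pos_of_neg hr lq) rp t1 hz hFz
lemma TD.exreg : ∃ y ∈ T, F y ≠ 0 := by
  by_contra! hc
  have : ∃ i, l i ≠ 0 := by
    by_contra! hl
    have := h.tr e
    simp [he, hl] at this
  obtain ⟨i, hi⟩ := this
  obtain ⟨z, hz, hn⟩ := h.slab (e i) (by simp)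
  have := F_crd h he z i
  rw [hc z hz, inner_zero_left] at this
  rw [real_inner_comm] at hn
  exact mul_ne_zero hi hn this.symm
end
def sc (a r : ℝ) : ℝ := r^(1-a/10)
lemma sc_spec {a r : ℝ} (hr : 0 < r) : 0 < sc a r ∧ (r^(a/20))^2 * sc a r = r := by
  refine ⟨Real.rpow_pos_of_pos hr _, ?_⟩
  rw [sc, ← Real.rpow_natCast, ← Real.rpow_mul hr.le, ← Real.rpow_add hr]
  have : a/20*((2:ℕ):ℝ)+(1-a/10) = 1 := by push_cast; ring
  rw [this, Real.rpow_one]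
lemma rpow_t0 {b : ℝ} (hb : 0 < b) : Tendsto (fun r : ℝ => r^b) (𝓝[>] 0) (𝓝 0) := by
  have := ((Real.continuous_rpow_const hb.le).tendsto 0).mono_left (nhdsWithin_le_nhds (s := Ioi 0))
  rwa [Real.zero_rpow hb.ne'] at this
lemma sc_t0 {a : ℝ} (ha1 : a ≤ 1) : Tendsto (sc a) (𝓝[>] 0) (𝓝[>] 0) :=
  tendsto_nhdsWithin_iff.2 ⟨rpow_t0 (by linarith), eventually_mem_nhdsWithin.mono fun _ h => (sc_spec h).1⟩
lemma clm_t {ι : Type*} {f : Filter ι} {G : ι → V →L[ℝ] V} {F : V →L[ℝ] V} {z : ι → V} {y : V} (hG : Tendsto G f (𝓝 F)) (hz : Tendsto z f (𝓝 y)) : Tendsto (fun r => G r (z r)) f (𝓝 (F y)) :=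
  ((isBoundedBilinearMap_apply (𝕜 := ℝ) (E := V) (F := V)).continuous.tendsto (F, y)).comp (hG.prodMk_nhds hz)
section
variable {m : Measure V} {S : Set V} {C a R s0 : ℝ} (h : HA m S C a R) (hs0 : 0 < s0) (hnf : ∀ s, 0 < s → s ≤ s0 → ¬ SL S 0 s et) {U : Ultrafilter ℝ} (hU : (U : Filter ℝ) ≤ 𝓝[>] 0)
include h hU
lemma TU_fill {ε : ℝ} (hF : 0 < ε ∧ ε ≤ 1 ∧ ∀ (m : Measure V) (S : Set V), AU m S ε 4 → (0:V) ∈ S → ∀ n : V, ‖n‖ = 1 →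
    (∀ z ∈ S, ‖z‖ ≤ 3 → |⟪n, z⟫| ≤ ε) → ∀ w : V, ⟪n, w⟫ = 0 → ‖w‖ ≤ 1 → ∃ z ∈ S, ‖z - w‖ ≤ 1/8) {p : V} (hp : p ∈ TU S U) {s : ℝ} (sp : 0 < s) {n : V} (hn : ‖n‖ = 1)
    (hs : ∀ z ∈ TU S U, ‖z - p‖ ≤ 4*s → |⟪n, z - p⟫| ≤ ε/2*s) {w : V} (hw : ⟪n, w⟫ = 0) (hws : ‖w‖ ≤ s) : ∃ q ∈ TU S U, ‖q - (p + w)‖ ≤ s/4 := by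
  obtain ⟨e0, e1, hF⟩ := hF
  set δ := min (ε*s/4) (s/16) with hδ
  have δp : 0 < δ := by positivity
  have d1 : δ ≤ ε*s/4 := min_le_left _ _
  have d2 : δ ≤ s/16 := min_le_right _ _
  clear_value δ
  have c0 : Tendsto (fun r : ℝ => r*(‖p‖+δ+6*s) + r*s) (𝓝[>] 0) (𝓝 0) := by
    have : Continuous fun r : ℝ => r*(‖p‖+δ+6*s) + r*s := by fun_prop
    simpa using (this.tendsto 0).mono_left nhdsWithin_le_nhds
  have c1 : Tendsto (fun r : ℝ => C*(r*s)^a) (𝓝[>] 0) (𝓝 0) := by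
    have : Continuous fun r : ℝ => C*(r*s)^a := continuous_const.mul ((continuous_id.mul continuous_const).rpow_const fun _ => Or.inr h.ha.le)
    simpa [Real.zero_rpow h.ha.ne'] using (this.tendsto 0).mono_left (nhdsWithin_le_nhds (s := Ioi 0))
  obtain ⟨r, ⟨z, hz, hzp⟩, near, ⟨r0, -⟩, hR, hε⟩ := ((hp δ δp).and ((TU_near S U (‖p‖+δ+3*s) δp).and ((ev_lt hU one_pos).and
    (((c0.mono_left hU).eventually_le_const (lt_min h.hR one_pos)).and ((c1.mono_left hU).eventually_le_const e0))))).exists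
  have hm := hR.trans (min_le_left _ _); have hm1 := hR.trans (min_le_right _ _)
  have rs0 : 0 < r*s := by positivity
  have zn : ‖z‖ ≤ ‖p‖ + δ := by have := norm_add_le (z-p) p; rw [sub_add_cancel] at this; linarith
  have rz : ‖r•z‖ ≤ r*(‖p‖+δ) := nsm r0.le zn
  have rp : 0 ≤ r*(‖p‖+δ) := by positivity
  have au := h.au (y := r•z) (r := r*s) (L := 4) rs0 (by linarith only [hm1, rp]) (by linarith only [hm, rs0, rz])
  have mem : ∀ ζ, ζ ∈ rS (r•z) (r*s) S → z + s•ζ ∈ rS 0 r S := fun ζ hζ => by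
    rw [mem_rS] at hζ ⊢; rwa [zero_add, smul_add, smul_smul]
  have zS : r•z ∈ S := by rw [mem_rS, zero_add] at hz; exact hz
  obtain ⟨ζ, hζ, hd⟩ := hF _ _ (au.mono hε le_rfl) (zero_rS _ zS) n hn (fun ζ hζ h3 => by
    have sz : ‖s•ζ‖ ≤ s*3 := nsm sp.le h3
    obtain ⟨y, hy, hyz⟩ := near _ (mem ζ hζ) (by have := norm_add_le z (s•ζ); linarith)
    have e1 : y - p = s•ζ + ((z - p) - (z + s•ζ - y)) := by abel
    have n1 := norm_sub_le (z-p) (z + s•ζ - y)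
    have k := hs y hy (by have := norm_add_le (s•ζ) ((z - p) - (z + s•ζ - y)); rw [← e1] at this; linarith)
    rw [e1, inner_add_right, real_inner_smul_right] at k
    have k2 := abs_inner_le_of_norm (z := (z - p) - (z + s•ζ - y)) hn
    have k3 := abs_sub_abs_le_abs_sub (s*⟪n, ζ⟫) (-⟪n, (z - p) - (z + s•ζ - y)⟫)
    rw [sub_neg_eq_add, abs_neg, abs_mul, abs_of_pos sp] at k3
    have : s*|⟪n, ζ⟫| ≤ s*ε := by linarith
    exact le_of_mul_le_mul_left this sp) (s⁻¹•w) (by rw [real_inner_smul_right, hw, mul_zero]) (by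
      rw [nsm_eq (by positivity), inv_mul_le_iff₀ sp]; linarith)
  have sw : ‖s•ζ - w‖ ≤ s*(1/8) := by
    have := nsm sp.le hd; rwa [smul_sub, smul_inv_smul₀ sp.ne'] at this
  have e0' : z + s•ζ = (z - p) + (s•ζ - w) + p + w := by abel
  obtain ⟨q, hq, hqz⟩ := near _ (mem ζ hζ) (by
    rw [e0']
    have := norm_add₃_le (a := (z - p) + (s•ζ - w)) (b := p) (c := w)
    have := norm_add_le (z - p) (s•ζ - w)
    linarith)
  refine ⟨q, hq, ?_⟩
  have e2 : q - (p + w) = (z - p) + (s•ζ - w) + (q - (z + s•ζ)) := by abel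
  have := norm_add₃_le (a := z - p) (b := s•ζ - w) (c := q - (z + s•ζ))
  rw [e2]; rw [norm_sub_rev q] at this; linarith
include hs0 hnf
omit h in
lemma TU_slab {n : V} (hn : ‖n‖ = 1) : ∃ z ∈ TU S U, ⟪n, z⟫ ≠ 0 := by
  have hnn : ¬ ∀ᶠ r in (U : Filter ℝ), ∀ z ∈ rS 0 r S, ‖z‖ ≤ 1 → |⟪n, z⟫| ≤ et := fun hc => by
    obtain ⟨r, h1, h2, h3⟩ := (hc.and (ev_lt hU hs0)).exists
    refine hnf r h2 h3.le ?_
    have := (SL_rS (S := S) (y := 0) (s := 1) (η := et) h2).1 ⟨n, hn, fun z hz hz1 => by rw [sub_zero] at hz1 ⊢; rw [mul_one]; exact h1 z hz hz1⟩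
    rwa [mul_one] at this
  obtain ⟨z, y, hz, hy, hT⟩ := TU_seq hnn
  refine ⟨y, hT, fun h0 => ?_⟩
  have : Tendsto (fun r => |⟪n, z r⟫|) U (𝓝 |⟪n, y⟫|) := ((continuous_const.inner continuous_id).abs.tendsto y).comp hy
  have := ge_of_tendsto this (hz.mono fun r hr => (not_le.1 hr.2.2).le)
  rw [h0, abs_zero] at this; linarith [et_pos]
lemma TDU : ∃ F ε, Tendsto (fun r => FG (rs 0 (sc a r) m)) U (𝓝 F) ∧ TD F (TU S U) ε := by
  have hU' : ((U.map (sc a) : Ultrafilter ℝ) : Filter ℝ) ≤ 𝓝[>] 0 := (sc_t0 h.ha1).mono_left hU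
  have au : ∀ᶠ r in (U : Filter ℝ), AU (rs 0 (sc a r) m) (rS 0 (sc a r) S) (C*(sc a r)^a) 1 := ev_au h hU' 1
  obtain ⟨F, hF⟩ := ulim (au.mono fun r h => nFG h)
  obtain ⟨ε, hε⟩ := FILL (1/8) (by norm_num)
  have ap : ∀ z w, Tendsto (fun r => ⟪FG (rs 0 (sc a r) m) z, w⟫) U (𝓝 ⟪F z, w⟫) := fun z w =>
    (clm_t hF tendsto_const_nhds).inner tendsto_const_nhds
  refine ⟨F, ε/2, hF, TU_closed S U, fun z w => ?_, fun e => ?_, fun y hy => ?_, fun n hn => TU_slab hs0 hnf hU hn, by linarith [hε.1], by linarith [hε.2.1], fun p hp s sp n hn hs w hw hws => TU_fill h hU hε hp sp hn hs hw hws⟩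
  · refine tendsto_nhds_unique (ap z w) (((ap w z).congr' (au.mono fun r h => ?_)).trans_eq ?_)
    · rw [FG_sym h, real_inner_comm]
    · rw [real_inner_comm]
  · have t1 : Tendsto (fun r => |∑ i, ⟪FG (rs 0 (sc a r) m) (e i), e i⟫ + 1|) U (𝓝 |∑ i, ⟪F (e i), e i⟫ + 1|) :=
      ((tendsto_finsetSum _ fun i _ => ap _ _).add_const 1).abs
    have t2 : Tendsto (fun r => 30/c3*(C*(sc a r)^a)) U (𝓝 (30/c3*(C*0))) := (((rpow_t0 h.ha).comp ((sc_t0 h.ha1).mono_left hU)).const_mul C).const_mul _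
    have := le_of_tendsto_of_tendsto t1 t2 (au.mono fun r h' => FG_tr h' (zero_rS _ h.zero) zero_le_one e)
    rw [mul_zero, mul_zero, abs_nonpos_iff] at this; linarith
  · obtain ⟨z, hz, hzy⟩ := TU_choose h hy
    obtain ⟨K, K1, hK⟩ := ZF
    set A := ‖y‖ + 1 with hA
    have A1 : 1 ≤ A := by linarith [norm_nonneg y]
    clear_value A
    have t1 : Tendsto (fun r => |⟪FG (rs 0 (sc a r) m) (z r), z r⟫|) U (𝓝 |⟪F y, y⟫|) := ((clm_t hF hzy).inner hzy).abs
    have ha := h.ha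
    have t2 : Tendsto (fun r : ℝ => K*A^5*r^(a/20)) U (𝓝 (K*A^5*0)) := ((rpow_t0 (by positivity)).mono_left hU).const_mul _
    have t3 : Tendsto (fun r : ℝ => A*r^(a/20)) U (𝓝 (A*0)) := ((rpow_t0 (by positivity)).mono_left hU).const_mul _
    have t4 : Tendsto (fun r : ℝ => C*r^(6*a/10)) U (𝓝 (C*0)) := ((rpow_t0 (by positivity)).mono_left hU).const_mul _
    have t5 := ((sc_t0 h.ha1).mono_right nhdsWithin_le_nhds).mono_left hU
    have hR := h.hR
    refine abs_nonpos_iff.1 ((le_of_tendsto_of_tendsto t1 t2 ?_).trans_eq (mul_zero _))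
    filter_upwards [ev_lt hU one_pos, t3.eventually_le_const (show A*0 < 1/2 by norm_num), t4.eventually_le_const (show C*0 < 1 by norm_num),
      t5.eventually_le_const (show (0:ℝ) < R/8 by positivity), t5.eventually_le_const hs0, hzy.norm.eventually_le_const (show ‖y‖ < A by linarith)] with r hr h3 h4 h5 h6 h7
    obtain ⟨q0, q1⟩ := sc_spec (a := a) hr.1
    have l0 : 0 < r^(a/20) := Real.rpow_pos_of_pos hr.1 _
    have c6 : C*(sc a r)^a ≤ (A*r^(a/20))^6 := by
      have e1 : (r^(a/20))^6 = r^(3*a/10) := by rw [← Real.rpow_natCast, ← Real.rpow_mul hr.1.le]; congr 1; push_cast; ring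
      have e2 : (sc a r)^a ≤ r^(6*a/10) * r^(3*a/10) := by
        rw [sc, ← Real.rpow_mul hr.1.le, ← Real.rpow_add hr.1]
        refine Real.rpow_le_rpow_of_exponent_ge hr.1 hr.2.le ?_
        nlinarith only [ha, h.ha1]
      have e3 : (1:ℝ) ≤ A^6 := one_le_pow₀ A1
      have e4 : 0 < r^(3*a/10) := Real.rpow_pos_of_pos hr.1 _
      calc C*(sc a r)^a ≤ C*(r^(6*a/10) * r^(3*a/10)) := mul_le_mul_of_nonneg_left e2 (by linarith [h.hC])
        _ = C*r^(6*a/10) * r^(3*a/10) := by ring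
        _ ≤ 1*r^(3*a/10) := mul_le_mul_of_nonneg_right h4 e4.le
        _ ≤ A^6*r^(3*a/10) := mul_le_mul_of_nonneg_right e3 e4.le
        _ = _ := by rw [mul_pow, e1]
    have zS : r•z r ∈ S := by have := hz r; rw [mem_rS, zero_add] at this; exact this
    have key := hK m S C a R s0 h hnf (sc a r) (A*r^(a/20)) q0 (by linarith) h6 (by positivity) h3 c6 _ zS (by
      have : ‖r•z r‖ ≤ r*A := nsm hr.1.le h7
      have e : 4*(A*r^(a/20))^2*sc a r = 4*A^2*r := by rw [mul_pow]; linear_combination 4*A^2*q1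
      have : r*A*1 ≤ r*A*(4*A) := mul_le_mul_of_nonneg_left (by linarith only [A1]) (by have := hr.1; positivity)
      rw [e]; linarith)
    rw [map_smul, real_inner_smul_left, real_inner_smul_right, ← mul_assoc, abs_mul, abs_of_nonneg (mul_self_nonneg r)] at key
    have e : K*(A*r^(a/20))^5*(sc a r)^2 = r*r*(K*A^5*r^(a/20)) := by linear_combination K*A^5*r^(a/20)*((r^(a/20))^2*sc a r + r)*q1
    rw [e] at key
    exact le_of_mul_le_mul_left key (mul_pos hr.1 hr.1)
end
lemma PMR {F : V →L[ℝ] V} {T : Set V} {ε : ℝ} (h : TD F T ε) {e : OB} {l : Fin 4 → ℝ} (he : ∀ i, F (e i) = l i • e i) {z : V} (hz : ⟪F z, z⟫ = 0) (hFz : F z ≠ 0) : z ∈ T ∨ -z ∈ T := by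
  obtain ⟨y, hy, hFy⟩ := h.exreg he
  by_cases h3 : ∀ p q, ∃ r, r ≠ p ∧ r ≠ q ∧ l r ≠ 0
  · exact PM h he hy hFy h3 hz hFz
  push Not at h3
  obtain ⟨p0, q0, h0⟩ := h3
  obtain ⟨p, q, lp, lq, -⟩ := Z_signs h he hz hFz
  have pq : p ≠ q := by rintro rfl; linarith
  have h1 : ∀ r, r ≠ p → r ≠ q → l r = 0 := fun r hp hq => by
    have a1 : p = p0 ∨ p = q0 := by by_contra! hc; exact lp.ne' (h0 p hc.1 hc.2)
    have a2 : q = p0 ∨ q = q0 := by by_contra! hc; exact lq.ne (h0 q hc.1 hc.2)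
    refine h0 r ?_ ?_ <;> rintro rfl <;> rcases a1 with rfl | rfl <;> rcases a2 with rfl | rfl <;> simp_all
  have h2 : ∀ v, ⟪F v, v⟫ = 0 → F v ≠ 0 → ⟪v, e p⟫ ≠ 0 ∧ ⟪v, e q⟫ ≠ 0 ∧ l p * ⟪v, e p⟫^2 + l q * ⟪v, e q⟫^2 = 0 := fun v v0 v1 => by
    obtain ⟨p', q', lp', lq', n1, n2⟩ := Z_signs h he v0 v1
    have a1 : p' = p := by
      by_contra hc
      rcases eq_or_ne p' q with rfl | hq
      · linarith
      · rw [h1 p' hc hq] at lp'; exact lp'.false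
    have a2 : q' = q := by
      by_contra hc
      rcases eq_or_ne q' p with rfl | hq
      · linarith
      · rw [h1 q' hq hc] at lq'; exact lq'.false
    subst a1 a2
    refine ⟨n1, n2, ?_⟩
    have hs : ∑ i, l i * ⟪v, e i⟫^2 = 0 := by rw [Fin.sum_univ_four, ← quad_exp h.sym he, v0]
    rwa [Finset.sum_eq_add p' q' pq (fun i _ hi => by rw [h1 i hi.1 hi.2]; simp) (by simp) (by simp)] at hs
  have main : ∀ v ∈ T, F v ≠ 0 → 0 < (⟪v, e p⟫*⟪v, e q⟫)*(⟪z, e p⟫*⟪z, e q⟫) → z ∈ T ∨ -z ∈ T := fun v hv hFv hc => by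
    obtain ⟨n1, n2, -⟩ := h2 v (h.zero v hv) hFv
    obtain ⟨σ, s1, s2⟩ := sgn_ex n1
    obtain ⟨τ, t1, t2⟩ := sgn_ex n2
    have E := Ed_of h he (mul_neg_of_pos_of_neg lp lq) s1 t1 hv hFv s2.le t2.le
    have k : 0 < (σ*⟪z, e p⟫)*(τ*⟪z, e q⟫) := by
      have e1 : (⟪v, e p⟫*⟪v, e q⟫)*(⟪z, e p⟫*⟪z, e q⟫) = ((σ*⟪v, e p⟫)*(τ*⟪v, e q⟫))*((σ*⟪z, e p⟫)*(τ*⟪z, e q⟫)) := by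
        linear_combination (-(⟪v, e p⟫*⟪v, e q⟫)*(⟪z, e p⟫*⟪z, e q⟫)*τ^2)*s1 - (⟪v, e p⟫*⟪v, e q⟫)*(⟪z, e p⟫*⟪z, e q⟫)*t1
      rw [e1] at hc
      exact pos_of_mul_pos_right hc (mul_pos s2 t2).le
    rcases mul_pos_iff.1 k with k | k
    · exact Or.inl (E z hz hFz k.1.le k.2.le)
    · exact Or.inr (E (-z) (Zneg hz) (by rwa [map_neg, neg_ne_zero]) (by rw [inner_neg_left]; linarith [k.1]) (by rw [inner_neg_left]; linarith [k.2]))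
  obtain ⟨z1, z2, z3⟩ := h2 z hz hFz
  obtain ⟨v, hv, hn⟩ := h.slab (‖⟪z, e q⟫ • e p + ⟪z, e p⟫ • e q‖⁻¹ • (⟪z, e q⟫ • e p + ⟪z, e p⟫ • e q)) (by
    rw [norm_smul, norm_inv, norm_norm, inv_mul_cancel₀]
    rw [norm_ne_zero_iff]; intro hc
    have := congrArg (fun x => ⟪x, e p⟫) hc
    simp [inner_add_left, real_inner_smul_left, ob_inner, pq.symm] at this
    exact z2 this)
  rw [real_inner_smul_left] at hn
  have hn := right_ne_zero_of_mul hn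
  rw [inner_add_left, real_inner_smul_left, real_inner_smul_left, real_inner_comm v, real_inner_comm v] at hn
  have hFv : F v ≠ 0 := by
    rw [reg_iff h he]; by_contra! hc
    have a1 := (mul_eq_zero.1 (hc p)).resolve_left lp.ne'; have a2 := (mul_eq_zero.1 (hc q)).resolve_left lq.ne
    rw [a1, a2] at hn; simp at hn
  obtain ⟨v1, v2, v3⟩ := h2 v (h.zero v hv) hFv
  refine main v hv hFv ?_
  have f : (⟪z, e q⟫*⟪v, e p⟫ + ⟪z, e p⟫*⟪v, e q⟫)*(⟪z, e q⟫*⟪v, e p⟫ - ⟪z, e p⟫*⟪v, e q⟫) = 0 := by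
    refine (mul_eq_zero.1 (show l p * _ = 0 from ?_)).resolve_left lp.ne'
    linear_combination ⟪z, e q⟫^2*v3 - ⟪v, e q⟫^2*z3
  have f := (mul_eq_zero.1 f).resolve_left hn
  have : (⟪v, e p⟫*⟪v, e q⟫)*(⟪z, e p⟫*⟪z, e q⟫) = (⟪z, e q⟫*⟪v, e p⟫)^2 := by linear_combination (-⟪v, e p⟫*⟪z, e q⟫)*f
  rw [this]; positivity
lemma mkv_norm (e : OB) (t : Fin 4 → ℝ) : ‖mkv e t‖^2 = t 0^2+t 1^2+t 2^2+t 3^2 := by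
  rw [norm_exp e]; simp only [mk_inner]
lemma ln_mkv (e : OB) (t : Fin 4 → ℝ) (x : V) : ln (mkv e t) x = t 0*ln (e 0) x+t 1*ln (e 1) x+t 2*ln (e 2) x+t 3*ln (e 3) x := by
  simp only [ln, mkv, inner_add_right, real_inner_smul_right]
def Qf (g : Fin 4 → Fin 4 → ℝ) (u : Fin 4 → ℝ) : ℝ := u 0^2*g 0 0 + u 1^2*g 1 1 + u 2^2*g 2 2 + u 3^2*g 3 3 + 6*(u 0*u 1*g 0 1 + u 0*u 2*g 0 2 + u 0*u 3*g 0 3 + u 1*u 2*g 1 2 + u 1*u 3*g 1 3 + u 2*u 3*g 2 3)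
section
variable {m : Measure V} {S : Set V} {C a R : ℝ} (h : HA m S C a R) {U : Ultrafilter ℝ} (hU : (U : Filter ℝ) ≤ 𝓝[>] 0)
include h hU
variable {Λ : (V → ℝ) →ₗ[ℝ] ℝ} (hΛ : ∀ f ∈ PGs, Tendsto (fun r => IG m r f) U (𝓝 (Λ f)))
include hΛ
lemma Lam_tr (e : OB) : Λ (ln (e 0)^2) + Λ (ln (e 1)^2) + Λ (ln (e 2)^2) + Λ (ln (e 3)^2) = 3/2*c3 := by
  have hp : ∀ i, ln (e i)^2 ∈ PGs := fun i => PGs_pow (PGs_ln _) 2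
  have hf := hΛ _ (add_mem (add_mem (add_mem (hp 0) (hp 1)) (hp 2)) (hp 3))
  simp only [map_add] at hf
  have t2 : Tendsto (fun r => 15*(C*r^a)) U (𝓝 (15*(C*0))) := (((rpow_t0 h.ha).mono_left hU).const_mul C).const_mul _
  have := le_of_tendsto_of_tendsto (hf.sub_const (3/2*c3)).abs t2 ((ev_au h hU 1).mono fun r h' => by
    have := H2 h' (zero_rS _ h.zero) zero_le_one
    refine le_of_eq_of_le (congrArg abs ?_) this
    rw [IG]; congr 2; ext x
    simp only [Pi.add_apply, Pi.pow_apply, ln, wt]; rw [norm_exp e x, mul_comm])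
  rw [mul_zero, mul_zero, abs_nonpos_iff] at this; linarith only [this]
variable {e : OB} {l : Fin 4 → ℝ} (tr : l 0 + l 1 + l 2 + l 3 = -1) {p : Fin 4} (hp : 0 < l p)
  (hr : ∀ z, l 0*⟪z, e 0⟫^2 + l 1*⟪z, e 1⟫^2 + l 2*⟪z, e 2⟫^2 + l 3*⟪z, e 3⟫^2 = 0 → ⟪z, e p⟫ ≠ 0 → (∀ t : ℝ, 0 < t → t • z ∈ TU S U) ∨ (∀ t : ℝ, 0 < t → t • (-z) ∈ TU S U))
include tr hp hr
omit tr hp in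
lemma MOM0 (t : Fin 4 → ℝ) (ht : l 0*t 0^2 + l 1*t 1^2 + l 2*t 2^2 + l 3*t 3^2 = 0) (tp : t p ≠ 0) : Λ (ln (mkv e t)^2) = 1/2*c3*(t 0^2+t 1^2+t 2^2+t 3^2) ∧ Λ (ln (mkv e t)^4) = 3/4*c3*(t 0^2+t 1^2+t 2^2+t 3^2)^2 := by
  rw [← mkv_norm e t, ← pow_mul]
  rcases hr (mkv e t) (by simpa only [mk_inner] using ht) (by rwa [mk_inner]) with k | k
  · exact (RAY h hU hΛ fun t t0 _ => k t t0).2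
  · have := (RAY h hU hΛ fun t t0 _ => k t t0).2
    have e : ln (-mkv e t) = -ln (mkv e t) := by ext x; simp [ln]
    rwa [e, neg_sq, norm_neg, Even.neg_pow (by decide)] at this
omit tr hp in
lemma MOM1 (w : Fin 4 → ℝ) (w0 : ∀ i, 0 < w i) (hw : l 0*w 0 + l 1*w 1 + l 2*w 2 + l 3*w 3 = 0) : w 0*Λ (ln (e 0)^2) + w 1*Λ (ln (e 1)^2) + w 2*Λ (ln (e 2)^2) + w 3*Λ (ln (e 3)^2) = 1/2*c3*(w 0+w 1+w 2+w 3) ∧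
    Qf (fun i j => Λ (ln (e i)^2*ln (e j)^2)) w = 3/4*c3*(w 0+w 1+w 2+w 3)^2 := by
  obtain ⟨t, tp, rfl⟩ : ∃ t : Fin 4 → ℝ, (∀ i, 0 < t i) ∧ w = fun i => t i^2 := ⟨fun i => √(w i), fun i => Real.sqrt_pos.2 (w0 i), funext fun i => (Real.sq_sqrt (w0 i).le).symm⟩
  have k : ∀ a b d : ℝ, a^2 = 1 → b^2 = 1 → d^2 = 1 → Λ (ln (mkv e ![t 0, a*t 1, b*t 2, d*t 3])^2) = 1/2*c3*(t 0^2+t 1^2+t 2^2+t 3^2) ∧ Λ (ln (mkv e ![t 0, a*t 1, b*t 2, d*t 3])^4) = 3/4*c3*(t 0^2+t 1^2+t 2^2+t 3^2)^2 := fun a b d ha hb hd => by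
    have ne : ∀ {a : ℝ}, a^2 = 1 → a ≠ 0 := fun h h0 => by rw [h0] at h; norm_num at h
    have := MOM0 h hU hΛ hr ![t 0, a*t 1, b*t 2, d*t 3] (by
      simp [Matrix.cons_val, mul_pow, ha, hb, hd]; exact hw) (by
      have n0 := (tp 0).ne'; have n1 := (tp 1).ne'; have n2 := (tp 2).ne'; have n3 := (tp 3).ne'
      have m1 := ne ha; have m2 := ne hb; have m3 := ne hd
      clear * - n0 n1 n2 n3 m1 m2 m3
      fin_cases p <;> simp [*])
    simpa [Matrix.cons_val, mul_pow, ha, hb, hd] using this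
  have o : (1:ℝ)^2 = 1 := by norm_num
  have n : (-1:ℝ)^2 = 1 := by norm_num
  have k1 := k 1 1 1 o o o; have k2 := k 1 1 (-1) o o n; have k3 := k 1 (-1) 1 o n o; have k4 := k 1 (-1) (-1) o n n
  have k5 := k (-1) 1 1 n o o; have k6 := k (-1) 1 (-1) n o n; have k7 := k (-1) (-1) 1 n n o; have k8 := k (-1) (-1) (-1) n n n
  clear k
  set G : ℝ → ℝ → ℝ → V → ℝ := fun a b d => ln (mkv e ![t 0, a*t 1, b*t 2, d*t 3]) with hG
  have Ge : ∀ a b d x, G a b d x = t 0*ln (e 0) x+a*t 1*ln (e 1) x+b*t 2*ln (e 2) x+d*t 3*ln (e 3) x := fun a b d x => by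
    simp [hG, ln_mkv]
  constructor
  · have q : G 1 1 1^2 + G 1 (-1) (-1)^2 + G (-1) 1 (-1)^2 + G (-1) (-1) 1^2 = (4*t 0^2)•(ln (e 0)^2) + (4*t 1^2)•(ln (e 1)^2) + (4*t 2^2)•(ln (e 2)^2) + (4*t 3^2)•(ln (e 3)^2) := by
      ext x; simp only [Pi.add_apply, Pi.pow_apply, Pi.smul_apply, smul_eq_mul, Ge]; ring
    have q := congrArg Λ q
    simp only [map_add, map_smul, smul_eq_mul] at q
    linear_combination (-1/4)*q + (1/4)*(k1.1+k4.1+k6.1+k7.1)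
  · have q : G 1 1 1^4 + G 1 1 (-1)^4 + G 1 (-1) 1^4 + G 1 (-1) (-1)^4 + G (-1) 1 1^4 + G (-1) 1 (-1)^4 + G (-1) (-1) 1^4 + G (-1) (-1) (-1)^4 =
      (8*t 0^4)•(ln (e 0)^2*ln (e 0)^2) + (8*t 1^4)•(ln (e 1)^2*ln (e 1)^2) + (8*t 2^4)•(ln (e 2)^2*ln (e 2)^2) + (8*t 3^4)•(ln (e 3)^2*ln (e 3)^2) +
      (48*t 0^2*t 1^2)•(ln (e 0)^2*ln (e 1)^2) + (48*t 0^2*t 2^2)•(ln (e 0)^2*ln (e 2)^2) + (48*t 0^2*t 3^2)•(ln (e 0)^2*ln (e 3)^2) +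
      (48*t 1^2*t 2^2)•(ln (e 1)^2*ln (e 2)^2) + (48*t 1^2*t 3^2)•(ln (e 1)^2*ln (e 3)^2) + (48*t 2^2*t 3^2)•(ln (e 2)^2*ln (e 3)^2) := by
      ext x; simp only [Pi.add_apply, Pi.mul_apply, Pi.pow_apply, Pi.smul_apply, smul_eq_mul, Ge]; ring
    have q := congrArg Λ q
    simp only [map_add, map_smul, smul_eq_mul] at q
    unfold Qf
    linear_combination (-1/8)*q + (1/8)*(k1.2+k2.2+k3.2+k4.2+k5.2+k6.2+k7.2+k8.2)
lemma MOM (u : Fin 4 → ℝ) (hu : l 0*u 0 + l 1*u 1 + l 2*u 2 + l 3*u 3 = 0) : u 0*Λ (ln (e 0)^2) + u 1*Λ (ln (e 1)^2) + u 2*Λ (ln (e 2)^2) + u 3*Λ (ln (e 3)^2) = 1/2*c3*(u 0+u 1+u 2+u 3) ∧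
    Qf (fun i j => Λ (ln (e i)^2*ln (e j)^2)) u = 3/4*c3*(u 0+u 1+u 2+u 3)^2 := by
  have hs : ∀ u : Fin 4 → ℝ, l 0*u 0 + l 1*u 1 + l 2*u 2 + l 3*u 3 = ∑ i, l i*u i := fun u => by rw [Fin.sum_univ_four]
  set v : Fin 4 → ℝ := fun i => 1 + if i = p then 1/l p else 0 with hv
  have v1 : ∀ i, 1 ≤ v i := fun i => by
    simp only [hv]; split_ifs
    · have : 0 < 1/l p := by positivity
      linarith
    · simp
  have vl : l 0*v 0 + l 1*v 1 + l 2*v 2 + l 3*v 3 = 0 := by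
    rw [hs]; simp only [hv, mul_add, Finset.sum_add_distrib, mul_ite, mul_zero, mul_one, Finset.sum_ite_eq', Finset.mem_univ, if_true]
    rw [Fin.sum_univ_four, tr]; field_simp; norm_num
  clear_value v
  set τ := (1 + |u 0| + |u 1| + |u 2| + |u 3|)⁻¹ with hτ
  have τ0 : 0 < τ := by positivity
  have τu : ∀ i, |τ*u i| < 1 := fun i => by
    rw [abs_mul, abs_of_pos τ0, hτ, inv_mul_lt_iff₀ (by positivity)]
    have := abs_nonneg (u 0); have := abs_nonneg (u 1); have := abs_nonneg (u 2); have := abs_nonneg (u 3)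
    fin_cases i <;> simp only [Fin.zero_eta, Fin.mk_one, Fin.reduceFinMk] <;> linarith
  clear_value τ
  have a0 := MOM1 h hU hΛ hr v (fun i => by linarith [v1 i]) vl
  have a1 := MOM1 h hU hΛ hr (fun i => v i + τ*u i) (fun i => by linarith only [v1 i, (abs_lt.1 (τu i)).1]) (by linear_combination vl + τ*hu)
  have a2 := MOM1 h hU hΛ hr (fun i => v i - τ*u i) (fun i => by linarith only [v1 i, (abs_lt.1 (τu i)).2]) (by linear_combination vl - τ*hu)
  constructor
  · refine mul_left_cancel₀ τ0.ne' ?_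
    linear_combination a1.1 - a0.1
  · refine mul_left_cancel₀ (pow_ne_zero 2 τ0.ne') ?_
    unfold Qf at *
    linear_combination (1/2)*a1.2 + (1/2)*a2.2 - a0.2
lemma MOMi (i : Fin 4) : Λ (ln (e i)^2) = 1/2*c3*(1 + l i) := by
  have key : ∀ i, Λ (ln (e i)^2) - 1/2*c3 = l i*((Λ (ln (e p)^2) - 1/2*c3)/l p) := fun i => by
    have e1 : ∀ u g : Fin 4 → ℝ, u 0*g 0 + u 1*g 1 + u 2*g 2 + u 3*g 3 = ∑ i, u i*g i := fun u g => by rw [Fin.sum_univ_four]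
    set u : Fin 4 → ℝ := fun j => (if j = i then 1 else 0) - (if j = p then l i/l p else 0) with hu
    have := (MOM h hU hΛ tr hp hr u (by
      rw [e1]; simp [hu, mul_sub, Finset.sum_sub_distrib]; field_simp; simp)).1
    have e2 : u 0 + u 1 + u 2 + u 3 = ∑ i, u i := by rw [Fin.sum_univ_four]
    rw [e1 u fun i => Λ (ln (e i)^2), e2] at this
    simp [hu, sub_mul, Finset.sum_sub_distrib] at this
    linear_combination this
  have t := Lam_tr h hU hΛ e
  set κ := (Λ (ln (e p)^2) - 1/2*c3)/l p with hκ
  clear_value κ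
  have : κ = 1/2*c3 := by linear_combination (-1)*t + key 0 + key 1 + key 2 + key 3 + κ*tr
  rw [this] at key
  linear_combination key i
end
lemma ALGX {l G : Fin 4 → ℝ} {p : Fin 4} (hp : 0 < l p) (s1 : ∑ i, l i = -1) (s2 : ∑ i, l i^2 = 1) (hA : ∀ i, G i*(2*l i^2+1/2) + l i*(3/2+(∑ j, l j*G j)/2) = 3/4)
    (hB : ∀ i, G i*(2*l i-1/2) + l i*((∑ j, G j)/2-15/4) + 3/4 = 0) : l p = 1/2 ∧ ∀ i, i ≠ p → l i = -1/2 := by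
  classical
  obtain ⟨n, hn⟩ : ∃ n, l n < 0 := by
    by_contra! hc
    have := Finset.sum_nonneg fun i (_ : i ∈ Finset.univ) => hc i
    linarith
  set A := 3/2+(∑ j, l j*G j)/2 with hAd
  set B := (∑ j, G j)/2-15/4 with hBd
  have q : ∀ i, l i ≠ 0 → 2*B*l i^2 - (2*A-3/2)*l i + (3/2+A/2+B/2) = 0 := fun i hi => by
    refine mul_left_cancel₀ hi ?_
    linear_combination (2*l i^2+1/2)*hB i - (2*l i-1/2)*hA i
  have hxy : l p ≠ l n := by linarith only [hp, hn]
  have tri : ∀ i, l i = l p ∨ l i = l n ∨ l i = 0 := fun i => by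
    by_contra! hc
    obtain ⟨c1, c2, c3⟩ := hc
    have q1 := q i c3; have q2 := q p hp.ne'; have q3 := q n hn.ne
    have e1 : 2*B*(l i + l p) - (2*A-3/2) = 0 := mul_left_cancel₀ (sub_ne_zero.2 c1) (by linear_combination q1 - q2)
    have e2 : 2*B*(l i + l n) - (2*A-3/2) = 0 := mul_left_cancel₀ (sub_ne_zero.2 c2) (by linear_combination q1 - q3)
    have e3 : B = 0 := mul_left_cancel₀ (sub_ne_zero.2 hxy) (by linear_combination (e1 - e2)/2)
    rw [e3] at e1 q1
    have e4 : A = 3/4 := by linarith only [e1]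
    rw [e4] at q1; linarith only [q1]
  have Gx : ∀ i j, l i = l j → G i = G j := fun i j hij => by
    have h1 := hA i; have h2 := hA j; rw [hij] at h1
    refine mul_right_cancel₀ (show (2*l j^2+1/2) ≠ 0 by positivity) ?_
    linear_combination h1 - h2
  have G0 : ∀ i, l i = 0 → G i = 3/2 := fun i hi => by have h1 := hA i; rw [hi] at h1; linarith only [h1]
  have ap := hA p; have an := hA n; have bp := hB p; have bn := hB n
  clear_value A B
  set a := (Finset.univ.filter fun i => l i = l p).card with ha
  set b := (Finset.univ.filter fun i => l i = l n).card with hb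
  have cnt : ∀ (f : Fin 4 → ℝ) (X Y : ℝ), (∀ i, l i = l p → f i = X) → (∀ i, l i = l n → f i = Y) → (∀ i, l i = 0 → f i = 0) → ∑ i, f i = a*X + b*Y := fun f X Y h1 h2 h3 => by
    have : ∀ i, f i = (if l i = l p then X else 0) + (if l i = l n then Y else 0) := fun i => by
      rcases tri i with c | c | c
      · rw [if_pos c, if_neg (by rw [c]; exact hxy), h1 i c, add_zero]
      · rw [if_neg (by rw [c]; exact hxy.symm), if_pos c, h2 i c, zero_add]
      · rw [if_neg (by linarith only [hp, c]), if_neg (by linarith only [hn, c]), h3 i c, add_zero]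
    simp only [this, Finset.sum_add_distrib, ← Finset.sum_filter, Finset.sum_const, nsmul_eq_mul, ha, hb]
  have a1 : 1 ≤ a := Finset.card_pos.2 ⟨p, by simp⟩
  have b1 : 1 ≤ b := Finset.card_pos.2 ⟨n, by simp⟩
  have ab : a + b ≤ 4 := by
    rw [ha, hb, ← Finset.card_union_of_disjoint]
    · exact (Finset.card_le_univ _).trans_eq (by simp)
    · exact Finset.disjoint_filter.2 fun i _ c1 c2 => hxy (c1.symm.trans c2)
  have t1 := cnt l (l p) (l n) (fun i h => h) (fun i h => h) (fun i h => h)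
  have t2 := cnt (fun i => l i^2) (l p^2) (l n^2) (fun i h => by rw [h]) (fun i h => by rw [h]) (fun i h => by rw [h]; norm_num)
  have t3 := cnt (fun i => l i*G i) (l p*G p) (l n*G n) (fun i h => by rw [h, Gx i p h]) (fun i h => by rw [h, Gx i n h]) (fun i h => by rw [h]; norm_num)
  have t4 := cnt (fun i => G i - 3/2) (G p - 3/2) (G n - 3/2) (fun i h => by rw [Gx i p h]) (fun i h => by rw [Gx i n h]) (fun i h => by rw [G0 i h]; norm_num)
  rw [Finset.sum_sub_distrib] at t4
  simp only [Finset.sum_const, Finset.card_univ, Fintype.card_fin, nsmul_eq_mul] at t4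
  rw [s1] at t1; rw [s2] at t2; rw [t3] at hAd
  have hS : ∑ i, G i = a*(G p-3/2) + b*(G n-3/2) + 6 := by push_cast at t4; linarith only [t4]
  rw [hS] at hBd
  have fin : l p = 1/2 → l n = -1/2 → l p = 1/2 ∧ ∀ i, i ≠ p → l i = -1/2 := fun h1 h2 => by
    refine ⟨h1, fun i hi => ?_⟩
    have b0 : ∀ i, -1/2 ≤ l i ∧ l i^2 ≤ 1/4 := fun i => by
      rcases tri i with c | c | c <;> rw [c] <;> norm_num [h1, h2]
    rw [← Finset.add_sum_erase _ _ (Finset.mem_univ p)] at s1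
    have : ∑ j ∈ Finset.univ.erase p, (l j - (-1/2)) = 0 := by
      rw [Finset.sum_sub_distrib, Finset.sum_const, Finset.card_erase_of_mem (Finset.mem_univ p)]
      simp only [Finset.card_univ, Fintype.card_fin, nsmul_eq_mul]
      have : ((4-1:ℕ):ℝ) = 3 := by norm_num
      rw [this]; linarith only [s1, h1]
    have := (Finset.sum_eq_zero_iff_of_nonneg fun j _ => by linarith only [(b0 j).1]).1 this i (by simp [hi])
    linarith only [this]
  clear_value a b
  clear cnt tri q Gx G0 hA hB s1 s2 t3 t4 hS ha hb hxy
  generalize l p = x at *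
  generalize l n = y at *
  generalize G p = X at *
  generalize G n = Y at *
  have a3 : a ≤ 3 := by omega
  have b3 : b ≤ 3 := by omega
  interval_cases a <;> interval_cases b <;> norm_num at t1 t2 hAd hBd ab
  · have : y = -1-x := by linarith only [t1]
    subst this; nlinarith only [hp, t2]
  · have : x = -1-2*y := by linarith only [t1]
    subst this
    have : y = -2/3 := mul_left_cancel₀ hn.ne (by linarith only [t2])
    subst this; linarith only [hBd, an, bn, ap, bp]
  · have : x = -1-3*y := by linarith only [t1]
    subst this
    have : y = -1/2 := mul_left_cancel₀ hn.ne (by linarith only [t2])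
    subst this; exact fin (by norm_num) rfl
  · have : y = -1-2*x := by linarith only [t1]
    subst this; nlinarith only [hp, t2]
  · have : y = -1/2-x := by linarith only [t1]
    subst this
    have x2 : x^2 - 1/8 + x/2 = 0 := by linarith only [t2]
    rw [hAd] at ap an; rw [hBd] at bp bn
    linarith [congrArg (x*·) ap, congrArg (x*·) an, congrArg (x*·) bp, congrArg (x*·) bn, congrArg (x*·) x2, congrArg (X*·) x2, congrArg (Y*·) x2, congrArg (x*X*·) x2, congrArg (x*Y*·) x2]
  · have : y = -1-3*x := by linarith
    subst this; nlinarith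
lemma rs_int {l : ℝ} (hl : 0 < l) (m : Measure V) {g : V → ℝ} (hg : Continuous g) : ∫ x, g x ∂(rs 0 l m) = (l^3)⁻¹ * ∫ x, g (l⁻¹ • x) ∂m := by
  rw [rs, integral_smul_measure, integral_map (by fun_prop) hg.aestronglyMeasurable, ENNReal.toReal_ofReal (by positivity)]
  simp
lemma IG_sc {k r : ℝ} (hk : 0 < k) (hr : 0 < r) (m : Measure V) (y : V) : IG m (k*r) (ln y^2) = (k^5)⁻¹ * IG m r (ln y^2 * fun x => Real.exp (-((k^2)⁻¹-1)*‖x‖^2)) := by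
  have c : Continuous (ln y) := (PGs_ln y).1
  rw [IG, IG, rs_int (mul_pos hk hr) m (g := fun x => wt x * (ln y^2) x) (wt_cont.mul (c.pow 2)), rs_int hr m (g := fun x => wt x * (ln y^2 * fun x : V => Real.exp (-((k^2)⁻¹-1)*‖x‖^2)) x) (wt_cont.mul ((c.pow 2).mul (by fun_prop))), ← integral_const_mul, ← integral_const_mul, ← integral_const_mul]
  congr 1; ext x
  simp only [Pi.mul_apply, Pi.pow_apply, ln, wt, real_inner_smul_left]
  rw [nsm_eq (by positivity), nsm_eq (by positivity)]
  have : Real.exp (-((k*r)⁻¹*‖x‖)^2) = Real.exp (-(r⁻¹*‖x‖)^2) * Real.exp (-((k^2)⁻¹-1)*(r⁻¹*‖x‖)^2) := by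
    rw [← Real.exp_add]; congr 1; field_simp; ring
  rw [this]; field_simp
lemma TU_map {S : Set V} {U : Ultrafilter ℝ} {k : ℝ} (hk : 0 < k) {y : V} (hy : k • y ∈ TU S U) : y ∈ TU S (U.map (k*·)) := by
  intro ε hε
  change ∀ᶠ r in (U : Filter ℝ), ∃ z ∈ rS 0 (k*r) S, ‖z - y‖ < ε
  filter_upwards [hy (k*ε) (by positivity)] with r ⟨z, hz, hd⟩
  refine ⟨k⁻¹ • z, ?_, ?_⟩
  · rw [mem_rS] at hz ⊢; rwa [smul_smul, mul_comm k r, mul_assoc, mul_inv_cancel₀ hk.ne', mul_one]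
  · have : k⁻¹ • z - y = k⁻¹ • (z - k • y) := by rw [smul_sub, inv_smul_smul₀ hk.ne']
    rwa [this, nsm_eq (by positivity), inv_mul_lt_iff₀ hk]
lemma exp_quad {u : ℝ} (hu : 0 ≤ u) : 0 ≤ Real.exp (-u) - 1 + u ∧ Real.exp (-u) - 1 + u ≤ u^2 := by
  refine ⟨by linarith [Real.add_one_le_exp (-u)], ?_⟩
  rcases le_or_gt u 1 with h | h
  · have := Real.abs_exp_sub_one_sub_id_le (x := -u) (by rw [abs_neg, abs_of_nonneg hu]; exact h)
    rw [neg_sq] at this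
    linarith [(abs_le.1 this).2]
  · have : Real.exp (-u) ≤ 1 := Real.exp_le_one_iff.2 (by linarith)
    nlinarith
section
variable {m : Measure V} {S : Set V} {C a R : ℝ} (h : HA m S C a R) {U : Ultrafilter ℝ} (hU : (U : Filter ℝ) ≤ 𝓝[>] 0)
  {Λ : (V → ℝ) →ₗ[ℝ] ℝ} (hΛ : ∀ f ∈ PGs, Tendsto (fun r => IG m r f) U (𝓝 (Λ f)))
  {e : OB} {l : Fin 4 → ℝ} (tr : l 0 + l 1 + l 2 + l 3 = -1) {p : Fin 4} (hp : 0 < l p)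
  (hr : ∀ z, l 0*⟪z, e 0⟫^2 + l 1*⟪z, e 1⟫^2 + l 2*⟪z, e 2⟫^2 + l 3*⟪z, e 3⟫^2 = 0 → ⟪z, e p⟫ ≠ 0 → (∀ t : ℝ, 0 < t → t • z ∈ TU S U) ∨ (∀ t : ℝ, 0 < t → t • (-z) ∈ TU S U))
include h hU hΛ tr hp hr
lemma SCL (i : Fin 4) : Λ (ln (e i)^2*ln (e 0)^2) + Λ (ln (e i)^2*ln (e 1)^2) + Λ (ln (e i)^2*ln (e 2)^2) + Λ (ln (e i)^2*ln (e 3)^2) = 5/4*c3*(1+l i) := by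
  have hμ := MOMi h hU hΛ tr hp hr i
  set μ := Λ (ln (e i)^2) with hμd
  have hX := PGs_pow (PGs_ln (e i)) 2
  set X := ln (e i)^2 with hXd
  have p2 : ∀ j, ln (e j)^2 ∈ PGs := fun j => PGs_pow (PGs_ln _) 2
  set N : V → ℝ := ln (e 0)^2 + ln (e 1)^2 + ln (e 2)^2 + ln (e 3)^2 with hN
  have hNm : N ∈ PGs := add_mem (add_mem (add_mem (p2 0) (p2 1)) (p2 2)) (p2 3)
  have Nx : ∀ x, N x = ‖x‖^2 := fun x => by rw [norm_exp e x]; rfl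
  have X0 : ∀ x, 0 ≤ X x := fun x => by rw [hXd]; exact sq_nonneg (ln (e i) x)
  have hM : Λ (X*N) = Λ (X*ln (e 0)^2) + Λ (X*ln (e 1)^2) + Λ (X*ln (e 2)^2) + Λ (X*ln (e 3)^2) := by rw [hN]; simp only [mul_add, map_add]
  rw [← hM]
  clear_value X N
  have key : ∀ k : ℝ, 0 < k → k < 1 → 0 ≤ -(k^2*(1+k+k^2+k^3+k^4))*μ + (1+k)*Λ (X*N) ∧ -(k^2*(1+k+k^2+k^3+k^4))*μ + (1+k)*Λ (X*N) ≤ (1-k)*(1+k)^2/k^2*Λ (X*(N*N)) := fun k k0 k1 => by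
    set E : V → ℝ := fun x => Real.exp (-((k^2)⁻¹-1)*‖x‖^2) with hE
    set hh := (k^2)⁻¹-1 with hhd
    have h0 : 0 ≤ hh := by
      have : 1 ≤ (k^2)⁻¹ := (one_le_inv₀ (by positivity)).2 (pow_le_one₀ k0.le k1.le)
      linarith
    have Em : E ∈ PGs := ⟨by fun_prop, 1, 0, zero_le_one, le_rfl, fun x => by
      simp only [hE, zero_mul, Real.exp_zero, mul_one, Real.abs_exp, Real.exp_le_one_iff]
      have := mul_nonneg h0 (sq_nonneg ‖x‖); linarith⟩
    have hUk : ((U.map (k*·) : Ultrafilter ℝ) : Filter ℝ) ≤ 𝓝[>] 0 := by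
      refine Tendsto.mono_left (tendsto_nhdsWithin_iff.2 ⟨?_, ?_⟩) hU
      · have : Continuous fun r : ℝ => k*r := by fun_prop
        simpa using (this.tendsto 0).mono_left (nhdsWithin_le_nhds (s := Ioi 0))
      · exact eventually_mem_nhdsWithin.mono fun r hr => mul_pos k0 hr
    obtain ⟨Λ', hΛ'⟩ := LAM h hUk
    have hk := MOMi h hUk hΛ' tr hp (fun z z0 z1 => (hr z z0 z1).imp (fun q t t0 => TU_map k0 (by rw [smul_smul]; exact q _ (mul_pos k0 t0)))
      (fun q t t0 => TU_map k0 (by rw [smul_smul]; exact q _ (mul_pos k0 t0)))) i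
    have t1 : Tendsto (fun r => IG m (k*r) X) U (𝓝 μ) := by have := hΛ' _ hX; rw [hXd, hk, ← hμ] at this; rw [hXd]; exact this
    have t2 : Tendsto (fun r => IG m (k*r) X) U (𝓝 ((k^5)⁻¹*Λ (X*E))) := ((hΛ _ (PGs_mul hX Em)).const_mul _).congr' ((ev_lt hU one_pos).mono fun r hr => by
      rw [hXd]; exact (IG_sc k0 hr.1 m _).symm)
    have e1 : Λ (X*E) = k^5*μ := by
      have := tendsto_nhds_unique t1 t2
      rw [this]; field_simp
    have pt : ∀ x, 0 ≤ E x - 1 + hh*N x ∧ E x - 1 + hh*N x ≤ (hh*N x)^2 := fun x => by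
      have := exp_quad (u := hh*‖x‖^2) (by positivity)
      rw [Nx]; simp only [hE]; rwa [← neg_mul] at this
    have f1 : X*E - X + hh•(X*N) ∈ PGs := add_mem (sub_mem (PGs_mul hX Em) hX) (PGs.smul_mem _ (PGs_mul hX hNm))
    have a1 := Lam_nn h hU hΛ f1 fun x _ => by
      have := mul_nonneg (X0 x) (pt x).1
      simp only [Pi.add_apply, Pi.sub_apply, Pi.mul_apply, Pi.smul_apply, smul_eq_mul]; linarith only [this]
    have a2 := Lam_nn h hU hΛ (sub_mem (PGs.smul_mem (hh^2) (PGs_mul hX (PGs_mul hNm hNm))) f1) fun x _ => by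
      have := mul_le_mul_of_nonneg_left (pt x).2 (X0 x)
      simp only [Pi.add_apply, Pi.sub_apply, Pi.mul_apply, Pi.smul_apply, smul_eq_mul]; linarith
    simp only [map_sub, map_add, map_smul, smul_eq_mul, e1] at a1 a2
    rw [← hμd] at a1 a2
    have hk2 : k^2*hh = (1-k)*(1+k) := by rw [hhd]; field_simp; ring
    have k10 : 0 < 1-k := by linarith only [k1]
    have e2 : k^2*(k^5*μ - μ + hh*Λ (X*N)) = (1-k)*(-(k^2*(1+k+k^2+k^3+k^4))*μ + (1+k)*Λ (X*N)) := by
      linear_combination Λ (X*N)*hk2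
    have e3 : k^2*(hh^2*Λ (X*(N*N))) = (1-k)*((1-k)*(1+k)^2/k^2*Λ (X*(N*N))) := by
      have : hh = (1-k)*(1+k)/k^2 := by rw [eq_div_iff (by positivity)]; linarith only [hk2]
      rw [this]; field_simp
    constructor
    · refine le_of_mul_le_mul_left (?_ : (1-k)*0 ≤ _) k10
      rw [mul_zero, ← e2]; positivity
    · refine le_of_mul_le_mul_left ?_ k10
      rw [← e2, ← e3]; exact mul_le_mul_of_nonneg_left (by linarith only [a2]) (by positivity)
  have ev : ∀ᶠ k : ℝ in 𝓝[<] 1, 0 < k ∧ k < 1 := Ioo_mem_nhdsLT one_pos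
  have c1 : Tendsto (fun k : ℝ => -(k^2*(1+k+k^2+k^3+k^4))*μ + (1+k)*Λ (X*N)) (𝓝[<] 1) (𝓝 (-(1^2*(1+1+1^2+1^3+1^4))*μ + (1+1)*Λ (X*N))) :=
    ((by fun_prop : Continuous fun k : ℝ => -(k^2*(1+k+k^2+k^3+k^4))*μ + (1+k)*Λ (X*N)).tendsto 1).mono_left nhdsWithin_le_nhds
  have c2 : Tendsto (fun k : ℝ => (1-k)*(1+k)^2/k^2*Λ (X*(N*N))) (𝓝[<] 1) (𝓝 ((1-1)*(1+1)^2/1^2*Λ (X*(N*N)))) := by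
    refine Tendsto.mono_left (ContinuousAt.tendsto ?_) nhdsWithin_le_nhds
    have : ContinuousAt (fun k : ℝ => (1-k)*(1+k)^2/k^2) 1 := ContinuousAt.div (by fun_prop) (by fun_prop) (by norm_num)
    exact this.mul continuousAt_const
  have i1 := ge_of_tendsto c1 (ev.mono fun k hk => (key k hk.1 hk.2).1)
  have i2 := le_of_tendsto_of_tendsto c1 c2 (ev.mono fun k hk => (key k hk.1 hk.2).2)
  norm_num at i1 i2
  rw [hμ] at i1 i2
  linarith
variable (hz : ∀ y ∈ TU S U, l 0*⟪y, e 0⟫^2 + l 1*⟪y, e 1⟫^2 + l 2*⟪y, e 2⟫^2 + l 3*⟪y, e 3⟫^2 = 0)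
include hz
lemma KPV : (l p = 1/2 ∧ ∀ i, i ≠ p → l i = -1/2) := by
  have p2 : ∀ j, ln (e j)^2 ∈ PGs := fun j => PGs_pow (PGs_ln _) 2
  have c0 := c3_pos
  have M := MOMi h hU hΛ tr hp hr
  have s2 : l 0^2 + l 1^2 + l 2^2 + l 3^2 = 1 := by
    have := Lam_zero h hU hΛ (f := l 0•ln (e 0)^2 + l 1•ln (e 1)^2 + l 2•ln (e 2)^2 + l 3•ln (e 3)^2)
      (add_mem (add_mem (add_mem (PGs.smul_mem _ (p2 0)) (PGs.smul_mem _ (p2 1))) (PGs.smul_mem _ (p2 2))) (PGs.smul_mem _ (p2 3))) hz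
    simp only [map_add, map_smul, smul_eq_mul, M] at this
    refine mul_left_cancel₀ c0.ne' ?_
    linear_combination 2*this - c3*tr
  set g : Fin 4 → Fin 4 → ℝ := fun i j => Λ (ln (e i)^2*ln (e j)^2)/c3 with hg
  have gm : ∀ i j, Λ (ln (e i)^2*ln (e j)^2) = c3*g i j := fun i j => by rw [hg]; field_simp
  have gs : ∀ i j, g i j = g j i := fun i j => by rw [hg]; simp only; rw [mul_comm]
  have R1 : ∀ i, g i 0 + g i 1 + g i 2 + g i 3 = 5/4*(1+l i) := fun i => by
    have := SCL h hU hΛ tr hp hr i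
    simp only [gm] at this
    refine mul_left_cancel₀ c0.ne' ?_
    linear_combination this
  have R2 : ∀ i, l 0*g i 0 + l 1*g i 1 + l 2*g i 2 + l 3*g i 3 = 0 := fun i => by
    have := Lam_zero h hU hΛ (f := l 0•(ln (e i)^2*ln (e 0)^2) + l 1•(ln (e i)^2*ln (e 1)^2) + l 2•(ln (e i)^2*ln (e 2)^2) + l 3•(ln (e i)^2*ln (e 3)^2))
      (add_mem (add_mem (add_mem (PGs.smul_mem _ (PGs_mul (p2 _) (p2 0))) (PGs.smul_mem _ (PGs_mul (p2 _) (p2 1)))) (PGs.smul_mem _ (PGs_mul (p2 _) (p2 2)))) (PGs.smul_mem _ (PGs_mul (p2 _) (p2 3)))) (fun y hy => by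
        simp only [Pi.add_apply, Pi.smul_apply, Pi.mul_apply, Pi.pow_apply, smul_eq_mul, ln]
        linear_combination ⟪y, e i⟫^2*hz y hy)
    simp only [map_add, map_smul, smul_eq_mul, gm] at this
    refine mul_left_cancel₀ c0.ne' ?_
    linear_combination this
  have R4 : ∀ u : Fin 4 → ℝ, l 0*u 0 + l 1*u 1 + l 2*u 2 + l 3*u 3 = 0 → Qf g u = 3/4*(u 0+u 1+u 2+u 3)^2 := fun u hu => by
    have := (MOM h hU hΛ tr hp hr u hu).2
    simp only [Qf, gm] at this
    refine mul_left_cancel₀ c0.ne' ?_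
    unfold Qf; linear_combination this
  clear_value g
  clear gm M p2
  set N : Fin 4 → Fin 4 → ℝ := fun i j => if i = j then g i j - 3/4 else 3*g i j - 3/4 with hN
  have Ns : ∀ i j, N i j = N j i := fun i j => by simp only [hN, gs i j, eq_comm]
  have R5 : ∀ u : Fin 4 → ℝ, l 0*u 0 + l 1*u 1 + l 2*u 2 + l 3*u 3 = 0 → ∑ i, ∑ j, N i j*u i*u j = 0 := fun u hu => by
    have := R4 u hu
    simp [Fin.sum_univ_four, hN, Qf] at this ⊢
    linear_combination this + 3*u 0*u 1*gs 1 0 + 3*u 0*u 2*gs 2 0 + 3*u 0*u 3*gs 3 0 + 3*u 1*u 2*gs 2 1 + 3*u 1*u 3*gs 3 1 + 3*u 2*u 3*gs 3 2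
  set G : Fin 4 → ℝ := fun j => (2*N p j - l j*N p p/l p)/l p with hG
  have Nf : ∀ i j, N i j = (l i*G j + l j*G i)/2 := fun i j => by
    have B : ∀ s t : ℝ, ∑ i', ∑ j', N i' j'*(s*((if i' = i then 1 else 0) - (if i' = p then l i/l p else 0)) + t*((if i' = j then 1 else 0) - (if i' = p then l j/l p else 0)))*
      (s*((if j' = i then 1 else 0) - (if j' = p then l i/l p else 0)) + t*((if j' = j then 1 else 0) - (if j' = p then l j/l p else 0))) = 0 := fun s t => by
      refine R5 (fun i' => s*((if i' = i then 1 else 0) - (if i' = p then l i/l p else 0)) + t*((if i' = j then 1 else 0) - (if i' = p then l j/l p else 0))) ?_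
      have e1 : ∀ u : Fin 4 → ℝ, l 0*u 0 + l 1*u 1 + l 2*u 2 + l 3*u 3 = ∑ i, l i*u i := fun u => by rw [Fin.sum_univ_four]
      rw [e1 fun i' => s*((if i' = i then 1 else 0) - (if i' = p then l i/l p else 0)) + t*((if i' = j then 1 else 0) - (if i' = p then l j/l p else 0))]
      simp [mul_sub, mul_add, Finset.sum_sub_distrib, Finset.sum_add_distrib]
      field_simp; ring
    have b1 := B 1 1; have b2 := B 1 0; have b3 := B 0 1
    simp [mul_sub, mul_add, sub_mul, add_mul, Finset.sum_sub_distrib, Finset.sum_add_distrib, -Finset.sum_const] at b1 b2 b3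
    have s1 := Ns j i; have s2 := Ns i p; have s3 := Ns j p
    simp only [hG]
    simp only [s1, s2, s3] at b1 b2 b3
    have k := hp.ne'
    field_simp at b1 b2 b3 ⊢
    linear_combination b1 - b2 - b3
  have gii : ∀ i, g i i = 3/4 + l i*G i := fun i => by have := Nf i i; simp only [hN, if_true] at this; linarith only [this]
  have gij : ∀ i j, i ≠ j → g i j = 1/4 + (l i*G j + l j*G i)/6 := fun i j hij => by have := Nf i j; simp only [hN, if_neg hij] at this; linarith
  refine ALGX (G := G) hp (by rw [Fin.sum_univ_four]; exact tr) (by rw [Fin.sum_univ_four]; exact s2) (fun i => ?_) (fun i => ?_)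
  · have r := R2 i
    rw [Fin.sum_univ_four]
    clear_value G
    fin_cases i <;> simp only [Fin.zero_eta, Fin.mk_one, Fin.reduceFinMk] at r ⊢ <;> simp only [gii, gij _ _ (show (0:Fin 4) ≠ 1 by decide), gij _ _ (show (0:Fin 4) ≠ 2 by decide), gij _ _ (show (0:Fin 4) ≠ 3 by decide), gij _ _ (show (1:Fin 4) ≠ 0 by decide), gij _ _ (show (1:Fin 4) ≠ 2 by decide), gij _ _ (show (1:Fin 4) ≠ 3 by decide), gij _ _ (show (2:Fin 4) ≠ 0 by decide), gij _ _ (show (2:Fin 4) ≠ 1 by decide), gij _ _ (show (2:Fin 4) ≠ 3 by decide), gij _ _ (show (3:Fin 4) ≠ 0 by decide), gij _ _ (show (3:Fin 4) ≠ 1 by decide), gij _ _ (show (3:Fin 4) ≠ 2 by decide)] at r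
    · linear_combination 3*r - 3/4*tr - G 0/2*s2
    · linear_combination 3*r - 3/4*tr - G 1/2*s2
    · linear_combination 3*r - 3/4*tr - G 2/2*s2
    · linear_combination 3*r - 3/4*tr - G 3/2*s2
  · have r := R1 i
    rw [Fin.sum_univ_four]
    clear_value G
    fin_cases i <;> simp only [Fin.zero_eta, Fin.mk_one, Fin.reduceFinMk] at r ⊢ <;> simp only [gii, gij _ _ (show (0:Fin 4) ≠ 1 by decide), gij _ _ (show (0:Fin 4) ≠ 2 by decide), gij _ _ (show (0:Fin 4) ≠ 3 by decide), gij _ _ (show (1:Fin 4) ≠ 0 by decide), gij _ _ (show (1:Fin 4) ≠ 2 by decide), gij _ _ (show (1:Fin 4) ≠ 3 by decide), gij _ _ (show (2:Fin 4) ≠ 0 by decide), gij _ _ (show (2:Fin 4) ≠ 1 by decide), gij _ _ (show (2:Fin 4) ≠ 3 by decide), gij _ _ (show (3:Fin 4) ≠ 0 by decide), gij _ _ (show (3:Fin 4) ≠ 1 by decide), gij _ _ (show (3:Fin 4) ≠ 2 by decide)] at r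
    · linear_combination 3*r - G 0/2*tr
    · linear_combination 3*r - G 1/2*tr
    · linear_combination 3*r - G 2/2*tr
    · linear_combination 3*r - G 3/2*tr
end
section
variable {m : Measure V} {S : Set V} {C a R s0 : ℝ} (h : HA m S C a R) (hs0 : 0 < s0) (hnf : ∀ s, 0 < s → s ≤ s0 → ¬ SL S 0 s et) {U : Ultrafilter ℝ} (hU : (U : Filter ℝ) ≤ 𝓝[>] 0)
include h hs0 hnf hU
lemma CONE : ∃ n : V, ‖n‖ = 1 ∧ (∀ z, Tendsto (fun r => ⟪FG (rs 0 (sc a r) m) z, z⟫) U (𝓝 (⟪n, z⟫^2 - 1/2*‖z‖^2))) ∧ ∀ z : V, ⟪n, z⟫^2 - 1/2*‖z‖^2 = 0 → z ∈ TU S U := by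
  obtain ⟨F, ε, hF, T⟩ := TDU h hs0 hnf hU
  obtain ⟨Λ, hΛ⟩ := LAM h hU
  obtain ⟨e, l, he, -⟩ := diag F T.sym
  obtain ⟨y0, hy0, hF0⟩ := TD.exreg T he
  obtain ⟨p, -, hp, -⟩ := Z_signs T he (T.zero _ hy0) hF0
  have tr : l 0 + l 1 + l 2 + l 3 = -1 := by
    have := T.tr e
    simpa [Fin.sum_univ_four, he, real_inner_smul_left, ob_inner] using this
  have rg : ∀ z, ⟪z, e p⟫ ≠ 0 → F z ≠ 0 := fun z hz => (reg_iff T he z).2 ⟨p, mul_ne_zero hp.ne' hz⟩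
  have hr : ∀ z, l 0*⟪z, e 0⟫^2 + l 1*⟪z, e 1⟫^2 + l 2*⟪z, e 2⟫^2 + l 3*⟪z, e 3⟫^2 = 0 → ⟪z, e p⟫ ≠ 0 → (∀ t : ℝ, 0 < t → t • z ∈ TU S U) ∨ (∀ t : ℝ, 0 < t → t • (-z) ∈ TU S U) := fun z hz hzp => by
    rw [← quad_exp T.sym he] at hz
    refine (PMR T he hz (rg z hzp)).imp (fun q t ht => T.ray he q (rg z hzp) ht) (fun q t ht => T.ray he q (rg _ ?_) ht)
    rw [inner_neg_left]; exact neg_ne_zero.2 hzp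
  obtain ⟨lp, lq⟩ := KPV h hU hΛ tr hp hr fun y hy => by rw [← quad_exp T.sym he]; exact T.zero y hy
  have Q : ∀ z, ⟪F z, z⟫ = ⟪e p, z⟫^2 - 1/2*‖z‖^2 := fun z => by
    rw [quad_exp T.sym he, norm_exp e z, real_inner_comm z (e p)]
    have : ∀ i, l i*⟪z, e i⟫^2 = (if i = p then ⟪z, e p⟫^2 else 0) - 1/2*⟪z, e i⟫^2 := fun i => by
      by_cases hi : i = p
      · rw [hi, lp, if_pos rfl]; ring
      · rw [lq i hi, if_neg hi]; ring
    simp only [this]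
    have : ∑ i, (if i = p then ⟪z, e p⟫^2 else 0) = ⟪z, e p⟫^2 := by simp
    rw [Fin.sum_univ_four] at this
    linarith only [this]
  refine ⟨e p, e.orthonormal.1 p, fun z => ?_, fun z hz => ?_⟩
  · rw [← Q]; exact (((ContinuousLinearMap.apply ℝ V z).continuous.tendsto F).comp hF).inner tendsto_const_nhds
  have c0 := c3_pos
  -- both nappes
  have qn : ∀ p : Fin 4, p + 1 ≠ p ∧ p + 2 ≠ p ∧ p + 2 ≠ p + 1 := by decide
  obtain ⟨q1, q2, q12⟩ := qn p
  have nap : ∀ σ : ℝ, σ^2 = 1 → ∃ y ∈ TU S U, 0 < σ*⟪y, e p⟫ := fun σ hσ => by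
    by_contra! hc
    have ray : ∀ τ : ℝ, τ^2 = 1 → Λ (ln (e p + τ • e (p+1))) = 0 := fun τ hτ => by
      set w := e p + τ • e (p+1) with hw
      have wp : ⟪w, e p⟫ = 1 := by rw [hw, inner_add_left, real_inner_smul_left, ob_inner, ob_inner]; simp
      have ww : ⟪F w, w⟫ = 0 := by
        have : ‖w‖^2 = 2 := by
          rw [hw, norm_add_sq_real, norm_smul, real_inner_smul_right, ob_inner, e.orthonormal.1, e.orthonormal.1, if_neg q1.symm, mul_one, Real.norm_eq_abs, sq_abs, hτ]; norm_num
        rw [Q, real_inner_comm, wp, this]; norm_num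
      rcases hr w (by rw [← quad_exp T.sym he, ww]) (by rw [wp]; norm_num) with q | q
      · exact (RAY h hU hΛ fun t ht _ => q t ht).1
      · have := (RAY h hU hΛ fun t ht _ => q t ht).1
        have e1 : ln (-w) = -ln w := by ext x; simp [ln]
        rwa [e1, map_neg, neg_eq_zero] at this
    have L0 : Λ (ln (e p)) = 0 := by
      have e1 : (2:ℝ) • ln (e p) = ln (e p + (1:ℝ) • e (p+1)) + ln (e p + (-1:ℝ) • e (p+1)) := by
        ext x; simp only [ln, Pi.smul_apply, Pi.add_apply, smul_eq_mul, inner_add_right, real_inner_smul_right]; ring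
      have := congrArg Λ e1
      rw [map_smul, map_add, ray 1 (by norm_num), ray (-1) (by norm_num), smul_eq_mul] at this
      linarith
    have L2 := MOMi h hU hΛ tr hp hr p
    rw [lp] at L2
    set x := ln (e p) with hx
    have x1 : x ∈ PGs := PGs_ln _
    have key : ∀ M : ℝ, 0 < M → 3/4*c3*M^2 ≤ Λ (x^4) := fun M hM => by
      have := Lam_nn h hU hΛ (f := (-σ*M^3)•x + x^4 - M^2•x^2) (sub_mem (add_mem (PGs.smul_mem _ x1) (PGs_pow x1 4)) (PGs.smul_mem _ (PGs_pow x1 2))) fun y hy => by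
        simp only [Pi.add_apply, Pi.sub_apply, Pi.smul_apply, Pi.pow_apply, smul_eq_mul]
        have hy0 : 0 ≤ -σ*x y := by have := hc y hy; simp only [hx, ln]; linarith
        have e2 : x y^2 = (-σ*x y)^2 := by linear_combination -x y^2*hσ
        have e4 : x y^4 = (-σ*x y)^4 := by linear_combination (-x y^4*(σ^2+1))*hσ
        rw [e2, e4]
        set v := -σ*x y with hv
        have : 0 ≤ v*(M^3 + v^3 - M^2*v) := mul_nonneg hy0 (by
          rcases le_or_gt v M with q | q
          · have := mul_le_mul_of_nonneg_left q (sq_nonneg M); have := pow_nonneg hy0 3; linarith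
          · have := mul_le_mul_of_nonneg_right (pow_le_pow_left₀ hM.le q.le 2) hy0; have := pow_nonneg hM.le 3; linarith)
        linear_combination this - M^3*hv
      simp only [map_sub, map_add, map_smul, smul_eq_mul, L0, L2] at this
      linarith only [this]
    have k0 := key 1 one_pos
    have := key (1 + Λ (x^4)/c3) (by have : 0 ≤ Λ (x^4)/c3 := div_nonneg (by linarith only [c0, k0]) c0.le
                                     linarith only [this])
    set D := Λ (x^4)/c3 with hD
    have hD' : Λ (x^4) = c3*D := by rw [hD]; field_simp
    rw [hD'] at this k0
    have a1 : 3/4*(1+D)^2 ≤ D := le_of_mul_le_mul_left (by linarith only [this]) c0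
    nlinarith only [a1]
  rcases eq_or_ne z 0 with rfl | z0
  · have := T.ray he hy0 hF0 (t := 1) one_pos
    refine T.cl.mem_of_tendsto (b := 𝓝[>] (0:ℝ)) (f := fun t : ℝ => t • y0) ?_ (eventually_mem_nhdsWithin.mono fun t ht => T.ray he hy0 hF0 ht)
    have : Continuous fun t : ℝ => t • y0 := by fun_prop
    simpa using (this.tendsto 0).mono_left (nhdsWithin_le_nhds (s := Ioi 0))
  have zp : ⟪z, e p⟫ ≠ 0 := fun q => by
    rw [real_inner_comm, q] at hz
    have := norm_pos_iff.2 z0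
    have := pow_pos this 2
    linarith
  obtain ⟨σ, hσ, sz⟩ := sgn_ex zp
  obtain ⟨y, hy, sy⟩ := nap σ hσ
  have sg : ∀ x : ℝ, ∃ τ : ℝ, τ^2 = 1 ∧ 0 ≤ τ*x := fun x => by
    rcases le_total 0 x with q | q
    · exact ⟨1, by norm_num, by linarith⟩
    · exact ⟨-1, by norm_num, by linarith⟩
  obtain ⟨τ, hτ, ty⟩ := sg ⟪y, e (p+1)⟫
  obtain ⟨τ', hτ', tz⟩ := sg ⟪z, e (p+1)⟫
  have ng : ∀ i, i ≠ p → l i * l p < 0 := fun i hi => by rw [lq i hi, lp]; norm_num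
  have E1 := Ed_of T he (ng _ q1) hτ hσ hy (rg y fun q => by rw [q, mul_zero] at sy; exact lt_irrefl _ sy) ty sy.le
  have E2 := Ed_any T he E1 (ng _ q1) (ng _ q1) (ng _ q2) q12 hτ' hσ
  exact E2 z (by rw [Q, hz]) (rg z zp) tz sz.le
end
lemma ev_ex {P : ℝ → Prop} (h : ∀ᶠ r in 𝓝[>] (0:ℝ), P r) : ∃ ρ, 0 < ρ ∧ ρ ≤ 1 ∧ ∀ r, 0 < r → r ≤ ρ → P r := by
  obtain ⟨u, hu, hs⟩ := mem_nhdsGT_iff_exists_Ioc_subset.1 h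
  exact ⟨min u 1, lt_min hu one_pos, min_le_right _ _, fun r h0 h1 => hs ⟨h0, h1.trans (min_le_left _ _)⟩⟩
lemma Zsc {n z : V} (hz : ⟪n, z⟫^2 - 1/2*‖z‖^2 = 0) (t : ℝ) : ⟪n, t • z⟫^2 - 1/2*‖t • z‖^2 = 0 := by
  rw [real_inner_smul_right, norm_smul, Real.norm_eq_abs, mul_pow, mul_pow, sq_abs]; linear_combination t^2*hz
lemma q_add {G : V →L[ℝ] V} (sy : ∀ z w, ⟪G z, w⟫ = ⟪z, G w⟫) (s t : ℝ) (z w : V) : ⟪G (s•z+t•w), s•z+t•w⟫ = s^2*⟪G z, z⟫ + 2*(s*t)*⟪G z, w⟫ + t^2*⟪G w, w⟫ := by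
  have : ⟪G w, z⟫ = ⟪G z, w⟫ := by rw [sy, real_inner_comm]
  simp only [map_add, map_smul, inner_add_left, inner_add_right, real_inner_smul_left, real_inner_smul_right, this]; ring
lemma FIN {n : V} (hn : ‖n‖ = 1) {G : V →L[ℝ] V} (sy : ∀ z w, ⟪G z, w⟫ = ⟪z, G w⟫) {τ : ℝ} (h0 : 0 ≤ τ) (hz : ∀ z, ⟪n, z⟫^2 - 1/2*‖z‖^2 = 0 → ‖z‖ < 1 → |⟪G z, z⟫| ≤ τ)
    (ht : ∀ e : OB, |∑ i, ⟪G (e i), e i⟫| ≤ τ) : ‖G‖ ≤ 100*τ := by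
  have A : ∀ v : V, ‖v‖ ≤ 1 → ⟪n, v⟫ = 0 → |‖v‖^2*⟪G n, n⟫ + ⟪G v, v⟫| ≤ 4*τ ∧ |2*‖v‖*⟪G n, v⟫| ≤ 4*τ := fun v hv h => by
    have B : ∀ σ : ℝ, σ^2 = 1/4 → |‖v‖^2*⟪G n, n⟫*(1/4) + 2*σ*(1/2)*(‖v‖*⟪G n, v⟫) + 1/4*⟪G v, v⟫| ≤ τ := fun σ hσ => by
      have e := q_add sy (1/2*‖v‖) σ n v
      have nn : ‖(1/2*‖v‖)•n+σ•v‖^2 = 1/2*‖v‖^2 := by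
        rw [norm_add_sq_real, real_inner_smul_left, real_inner_smul_right, h, norm_smul, norm_smul, hn, Real.norm_eq_abs, Real.norm_eq_abs, mul_pow, mul_pow, sq_abs, sq_abs, hσ]; ring
      have := hz ((1/2*‖v‖)•n+σ•v) (by rw [nn, inner_add_right, real_inner_smul_right, real_inner_smul_right, h, real_inner_self_eq_norm_sq, hn]; ring)
        (by have := pow_le_one₀ (n := 2) (norm_nonneg v) hv
            exact lt_of_pow_lt_pow_left₀ 2 zero_le_one (by rw [nn]; linarith only [this]))
      rw [e] at this
      convert this using 2; linear_combination -⟪G v, v⟫*hσ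
    have b1 := abs_le.1 (B (1/2) (by norm_num)); have b2 := abs_le.1 (B (-1/2) (by norm_num))
    constructor <;> rw [abs_le] <;> constructor <;> linarith [b1.1, b1.2, b2.1, b2.2]
  obtain ⟨e, he⟩ := ob_ext n hn
  have N0 : |⟪G n, n⟫| ≤ 7*τ := by
    have t := ht e
    rw [Fin.sum_univ_four, he] at t
    have a : ∀ i, i ≠ 0 → |⟪G n, n⟫ + ⟪G (e i), e i⟫| ≤ 4*τ := fun i hi => by
      have := (A (e i) (e.orthonormal.1 i).le (by rw [← he, ob_inner, if_neg hi.symm])).1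
      rwa [e.orthonormal.1 i, one_pow, one_mul] at this
    have a1 := abs_le.1 (a 1 (by decide)); have a2 := abs_le.1 (a 2 (by decide)); have a3 := abs_le.1 (a 3 (by decide))
    have t := abs_le.1 t
    rw [abs_le]; constructor <;> linarith [a1.1, a1.2, a2.1, a2.2, a3.1, a3.2, t.1, t.2]
  obtain ⟨g, l, hg, -⟩ := diag G sy
  have L : ∀ i, |l i| ≤ 25*τ := fun i => by
    have e1 : ⟪G (g i), g i⟫ = l i := by rw [hg, real_inner_smul_left, ob_inner, if_pos rfl, mul_one]
    obtain ⟨p1, p2⟩ := proj_le hn (z := g i)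
    set s := ⟪n, g i⟫ with hs
    set v := g i - s • n with hv
    have e2 : g i = s • n + (1:ℝ) • v := by rw [hv, one_smul]; abel
    have s1 : |s| ≤ 1 := (abs_inner_le_of_norm hn).trans (g.orthonormal.1 i).le
    have v1 : ‖v‖ ≤ 1 := p1.trans (g.orthonormal.1 i).le
    obtain ⟨a1, a2⟩ := A v v1 p2
    have v0 := norm_nonneg v
    have b : |s*⟪G n, v⟫| ≤ 2*τ := by
      rcases eq_or_lt_of_le v0 with q | q
      · rw [norm_eq_zero.1 q.symm, inner_zero_right, mul_zero, abs_zero]; linarith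
      · have n1 : ‖(‖v‖⁻¹) • v‖ = 1 := norm_smul_inv_norm (𝕜 := ℝ) (norm_pos_iff.1 q)
        have := (A (‖v‖⁻¹ • v) n1.le (by rw [real_inner_smul_right, p2, mul_zero])).2
        have e3 : ⟪G n, v⟫ = ‖v‖*⟪G n, ‖v‖⁻¹ • v⟫ := by rw [real_inner_smul_right, mul_inv_cancel_left₀ q.ne']
        rw [n1, mul_one, abs_mul, abs_two] at this
        rw [e3, abs_mul, abs_mul, abs_of_pos q]
        have k := mul_le_mul v1 (show _ ≤ 2*τ by linarith) (abs_nonneg ⟪G n, ‖v‖⁻¹ • v⟫) zero_le_one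
        have := mul_le_mul s1 k (by positivity) zero_le_one
        linarith
    have v2 : ‖v‖^2 ≤ 1 := pow_le_one₀ v0 v1
    have s2 : s^2 ≤ 1 := by rw [← sq_abs]; exact pow_le_one₀ (abs_nonneg _) s1
    have c1 : |s^2*⟪G n, n⟫| ≤ 7*τ := by rw [abs_mul, abs_of_nonneg (sq_nonneg s)]; exact (mul_le_mul s2 N0 (abs_nonneg _) zero_le_one).trans_eq (one_mul _)
    have c2 : |‖v‖^2*⟪G n, n⟫| ≤ 7*τ := by rw [abs_mul, abs_of_nonneg (sq_nonneg ‖v‖)]; exact (mul_le_mul v2 N0 (abs_nonneg _) zero_le_one).trans_eq (one_mul _)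
    rw [← e1, e2, q_add sy]
    have a1 := abs_le.1 a1; have b := abs_le.1 b; have c1 := abs_le.1 c1; have c2 := abs_le.1 c2
    rw [abs_le]; constructor <;> linarith [a1.1, a1.2, b.1, b.2, c1.1, c1.2, c2.1, c2.2]
  refine ContinuousLinearMap.opNorm_le_bound _ (by positivity) fun z => ?_
  have e1 : G z = ∑ i, (⟪z, g i⟫ * l i) • g i := by
    conv_lhs => rw [← g.sum_repr' z, map_sum]
    exact Finset.sum_congr rfl fun i _ => by rw [map_smul, hg, smul_smul, real_inner_comm]
  rw [e1]
  refine (norm_sum_le_of_le _ fun i _ => (?_ : _ ≤ ‖z‖*(25*τ))).trans_eq ?_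
  · rw [norm_smul, g.orthonormal.1, mul_one, Real.norm_eq_abs, abs_mul]
    exact mul_le_mul (coord_le g z i) (L i) (abs_nonneg _) (norm_nonneg _)
  · simp; ring
section
variable {m : Measure V} {S : Set V} {C a R s0 : ℝ} (h : HA m S C a R) (hs0 : 0 < s0) (hnf : ∀ s, 0 < s → s ≤ s0 → ¬ SL S 0 s et)
include h hs0 hnf
lemma NORM : ∀ᶠ r in 𝓝[>] (0:ℝ), ∀ (G : V →L[ℝ] V) (τ : ℝ), (∀ z w, ⟪G z, w⟫ = ⟪z, G w⟫) → (∀ z ∈ rS 0 r S, ‖z‖ ≤ 1 → |⟪G z, z⟫| ≤ τ) → (∀ e : OB, |∑ i, ⟪G (e i), e i⟫| ≤ τ) → ‖G‖ ≤ 1000*τ := by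
  refine mem_iff_ultrafilter.2 fun U hU => ?_
  by_contra hc
  obtain ⟨n, hn, -, hZ⟩ := CONE h hs0 hnf hU
  have hc' := Ultrafilter.compl_mem_iff_notMem.2 hc
  have : ∀ r, ∃ G : V →L[ℝ] V, r ∈ {r | ∀ (G : V →L[ℝ] V) (τ : ℝ), (∀ z w, ⟪G z, w⟫ = ⟪z, G w⟫) → (∀ z ∈ rS 0 r S, ‖z‖ ≤ 1 → |⟪G z, z⟫| ≤ τ) → (∀ e : OB, |∑ i, ⟪G (e i), e i⟫| ≤ τ) → ‖G‖ ≤ 1000*τ}ᶜ →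
      ‖G‖ = 1 ∧ (∀ z w, ⟪G z, w⟫ = ⟪z, G w⟫) ∧ (∀ z ∈ rS 0 r S, ‖z‖ ≤ 1 → |⟪G z, z⟫| ≤ 1/1000) ∧ (∀ e : OB, |∑ i, ⟪G (e i), e i⟫| ≤ 1/1000) := fun r => by
    by_cases hr : ∀ (G : V →L[ℝ] V) (τ : ℝ), (∀ z w, ⟪G z, w⟫ = ⟪z, G w⟫) → (∀ z ∈ rS 0 r S, ‖z‖ ≤ 1 → |⟪G z, z⟫| ≤ τ) → (∀ e : OB, |∑ i, ⟪G (e i), e i⟫| ≤ τ) → ‖G‖ ≤ 1000*τ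
    · exact ⟨0, fun q => absurd hr q⟩
    push Not at hr
    obtain ⟨G, τ, sy, h1, h2, h3⟩ := hr
    obtain ⟨e, -⟩ := ob_ext n hn
    have t0 : 0 ≤ τ := (abs_nonneg _).trans (h2 e)
    have g0 : 0 < ‖G‖ := lt_of_le_of_lt (by positivity) h3
    have g1 : ‖G‖⁻¹*τ ≤ 1/1000 := by rw [inv_mul_le_iff₀ g0]; linarith
    refine ⟨‖G‖⁻¹ • G, fun _ => ⟨norm_smul_inv_norm (𝕜 := ℝ) (norm_pos_iff.1 g0), fun z w => ?_, fun z hz z1 => ?_, fun e => ?_⟩⟩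
    · simp only [smul_apply, real_inner_smul_left, real_inner_smul_right, sy]
    · rw [smul_apply, real_inner_smul_left, abs_mul, abs_of_pos (inv_pos.2 g0)]
      exact (mul_le_mul_of_nonneg_left (h1 z hz z1) (inv_pos.2 g0).le).trans g1
    · simp only [smul_apply, real_inner_smul_left]
      rw [← Finset.mul_sum, abs_mul, abs_of_pos (inv_pos.2 g0)]
      exact (mul_le_mul_of_nonneg_left (h2 e) (inv_pos.2 g0).le).trans g1
  choose G hG using this
  have ev := hc'
  obtain ⟨F, hF⟩ := ulim (U := U) (f := G) (K := 1) (mem_of_superset ev fun r hr => (hG r hr).1.le)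
  have f1 : ‖F‖ = 1 := tendsto_nhds_unique hF.norm (tendsto_const_nhds.congr' (mem_of_superset ev fun r hr => (hG r hr).1.symm))
  have ap : ∀ z w, Tendsto (fun r => ⟪G r z, w⟫) U (𝓝 ⟪F z, w⟫) := fun z w => (clm_t hF tendsto_const_nhds).inner tendsto_const_nhds
  have := FIN hn (G := F) (τ := 1/1000) (fun z w => ?_) (by norm_num) (fun z hz z1 => ?_) (fun e => ?_)
  · rw [f1] at this; norm_num at this
  · have t2 : Tendsto (fun r => ⟪z, G r w⟫) U (𝓝 ⟪z, F w⟫) := tendsto_const_nhds.inner (clm_t hF tendsto_const_nhds)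
    exact tendsto_nhds_unique (ap z w) (t2.congr' (mem_of_superset ev fun r hr => ((hG r hr).2.1 z w).symm))
  · obtain ⟨y, hy, hyz⟩ := TU_choose h (hZ z hz)
    refine le_of_tendsto ((clm_t hF hyz).inner hyz).abs ?_
    filter_upwards [ev, hyz.norm.eventually_le_const z1] with r hr h1 using (hG r hr).2.2.1 _ (hy r) h1
  · exact le_of_tendsto (tendsto_finsetSum _ fun i _ => ap _ _).abs (mem_of_superset ev fun r hr => (hG r hr).2.2.2 e)
lemma GS : ∃ K, 1 ≤ K ∧ ∀ᶠ r in 𝓝[>] (0:ℝ), (∀ z w, ⟪FG (rs 0 (sc a r) m) z, w⟫ = ⟪z, FG (rs 0 (sc a r) m) w⟫) ∧ (∀ z ∈ S, ‖z‖ ≤ 4*r → |⟪FG (rs 0 (sc a r) m) z, z⟫| ≤ K*r^(a/20)*r^2) ∧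
    ∀ e : OB, |∑ i, ⟪FG (rs 0 (sc a r) m) (e i), e i⟫ + 1| ≤ K*r^(a/20) := by
  obtain ⟨K, K1, hK⟩ := ZF
  have ha := h.ha; have hR := h.hR
  have t3 := rpow_t0 (b := a/20) (by positivity)
  have t4 : Tendsto (fun r : ℝ => C*r^(6*a/10)) (𝓝[>] 0) (𝓝 (C*0)) := (rpow_t0 (by positivity)).const_mul _
  have t5 := (sc_t0 h.ha1).mono_right nhdsWithin_le_nhds
  have c0 := c3_pos
  refine ⟨K + 30/c3, by have : 0 < 30/c3 := by positivity
                        linarith, ?_⟩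
  filter_upwards [Ioo_mem_nhdsGT one_pos, t3.eventually_le_const (show (0:ℝ) < 1/2 by norm_num), t4.eventually_le_const (show C*0 < 1 by norm_num),
      t5.eventually_le_const (show (0:ℝ) < R/8 by positivity), t5.eventually_le_const hs0] with r hr h3 h4 h5 h6
  obtain ⟨q0, q1⟩ := sc_spec (a := a) hr.1
  have l0 : 0 < r^(a/20) := Real.rpow_pos_of_pos hr.1 _
  have c6 : C*(sc a r)^a ≤ (r^(a/20))^6 := by
    have e1 : (r^(a/20))^6 = r^(3*a/10) := by rw [← Real.rpow_natCast, ← Real.rpow_mul hr.1.le]; congr 1; push_cast; ring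
    have e2 : (sc a r)^a ≤ r^(6*a/10) * r^(3*a/10) := by
      rw [sc, ← Real.rpow_mul hr.1.le, ← Real.rpow_add hr.1]
      refine Real.rpow_le_rpow_of_exponent_ge hr.1 hr.2.le ?_
      have := mul_le_mul_of_nonneg_left h.ha1 ha.le; linarith only [this]
    have := mul_le_mul_of_nonneg_left e2 (show 0 ≤ C by linarith only [h.hC])
    have := mul_le_mul_of_nonneg_right h4 (Real.rpow_pos_of_pos hr.1 (3*a/10)).le
    rw [e1]; linarith
  have au := h.au q0 (by linarith [h.hR1]) (y := 0) (L := 1) (by rw [norm_zero]; linarith)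
  set l := r^(a/20) with hl
  clear_value l
  refine ⟨FG_sym au, fun z hz z4 => ?_, fun e => ?_⟩
  · have := hK m S C a R s0 h hnf (sc a r) l q0 (by linarith) h6 l0 h3 c6 z hz (by linarith)
    have e1 : K*l^5*(sc a r)^2 = K*l*r^2 := by
      have q2 : (l^2*sc a r)^2 = r^2 := by rw [q1]
      linear_combination K*l*q2
    rw [e1] at this
    have : 0 ≤ 30/c3*(l*r^2) := by positivity
    linarith
  · have := FG_tr au (zero_rS _ h.zero) zero_le_one e
    have l6 : l^6 ≤ l := (pow_le_pow_of_le_one l0.le (by linarith) (show 1 ≤ 6 by norm_num)).trans_eq (pow_one l)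
    have := mul_le_mul_of_nonneg_left (c6.trans l6) (show 0 ≤ 30/c3 by positivity)
    have := mul_pos (show 0 < K by linarith) l0
    linarith
lemma P12 : ∃ n K ρ, ‖n‖ = 1 ∧ 1 ≤ K ∧ 0 < ρ ∧ ρ ≤ 1 ∧ (∀ z ∈ S, ‖z‖ ≤ ρ → |⟪n, z⟫^2 - 1/2*‖z‖^2| ≤ K*‖z‖^(a/20)*‖z‖^2) ∧
    ∀ η, 0 < η → ∀ᶠ r in 𝓝[>] (0:ℝ), ∀ z, ⟪n, z⟫^2 - 1/2*‖z‖^2 = 0 → ‖z‖ ≤ 2 → ∃ w ∈ rS 0 r S, ‖w - z‖ < η := by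
  obtain ⟨K, K1, hK⟩ := GS h hs0 hnf
  obtain ⟨ρ, ρ0, ρ1, hρ⟩ := ev_ex (hK.and (NORM h hs0 hnf))
  have ha := h.ha
  set c := a/20 with hc
  have c0 : 0 < c := by positivity
  set G : ℝ → V →L[ℝ] V := fun r => FG (rs 0 (sc a r) m) with hG
  have st : ∀ r r', 0 < r' → r' ≤ r → r ≤ 2*r' → r ≤ ρ → ‖G r - G r'‖ ≤ 5000*K*r^c := fun r r' h0 h1 h2 h3 => by
    obtain ⟨⟨a1, a2, a3⟩, -⟩ := hρ r (by linarith only [h0, h1]) h3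
    obtain ⟨⟨b1, b2, b3⟩, b4⟩ := hρ r' h0 (by linarith)
    have r0 : 0 < r := by linarith
    have rc : K*r'^c ≤ K*r^c := mul_le_mul_of_nonneg_left (Real.rpow_le_rpow h0.le h1 c0.le) (by linarith)
    have rp : 0 < K*r^c := mul_pos (by linarith) (Real.rpow_pos_of_pos r0 _)
    have := b4 (G r - G r') (5*(K*r^c)) (fun z w => ?_) (fun z hz z1 => ?_) (fun e => ?_)
    · linarith
    · simp only [sub_apply, inner_sub_left, inner_sub_right, a1, b1, hG]
    · rw [mem_rS] at hz
      have nz : ‖r' • z‖ ≤ r'*1 := nsm h0.le z1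
      rw [zero_add] at hz
      have x1 := a2 _ hz (by linarith); have x2 := b2 _ hz (by linarith)
      simp only [map_smul, real_inner_smul_left, real_inner_smul_right] at x1 x2
      rw [← mul_assoc, abs_mul, abs_of_pos (mul_pos h0 h0)] at x1 x2
      have y2 : |⟪FG (rs 0 (sc a r') m) z, z⟫| ≤ K*r'^c := le_of_mul_le_mul_left (by linarith) (mul_pos h0 h0)
      have y1 : |⟪FG (rs 0 (sc a r) m) z, z⟫| ≤ 4*(K*r^c) := le_of_mul_le_mul_left (by
        have : r^2 ≤ (2*r')^2 := pow_le_pow_left₀ r0.le h2 2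
        have := mul_le_mul_of_nonneg_left this rp.le
        linarith) (mul_pos h0 h0)
      simp only [hG, sub_apply, inner_sub_left]
      refine (abs_sub _ _).trans ?_
      linarith
    · simp only [hG, sub_apply, inner_sub_left, Finset.sum_sub_distrib]
      have a3 := abs_le.1 (a3 e); have b3 := abs_le.1 (b3 e)
      rw [abs_le]; constructor <;> linarith [a3.1, a3.2, b3.1, b3.2]
  set θ : ℝ := (1/2:ℝ)^c with hθ
  have θ1 : θ < 1 := Real.rpow_lt_one (by norm_num) (by norm_num) c0
  set D := 5000*K/(1-θ) with hD
  have hD' : 5000*K + D*θ = D := by rw [hD]; have : 1 - θ ≠ 0 := by linarith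
                                    field_simp; ring
  have D0 : 5000*K ≤ D := by
    rw [hD, le_div_iff₀ (by linarith only [θ1])]
    have : 0 < θ := Real.rpow_pos_of_pos (by norm_num) _
    have : 0 < 5000*K*θ := mul_pos (by linarith) this
    linarith
  clear_value D
  have all : ∀ k : ℕ, ∀ r r', 0 < r' → r' ≤ r → r ≤ 2^k*r' → r ≤ ρ → ‖G r - G r'‖ ≤ D*r^c := fun k => by
    induction k with
    | zero => intro r r' h0 h1 h2 h3
              rw [pow_zero, one_mul] at h2
              rw [le_antisymm h2 h1, sub_self, norm_zero]
              have := Real.rpow_pos_of_pos h0 c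
              exact mul_nonneg (by linarith) this.le
    | succ k ih =>
      intro r r' h0 h1 h2 h3
      have r0 : 0 < r := by linarith
      have rp := Real.rpow_pos_of_pos r0 c
      rcases le_or_gt r (2*r') with q | q
      · exact (st r r' h0 h1 q h3).trans (mul_le_mul_of_nonneg_right D0 rp.le)
      · have x1 := st r (r/2) (by linarith) (by linarith) (by linarith) h3
        have x2 := ih (r/2) r' h0 (by linarith) (by rw [pow_succ] at h2; linarith) (by linarith)
        have e1 : (r/2)^c = θ*r^c := by rw [hθ, ← Real.mul_rpow (by norm_num) r0.le]; congr 1; ring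
        rw [e1] at x2
        have := norm_sub_le_norm_sub_add_norm_sub (G r) (G (r/2)) (G r')
        have : (5000*K + D*θ)*r^c = D*r^c := by rw [hD']
        linarith
  obtain ⟨U0, hU0⟩ := Ultrafilter.exists_le (𝓝[>] (0:ℝ))
  obtain ⟨n, hn, hlim, -⟩ := CONE h hs0 hnf hU0
  have key : ∀ r, 0 < r → r ≤ ρ → ∀ z, |⟪G r z, z⟫ - (⟪n, z⟫^2 - 1/2*‖z‖^2)| ≤ D*r^c*‖z‖^2 := fun r r0 r1 z => by
    refine le_of_tendsto ((tendsto_const_nhds.sub (hlim z)).abs) ((ev_lt hU0 r0).mono fun r' hr' => ?_)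
    obtain ⟨k, hk⟩ := pow_unbounded_of_one_lt (r/r') (one_lt_two (α := ℝ))
    have := all k r r' hr'.1 hr'.2.le (by rw [div_lt_iff₀ hr'.1] at hk; exact hk.le) r1
    have q := quad_bd this (le_refl ‖z‖)
    rwa [sub_apply, inner_sub_left] at q
  refine ⟨n, K + D, ρ, hn, by linarith, ρ0, ρ1, fun z hz hz1 => ?_, fun η hη => mem_iff_ultrafilter.2 fun U hU => ?_⟩
  · rcases eq_or_ne z 0 with rfl | z0
    · simp
    have zp := norm_pos_iff.2 z0
    have x1 := abs_le.1 ((hρ _ zp hz1).1.2.1 z hz (by linarith only [zp]))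
    have x2 := abs_le.1 (key _ zp hz1 z)
    rw [abs_le]; constructor <;> linarith [x1.1, x1.2, x2.1, x2.2]
  · obtain ⟨n', -, hlim', hZ⟩ := CONE h hs0 hnf hU
    have same : ∀ z, ⟪n', z⟫^2 - 1/2*‖z‖^2 = ⟪n, z⟫^2 - 1/2*‖z‖^2 := fun z => by
      refine tendsto_nhds_unique (hlim' z) (tendsto_iff_norm_sub_tendsto_zero.2 ?_)
      have t : Tendsto (fun r : ℝ => D*r^c*‖z‖^2) U (𝓝 (D*0*‖z‖^2)) := (((rpow_t0 c0).mono_left hU).const_mul D).mul_const _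
      rw [mul_zero, zero_mul] at t
      refine squeeze_zero' (.of_forall fun _ => norm_nonneg _) ((ev_lt hU ρ0).mono fun r hr => ?_) t
      exact key r hr.1 hr.2.le z
    by_contra hcn
    have ev := Ultrafilter.compl_mem_iff_notMem.2 hcn
    have : ∀ r, ∃ z : V, r ∈ {r | ∀ z, ⟪n, z⟫^2 - 1/2*‖z‖^2 = 0 → ‖z‖ ≤ 2 → ∃ w ∈ rS 0 r S, ‖w - z‖ < η}ᶜ → ⟪n, z⟫^2 - 1/2*‖z‖^2 = 0 ∧ ‖z‖ ≤ 2 ∧ ∀ w ∈ rS 0 r S, η ≤ ‖w - z‖ := fun r => by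
      by_cases hr : ∀ z, ⟪n, z⟫^2 - 1/2*‖z‖^2 = 0 → ‖z‖ ≤ 2 → ∃ w ∈ rS 0 r S, ‖w - z‖ < η
      · exact ⟨0, fun q => absurd hr q⟩
      · push Not at hr; exact hr.imp fun z hz _ => hz
    choose z hz using this
    obtain ⟨y, hy⟩ := ulim (U := U) (f := z) (K := 2) (mem_of_superset ev fun r hr => (hz r hr).2.1)
    have yZ : ⟪n, y⟫^2 - 1/2*‖y‖^2 = 0 := tendsto_nhds_unique (((tendsto_const_nhds.inner hy).pow 2).sub ((hy.norm.pow 2).const_mul _)) (tendsto_const_nhds.congr' (mem_of_superset ev fun r hr => (hz r hr).1.symm))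
    have yT := hZ y (by rw [same, yZ])
    have hd : Tendsto (fun r => ‖y - z r‖) U (𝓝 ‖y - y‖) := (tendsto_const_nhds.sub hy).norm
    rw [sub_self, norm_zero] at hd
    obtain ⟨r, hr, ⟨w, hw, hwy⟩, hd⟩ := (Filter.Eventually.and (p := fun r => r ∈ {r | ∀ z, ⟪n, z⟫^2 - 1/2*‖z‖^2 = 0 → ‖z‖ ≤ 2 → ∃ w ∈ rS 0 r S, ‖w - z‖ < η}ᶜ) ev ((yT (η/2) (by positivity)).and (hd.eventually_lt_const (show (0:ℝ) < η/2 by positivity)))).exists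
    have := (hz r hr).2.2 w hw
    have := norm_sub_le_norm_sub_add_norm_sub w y (z r)
    linarith
end
lemma HA.weak {m : Measure V} {S : Set V} {C a R b : ℝ} (h : HA m S C a R) (hb : 0 < b) (hba : b ≤ a) : HA m S (C+16*om) b R := by
  have o := om_pos
  refine ⟨h.au0, h.zero, hb, hba.trans h.ha1, by linarith [h.hC], h.hR, h.hR1, fun p hp hpR t ht => ?_⟩
  have t3 : 0 < t^3 := by positivity
  have tb : 0 < t^b := Real.rpow_pos_of_pos ht _
  have x1 : 0 ≤ om*t^3*t^b := by positivity
  rcases le_or_gt t 1 with t1 | t1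
  · have := mul_le_mul_of_nonneg_left (Real.rpow_le_rpow_of_exponent_ge ht t1 hba) (show 0 ≤ C*t^3 from mul_nonneg (by linarith [h.hC]) t3.le)
    linarith [h.two p hp hpR t ht]
  · have := h.au0.up p t ht
    have := measureReal_nonneg (μ := m) (s := closedBall p t)
    have tb1 : 1 ≤ t^b := Real.one_le_rpow t1.le hb.le
    have := mul_le_mul_of_nonneg_left tb1 (show 0 ≤ om*t^3 by positivity)
    have : 0 ≤ C*t^3*t^b := mul_nonneg (mul_nonneg (by linarith [h.hC]) t3.le) tb.le
    have : 0 ≤ om*t^3 := by positivity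
    rw [abs_le]; constructor <;> linarith
structure TG (S : Set V) (n : V) (K γ ρ : ℝ) : Prop where
  cl : IsClosed S
  n1 : ‖n‖ = 1
  K1 : 1 ≤ K
  g0 : 0 < γ
  g1 : γ ≤ 1/100
  r0 : 0 < ρ
  r1 : ρ ≤ 1
  p1 : ∀ z ∈ S, ‖z‖ ≤ ρ → |⟪n, z⟫^2 - 1/2*‖z‖^2| ≤ K*‖z‖^(15*γ)*‖z‖^2
  p2 : ∀ η, 0 < η → ∀ᶠ r in 𝓝[>] (0:ℝ), ∀ z, ⟪n, z⟫^2 - 1/2*‖z‖^2 = 0 → ‖z‖ ≤ 2 → ∃ w ∈ rS 0 r S, ‖w - z‖ < η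
  p3 : ∀ y ∈ S, y ≠ 0 → ‖y‖ ≤ ρ → ∃ b : V, ‖‖y‖ • b - ((2*⟪n, y⟫) • n - y)‖ ≤ K*‖y‖^γ*‖y‖ ∧
    (∀ z ∈ S, K*‖z - y‖ ≤ ‖y‖^(1+2*γ) → |⟪b, z - y⟫| ≤ K*‖z - y‖^γ*‖z - y‖) ∧
    ∀ η, 0 < η → ∃ s0, 0 < s0 ∧ ∀ s, 0 < s → s ≤ s0 → ∀ w, ⟪b, w⟫ = 0 → ‖w‖ ≤ s → ∃ z ∈ S, ‖z - (y + w)‖ ≤ η*s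
lemma TG.neg {S : Set V} {n : V} {K γ ρ : ℝ} (h : TG S n K γ ρ) : TG S (-n) K γ ρ := by
  refine ⟨h.cl, by rw [norm_neg, h.n1], h.K1, h.g0, h.g1, h.r0, h.r1, ?_, ?_, ?_⟩
  · simpa only [inner_neg_left, neg_sq] using h.p1
  · simpa only [inner_neg_left, neg_sq] using h.p2
  · simpa only [inner_neg_left, mul_neg, neg_smul_neg] using h.p3
lemma FILLP {m : Measure V} {S : Set V} {C a R : ℝ} (h : HA m S C a R) {y b : V} (hy : y ∈ S) (hyR : ‖y‖ ≤ R/2) (hb : ‖b‖ = 1) {K γ σ : ℝ} (h0 : 0 < γ) (g : γ ≤ 1) (hσ : 0 < σ)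
    (hs : ∀ z ∈ S, ‖z - y‖ ≤ σ → |⟪b, z - y⟫| ≤ K*‖z - y‖^γ*‖z - y‖) (K1 : 1 ≤ K) {η : ℝ} (hη : 0 < η) :
    ∃ s0, 0 < s0 ∧ ∀ s, 0 < s → s ≤ s0 → ∀ w, ⟪b, w⟫ = 0 → ‖w‖ ≤ s → ∃ z ∈ S, ‖z - (y + w)‖ ≤ η*s := by
  obtain ⟨ε, e0, e1, hF⟩ := FILL η hη
  have tI : Tendsto (fun r : ℝ => r) (𝓝[>] 0) (𝓝 0) := tendsto_id.mono_left nhdsWithin_le_nhds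
  have t1 : Tendsto (fun r : ℝ => C*r^a) (𝓝[>] 0) (𝓝 0) := by simpa using (rpow_t0 h.ha).const_mul C
  have t2 : Tendsto (fun r : ℝ => 9*K*r^γ) (𝓝[>] 0) (𝓝 0) := by simpa using (rpow_t0 h0).const_mul (9*K)
  obtain ⟨s0, p0, p1, hp⟩ := ev_ex (((t1.eventually_le_const e0).and (t2.eventually_le_const e0)).and ((tI.eventually_le_const (show 0 < R/8 by linarith [h.hR])).and (tI.eventually_le_const (show 0 < σ/3 by linarith))))
  refine ⟨s0, p0, fun s q0 q1 w hw hws => ?_⟩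
  obtain ⟨⟨x1, x2⟩, x3, x4⟩ := hp s q0 q1
  have au := (h.au q0 (by linarith) (y := y) (L := 4) (by linarith)).mono x1 le_rfl
  have sl : ∀ z ∈ rS y s S, ‖z‖ ≤ 3 → |⟪b, z⟫| ≤ ε := fun z hz z3 => by
    have n3 : ‖s • z‖ ≤ s*3 := nsm q0.le z3
    have := hs _ hz (by rw [add_sub_cancel_left]; linarith)
    rw [add_sub_cancel_left, real_inner_smul_right, abs_mul, abs_of_pos q0] at this
    have k1 : ‖s • z‖^γ ≤ 3*s^γ := by
      refine (Real.rpow_le_rpow (norm_nonneg _) n3 h0.le).trans ?_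
      rw [mul_comm s, Real.mul_rpow (by norm_num) q0.le]
      refine mul_le_mul_of_nonneg_right ?_ (Real.rpow_nonneg q0.le _)
      exact (Real.rpow_le_rpow_of_exponent_le (by norm_num) g).trans_eq (Real.rpow_one 3)
    have k2 := mul_le_mul k1 n3 (norm_nonneg _) (mul_nonneg zero_le_three (Real.rpow_nonneg q0.le _))
    have k3 := mul_le_mul_of_nonneg_left k2 (show 0 ≤ K by linarith)
    have k4 := mul_le_mul_of_nonneg_right x2 q0.le
    exact le_of_mul_le_mul_left (by linarith) q0
  obtain ⟨z, hz, hzw⟩ := hF _ _ au (zero_rS s hy) b hb sl (s⁻¹ • w) (by rw [real_inner_smul_right, hw, mul_zero])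
    (by have := nsm (inv_nonneg.2 q0.le) hws; rwa [inv_mul_cancel₀ q0.ne'] at this)
  refine ⟨_, hz, ?_⟩
  have e : y + s • z - (y + w) = s • (z - s⁻¹ • w) := by rw [smul_sub, smul_inv_smul₀ q0.ne']; abel
  rw [e]; have := nsm q0.le hzw; linarith
lemma pd_sgn {b ν : V} (hb : ‖b‖ = 1) (hν : ‖ν‖ = 1) {q : ℝ} (hp : pd b ν ≤ q) (h : 0 ≤ ⟪b, ν⟫) : ‖b - ν‖ ≤ 2*q := by
  rw [pd] at hp
  have e : b - ν = (b - ⟪b, ν⟫ • ν) - (1 - ⟪b, ν⟫) • ν := by module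
  have s1 : ⟪b, ν⟫ ≤ 1 := (real_inner_le_norm b ν).trans (by rw [hb, hν, one_mul])
  have e1 : ‖⟪b, ν⟫ • ν‖ = ⟪b, ν⟫ := by rw [nsm_eq h, hν, mul_one]
  have e2 : ‖(1 - ⟪b, ν⟫) • ν‖ = 1 - ⟪b, ν⟫ := by rw [nsm_eq (by linarith), hν, mul_one]
  have := norm_sub_norm_le b (⟪b, ν⟫ • ν)
  rw [e]; refine (norm_sub_le _ _).trans ?_
  linarith
lemma nNy {n : V} (hn : ‖n‖ = 1) (y : V) : ‖(2*⟪n, y⟫) • n - y‖ = ‖y‖ := by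
  refine (sq_eq_sq₀ (norm_nonneg _) (norm_nonneg _)).1 ?_
  rw [norm_sub_sq_real, norm_smul, hn, real_inner_smul_left, Real.norm_eq_abs, mul_one, sq_abs]; ring
lemma NyQ {n : V} (hn : ‖n‖ = 1) {y z : V} {A s : ℝ} (h1 : |⟪n, y⟫^2 - 1/2*‖y‖^2| ≤ A) (h2 : |⟪n, z⟫^2 - 1/2*‖z‖^2| ≤ A) (hs : ‖z - y‖ ≤ s) :
    |⟪(2*⟪n, y⟫) • n - y, z - y⟫| ≤ s^2 + 2*A := by
  have e : ⟪(2*⟪n, y⟫) • n - y, z - y⟫ = (⟪n, z⟫^2 - 1/2*‖z‖^2) - (⟪n, y⟫^2 - 1/2*‖y‖^2) - (⟪n, z-y⟫^2 - 1/2*‖z-y‖^2) := by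
    rw [norm_sub_sq_real, inner_sub_left, inner_sub_right, inner_sub_right, inner_sub_right, real_inner_smul_left, real_inner_smul_left, real_inner_self_eq_norm_sq, real_inner_comm z y]; ring
  have s2 : ‖z-y‖^2 ≤ s^2 := pow_le_pow_left₀ (norm_nonneg _) hs 2
  have : ⟪n, z-y⟫^2 ≤ s^2 := by rw [← sq_abs]; exact pow_le_pow_left₀ (abs_nonneg _) ((abs_inner_le_of_norm hn).trans hs) 2
  have := sq_nonneg ⟪n, z-y⟫; have := sq_nonneg ‖z-y‖
  have h1 := abs_le.1 h1; have h2 := abs_le.1 h2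
  rw [e, abs_le]; constructor <;> linarith [h1.1, h1.2, h2.1, h2.2]
lemma pow_lo {t x y : ℝ} (h0 : 0 < t) (h1 : t ≤ 1) (h : y ≤ x) : t^x ≤ t^y := Real.rpow_le_rpow_of_exponent_ge h0 h1 h
set_option maxHeartbeats 1000000 in
lemma MKTG {m : Measure V} {S : Set V} {C a R s0 : ℝ} (h : HA m S C a R) (hs0 : 0 < s0) (hnf : ∀ s, 0 < s → s ≤ s0 → ¬ SL S 0 s et) :
    ∃ n K ρ, TG S n K (a/300) ρ := by
  obtain ⟨n, K, ρ, hn, K1, r0, r1, q1, q2⟩ := P12 h hs0 hnf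
  have ha := h.ha; have ha1 := h.ha1
  have h' := h.weak (b := a/10) (by linarith) (by linarith)
  set γ := a/300 with hγ
  have g0 : 0 < γ := by linarith
  have g1 : γ ≤ 1/100 := by linarith
  have a15 : a/20 = 15*γ := by linarith
  rw [a15] at q1
  clear_value γ
  obtain ⟨K2, κ2, s1, K21, κ0, κ1, s10, s11, hFP⟩ := FP h' (c := γ) (by linarith only [hγ])
  obtain ⟨K3, s3, K31, s30, s31, hNY⟩ := NY h' K21 g0 (by linarith)
  obtain ⟨s4, s40, s41, hNC⟩ := NCMP h'
  obtain ⟨κ, k0, k1, ket⟩ : ∃ κ, 0 < κ ∧ κ ≤ 1 ∧ κ ≤ et/2 := ⟨min 1 (et/2), lt_min one_pos (half_pos et_pos), min_le_left _ _, min_le_right _ _⟩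
  set k := κ2*κ^(1+2*γ) with hk
  have kk0 : 0 < k := mul_pos κ0 (Real.rpow_pos_of_pos k0 _)
  have kk1 : k ≤ 1 := mul_le_one₀ κ1 (Real.rpow_nonneg k0.le _) (Real.rpow_le_one k0.le k1 (by linarith only [g0]))
  have σe : ∀ t, 0 < t → κ2*(κ*t)^(1+2*γ) = k*t^(1+2*γ) := fun t ht => by rw [Real.mul_rpow k0.le ht.le, hk, mul_assoc]
  clear_value k
  have tI : Tendsto (fun r : ℝ => r) (𝓝[>] 0) (𝓝 0) := tendsto_id.mono_left nhdsWithin_le_nhds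
  have t2 : Tendsto (fun r : ℝ => 16*K*r^(15*γ)) (𝓝[>] 0) (𝓝 0) := by simpa using (rpow_t0 (show 0 < 15*γ by linarith only [g0])).const_mul (16*K)
  have hR := h.hR
  obtain ⟨ρ', p0, p1, hp⟩ := ev_ex (((t2.eventually_le_const (show 0 < κ*(et/2) from mul_pos k0 (half_pos et_pos))).and (tI.eventually_le_const (show 0 < R/2 by linarith))).and ((tI.eventually_le_const s10).and ((tI.eventually_le_const s30).and ((tI.eventually_le_const s40).and (tI.eventually_le_const (show 0 < ρ/2 by linarith only [r0]))))))
  set M := K3 + 1 + 16*K/k with hM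
  have M0 : 0 < 16*K/k := by positivity
  have KNp := KN_pos
  have ki : 0 < k⁻¹ := inv_pos.2 kk0
  have KM : 0 < 2*KN*M := by positivity
  have main : ∀ y ∈ S, y ≠ 0 → ‖y‖ ≤ ρ' → ∃ b : V, ‖b‖ = 1 ∧ ‖‖y‖ • b - ((2*⟪n, y⟫) • n - y)‖ ≤ 2*KN*M*‖y‖^γ*‖y‖ ∧
      (∀ z ∈ S, ‖z - y‖ ≤ k*‖y‖^(1+2*γ) → |⟪b, z - y⟫| ≤ K3*‖z - y‖^γ*‖z - y‖) := fun y hy y0 hyρ => by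
    have t0 := norm_pos_iff.2 y0
    obtain ⟨⟨x1, x2⟩, x3, x4, x5, x6⟩ := hp _ t0 hyρ
    have nN := nNy hn y
    have Nsl : ∀ s, s ≤ ‖y‖ → ∀ z ∈ S, ‖z - y‖ ≤ s → |⟪(2*⟪n, y⟫) • n - y, z - y⟫| ≤ s^2 + 16*K*‖y‖^(15*γ)*‖y‖^2 := fun s hs z hz hzs => by
      have z2 : ‖z‖ ≤ 2*‖y‖ := by have := norm_le_norm_add_norm_sub' z y; linarith only [hs, hzs, this]
      have b2 : ‖z‖^(15*γ)*‖z‖^2 ≤ (2*‖y‖^(15*γ))*(2*‖y‖)^2 := by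
        refine mul_le_mul ?_ (pow_le_pow_left₀ (norm_nonneg _) z2 2) (by positivity) (by positivity)
        refine (Real.rpow_le_rpow (norm_nonneg _) z2 (by linarith only [g0])).trans ?_
        rw [Real.mul_rpow zero_le_two t0.le]
        exact mul_le_mul_of_nonneg_right ((Real.rpow_le_rpow_of_exponent_le one_le_two (show 15*γ ≤ 1 by linarith only [ha1, hγ])).trans_eq (Real.rpow_one 2)) (by positivity)
      have b1 := q1 z hz (by linarith only [x6, z2])
      have b3 := q1 y hy (by linarith only [r0, x6])
      have b4 := mul_le_mul_of_nonneg_left b2 (show 0 ≤ K by linarith only [K1])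
      have pz : 0 ≤ K*‖y‖^(15*γ)*‖y‖^2 := by positivity
      have := NyQ hn (A := 8*K*‖y‖^(15*γ)*‖y‖^2) (by linarith only [b3, pz]) (by linarith only [b1, b4]) hzs
      linarith only [this]
    set N := (2*⟪n, y⟫) • n - y with hN
    set t := ‖y‖ with ht
    obtain ⟨hν1, hνe⟩ : ‖t⁻¹ • N‖ = 1 ∧ t • (t⁻¹ • N) = N := ⟨by rw [nsm_eq (inv_nonneg.2 t0.le), nN, inv_mul_cancel₀ t0.ne'], smul_inv_smul₀ t0.ne' _⟩
    set ν := t⁻¹ • N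
    have hνi : ∀ z, ⟪N, z⟫ = t*⟪ν, z⟫ := fun z => by rw [← hνe, real_inner_smul_left]
    clear_value ν N t
    have κt : κ*t ≤ t := mul_le_of_le_one_left t0.le k1
    have tp : ∀ x : ℝ, 0 < t^x := fun x => Real.rpow_pos_of_pos t0 x
    have Nsl' : ∀ s, s ≤ t → ∀ z ∈ S, ‖z - y‖ ≤ s → t*|⟪ν, z - y⟫| ≤ s^2 + 16*K*t^(15*γ)*t^2 := fun s hs z hz hzs => by
      have := Nsl s hs z hz hzs
      rwa [hνi, abs_mul, abs_of_pos t0] at this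
    have sl1 : SL S y (κ*t) et := ⟨ν, hν1, fun z hz hzs => le_of_mul_le_mul_left (by
      have u1 := mul_le_mul_of_nonneg_right x1 (show 0 ≤ t^2 by positivity)
      have u2 := mul_le_mul_of_nonneg_left ket (show 0 ≤ κ*t^2 by positivity)
      linarith only [u1, u2, Nsl' _ κt z hz hzs]) t0⟩
    have sl2 := hFP y hy (ht ▸ x2) (κ*t) (by positivity) (by linarith only [x3, κt]) sl1
    rw [σe t t0] at sl2
    have te : t^(1+2*γ) = t*(t^γ)^2 := by rw [Real.rpow_add t0, Real.rpow_one, mul_comm 2, Real.rpow_mul t0.le, Real.rpow_two]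
    have l0 := tp γ
    have l1 : t^γ ≤ 1 := Real.rpow_le_one t0.le (by linarith only [r1, x6]) g0.le
    have l2 : (t^γ)^2 ≤ t^γ := by have := mul_le_mul_of_nonneg_left l1 l0.le; linarith only [this]
    have σt : k*t^(1+2*γ) ≤ t*t^γ := by
      rw [te]; have := mul_le_mul_of_nonneg_left l2 t0.le
      have : k*(t*(t^γ)^2) ≤ t*(t^γ)^2 := mul_le_of_le_one_left (by positivity) kk1
      linarith
    have σt' : t*t^γ ≤ t := mul_le_of_le_one_right t0.le l1
    have σ0 : 0 < k*t^(1+2*γ) := mul_pos kk0 (tp _)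
    have t15 : t^(15*γ)*t ≤ t^γ*t^(1+2*γ) := by
      have : t^(15*γ) ≤ t^(3*γ) := pow_lo t0 (by linarith only [r1, x6]) (by linarith only [g0])
      have e3 : t^(3*γ) = (t^γ)^3 := by rw [mul_comm, Real.rpow_mul t0.le]; norm_cast
      rw [e3] at this; rw [te]; have := mul_le_mul_of_nonneg_right this t0.le
      linarith only [this]
    set σ := k*t^(1+2*γ) with hσ
    have t16 : 16*K*t^(15*γ)*t ≤ 16*K/k*t^γ*σ := by
      have : 16*K/k*t^γ*σ = 16*K*(t^γ*t^(1+2*γ)) := by rw [hσ]; field_simp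
      rw [this]; have := mul_le_mul_of_nonneg_left t15 (show 0 ≤ 16*K by linarith only [K1])
      linarith only [this]
    clear_value σ
    obtain ⟨b, hb, hbs⟩ := hNY y hy (ht ▸ x2) σ σ0 (by linarith only [x4, σt', σt]) fun s q0 q1 => sl2 s q0 q1
    have lσ := mul_pos l0 σ0
    have bsl : ∀ z ∈ S, ‖z - y‖ ≤ σ → |⟪b, z - y⟫| ≤ M*t^γ*σ := fun z hz hzs => by
      refine (hbs z hz hzs).trans ?_
      have v1 : ‖z - y‖^γ ≤ t^γ := Real.rpow_le_rpow (norm_nonneg _) (by linarith only [σt', σt, hzs]) g0.le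
      have v2 := mul_le_mul_of_nonneg_left (mul_le_mul v1 hzs (norm_nonneg _) l0.le) (show 0 ≤ K3 by linarith only [K31])
      have : 0 < 16*K/k*(t^γ*σ) := by positivity
      rw [hM]; linarith only [lσ, v2, this]
    have nsl : ∀ z ∈ S, ‖z - y‖ ≤ σ → |⟪ν, z - y⟫| ≤ M*t^γ*σ := fun z hz hzs => le_of_mul_le_mul_left (by
      have v0 := Nsl' σ (by linarith only [σt', σt]) z hz hzs
      have v1 := mul_le_mul_of_nonneg_left σt σ0.le
      have v2 := mul_le_mul_of_nonneg_left t16 t0.le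
      have v3 : 0 < K3*(t^γ*σ*t) := mul_pos (by linarith only [K31]) (by positivity)
      rw [hM]; linarith only [v0, v1, v2, v3]) t0
    have pdb := hNC y hy (ht ▸ x2) σ σ0 (by linarith only [x5, σt', σt]) (M*t^γ) (by positivity) ν b hν1 hb nsl bsl
    have fin : ∀ b : V, ‖b - ν‖ ≤ 2*(KN*(M*t^γ)) → ‖t • b - N‖ ≤ 2*KN*M*t^γ*t := fun b hb => by
      rw [← hνe, ← smul_sub]; have := nsm t0.le hb; linarith only [this]
    rcases le_total 0 ⟪b, ν⟫ with hs | hs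
    · exact ⟨b, hb, fin b (pd_sgn hb hν1 pdb hs), hbs⟩
    · refine ⟨-b, by rw [norm_neg, hb], fin _ (pd_sgn (by rw [norm_neg, hb]) hν1 ?_ (by rw [inner_neg_left]; linarith only [hs])), fun z hz hzs => ?_⟩
      · rwa [pd, inner_neg_left, neg_smul, neg_sub_neg, norm_sub_rev, ← pd]
      · rw [inner_neg_left, abs_neg]; exact hbs z hz hzs
  clear_value M
  set Kf := K + K3 + k⁻¹ + 2*KN*M with hKf
  have p2 := (hp ρ' p0 le_rfl).2.2.2.2
  refine ⟨n, Kf, ρ', h.au0.cl, hn, by linarith only [K1, K31, ki, KM], g0, g1, p0, p1, fun z hz hzρ => (q1 z hz (by linarith only [p0, p2, hzρ])).trans ?_, q2, fun y hy y0 hyρ => ?_⟩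
  · gcongr; linarith only [K31, ki, KM]
  · obtain ⟨b, hb, b1, b2⟩ := main y hy y0 hyρ
    have t0 := norm_pos_iff.2 y0
    have tp := Real.rpow_pos_of_pos t0 (1+2*γ)
    refine ⟨b, b1.trans (by gcongr; linarith only [K1, K31, ki]), fun z hz hzs => (b2 z hz ?_).trans (by gcongr; linarith only [K1, ki, KM]), fun η hη => ?_⟩
    · have : k⁻¹*‖z - y‖ ≤ Kf*‖z - y‖ := mul_le_mul_of_nonneg_right (by linarith only [K1, K31, KM]) (norm_nonneg _)
      rw [← inv_mul_le_iff₀ kk0]; linarith only [hzs, this]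
    · exact FILLP h hy (hp _ t0 hyρ).1.2 hb g0 (by linarith only [ha1, hγ]) (mul_pos kk0 tp) b2 K31 hη
def pr (n z : V) : V := z - ⟪n, z⟫ • n
lemma rp_t {b : ℝ} (hb : 0 < b) (K : ℝ) {e : ℝ} (he : 0 < e) : ∀ᶠ r in 𝓝[>] (0:ℝ), K*r^b ≤ e := by
  have : Tendsto (fun r : ℝ => K*r^b) (𝓝[>] 0) (𝓝 0) := by simpa using (rpow_t0 hb).const_mul K
  exact this.eventually_le_const he
lemma rp_s {b k X Y : ℝ} (hb : 0 ≤ b) (hb1 : b ≤ 1) (hk : 1 ≤ k) (hX : 0 ≤ X) (hY : 0 ≤ Y) (h : X ≤ k*Y) : X^b ≤ k*Y^b := by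
  refine (Real.rpow_le_rpow hX h hb).trans ?_
  rw [Real.mul_rpow (by linarith) hY]
  exact mul_le_mul_of_nonneg_right ((Real.rpow_le_rpow_of_exponent_le hk hb1).trans_eq (Real.rpow_one k)) (Real.rpow_nonneg hY _)
structure SG (S : Set V) (n : V) (K γ ρ : ℝ) : Prop where
  cl : IsClosed S
  n1 : ‖n‖ = 1
  K1 : 1 ≤ K
  g0 : 0 < γ
  g1 : γ ≤ 1/100
  r0 : 0 < ρ
  r1 : ρ ≤ 1
  c1 : ∀ z ∈ S, ‖z‖ ≤ ρ → |(|⟪n, z⟫| - ‖pr n z‖)| ≤ K*‖pr n z‖^(15*γ)*‖pr n z‖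
  p2 : ∀ η, 0 < η → ∀ᶠ r in 𝓝[>] (0:ℝ), ∀ z, ⟪n, z⟫^2 - 1/2*‖z‖^2 = 0 → ‖z‖ ≤ 2 → ∃ w ∈ rS 0 r S, ‖w - z‖ < η
  p3 : ∀ y ∈ S, ‖y‖ ≤ ρ → 0 < ⟪n, y⟫ → ∃ L : V, ‖L - ‖pr n y‖⁻¹ • pr n y‖ ≤ K*‖pr n y‖^γ ∧ ⟪n, L⟫ = 0 ∧
    (∀ z ∈ S, K*‖z - y‖ ≤ ‖pr n y‖^(1+2*γ) → |⟪n - L, z - y⟫| ≤ K*‖z - y‖^γ*‖z - y‖) ∧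
    ∀ η, 0 < η → ∃ s0, 0 < s0 ∧ ∀ s, 0 < s → s ≤ s0 → ∀ w, ⟪n - L, w⟫ = 0 → ‖w‖ ≤ s → ∃ z ∈ S, ‖z - (y + w)‖ ≤ η*s
lemma nsq_pr {n : V} (hn : ‖n‖ = 1) (z : V) : ‖z‖^2 = ⟪n, z⟫^2 + ‖pr n z‖^2 := by
  rw [pr, norm_sub_sq_real, norm_smul, hn, real_inner_smul_right, Real.norm_eq_abs, mul_one, sq_abs, real_inner_comm]; ring
lemma pr_dec (n z : V) : z = pr n z + ⟪n, z⟫ • n := by rw [pr]; abel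
lemma n_pr {n : V} (hn : ‖n‖ = 1) (z : V) : ⟪n, pr n z⟫ = 0 := (proj_le hn).2
lemma pr_le {n : V} (hn : ‖n‖ = 1) (z : V) : ‖pr n z‖ ≤ ‖z‖ := (proj_le hn).1
lemma nrm_le {n : V} (hn : ‖n‖ = 1) (z : V) : ‖z‖ ≤ |⟪n, z⟫| + ‖pr n z‖ := by
  conv_lhs => rw [pr_dec n z]
  refine (norm_add_le _ _).trans ?_
  rw [norm_smul, hn, mul_one, Real.norm_eq_abs, add_comm]
lemma TGc {S : Set V} {n : V} {K γ ρ : ℝ} (h : TG S n K γ ρ) {z : V} (hz : z ∈ S) (hzr : ‖z‖ ≤ ρ) (hs : 16*K*‖z‖^(15*γ) ≤ 1) :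
    7*|⟪n, z⟫| ≤ 9*‖pr n z‖ ∧ 7*‖pr n z‖ ≤ 9*|⟪n, z⟫| ∧ ‖z‖ ≤ 3*‖pr n z‖ ∧ |(|⟪n, z⟫| - ‖pr n z‖)| ≤ 18*K*‖pr n z‖^(15*γ)*‖pr n z‖ := by
  have hq := h.p1 z hz hzr
  have d := nsq_pr h.n1 z
  have nl := nrm_le h.n1 z
  have hK := h.K1; have g0 := h.g0; have g1 := h.g1
  have X0 := norm_nonneg (pr n z)
  have τ0 := norm_nonneg z
  set X := ‖pr n z‖
  set τ := ‖z‖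
  have c0 : 0 ≤ τ^(15*γ) := Real.rpow_nonneg τ0 _
  have A : |(|⟪n, z⟫| - X)| ≤ 2*K*τ^(15*γ)*τ := by
    rcases eq_or_lt_of_le (add_nonneg (abs_nonneg ⟪n, z⟫) X0) with e | e
    · have x0 : X = 0 := by linarith only [X0, e, abs_nonneg ⟪n, z⟫]
      have y0 : |⟪n, z⟫| = 0 := by linarith only [X0, e, abs_nonneg ⟪n, z⟫]
      rw [x0, y0, sub_zero, abs_zero]; positivity
    · refine le_of_mul_le_mul_right ?_ e
      have e1 : |(|⟪n, z⟫| - X)| * (|⟪n, z⟫| + X) = 2*|⟪n, z⟫^2 - 1/2*τ^2| := by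
        have e2 : (|⟪n, z⟫| - X) * (|⟪n, z⟫| + X) = 2*(⟪n, z⟫^2 - 1/2*τ^2) := by rw [d, ← sq_abs ⟪n, z⟫]; ring
        rw [← abs_two, ← abs_mul, abs_two, ← e2, abs_mul, abs_of_pos e]
      rw [e1]
      have := mul_le_mul_of_nonneg_left nl (show 0 ≤ 2*K*τ^(15*γ)*τ by positivity)
      linarith
  have B : 2*K*τ^(15*γ)*τ ≤ 1/8*(|⟪n, z⟫| + X) := by
    have := mul_le_mul_of_nonneg_right hs τ0; linarith
  have A' := abs_le.1 (A.trans B)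
  have t3 : τ ≤ 3*X := by linarith only [nl, A']
  refine ⟨by linarith only [A'.2], by linarith only [A'.1], t3, A.trans ?_⟩
  have u1 := rp_s (b := 15*γ) (by linarith only [g0]) (by linarith only [g1]) (by norm_num : (1:ℝ) ≤ 3) τ0 X0 t3
  have u2 := mul_le_mul u1 t3 τ0 (mul_nonneg zero_le_three (Real.rpow_nonneg X0 _))
  have := mul_le_mul_of_nonneg_left u2 (show 0 ≤ 2*K by linarith only [hK])
  linarith only [this]
lemma TGt {S : Set V} {n : V} {K γ ρ : ℝ} (h : TG S n K γ ρ) : ∃ K' ρ', SG S n K' γ ρ' := by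
  have hK := h.K1; have g0 := h.g0; have g1 := h.g1; have r0 := h.r0; have hn := h.n1
  obtain ⟨ρ1, p0, p1, hp⟩ := ev_ex ((rp_t (show 0 < 15*γ by linarith) (16*K) one_pos).and (rp_t g0 K (show (0:ℝ) < 1/12 by norm_num)))
  have small : ∀ z : V, ‖z‖ ≤ min ρ ρ1 → 16*K*‖z‖^(15*γ) ≤ 1 := fun z hz => by
    rcases eq_or_lt_of_le (norm_nonneg z) with e | e
    · rw [← e, Real.zero_rpow (by linarith), mul_zero]; exact zero_le_one
    · exact (hp _ e (hz.trans (min_le_right _ _))).1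
  refine ⟨200*K, min ρ ρ1, h.cl, hn, by linarith, g0, g1, lt_min r0 p0, (min_le_left _ _).trans h.r1, fun z hz hzr => ?_, h.p2, fun y hy hyr hh => ?_⟩
  · refine (TGc h hz (hzr.trans (min_le_left _ _)) (small z hzr)).2.2.2.trans ?_
    gcongr; norm_num
  obtain ⟨c1, c2, c3, c4⟩ := TGc h hy (hyr.trans (min_le_left _ _)) (small y hyr)
  rw [abs_of_pos hh] at c1 c2 c4
  have X0 : 0 < ‖pr n y‖ := by linarith
  have y0 : y ≠ 0 := fun e => by rw [e, inner_zero_right] at hh; exact lt_irrefl _ hh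
  obtain ⟨b, b1, b2, b3⟩ := h.p3 y hy y0 (hyr.trans (min_le_left _ _))
  have τ0 := norm_pos_iff.2 y0
  have k1 := (hp _ τ0 (hyr.trans (min_le_right _ _))).2
  have nl := nrm_le hn y
  rw [abs_of_pos hh] at nl
  have prl := pr_le hn y
  have y1 : ‖y‖ ≤ 1 := hyr.trans ((min_le_left _ _).trans h.r1)
  obtain ⟨e, he⟩ : ∃ e, e = ‖y‖ • b - ((2*⟪n, y⟫) • n - y) := ⟨_, rfl⟩
  rw [← he] at b1
  have hb : ‖y‖ • b = ⟪n, y⟫ • n - pr n y + e := by rw [he, pr]; module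
  have hβ : ‖y‖*⟪n, b⟫ = ⟪n, y⟫ + ⟪n, e⟫ := by
    rw [← real_inner_smul_right, hb, inner_add_right, inner_sub_right, real_inner_smul_right, n_pr hn, real_inner_self_eq_norm_sq, hn]; ring
  have ne : |⟪n, e⟫| ≤ ‖e‖ := abs_inner_le_of_norm hn
  have k2 := mul_le_mul_of_nonneg_right k1 τ0.le
  have β4 : 1/4 ≤ ⟪n, b⟫ := le_of_mul_le_mul_left (by linarith [(abs_le.1 ne).1]) τ0
  have xu : ‖‖pr n y‖⁻¹ • pr n y‖ = 1 := by rw [nsm_eq (inv_nonneg.2 X0.le), inv_mul_cancel₀ X0.ne']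
  have Xu : pr n y = ‖pr n y‖ • (‖pr n y‖⁻¹ • pr n y) := (smul_inv_smul₀ X0.ne' _).symm
  have lg : ‖y‖^γ ≤ 3*‖pr n y‖^γ := rp_s g0.le (by linarith only [g1]) (by norm_num) τ0.le X0.le c3
  have lc : ‖pr n y‖^(15*γ) ≤ ‖pr n y‖^γ := pow_lo X0 (by linarith only [prl, y1]) (by linarith only [g0])
  have XG := Real.rpow_pos_of_pos X0 γ
  have Xm : ‖pr n y‖^(1+2*γ) ≤ ‖y‖^(1+2*γ) := Real.rpow_le_rpow X0.le prl (by linarith only [g0])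
  have nn : ⟪n, n⟫ = 1 := by rw [real_inner_self_eq_norm_sq, hn, one_pow]
  have npr := n_pr hn y
  set X := ‖pr n y‖
  set v := X⁻¹ • pr n y with hv
  have nv : ⟪n, v⟫ = 0 := by rw [hv, real_inner_smul_right, npr, mul_zero]
  clear_value v
  rw [Xu] at hb
  clear_value X
  set β := ⟪n, b⟫ with hβd
  have hβ' : ⟪b, n⟫ = β := real_inner_comm _ _
  have β0 : 0 < β := by linarith only [β4]
  have li : ∀ w, ⟪n - (n - β⁻¹ • b), w⟫ = β⁻¹*⟪b, w⟫ := fun w => by rw [sub_sub_cancel, real_inner_smul_left]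
  refine ⟨n - β⁻¹ • b, ?_, ?_, fun z hz hzs => ?_, fun η hη => ?_⟩
  · have e1 : (‖y‖*β) • (n - β⁻¹ • b - v) = ⟪n, e⟫ • n - ⟪n, e⟫ • v + (X - ⟪n, y⟫) • v - e := by
      have : (‖y‖*β) • (β⁻¹ • b) = ‖y‖ • b := by rw [smul_smul, mul_assoc, mul_inv_cancel₀ β0.ne', mul_one]
      rw [smul_sub, smul_sub, this, hb, hβ]; module
    have e2 : ‖(‖y‖*β) • (n - β⁻¹ • b - v)‖ ≤ ‖e‖ + ‖e‖ + |⟪n, y⟫ - X| + ‖e‖ := by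
      rw [e1]
      have z1 : ‖⟪n, e⟫ • n‖ ≤ ‖e‖ := by rwa [norm_smul, hn, mul_one]
      have z2 : ‖⟪n, e⟫ • v‖ ≤ ‖e‖ := by rwa [norm_smul, xu, mul_one]
      have z3 : ‖(X - ⟪n, y⟫) • v‖ = |⟪n, y⟫ - X| := by rw [norm_smul, xu, mul_one, Real.norm_eq_abs, abs_sub_comm]
      exact (norm_sub_le _ _).trans (add_le_add_left ((norm_add_le _ _).trans (add_le_add ((norm_sub_le _ _).trans (add_le_add z1 z2)) z3.le)) _)
    rw [nsm_eq (by positivity)] at e2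
    have f1 := mul_le_mul_of_nonneg_right β4 (mul_nonneg τ0.le (norm_nonneg (n - β⁻¹ • b - v)))
    have f2 := mul_le_mul_of_nonneg_left lg (show 0 ≤ K*‖y‖ by positivity)
    have f3 := mul_le_mul lc prl X0.le XG.le
    have f4 := mul_le_mul_of_nonneg_left f3 (show 0 ≤ K by linarith only [hK])
    refine le_of_mul_le_mul_left ?_ τ0
    have : 0 < ‖y‖*(K*X^γ) := by positivity
    linarith only [b1, c4, e2, f1, f2, f4, this]
  · rw [inner_sub_right, real_inner_smul_right, nn, ← hβd, inv_mul_cancel₀ β0.ne', sub_self]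
  · have := b2 z hz (by have : 0 ≤ 199*K*‖z-y‖ := by positivity
                        linarith only [Xm, hzs, this])
    rw [li, abs_mul, abs_of_pos (inv_pos.2 β0), inv_mul_le_iff₀ β0]
    have := mul_le_mul_of_nonneg_right β4 (show 0 ≤ K*‖z-y‖^γ*‖z-y‖ by positivity)
    have : 0 ≤ K*‖z-y‖^γ*‖z-y‖ := by positivity
    linarith
  · obtain ⟨s0, q0, hs⟩ := b3 η hη
    exact ⟨s0, q0, fun s h0 h1 w hw => hs s h0 h1 w (by rw [li] at hw; exact (mul_eq_zero.1 hw).resolve_left (inv_pos.2 β0).ne')⟩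
lemma pr_sub (n a b : V) : pr n (a - b) = pr n a - pr n b := by rw [pr, pr, pr, inner_sub_right]; module
lemma pr_add (n a b : V) : pr n (a + b) = pr n a + pr n b := by rw [pr, pr, pr, inner_add_right]; module
lemma pr_of {n x : V} (hx : ⟪n, x⟫ = 0) : pr n x = x := by rw [pr, hx, zero_smul, sub_zero]
lemma pr_n {n : V} (hn : ‖n‖ = 1) (t : ℝ) : pr n (t • n) = 0 := by
  rw [pr, real_inner_smul_right, real_inner_self_eq_norm_sq, hn, one_pow, mul_one, sub_self]
lemma in_n {n x : V} (hn : ‖n‖ = 1) (hx : ⟪n, x⟫ = 0) (t : ℝ) : ⟪n, x + t • n⟫ = t := by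
  rw [inner_add_right, hx, real_inner_smul_right, real_inner_self_eq_norm_sq, hn]; ring
lemma pr_x {n x : V} (hn : ‖n‖ = 1) (hx : ⟪n, x⟫ = 0) (t : ℝ) : pr n (x + t • n) = x := by
  rw [pr_add, pr_of hx, pr_n hn, add_zero]
lemma UNQ {S : Set V} {n : V} {K γ ρ : ℝ} (h : SG S n K γ ρ) {x : V} (hx : ⟪n, x⟫ = 0) (x0 : x ≠ 0) {s t : ℝ} (s0 : 0 < s) (t0 : 0 < t)
    (hs : x + s • n ∈ S) (ht : x + t • n ∈ S) (ns : ‖x + s • n‖ ≤ ρ) (nt : ‖x + t • n‖ ≤ ρ)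
    (e1 : 2*K*‖x‖^(15*γ) ≤ 1) (e2 : 2*K^2*‖x‖^(13*γ) ≤ 1) (e3 : K*‖x‖^γ ≤ 1/2) : s = t := by
  have hn := h.n1; have K1 := h.K1; have g0 := h.g0
  have X0 := norm_pos_iff.2 x0
  have a1 := h.c1 _ hs ns; have a2 := h.c1 _ ht nt
  rw [in_n hn hx, pr_x hn hx, abs_of_pos s0] at a1
  rw [in_n hn hx, pr_x hn hx, abs_of_pos t0] at a2
  obtain ⟨L, -, L0, L1, -⟩ := h.p3 _ hs ns (by rwa [in_n hn hx])
  have ed : x + t • n - (x + s • n) = (t - s) • n := by module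
  have L2 := L1 _ ht
  have nn : ⟪n, n⟫ = 1 := by rw [real_inner_self_eq_norm_sq, hn, one_pow]
  rw [ed, norm_smul, hn, mul_one, Real.norm_eq_abs, pr_x hn hx, real_inner_smul_right, inner_sub_left, nn, real_inner_comm, L0, sub_zero, mul_one] at L2
  have a1 := abs_le.1 a1; have a2 := abs_le.1 a2
  have d2 : |t - s| ≤ 2*K*‖x‖^(15*γ)*‖x‖ := by rw [abs_le]; constructor <;> linarith [a1.1, a1.2, a2.1, a2.2]
  have d1 : |t - s| ≤ ‖x‖ := d2.trans (mul_le_of_le_one_left X0.le e1)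
  have := L2 (by
    have p1 : ‖x‖^(15*γ) = ‖x‖^(13*γ)*‖x‖^(2*γ) := by rw [← Real.rpow_add X0]; congr 1; ring
    have p2 : ‖x‖^(1+2*γ) = ‖x‖^(2*γ)*‖x‖ := by rw [add_comm, Real.rpow_add X0, Real.rpow_one]
    rw [p1] at d2
    have q1 := mul_le_mul_of_nonneg_left d2 (show 0 ≤ K by linarith)
    have q2 := mul_le_mul_of_nonneg_right e2 (show 0 ≤ ‖x‖^(2*γ)*‖x‖ by positivity)
    rw [p2]; linarith)
  have q3 := mul_le_mul_of_nonneg_left (Real.rpow_le_rpow (abs_nonneg _) d1 g0.le) (show 0 ≤ K by linarith)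
  have q4 := mul_le_mul_of_nonneg_right (q3.trans e3) (abs_nonneg (t-s))
  have : |t - s| ≤ 0 := by linarith
  have := abs_nonpos_iff.1 this
  linarith only [this]
lemma EXS {S : Set V} {n : V} {K γ ρ : ℝ} (h : SG S n K γ ρ) {x : V} (hx : ⟪n, x⟫ = 0) (x0 : x ≠ 0) (xr : 3*‖x‖ ≤ ρ)
    (e1 : ∀ r, 0 < r → r ≤ 2*‖x‖ → K*r^(15*γ) ≤ 1/100 ∧ K*r^γ ≤ 1)
    (hp : ∀ z, ⟪n, z⟫^2 - 1/2*‖z‖^2 = 0 → ‖z‖ ≤ 2 → ∃ w ∈ rS 0 ‖x‖ S, ‖w - z‖ < 1/100) : ∃ t, 0 < t ∧ t ≤ 2*‖x‖ ∧ x + t • n ∈ S := by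
  have hn := h.n1
  have X0 := norm_pos_iff.2 x0
  have nn : ⟪n, n⟫ = 1 := by rw [real_inner_self_eq_norm_sq, hn, one_pow]
  obtain ⟨X, hX⟩ : ∃ X, X = ‖x‖ := ⟨_, rfl⟩
  rw [← hX] at X0 xr e1 hp ⊢
  have nz : ‖X⁻¹ • x + (1:ℝ) • n‖^2 = 2 := by
    rw [one_smul, norm_add_sq_real, nsm_eq (inv_nonneg.2 X0.le), ← hX, inv_mul_cancel₀ X0.ne', hn, real_inner_smul_left, real_inner_comm, hx]; norm_num
  obtain ⟨w, hw, hwz⟩ := hp (X⁻¹ • x + (1:ℝ) • n) (by rw [in_n hn (by rw [real_inner_smul_right, hx, mul_zero]), nz]; norm_num)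
    ((sq_le_sq₀ (norm_nonneg _) zero_le_two).1 (by rw [nz]; norm_num))
  rw [mem_rS, zero_add] at hw
  set p := x + X • n with hp'
  have w1 : ‖X • w - p‖ ≤ X*(1/100) := by
    have := nsm X0.le hwz.le
    rwa [smul_sub, one_smul, smul_add, smul_inv_smul₀ X0.ne'] at this
  have pp : pr n p = x := pr_x hn hx X
  have np : ⟪n, p⟫ = X := in_n hn hx X
  have pn : ‖p‖ ≤ 2*X := by
    refine (norm_add_le _ _).trans ?_
    rw [nsm_eq X0.le, hn, ← hX]; linarith
  have hcp : IsCompact (S ∩ closedBall p (X/4)) := (isCompact_closedBall _ _).inter_left h.cl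
  have hc : Continuous fun y => ‖pr n y - x‖ := by unfold pr; fun_prop
  obtain ⟨y, ⟨hy, hyp⟩, hmin⟩ := hcp.exists_isMinOn ⟨X • w, hw, by rw [mem_closedBall, dist_eq_norm]; linarith⟩ hc.continuousOn
  rw [mem_closedBall, dist_eq_norm] at hyp
  have hm : ∀ z ∈ S, ‖z - p‖ ≤ X/4 → ‖pr n y - x‖ ≤ ‖pr n z - x‖ := fun z hz hzp => hmin ⟨hz, by rwa [mem_closedBall, dist_eq_norm]⟩
  have pz : ∀ z, ‖pr n z - x‖ ≤ ‖z - p‖ := fun z => by rw [← pp, ← pr_sub]; exact pr_le hn _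
  have d1 : ‖pr n y - x‖ ≤ X*(1/100) := (hm _ hw (by linarith)).trans ((pz _).trans w1)
  have yr : ‖y‖ ≤ ρ := by have := norm_le_norm_add_norm_sub' y p; linarith
  have hyl : |⟪n, y⟫ - X| ≤ X/4 := by
    have : |⟪n, y - p⟫| ≤ X/4 := (abs_inner_le_of_norm hn).trans hyp
    rwa [inner_sub_right, np] at this
  have h0 : 0 < ⟪n, y⟫ := by have := (abs_le.1 hyl).1; linarith
  have py1 : ‖pr n y‖ ≤ X*(101/100) := by have := norm_le_norm_add_norm_sub' (pr n y) x; linarith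
  have py2 : X*(99/100) ≤ ‖pr n y‖ := by have := norm_le_norm_add_norm_sub (pr n y) x; linarith only [hX, d1, this]
  obtain ⟨k1, k2⟩ := e1 ‖pr n y‖ (by linarith only [X0, py2]) (by linarith only [X0, py1])
  have cy := h.c1 y hy yr
  rw [abs_of_pos h0] at cy
  have c2 := abs_le.1 (cy.trans (mul_le_mul_of_nonneg_right k1 (norm_nonneg _)))
  have hX3 : |⟪n, y⟫ - X| ≤ X*(3/100) := by rw [abs_le]; constructor <;> linarith [c2.1, c2.2]
  refine ⟨inner ℝ n y, h0, by linarith only [c2, (abs_le.1 hX3).2], ?_⟩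
  have yp : ‖y - p‖ ≤ X*(4/100) := by
    refine (nrm_le hn _).trans ?_
    rw [pr_sub, pp, inner_sub_right, np]; linarith only [d1, hX3]
  by_contra hne
  have dne : pr n y ≠ x := fun e => hne (by rw [← e, ← pr_dec]; exact hy)
  have d0 : 0 < ‖pr n y - x‖ := norm_pos_iff.2 (sub_ne_zero.2 dne)
  obtain ⟨L, La, L0, -, Lf⟩ := h.p3 y hy yr h0
  obtain ⟨s0, q0, hs⟩ := Lf (1/6) (by norm_num)
  set d := ‖pr n y - x‖ with hd
  set v := d⁻¹ • (x - pr n y) with hv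
  have v1 : ‖v‖ = 1 := by rw [hv, nsm_eq (inv_nonneg.2 d0.le), norm_sub_rev, ← hd, inv_mul_cancel₀ d0.ne']
  have vd : d • v = x - pr n y := smul_inv_smul₀ d0.ne' _
  have nv : ⟪n, v⟫ = 0 := by rw [hv, real_inner_smul_right, inner_sub_right, hx, n_pr hn, sub_self, mul_zero]
  clear_value v d
  have L2 : ‖L‖ ≤ 2 := by
    have := norm_le_norm_add_norm_sub' L (‖pr n y‖⁻¹ • pr n y)
    have : ‖‖pr n y‖⁻¹ • pr n y‖ = 1 := by rw [nsm_eq (inv_nonneg.2 (norm_nonneg _)), inv_mul_cancel₀ (by linarith only [py2, d1, d0])]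
    linarith
  have Lv : |⟪L, v⟫| ≤ 2 := (abs_real_inner_le_norm _ _).trans (by rwa [v1, mul_one])
  obtain ⟨s, sp, sa, sb, sc⟩ : ∃ s, 0 < s ∧ 3*s ≤ s0 ∧ s ≤ d ∧ s ≤ X/100 :=
    ⟨min (s0/3) (min d (X/100)), by positivity, by have := min_le_left (s0/3) (min d (X/100)); linarith only [this], (min_le_right _ _).trans (min_le_left _ _), (min_le_right _ _).trans (min_le_right _ _)⟩
  have wn : ‖s • (v + ⟪L, v⟫ • n)‖ ≤ s*3 := nsm sp.le ((norm_add_le _ _).trans (by rw [norm_smul, hn, mul_one, v1, Real.norm_eq_abs]; linarith only [Lv]))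
  obtain ⟨z, hz, hzw⟩ := hs (3*s) (by linarith only [sp]) sa (s • (v + ⟪L, v⟫ • n)) (by
    rw [real_inner_smul_right, inner_sub_left, in_n hn nv, inner_add_right, real_inner_smul_right, real_inner_comm n L, L0]; ring) (by linarith only [wn])
  set W := s • (v + ⟪L, v⟫ • n) with hW
  have ez : z - p = (z - (y + W)) + (y - p) + W := by abel
  have := hm z hz (by rw [ez]; exact norm_add₃_le.trans (by linarith only [yp, d1, d0, sb, wn, hzw]))
  have e2 : pr n z - x = pr n (z - (y + W)) + (-(d-s)) • v := by
    have : pr n W = s • v := by rw [hW, smul_add, smul_smul, pr_add, pr_n hn, add_zero, pr_of (by rw [real_inner_smul_right, nv, mul_zero])]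
    have e : x = d • v + pr n y := by rw [vd]; abel
    rw [pr_sub, pr_add, this]; nth_rw 1 [e]; module
  have : ‖pr n z - x‖ ≤ s/2 + (d - s) := by
    rw [e2]; refine (norm_add_le _ _).trans (add_le_add ((pr_le hn _).trans (by linarith only [hzw])) ?_)
    rw [neg_smul, norm_neg, nsm_eq (by linarith only [sb]), v1, mul_one]
  linarith
structure UF (n : V) (u : V → ℝ) (K γ ρ : ℝ) : Prop where
  K1 : 1 ≤ K
  r0 : 0 < ρ
  r1 : ρ ≤ 1
  gr : ∀ x, ⟪n, x⟫ = 0 → ‖x‖ ≤ ρ → |u x| ≤ K*‖x‖^(15*γ)*‖x‖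
  ex : ∀ x, ⟪n, x⟫ = 0 → x ≠ 0 → ‖x‖ ≤ ρ → ∃ L : V, ‖L‖ ≤ K*‖x‖^γ ∧ ∀ x', ⟪n, x'⟫ = 0 → K*‖x' - x‖ ≤ ‖x‖^(1+2*γ) →
    |u x' - u x - ⟪L, x' - x⟫| ≤ K*‖x' - x‖^γ*‖x' - x‖
lemma UF.mono {n : V} {u : V → ℝ} {K γ ρ K' ρ' : ℝ} (h : UF n u K γ ρ) (hK : K ≤ K') (r0 : 0 < ρ') (hr : ρ' ≤ ρ) : UF n u K' γ ρ' := by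
  refine ⟨h.K1.trans hK, r0, hr.trans h.r1, fun x hx hxr => (h.gr x hx (hxr.trans hr)).trans (by gcongr), fun x hx x0 hxr => ?_⟩
  obtain ⟨L, L1, L2⟩ := h.ex x hx x0 (hxr.trans hr)
  exact ⟨L, L1.trans (by gcongr), fun x' hx' hd => (L2 x' hx' ((mul_le_mul_of_nonneg_right hK (norm_nonneg _)).trans hd)).trans (by gcongr)⟩
lemma nrm_ex {x x' : V} (x0 : x ≠ 0) : |‖x'‖ - ‖x‖ - ⟪‖x‖⁻¹ • x, x' - x⟫| * ‖x‖ ≤ ‖x' - x‖^2 := by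
  have X0 := norm_pos_iff.2 x0
  have e := norm_sub_sq_real x' x
  have e1 : (‖x'‖ - ‖x‖ - ⟪‖x‖⁻¹ • x, x' - x⟫)*‖x‖ = (‖x' - x‖^2 - (‖x'‖ - ‖x‖)^2)/2 := by
    rw [real_inner_smul_left, inner_sub_right, real_inner_self_eq_norm_sq, e, real_inner_comm]; field_simp; ring
  have : (‖x'‖ - ‖x‖)^2 ≤ ‖x' - x‖^2 := by rw [← sq_abs]; exact pow_le_pow_left₀ (abs_nonneg _) (abs_norm_sub_norm_le _ _) 2
  have := sq_nonneg (‖x'‖ - ‖x‖)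
  have e2 := abs_mul (‖x'‖ - ‖x‖ - ⟪‖x‖⁻¹ • x, x' - x⟫) ‖x‖
  rw [abs_norm] at e2
  rw [← e2, e1, abs_le]; constructor <;> linarith
lemma nearp {γ δ X : ℝ} (g0 : 0 < γ) (g1 : γ ≤ 1/100) (d0 : 0 ≤ δ) (X0 : 0 < X) (X1 : X ≤ 1) (h : δ ≤ X^(1+2*γ)) : δ ≤ X*δ^γ := by
  rcases eq_or_lt_of_le d0 with e | e
  · rw [← e]; positivity
  have : δ = δ^(1-γ)*δ^γ := by rw [← Real.rpow_add e, sub_add_cancel, Real.rpow_one]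
  nth_rw 1 [this]
  refine mul_le_mul_of_nonneg_right ?_ (by positivity)
  refine (Real.rpow_le_rpow d0 h (by linarith)).trans ?_
  rw [← Real.rpow_mul X0.le]
  refine (pow_lo X0 X1 ?_).trans_eq (Real.rpow_one X)
  have := mul_le_mul_of_nonneg_left g1 g0.le
  linarith
set_option maxHeartbeats 1000000 in
lemma SHEET {S : Set V} {n : V} {K γ ρ : ℝ} (h : SG S n K γ ρ) (hS : (0:V) ∈ S) : ∃ u K' ρ', UF n u K' γ ρ' ∧ (∀ x, ⟪n, x⟫ = 0 → ‖x‖ ≤ ρ' → 0 ≤ ‖x‖ + u x ∧ x + (‖x‖ + u x) • n ∈ S) ∧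
    ∀ z ∈ S, ‖z‖ ≤ ρ' → 0 ≤ ⟪n, z⟫ → ⟪n, z⟫ = ‖pr n z‖ + u (pr n z) := by
  have hn := h.n1; have K1 := h.K1; have g0 := h.g0; have g1 := h.g1; have r0 := h.r0
  have tI : Tendsto (fun r : ℝ => r) (𝓝[>] 0) (𝓝 0) := tendsto_id.mono_left nhdsWithin_le_nhds
  obtain ⟨τ, t0, t1, hτ⟩ := ev_ex (((rp_t (show 0 < 15*γ by linarith) K (show (0:ℝ) < 1/100 by norm_num)).and (rp_t g0 K (show (0:ℝ) < 1/2 by norm_num))).and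
    ((rp_t (show 0 < 13*γ by linarith) (K^2) (show (0:ℝ) < 1/10 by norm_num)).and ((tI.eventually_le_const (show 0 < ρ/3 by linarith)).and (h.p2 (1/100) (by norm_num)))))
  obtain ⟨f, hf⟩ : ∃ f : V → ℝ, ∀ x, ⟪n, x⟫ = 0 → ‖x‖ ≤ τ/2 → 0 ≤ f x ∧ x + f x • n ∈ S ∧ |f x - ‖x‖| ≤ K*‖x‖^(15*γ)*‖x‖ ∧ ‖x + f x • n‖ ≤ ρ := by
    have : ∀ x, ∃ t, ⟪n, x⟫ = 0 → ‖x‖ ≤ τ/2 → 0 ≤ t ∧ x + t • n ∈ S ∧ |t - ‖x‖| ≤ K*‖x‖^(15*γ)*‖x‖ ∧ ‖x + t • n‖ ≤ ρ := fun x => by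
      rcases eq_or_ne x 0 with x0 | x0
      · refine ⟨0, fun _ _ => ⟨le_rfl, ?_⟩⟩
        simpa [x0, hS] using r0.le
      · by_cases hx : ⟪n, x⟫ = 0 ∧ ‖x‖ ≤ τ/2
        · have X0 := norm_pos_iff.2 x0
          obtain ⟨-, -, c3, c4⟩ := hτ ‖x‖ X0 (by linarith)
          obtain ⟨t, ta, tb, tc⟩ := EXS h hx.1 x0 (by linarith) (fun r q0 q1 => by
            obtain ⟨⟨c1, c2⟩, -⟩ := hτ r q0 (by linarith)
            exact ⟨c1, by linarith⟩) c4
          have nb : ‖x + t • n‖ ≤ ρ := by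
            refine (norm_add_le _ _).trans ?_
            rw [nsm_eq ta.le, hn]; linarith
          refine ⟨t, fun _ _ => ⟨ta.le, tc, ?_, nb⟩⟩
          have := h.c1 _ tc nb
          rwa [in_n hn hx.1, pr_x hn hx.1, abs_of_pos ta] at this
        · exact ⟨0, fun a b => absurd ⟨a, b⟩ hx⟩
    choose f hf using this
    exact ⟨f, hf⟩
  have fz : f 0 = 0 := by
    have := (hf 0 (inner_zero_right _) (by rw [norm_zero]; linarith)).2.2.1
    rw [norm_zero, mul_zero, sub_zero] at this
    exact abs_nonpos_iff.1 this
  have pos : ∀ (x : V) (t : ℝ), x ≠ 0 → ‖x‖ ≤ τ → |t - ‖x‖| ≤ K*‖x‖^(15*γ)*‖x‖ → 0 < t := fun x t x0 hx ht => by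
    have X0 := norm_pos_iff.2 x0
    have := mul_le_mul_of_nonneg_right (hτ _ X0 hx).1.1 X0.le
    linarith [(abs_le.1 ht).1]
  refine ⟨fun x => f x - ‖x‖, 50*K, τ/4, ⟨by linarith, by linarith, by linarith, fun x hx hxr => ?_, fun x hx x0 hxr => ?_⟩, fun x hx hxr => ?_, fun z hz hzr h0 => ?_⟩
  · exact (hf x hx (by linarith)).2.2.1.trans (by gcongr; linarith)
  · have X0 := norm_pos_iff.2 x0
    obtain ⟨⟨k1, k2⟩, k3, -⟩ := hτ _ X0 (by linarith)
    obtain ⟨-, f2, f3, f4⟩ := hf x hx (by linarith)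
    have fp := pos x _ x0 (by linarith) f3
    obtain ⟨L, La, L0, Lb, -⟩ := h.p3 _ f2 f4 (by rwa [in_n hn hx])
    rw [pr_x hn hx] at La Lb
    refine ⟨L - ‖x‖⁻¹ • x, La.trans (by gcongr; linarith only [K1]), fun x' hx' hd => ?_⟩
    have Xg := Real.rpow_pos_of_pos X0
    have X1 : ‖x‖ ≤ 1 := by linarith only [t1, hxr]
    have XX : ‖x‖^(1+2*γ) ≤ ‖x‖ := (pow_lo X0 X1 (by linarith only [g0])).trans_eq (Real.rpow_one _)
    have δ0 := norm_nonneg (x' - x)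
    have Kd : 0 ≤ (K-1)*‖x'-x‖ := mul_nonneg (by linarith only [K1]) δ0
    have d1 : ‖x' - x‖ ≤ ‖x‖^(1+2*γ) := by linarith only [hd, δ0, Kd]
    have x2 : ‖x'‖ ≤ 2*‖x‖ := by have := norm_le_norm_add_norm_sub' x' x; linarith only [X0, hd, XX, Kd, this]
    obtain ⟨-, F2, F3, -⟩ := hf x' hx' (by linarith only [hxr, x2])
    have u1 : ‖x'‖^(15*γ)*‖x'‖ ≤ (2*‖x‖^(15*γ))*(2*‖x‖) := mul_le_mul (rp_s (by linarith only [g0]) (by linarith) one_le_two (norm_nonneg _) X0.le x2) x2 (norm_nonneg _) (by positivity)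
    have u2 := mul_le_mul_of_nonneg_left u1 (show 0 ≤ K by linarith only [K1])
    have nx := abs_norm_sub_norm_le x' x
    have ed : x' + f x' • n - (x + f x • n) = (x' - x) + (f x' - f x) • n := by module
    have nA : |f x' - f x| ≤ ‖x' - x‖ + 5*(K*‖x‖^(15*γ)*‖x‖) := by
      have a1 := abs_le.1 f3; have a2 := abs_le.1 F3; have a3 := abs_le.1 nx
      rw [abs_le]; constructor <;> linarith [a1.1, a1.2, a2.1, a2.2, a3.1, a3.2]
    have ny : ‖(x' - x) + (f x' - f x) • n‖ ≤ ‖x' - x‖ + |f x' - f x| := (norm_add_le _ _).trans (by rw [norm_smul, hn, mul_one, Real.norm_eq_abs])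
    have p1 : ‖x‖^(15*γ) = ‖x‖^(13*γ)*‖x‖^(2*γ) := by rw [← Real.rpow_add X0]; congr 1; ring
    have p2 : ‖x‖^(1+2*γ) = ‖x‖^(2*γ)*‖x‖ := by rw [add_comm, Real.rpow_add X0, Real.rpow_one]
    have v1 := mul_le_mul_of_nonneg_right k3 (mul_pos (Xg (2*γ)) X0).le
    have v2 : K*(‖x' - x‖ + |f x' - f x|) ≤ ‖x‖^(1+2*γ) := by
      have w1 := mul_le_mul_of_nonneg_left nA (show 0 ≤ K by linarith only [K1])
      rw [p1] at w1; rw [p2] at hd ⊢; linarith only [hd, δ0, Kd, v1, w1]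
    have ob : ⟪n, x' - x⟫ = 0 := by rw [inner_sub_right, hx, hx', sub_self]
    have key := Lb _ F2 (by
      rw [ed]; exact (mul_le_mul_of_nonneg_left ny (show 0 ≤ K by linarith only [K1])).trans v2)
    have ei : ⟪n - L, (x' - x) + (f x' - f x) • n⟫ = f x' - f x - ⟪L, x' - x⟫ := by
      rw [inner_sub_left, in_n hn ob, inner_add_right, real_inner_smul_right, real_inner_comm n L, L0]; ring
    rw [ed, ei] at key
    obtain ⟨δ, hδ⟩ : ∃ δ, δ = ‖x' - x‖ := ⟨_, rfl⟩
    obtain ⟨A, hA⟩ : ∃ A, A = |f x' - f x| := ⟨_, rfl⟩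
    obtain ⟨D, hD⟩ : ∃ D, D = ‖(x' - x) + (f x' - f x) • n‖ := ⟨_, rfl⟩
    have D0 : 0 ≤ D := hD ▸ norm_nonneg _
    have A0 : 0 ≤ A := hA ▸ abs_nonneg _
    have LL : ‖L‖ ≤ 2 := by
      have := norm_le_norm_add_norm_sub' L (‖x‖⁻¹ • x)
      have : ‖‖x‖⁻¹ • x‖ = 1 := by rw [nsm_eq (inv_nonneg.2 X0.le), inv_mul_cancel₀ X0.ne']
      linarith
    have Li : |⟪L, x' - x⟫| ≤ 2*δ := (abs_real_inner_le_norm _ _).trans (by rw [hδ]; gcongr)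
    rw [← hD] at key ny
    rw [← hδ] at ny v2 δ0 d1
    rw [← hA] at ny v2
    have DX : D ≤ ‖x‖ := by
      have : 0 ≤ (K-1)*(δ+A) := mul_nonneg (by linarith only [K1]) (by linarith only [ny, D0])
      linarith only [XX, v2, ny, this]
    have Dg : K*D^γ ≤ 1/2 := (mul_le_mul_of_nonneg_left (Real.rpow_le_rpow D0 DX g0.le) (by linarith only [K1])).trans k2
    have A5 : A ≤ 5*δ := by
      have b1 := mul_le_mul_of_nonneg_right Dg D0
      have b2 := abs_sub_abs_le_abs_sub (f x' - f x) ⟪L, x' - x⟫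
      rw [← hA] at b2
      linarith only [ny, key, Li, b1, b2]
    have D6 : D ≤ 6*δ := by linarith only [ny, A5]
    have c1 := mul_le_mul (rp_s g0.le (by linarith only [g1]) (by norm_num) D0 δ0 D6) D6 D0 (by positivity)
    have c2 := mul_le_mul_of_nonneg_left c1 (show 0 ≤ K by linarith only [K1])
    have c3 : |‖x'‖ - ‖x‖ - ⟪‖x‖⁻¹ • x, x' - x⟫| ≤ δ^γ*δ := by
      refine le_of_mul_le_mul_right ((nrm_ex x0).trans ?_) X0
      rw [← hδ]
      have := mul_le_mul_of_nonneg_right (nearp g0 g1 δ0 X0 X1 d1) δ0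
      linarith only [this]
    have c4 : 0 ≤ (K-1)*(δ^γ*δ) := mul_nonneg (by linarith only [K1]) (by positivity)
    have c5 : 0 ≤ δ^γ*δ := by positivity
    have e9 : f x' - ‖x'‖ - (f x - ‖x‖) - ⟪L - ‖x‖⁻¹ • x, x' - x⟫ = (f x' - f x - ⟪L, x' - x⟫) - (‖x'‖ - ‖x‖ - ⟪‖x‖⁻¹ • x, x' - x⟫) := by rw [inner_sub_left]; ring
    rw [e9, ← hδ]
    refine (abs_sub _ _).trans ?_
    linarith only [key, c2, c3, c4, c5]
  · rw [add_sub_cancel]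
    obtain ⟨f1, f2, -⟩ := hf x hx (by linarith)
    exact ⟨f1, f2⟩
  · rw [add_sub_cancel]
    have c1 := h.c1 z hz (by have := (hτ τ t0 le_rfl).2.2.1; linarith)
    rw [abs_of_nonneg h0] at c1
    have pl := pr_le hn z
    rcases eq_or_ne (pr n z) 0 with e | e
    · rw [e, norm_zero, mul_zero, sub_zero] at c1
      rw [e, fz]; exact abs_nonpos_iff.1 c1
    · have X0 := norm_pos_iff.2 e
      obtain ⟨⟨k1, k2⟩, k3, k4, -⟩ := hτ _ X0 (by linarith)
      obtain ⟨f1, f2, f3, f4⟩ := hf _ (n_pr hn z) (by linarith only [hzr, pl, X0])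
      have := hτ τ t0 le_rfl
      exact UNQ h (n_pr hn z) e (pos _ _ e (by linarith only [hzr, pl, X0]) c1) (pos _ _ e (by linarith only [hzr, pl, X0]) f3) (by rwa [← pr_dec]) f2 (by rw [← pr_dec]; linarith only [hzr, pl, X0, this]) f4 (by linarith only [k1]) (by linarith only [k3]) k2
lemma rad {x x' : V} (x0 : x ≠ 0) : ‖‖x'‖⁻¹ • x' - ‖x‖⁻¹ • x‖ * ‖x‖ ≤ 2*‖x' - x‖ ∧ ‖‖x'‖⁻¹ • x'‖ ≤ 1 ∧
    ‖(‖x'‖⁻¹ • x' - ‖x‖⁻¹ • x) - ‖x‖⁻¹ • ((x' - x) - ⟪‖x‖⁻¹ • x, x' - x⟫ • (‖x‖⁻¹ • x))‖ * ‖x‖^2 ≤ 3*‖x' - x‖^2 := by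
  have X0 := norm_pos_iff.2 x0
  have ee := nrm_ex (x' := x') x0
  have nx := abs_norm_sub_norm_le x' x
  have e1 : ‖‖x‖⁻¹ • x‖ = 1 := by rw [nsm_eq (inv_nonneg.2 X0.le), inv_mul_cancel₀ X0.ne']
  have h1 : ‖x‖ • (‖x‖⁻¹ • x) = x := smul_inv_smul₀ X0.ne' _
  have h2 : ‖x'‖ • (‖x'‖⁻¹ • x') = x' := by
    rcases eq_or_ne x' 0 with e | e
    · simp [e]
    · exact smul_inv_smul₀ (norm_pos_iff.2 e).ne' _
  have e2 : ‖‖x'‖⁻¹ • x'‖ ≤ 1 := by rw [nsm_eq (inv_nonneg.2 (norm_nonneg _))]; exact inv_mul_le_one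
  set e := ‖x‖⁻¹ • x
  set e' := ‖x'‖⁻¹ • x'
  set X := ‖x‖
  set X' := ‖x'‖
  have a1 : ‖e' - e‖ * X ≤ 2*‖x' - x‖ := by
    rw [mul_comm, ← nsm_eq X0.le]
    have : X • (e' - e) = (x' - x) - (X' - X) • e' := by rw [← h1, ← h2]; module
    rw [this]
    have : ‖(X' - X) • e'‖ ≤ ‖x' - x‖*1 := by rw [norm_smul]; exact mul_le_mul nx e2 (norm_nonneg _) (norm_nonneg _)
    exact (norm_sub_le _ _).trans (by linarith)
  refine ⟨a1, e2, ?_⟩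
  have h3 : X • ((e' - e) - X⁻¹ • ((x' - x) - ⟪e, x' - x⟫ • e)) = (-(X' - X)) • (e' - e) - (X' - X - ⟪e, x' - x⟫) • e := by
    rw [smul_sub, smul_inv_smul₀ X0.ne']
    generalize ⟪e, x' - x⟫ = q
    rw [← h1, ← h2]; module
  have h4 : ‖(e' - e) - X⁻¹ • ((x' - x) - ⟪e, x' - x⟫ • e)‖ * X = ‖(-(X' - X)) • (e' - e) - (X' - X - ⟪e, x' - x⟫) • e‖ := by rw [← h3, nsm_eq X0.le, mul_comm]
  rw [pow_two X, ← mul_assoc, h4]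
  have h5 : ‖(-(X' - X)) • (e' - e) - (X' - X - ⟪e, x' - x⟫) • e‖ ≤ ‖x' - x‖*‖e' - e‖ + |X' - X - ⟪e, x' - x⟫| := by
    refine (norm_sub_le _ _).trans (add_le_add ?_ ?_)
    · rw [norm_smul, norm_neg]; exact mul_le_mul_of_nonneg_right nx (norm_nonneg _)
    · rw [norm_smul, e1, mul_one, Real.norm_eq_abs]
  have := mul_le_mul_of_nonneg_right h5 X0.le
  have := mul_le_mul_of_nonneg_left a1 (norm_nonneg (x' - x))
  linarith
structure GF (n : V) (g : V → V) (K γ ρ : ℝ) : Prop where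
  K1 : 1 ≤ K
  r0 : 0 < ρ
  r1 : ρ ≤ 1
  gr : ∀ x, ⟪n, x⟫ = 0 → ‖x‖ ≤ ρ → ‖g x‖ ≤ K*‖x‖^(15*γ)*‖x‖
  ex : ∀ x, ⟪n, x⟫ = 0 → ‖x‖ ≤ ρ → ∃ A : V →L[ℝ] V, ‖A‖ ≤ K*‖x‖^γ ∧ ∀ x', ⟪n, x'⟫ = 0 → K*‖x' - x‖ ≤ ‖x‖^(1+2*γ) →
    ‖g x' - g x - A (x' - x)‖ ≤ K*‖x' - x‖^γ*‖x' - x‖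
lemma MKGF {n : V} {a b : V → ℝ} {K γ ρ : ℝ} (hn : ‖n‖ = 1) (ha : UF n a K γ ρ) (hb : UF n b K γ ρ) (g0 : 0 < γ) (g1 : γ ≤ 1/100) :
    GF n (fun x => b x • (‖x‖⁻¹ • x) - a x • n) (10*K) γ ρ := by
  have K1 := ha.K1
  have e1 : ∀ x : V, ‖‖x‖⁻¹ • x‖ ≤ 1 := fun x => by rw [nsm_eq (inv_nonneg.2 (norm_nonneg _))]; exact inv_mul_le_one
  refine ⟨by linarith, ha.r0, ha.r1, fun x hx hxr => ?_, fun x hx hxr => ?_⟩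
  · have q1 := ha.gr x hx hxr; have q2 := hb.gr x hx hxr
    refine (norm_sub_le _ _).trans ?_
    have q3 : ‖b x • (‖x‖⁻¹ • x)‖ ≤ |b x| * 1 := by rw [norm_smul]; exact mul_le_mul_of_nonneg_left (e1 x) (abs_nonneg _)
    have q4 : ‖a x • n‖ = |a x| := by rw [norm_smul, hn, mul_one, Real.norm_eq_abs]
    have : 0 ≤ K*‖x‖^(15*γ)*‖x‖ := by positivity
    linarith
  rcases eq_or_ne x 0 with x0 | x0
  · refine ⟨0, by rw [norm_zero]; positivity, fun x' _ hd => ?_⟩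
    rw [x0, norm_zero, Real.zero_rpow (by linarith), sub_zero] at hd
    have : ‖x'‖ ≤ 0 := le_of_mul_le_mul_left (by rwa [mul_zero]) (show 0 < 10*K by linarith)
    have : x' = 0 := norm_le_zero_iff.1 this
    rw [this, x0]; simp
  have X0 := norm_pos_iff.2 x0
  obtain ⟨L, L1, L2⟩ := hb.ex x hx x0 hxr
  obtain ⟨M, M1, M2⟩ := ha.ex x hx x0 hxr
  have bx := hb.gr x hx hxr
  have X1 : ‖x‖ ≤ 1 := hxr.trans ha.r1
  have l1 : ‖x‖^(15*γ) ≤ ‖x‖^γ := pow_lo X0 X1 (by linarith)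
  have l2 : ‖x‖^γ ≤ 1 := Real.rpow_le_one X0.le X1 g0.le
  have l0 := Real.rpow_pos_of_pos X0 γ
  have u1 : ‖‖x‖⁻¹ • x‖ = 1 := by rw [nsm_eq (inv_nonneg.2 X0.le), inv_mul_cancel₀ X0.ne']
  have bx' : |b x| * ‖x‖⁻¹ ≤ K*‖x‖^γ := by
    rw [← div_eq_mul_inv, div_le_iff₀ X0]; refine bx.trans ?_; gcongr
  have rd := fun x' => rad (x' := x') x0
  set e := ‖x‖⁻¹ • x with he
  set X := ‖x‖ with hX
  have inl : ∀ (L d : V) (c : ℝ), ‖L‖ ≤ c → |⟪L, d⟫| ≤ c*‖d‖ := fun L d c hc => (abs_real_inner_le_norm _ _).trans (mul_le_mul_of_nonneg_right hc (norm_nonneg _))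
  set A : V →L[ℝ] V := (innerSL ℝ L).smulRight e + (b x*X⁻¹) • (ContinuousLinearMap.id ℝ V - (innerSL ℝ e).smulRight e) - (innerSL ℝ M).smulRight n with hA
  have Av : ∀ d, A d = ⟪L, d⟫ • e + (b x*X⁻¹) • (d - ⟪e, d⟫ • e) - ⟪M, d⟫ • n := fun d => by simp [hA]
  clear_value A e X
  refine ⟨A, A.opNorm_le_bound (by positivity) fun d => ?_, fun x' hx' hd => ?_⟩
  · rw [Av]
    have i1 := inl L d _ L1; have i2 := inl M d _ M1; have i3 := inl e d 1 u1.le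
    have j1 : ‖d - ⟪e, d⟫ • e‖ ≤ 2*‖d‖ := (norm_sub_le _ _).trans (by rw [norm_smul, u1, Real.norm_eq_abs]; linarith only [i3])
    have j2 : ‖(b x*X⁻¹) • (d - ⟪e, d⟫ • e)‖ ≤ K*X^γ*(2*‖d‖) := by
      rw [norm_smul, Real.norm_eq_abs, abs_mul, abs_of_pos (inv_pos.2 X0)]; exact mul_le_mul bx' j1 (norm_nonneg _) (by positivity)
    have j3 : ‖⟪L, d⟫ • e‖ = |⟪L, d⟫| := by rw [norm_smul, u1, mul_one, Real.norm_eq_abs]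
    have j4 : ‖⟪M, d⟫ • n‖ = |⟪M, d⟫| := by rw [norm_smul, hn, mul_one, Real.norm_eq_abs]
    have : 0 ≤ K*X^γ*‖d‖ := by positivity
    refine (norm_sub_le _ _).trans ?_
    have := norm_add_le (⟪L, d⟫ • e) ((b x*X⁻¹) • (d - ⟪e, d⟫ • e))
    linarith
  · obtain ⟨r1, r2, r3⟩ := rd x'
    have d0 := norm_nonneg (x' - x)
    have Kd : 0 ≤ (K-1)*‖x'-x‖ := mul_nonneg (by linarith only [K1]) d0
    have dX : ‖x' - x‖ ≤ X^(1+2*γ) := by linarith only [hd, d0, Kd]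
    have hd' : K*‖x' - x‖ ≤ X^(1+2*γ) := by linarith only [hd, d0, Kd]
    have np := nearp g0 g1 d0 X0 X1 dX
    have f1 := L2 x' hx' hd'; have f2 := M2 x' hx' hd'
    have i1 := inl L (x' - x) _ L1
    rw [Av]
    have eq : b x' • (‖x'‖⁻¹ • x') - a x' • n - (b x • e - a x • n) - (⟪L, x' - x⟫ • e + (b x*X⁻¹) • (x' - x - ⟪e, x' - x⟫ • e) - ⟪M, x' - x⟫ • n)
      = (b x' - b x - ⟪L, x' - x⟫) • (‖x'‖⁻¹ • x') + ⟪L, x' - x⟫ • (‖x'‖⁻¹ • x' - e) + b x • ((‖x'‖⁻¹ • x' - e) - X⁻¹ • ((x' - x) - ⟪e, x' - x⟫ • e)) - (a x' - a x - ⟪M, x' - x⟫) • n := by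
      generalize ⟪L, x' - x⟫ = q1; generalize ⟪M, x' - x⟫ = q2; generalize ⟪e, x' - x⟫ = q3; generalize ‖x'‖⁻¹ • x' = q4
      module
    rw [eq]
    set R := (‖x'‖⁻¹ • x' - e) - X⁻¹ • ((x' - x) - ⟪e, x' - x⟫ • e)
    set e' := ‖x'‖⁻¹ • x'
    set q := b x' - b x - ⟪L, x' - x⟫
    set p := a x' - a x - ⟪M, x' - x⟫
    set l := ⟪L, x' - x⟫
    set δ := ‖x' - x‖
    clear_value R e' q p l δ
    have t1 : ‖q • e'‖ ≤ K*δ^γ*δ := by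
      rw [norm_smul, Real.norm_eq_abs]; exact (mul_le_of_le_one_right (abs_nonneg _) r2).trans f1
    have npd := mul_le_mul_of_nonneg_right np d0
    have t2 : ‖l • (e' - e)‖ ≤ 2*(K*δ^γ*δ) := by
      rw [norm_smul, Real.norm_eq_abs]
      refine le_of_mul_le_mul_right ?_ X0
      rw [mul_assoc]
      refine (mul_le_mul i1 r1 (by positivity) (by positivity)).trans ?_
      have s1 := mul_le_mul_of_nonneg_left npd (show 0 ≤ 2*K*X^γ by positivity)
      have s2 := mul_le_mul_of_nonneg_left l2 (show 0 ≤ 2*K*(X*δ^γ*δ) by positivity)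
      linarith only [s1, s2]
    have t3 : ‖b x • R‖ ≤ 3*(K*δ^γ*δ) := by
      rw [norm_smul, Real.norm_eq_abs]
      refine le_of_mul_le_mul_right ?_ (pow_pos X0 2)
      rw [mul_assoc]
      have bk : |b x| ≤ K*X := bx.trans (by
        have := mul_le_mul_of_nonneg_right (l1.trans l2) (show 0 ≤ K*X by positivity)
        linarith only [this])
      refine (mul_le_mul bk r3 (by positivity) (by positivity)).trans ?_
      have s1 := mul_le_mul_of_nonneg_left npd (show 0 ≤ 3*K*X by positivity)
      linarith only [s1]
    have t4 : ‖p • n‖ ≤ K*δ^γ*δ := by rw [norm_smul, hn, mul_one]; exact f2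
    refine (norm_sub_le _ _).trans ?_
    have := norm_add₃_le (a := q • e') (b := l • (e' - e)) (c := b x • R)
    have : 0 ≤ K*δ^γ*δ := by positivity
    linarith
lemma GLUE {n : V} {g : V → V} {K γ ρ : ℝ} (hn : ‖n‖ = 1) (h : GF n g K γ ρ) (g0 : 0 < γ) (g1 : γ ≤ 1/100) :
    ∃ K' ρ', ∃ B : V → V →L[ℝ] V, 1 ≤ K' ∧ 0 < ρ' ∧ ρ' ≤ ρ ∧ g 0 = 0 ∧ B 0 = 0 ∧ ∀ x y : V, ‖x‖ ≤ ρ' → ‖y‖ ≤ ρ' →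
      ‖g (pr n y) - g (pr n x) - B x (y - x)‖ ≤ K'*‖y - x‖^(γ/2)*‖y - x‖ := by
  have K1 := h.K1
  have K0 : 0 < K := by linarith
  have z0 : g 0 = 0 := by
    have := h.gr 0 (inner_zero_right _) (by rw [norm_zero]; exact h.r0.le)
    rw [norm_zero, mul_zero] at this; exact norm_le_zero_iff.1 this
  have hA : ∀ x, ∃ A : V →L[ℝ] V, ⟪n, x⟫ = 0 → ‖x‖ ≤ ρ → ‖A‖ ≤ K*‖x‖^γ ∧ ∀ x', ⟪n, x'⟫ = 0 → K*‖x' - x‖ ≤ ‖x‖^(1+2*γ) →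
    ‖g x' - g x - A (x' - x)‖ ≤ K*‖x' - x‖^γ*‖x' - x‖ := fun x => by
    by_cases hx : ⟪n, x⟫ = 0 ∧ ‖x‖ ≤ ρ
    · obtain ⟨A, a⟩ := h.ex x hx.1 hx.2; exact ⟨A, fun _ _ => a⟩
    · exact ⟨0, fun a b => absurd ⟨a, b⟩ hx⟩
  choose A hA using hA
  set r := min ρ (1/(2*K)) with hr
  have r0 : 0 < r := lt_min h.r0 (by positivity)
  have rK : K*(2*r) ≤ 1 := by
    have := mul_le_mul_of_nonneg_left (min_le_right ρ (1/(2*K))) (show 0 ≤ 2*K by linarith)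
    rw [mul_one_div_cancel (by positivity)] at this; linarith
  have rr : r ≤ ρ := min_le_left _ _
  have key : ∀ x x' : V, ⟪n, x⟫ = 0 → ⟪n, x'⟫ = 0 → ‖x‖ ≤ r → ‖x'‖ ≤ r → ‖g x' - g x - A x (x' - x)‖ ≤ 6*K^3*‖x' - x‖^(γ/2)*‖x' - x‖ := by
    intro x x' hx hx' xr xr'
    obtain ⟨a1, a2⟩ := hA x hx (xr.trans rr)
    have d1 : ‖x' - x‖ ≤ 2*r := (norm_sub_le _ _).trans (by linarith)
    have Kd : K*‖x' - x‖ ≤ 1 := (mul_le_mul_of_nonneg_left d1 K0.le).trans rK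
    have X' : ‖x'‖ ≤ ‖x‖ + ‖x' - x‖ := by have := norm_add_le x (x' - x); rwa [add_sub_cancel] at this
    have b1 := h.gr x hx (xr.trans rr); have b2 := h.gr x' hx' (xr'.trans rr)
    have al := (A x).le_opNorm (x' - x)
    have d0 := norm_nonneg (x' - x)
    have K3 : K ≤ K^3 := le_self_pow₀ K1 (by norm_num)
    by_cases hc : K*‖x' - x‖ ≤ ‖x‖^(1+2*γ)
    · refine (a2 x' hx' hc).trans ?_
      rcases d0.eq_or_lt with e | d0
      · rw [← e]; simp
      have dd : ‖x' - x‖ ≤ 1 := by have := mul_le_mul_of_nonneg_right K1 d0.le; linarith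
      have := pow_lo d0 dd (show γ/2 ≤ γ by linarith)
      gcongr; linarith only [K1, K3]
    · push Not at hc
      have nn := norm_nonneg x; have nn' := norm_nonneg x'
      have tri : ‖g x' - g x - A x (x' - x)‖ ≤ ‖g x'‖ + ‖g x‖ + ‖A x (x' - x)‖ := (norm_sub_le _ _).trans (add_le_add_left (norm_sub_le _ _) _)
      refine tri.trans ?_
      set δ := ‖x' - x‖
      set X := ‖x‖
      set Y := ‖x'‖
      clear_value δ X Y
      have kd0 : 0 < K*δ := (Real.rpow_nonneg nn _).trans_lt hc
      have d0 : 0 < δ := pos_of_mul_pos_right kd0 K0.le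
      set p := (1+2*γ)⁻¹ with hp
      have pp : 0 < 1+2*γ := by linarith
      have p0 : 0 < p := inv_pos.2 pp
      have p1 : p ≤ 1 := inv_le_one_of_one_le₀ (by linarith)
      have pe : p*(1+2*γ) = 1 := inv_mul_cancel₀ pp.ne'
      clear_value p
      set ξ := (K*δ)^p with hξ
      have x0 : 0 < ξ := Real.rpow_pos_of_pos kd0 _
      have f1 : X ≤ ξ := by
        have := Real.rpow_le_rpow (Real.rpow_nonneg nn _) hc.le p0.le
        rwa [← Real.rpow_mul nn, mul_comm (1+2*γ), pe, Real.rpow_one] at this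
      have f2 : K*δ ≤ ξ := by have := pow_lo kd0 Kd p1; rwa [Real.rpow_one] at this
      have f3 : δ ≤ K*δ := by have := mul_le_mul_of_nonneg_right K1 d0.le; linarith only [this]
      have f4 : Y ≤ 2*ξ := by linarith
      have pe' : p*γ ≤ 1*γ := mul_le_mul_of_nonneg_right p1 g0.le
      have pg : (9/10)*γ ≤ p*γ := mul_le_mul_of_nonneg_right (by linarith) g0.le
      have g2 : (K*δ)^(γ/2) ≤ K*δ^(γ/2) := by
        rw [Real.mul_rpow K0.le d0.le]
        have := Real.rpow_le_rpow_of_exponent_le K1 (show γ/2 ≤ 1 by linarith only [g1])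
        rw [Real.rpow_one] at this; gcongr
      have g3 : ξ^γ ≤ K*δ^(γ/2) := by
        rw [hξ, ← Real.rpow_mul kd0.le]
        exact (pow_lo kd0 Kd (by linarith only [g0, pg])).trans g2
      have g4 : ξ^(15*γ)*ξ ≤ K^2*(δ^(γ/2)*δ) := by
        have e1 : ξ^(15*γ)*ξ = (K*δ)^(p*(1+15*γ)) := by
          rw [Real.rpow_mul kd0.le, ← hξ, add_comm, Real.rpow_add x0, Real.rpow_one]
        have e2 := pow_lo kd0 Kd (show γ/2+1 ≤ p*(1+15*γ) by linarith only [g0, pe, pg])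
        rw [Real.rpow_add kd0, Real.rpow_one] at e2
        rw [e1]; refine e2.trans ?_
        have := mul_le_mul_of_nonneg_right g2 kd0.le
        linarith only [this]
      have b3 : K*X^(15*γ)*X ≤ K*(K^2*(δ^(γ/2)*δ)) := by
        rw [mul_assoc]; refine mul_le_mul_of_nonneg_left (le_trans ?_ g4) K0.le; gcongr
      have b4 : K*Y^(15*γ)*Y ≤ 4*(K*(K^2*(δ^(γ/2)*δ))) := by
        have c1 := rp_s (b := 15*γ) (by linarith only [g0]) (by linarith only [g1]) (by norm_num : (1:ℝ) ≤ 2) nn' x0.le f4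
        have c2 : Y^(15*γ)*Y ≤ (2*ξ^(15*γ))*(2*ξ) := mul_le_mul c1 f4 nn' (by positivity)
        have c3 := mul_le_mul_of_nonneg_left c2 K0.le
        have c4 := mul_le_mul_of_nonneg_left g4 K0.le
        linarith only [c3, c4]
      have b5 : K*X^γ*δ ≤ K*(K*δ^(γ/2))*δ := by
        have : X^γ ≤ ξ^γ := by gcongr
        have := this.trans g3
        gcongr
      have b6 : ‖A x‖*δ ≤ K*X^γ*δ := mul_le_mul_of_nonneg_right a1 d0.le
      have b7 : K*(K*δ^(γ/2))*δ ≤ K^3*(δ^(γ/2)*δ) := by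
        have : K^2 ≤ K^3 := pow_le_pow_right₀ K1 (by norm_num)
        have := mul_le_mul_of_nonneg_right this (show 0 ≤ δ^(γ/2)*δ by positivity)
        linarith only [this]
      linarith
  have A0 : A 0 = 0 := by
    have := (hA 0 (inner_zero_right _) (by rw [norm_zero]; exact h.r0.le)).1
    rw [norm_zero, Real.zero_rpow g0.ne', mul_zero] at this; exact norm_le_zero_iff.1 this
  have p0 : pr n 0 = 0 := by simp [pr]
  refine ⟨6*K^3, r, fun x => (A (pr n x)).comp (ContinuousLinearMap.id ℝ V - (innerSL ℝ n).smulRight n), ?_, r0, rr, z0, ?_, fun x y hx hy => ?_⟩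
  · have := one_le_pow₀ K1 (n := 3); linarith
  · show (A (pr n 0)).comp _ = 0
    rw [p0, A0, ContinuousLinearMap.zero_comp]
  · have k := key (pr n x) (pr n y) (n_pr hn x) (n_pr hn y) ((pr_le hn x).trans hx) ((pr_le hn y).trans hy)
    have e1 : (A (pr n x)).comp (ContinuousLinearMap.id ℝ V - (innerSL ℝ n).smulRight n) (y - x) = A (pr n x) (pr n y - pr n x) := by
      rw [← pr_sub]; simp [pr]
    rw [e1]; refine k.trans ?_
    have : ‖pr n y - pr n x‖ ≤ ‖y - x‖ := by rw [← pr_sub]; exact pr_le hn _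
    gcongr
lemma TINV {B : V →L[ℝ] V} (hB : ‖B‖ ≤ 1/2) : ∃ T : V ≃L[ℝ] V, (T : V →L[ℝ] V) = ContinuousLinearMap.id ℝ V + B ∧ ∀ v, ‖T.symm v‖ ≤ 2*‖v‖ := by
  have key : ∀ w, ‖w‖ ≤ 2*‖w + B w‖ := fun w => by
    have h1 := (B.le_opNorm w).trans (mul_le_mul_of_nonneg_right hB (norm_nonneg w))
    have h2 := norm_sub_le (w + B w) (B w)
    rw [add_sub_cancel_right] at h2; linarith
  have inj : Function.Injective ((ContinuousLinearMap.id ℝ V + B : V →L[ℝ] V) : V →ₗ[ℝ] V) := by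
    refine (injective_iff_map_eq_zero _).2 fun w hw => ?_
    have hw : w + B w = 0 := hw
    have := key w
    rw [hw, norm_zero, mul_zero] at this; exact norm_le_zero_iff.1 this
  refine ⟨(LinearEquiv.ofInjectiveEndo _ inj).toContinuousLinearEquiv, by ext v; rfl, fun v => ?_⟩
  set T := (LinearEquiv.ofInjectiveEndo _ inj).toContinuousLinearEquiv
  have e : T (T.symm v) = T.symm v + B (T.symm v) := rfl
  rw [T.apply_symm_apply] at e
  have := key (T.symm v)
  rwa [← e] at this
lemma PC {β K ρ : ℝ} {H : V → V} {B : V → V →L[ℝ] V} (b0 : 0 < β) (b1 : β ≤ 1) (K1 : 1 ≤ K) (r0 : 0 < ρ) (H0 : H 0 = 0) (B0 : B 0 = 0)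
    (h : ∀ x y : V, ‖x‖ ≤ ρ → ‖y‖ ≤ ρ → ‖H y - H x - B x (y - x)‖ ≤ K*‖y - x‖^β*‖y - x‖) (x0 : V) {r1 : ℝ} (h1 : 0 < r1) :
    ∃ r, 0 < r ∧ r ≤ r1 ∧ ∃ U φ, IsOpen U ∧ (0:V) ∈ U ∧ U = (fun X => (X - x0) + H (X - x0)) '' ball x0 r ∧ IsC1HolderDiffeoOn β U (ball x0 r) φ ∧
      (∀ X ∈ ball x0 r, φ ((X - x0) + H (X - x0)) = X) ∧ φ 0 = x0 ∧ fderiv ℝ φ 0 = ContinuousLinearMap.id ℝ V := by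
  have K0 : 0 < K := by linarith
  have hol : ∀ x y : V, ‖x‖ ≤ ρ/3 → ‖y‖ ≤ ρ/3 → ‖B x - B y‖ ≤ 6*K*‖x - y‖^β := by
    intro x y hx hy
    rcases eq_or_ne x y with e | e
    · rw [e, sub_self, norm_zero]; positivity
    have d0 : 0 < ‖y - x‖ := norm_pos_iff.2 (sub_ne_zero.2 e.symm)
    have d1 : ‖y - x‖ ≤ 2*(ρ/3) := (norm_sub_le _ _).trans (by linarith)
    rw [norm_sub_rev x y]
    refine ContinuousLinearMap.opNorm_le_of_unit_norm (by positivity) fun v hv => ?_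
    set δ := ‖y - x‖ with hδ
    have nv : ‖δ • v‖ = δ := by rw [nsm_eq d0.le, hv, mul_one]
    have hz : ‖y + δ • v‖ ≤ ρ := (norm_add_le _ _).trans (by linarith)
    have t1 := h y (y + δ • v) (by linarith) hz
    have t2 := h x (y + δ • v) (by linarith) hz
    have t3 := h x y (by linarith) (by linarith)
    have nz : ‖y + δ • v - x‖ ≤ 2*δ := by
      rw [show y + δ • v - x = (y - x) + δ • v by abel]; exact (norm_add_le _ _).trans (by linarith only [nv])
    have t4 := rp_s b0.le b1 (by norm_num : (1:ℝ) ≤ 2) (norm_nonneg _) d0.le nz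
    have t5 : K*‖y + δ • v - x‖^β*‖y + δ • v - x‖ ≤ K*(2*δ^β)*(2*δ) := by gcongr
    rw [add_sub_cancel_left, nv] at t1
    rw [← hδ] at t3
    have eq : (δ • ((B x - B y) v) : V) = (H (y + δ • v) - H y - B y (δ • v)) - (H (y + δ • v) - H x - B x (y + δ • v - x)) + (H y - H x - B x (y - x)) := by
      rw [sub_apply, show y + δ • v - x = (y - x) + δ • v by abel, map_add, map_smul, map_smul]; module
    have : δ*‖(B x - B y) v‖ ≤ δ*(6*K*δ^β) := by
      rw [← nsm_eq d0.le, eq]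
      refine (norm_add_le _ _).trans ?_
      have := norm_sub_le (H (y + δ • v) - H y - B y (δ • v)) (H (y + δ • v) - H x - B x (y + δ • v - x))
      linarith only [t1, t2, t3, t5, this]
    exact le_of_mul_le_mul_left this d0
  have der : ∀ x : V, ‖x‖ < ρ → HasFDerivAt H (B x) x := by
    intro x hx
    refine HasFDerivAt.of_isLittleO (Asymptotics.isLittleO_iff.2 fun c hc => ?_)
    have c1 : Tendsto (fun y => K*‖y - x‖^β) (𝓝 x) (𝓝 0) := by
      have : Continuous fun y : V => K*‖y - x‖^β := by
        refine continuous_const.mul (Continuous.rpow_const (by fun_prop) fun _ => Or.inr b0.le)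
      have := this.tendsto x
      simpa [Real.zero_rpow b0.ne'] using this
    have c2 : ∀ᶠ y : V in 𝓝 x, ‖y‖ < ρ := continuous_norm.continuousAt.eventually_lt_const hx
    filter_upwards [c1.eventually_le_const hc, c2] with y y1 y2
    exact (h x y hx.le y2.le).trans (mul_le_mul_of_nonneg_right y1 (norm_nonneg _))
  obtain ⟨r, hr⟩ := ((rp_t b0 (6*K) (by norm_num : (0:ℝ) < 1/2)).and (Ioc_mem_nhdsGT (lt_min h1 (show 0 < ρ/3 by linarith)))).exists
  obtain ⟨rs, rp, rm⟩ := hr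
  have rr1 := rm.trans (min_le_left _ _); have rr := rm.trans (min_le_right _ _)
  have Bs : ∀ x : V, ‖x‖ < r → ‖B x‖ ≤ 1/2 := fun x hx => by
    have := hol x 0 (by linarith) (by rw [norm_zero]; linarith)
    rw [B0, sub_zero, sub_zero] at this
    refine this.trans (le_trans ?_ rs); gcongr
  set ψ : V → V := fun X => (X - x0) + H (X - x0) with hψ
  have mb : ∀ X ∈ ball x0 r, ‖X - x0‖ < r := fun X hX => mem_ball_iff_norm.1 hX
  have dψ : ∀ X ∈ ball x0 r, HasFDerivAt ψ (ContinuousLinearMap.id ℝ V + B (X - x0)) X := fun X hX => by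
    have i1 : HasFDerivAt (fun X : V => X - x0) (ContinuousLinearMap.id ℝ V) X := (hasFDerivAt_id X).sub_const x0
    exact i1.add ((der (X - x0) (by linarith [mb X hX])).comp X i1)
  have lip : ∀ X ∈ ball x0 r, ∀ Y ∈ ball x0 r, ‖H (X - x0) - H (Y - x0)‖ ≤ 1/2*‖X - Y‖ := fun X hX Y hY => by
    have := (convex_ball (0:V) r).norm_image_sub_le_of_norm_hasFDerivWithin_le (f := H) (f' := B) (C := 1/2)
      (fun x hx => (der x (by have := mem_ball_zero_iff.1 hx; linarith)).hasFDerivWithinAt) (fun x hx => Bs x (mem_ball_zero_iff.1 hx))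
      (mem_ball_zero_iff.2 (mb Y hY)) (mem_ball_zero_iff.2 (mb X hX))
    rwa [sub_sub_sub_cancel_right] at this
  have ap : ApproximatesLinearOn ψ ((ContinuousLinearEquiv.refl ℝ V : V ≃L[ℝ] V) : V →L[ℝ] V) (ball x0 r) (1/2) := fun X hX Y hY => by
    have e : ψ X - ψ Y - ((ContinuousLinearEquiv.refl ℝ V : V ≃L[ℝ] V) : V →L[ℝ] V) (X - Y) = H (X - x0) - H (Y - x0) := by
      show (X - x0 + H (X - x0)) - (Y - x0 + H (Y - x0)) - (X - Y) = _
      abel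
    rw [e]; simpa using lip X hX Y hY
  have hc : Subsingleton V ∨ (1/2 : NNReal) < ‖(((ContinuousLinearEquiv.refl ℝ V).symm : V ≃L[ℝ] V) : V →L[ℝ] V)‖₊⁻¹ := by
    right
    have : ‖(((ContinuousLinearEquiv.refl ℝ V).symm : V ≃L[ℝ] V) : V →L[ℝ] V)‖₊ ≤ 1 := ContinuousLinearMap.norm_id_le
    have h2 : (1/2 : NNReal) < 1 := by rw [← NNReal.coe_lt_coe]; norm_num
    rcases eq_or_ne ‖(((ContinuousLinearEquiv.refl ℝ V).symm : V ≃L[ℝ] V) : V →L[ℝ] V)‖₊ 0 with e | e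
    · exfalso
      have := ContinuousLinearMap.norm_id (𝕜 := ℝ) (E := V)
      have e' : ‖ContinuousLinearMap.id ℝ V‖₊ = 0 := e
      have e2 : ‖ContinuousLinearMap.id ℝ V‖ = 0 := by rw [← coe_nnnorm, e']; rfl
      rw [this] at e2; exact one_ne_zero e2
    · exact h2.trans_le ((one_le_inv₀ (pos_iff_ne_zero.2 e)).2 this)
  set P := ap.toOpenPartialHomeomorph ψ (ball x0 r) hc isOpen_ball with hP
  have Ps : P.source = ball x0 r := rfl
  have Pt : P.target = ψ '' ball x0 r := rfl
  have Pc : ∀ X, P X = ψ X := fun X => rfl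
  clear_value P
  have x0m : x0 ∈ ball x0 r := mem_ball_self rp
  have ψ0 : ψ x0 = 0 := by simp [hψ, H0]
  have li : ∀ X ∈ ball x0 r, P.symm (ψ X) = X := fun X hX => by rw [← Pc]; exact P.left_inv (by rwa [Ps])
  have ri : ∀ Y ∈ P.target, ψ (P.symm Y) = Y := fun Y hY => by rw [← Pc]; exact P.right_inv hY
  have ms : ∀ Y ∈ P.target, P.symm Y ∈ ball x0 r := fun Y hY => by rw [← Ps]; exact P.map_target hY
  have mt : ∀ X ∈ ball x0 r, ψ X ∈ P.target := fun X hX => by rw [Pt]; exact mem_image_of_mem _ hX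
  have z0 : (0:V) ∈ P.target := by rw [← ψ0]; exact mt _ x0m
  have T' : ∀ Y ∈ P.target, ∃ T : V ≃L[ℝ] V, (T : V →L[ℝ] V) = ContinuousLinearMap.id ℝ V + B (P.symm Y - x0) ∧ (∀ v, ‖T.symm v‖ ≤ 2*‖v‖) ∧
      HasFDerivAt P.symm (T.symm : V →L[ℝ] V) Y := fun Y hY => by
    obtain ⟨T, T1, T2⟩ := TINV (Bs _ (mb _ (ms Y hY)))
    refine ⟨T, T1, T2, P.hasFDerivAt_symm hY ?_⟩
    rw [T1, show (P : V → V) = ψ from funext Pc]; exact dψ _ (ms Y hY)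
  refine ⟨r, rp, rr1, P.target, P.symm, P.open_target, z0, Pt, ⟨?_, fun Y hY => ?_, ⟨48*K, fun Y hY Z hZ => ?_⟩, ψ, ?_, ri, li, fun X hX => ?_, ⟨6*K, fun X hX Z hZ => ?_⟩⟩, li, ?_, ?_⟩
  · rw [← Ps]; exact P.symm.bijOn
  · obtain ⟨T, _, _, T3⟩ := T' Y hY
    exact T3.differentiableAt.hasFDerivAt
  · obtain ⟨T, T1, T2, T3⟩ := T' Y hY
    obtain ⟨Q, Q1, Q2, Q3⟩ := T' Z hZ
    rw [T3.fderiv, Q3.fderiv]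
    have d1 : ‖P.symm Y - P.symm Z‖ ≤ 2*‖Y - Z‖ := by
      have l := lip _ (ms Y hY) _ (ms Z hZ)
      have e1 := ri Y hY; have e2 := ri Z hZ
      have e3 : Y - Z = (P.symm Y - P.symm Z) + (H (P.symm Y - x0) - H (P.symm Z - x0)) := by
        calc Y - Z = ψ (P.symm Y) - ψ (P.symm Z) := by rw [e1, e2]
          _ = _ := by
            show (P.symm Y - x0 + H (P.symm Y - x0)) - (P.symm Z - x0 + H (P.symm Z - x0)) = _
            abel
      have := norm_sub_le (Y - Z) (H (P.symm Y - x0) - H (P.symm Z - x0))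
      rw [show Y - Z - (H (P.symm Y - x0) - H (P.symm Z - x0)) = P.symm Y - P.symm Z by rw [e3, add_sub_cancel_right]] at this
      linarith only [l, this]
    have hh := hol (P.symm Z - x0) (P.symm Y - x0) (by linarith [mb _ (ms Z hZ)]) (by linarith [mb _ (ms Y hY)])
    rw [sub_sub_sub_cancel_right, norm_sub_rev (P.symm Z)] at hh
    have hb := rp_s b0.le b1 (by norm_num : (1:ℝ) ≤ 2) (norm_nonneg _) (norm_nonneg _) d1
    have hh2 : ‖B (P.symm Z - x0) - B (P.symm Y - x0)‖ ≤ 12*K*‖Y - Z‖^β := by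
      have := mul_le_mul_of_nonneg_left hb (show 0 ≤ 6*K by linarith); linarith
    refine ContinuousLinearMap.opNorm_le_bound _ (by positivity) fun v => ?_
    have e1 : (T.symm : V →L[ℝ] V) v - (Q.symm : V →L[ℝ] V) v = T.symm ((B (P.symm Z - x0) - B (P.symm Y - x0)) (Q.symm v)) := by
      rw [T.eq_symm_apply, map_sub]
      have q1 : T (T.symm v) = v := T.apply_symm_apply v
      have q2 : T (Q.symm v) = Q.symm v + B (P.symm Y - x0) (Q.symm v) := congrArg (fun f : V →L[ℝ] V => f (Q.symm v)) T1
      have q3 : Q (Q.symm v) = Q.symm v + B (P.symm Z - x0) (Q.symm v) := congrArg (fun f : V →L[ℝ] V => f (Q.symm v)) Q1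
      rw [Q.apply_symm_apply] at q3
      show T (T.symm v) - T (Q.symm v) = _
      rw [q1, q2, sub_apply]; nth_rewrite 1 [q3]; abel
    rw [sub_apply, e1]
    refine (T2 _).trans ?_
    have s1 := (B (P.symm Z - x0) - B (P.symm Y - x0)).le_of_opNorm_le hh2 (Q.symm v)
    have s2 := mul_le_mul_of_nonneg_left (Q2 v) (show 0 ≤ 12*K*‖Y - Z‖^β by positivity)
    linarith only [s1, s2]
  · rw [Pt]; refine ⟨mapsTo_image _ _, fun X hX Y hY e => ?_, subset_rfl⟩
    rw [← li X hX, ← li Y hY, e]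
  · exact (dψ X hX).differentiableAt.hasFDerivAt
  · rw [(dψ X hX).fderiv, (dψ Z hZ).fderiv, add_sub_add_left_eq_sub]
    have := hol (X - x0) (Z - x0) (by linarith [mb X hX]) (by linarith [mb Z hZ])
    rwa [sub_sub_sub_cancel_right] at this
  · rw [← ψ0]; exact li _ x0m
  · obtain ⟨T, T1, _, T3⟩ := T' 0 z0
    rw [T3.fderiv]
    have e0 : P.symm 0 = x0 := by rw [← ψ0]; exact li _ x0m
    rw [e0, sub_self, B0, add_zero] at T1
    ext1 v
    have : T v = v := congrArg (fun f : V →L[ℝ] V => f v) T1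
    show T.symm v = v
    rw [T.symm_apply_eq, this]
lemma UFc {n : V} {u v : V → ℝ} {K γ ρ s : ℝ} (hu : UF n u K γ ρ) (hv : UF n v K γ ρ) (hs : |s| = 1) : UF n (fun x => (1/2)*(u x + s*v x)) K γ ρ := by
  have K1 := hu.K1
  have key : ∀ p q c : ℝ, |p| ≤ c → |q| ≤ c → |(1/2)*(p + s*q)| ≤ c := fun p q c hp hq => by
    have := abs_add_le p (s*q)
    rw [abs_mul s, hs, one_mul] at this
    rw [abs_mul, abs_of_pos (by norm_num : (0:ℝ) < 1/2)]; linarith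
  refine ⟨K1, hu.r0, hu.r1, fun x hx hr => key _ _ _ (hu.gr x hx hr) (hv.gr x hx hr), fun x hx x0 hr => ?_⟩
  obtain ⟨L, L1, L2⟩ := hu.ex x hx x0 hr
  obtain ⟨M, M1, M2⟩ := hv.ex x hx x0 hr
  refine ⟨(1/2:ℝ) • (L + s • M), ?_, fun x' hx' hd => ?_⟩
  · rw [nsm_eq (by norm_num)]
    have := norm_add_le L (s • M)
    rw [norm_smul s, Real.norm_eq_abs, hs, one_mul] at this; linarith
  · have := key _ _ _ (L2 x' hx' hd) (M2 x' hx' hd)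
    rw [inner_smul_left, inner_add_left, inner_smul_left]
    convert this using 2; simp; ring
lemma KPc {n : V} (hn : ‖n‖ = 1) : IsKPCone (le_refl 4) 0 {Y : V | ⟪n, Y⟫^2 = ‖pr n Y‖^2} := by
  obtain ⟨e, he⟩ := ob_ext n hn
  refine ⟨(e.reindex (Equiv.swap 0 3)).repr, ?_⟩
  ext z
  set f := (e.reindex (Equiv.swap 0 3)).repr with hf
  have h3 : f z 3 = ⟪n, z⟫ := by
    rw [hf, OrthonormalBasis.repr_apply_apply, OrthonormalBasis.reindex_apply, Equiv.symm_swap, Equiv.swap_apply_right, he]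
  have hN : ‖z‖^2 = (f z 0)^2 + (f z 1)^2 + (f z 2)^2 + (f z 3)^2 := by
    rw [← f.norm_map z, EuclideanSpace.norm_sq_eq, Fin.sum_univ_four]; simp only [Real.norm_eq_abs, sq_abs]
  rw [nsq_pr hn z, h3] at hN
  show ⟪n, 0 + z⟫^2 = ‖pr n (0 + z)‖^2 ↔ (f z 3)^2 = (f z 0)^2 + (f z 1)^2 + (f z 2)^2
  rw [zero_add, h3]
  constructor <;> intro h <;> linarith
lemma pr_neg (n z : V) : pr (-n) z = pr n z := by simp [pr, inner_neg_left]
lemma CONC {S : Set V} {n : V} {K γ ρ : ℝ} (h : TG S n K γ ρ) (hS : (0:V) ∈ S) {T : Set V} {x0 : V} {r2 : ℝ} (h2 : 0 < r2)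
    (hT : ∀ X ∈ ball x0 r2, X ∈ T ↔ X - x0 ∈ S) :
    ∃ Cone : Set V, IsKPCone (le_refl 4) 0 Cone ∧ ∃ U U' : Set V, IsOpen U ∧ IsOpen U' ∧ (0:V) ∈ U ∧ x0 ∈ U' ∧ ∃ φ : V → V,
      IsC1HolderDiffeoOn (γ/2) U U' φ ∧ φ '' (Cone ∩ U) = T ∩ U' ∧ φ 0 = x0 ∧ fderiv ℝ φ 0 = ContinuousLinearMap.id ℝ V := by
  have hn := h.n1
  obtain ⟨_, _, h1⟩ := TGt h
  obtain ⟨_, _, h1'⟩ := TGt h.neg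
  obtain ⟨u, K1, ρ1, u1, u2, u3⟩ := SHEET h1 hS
  obtain ⟨v, K2, ρ2, v1, v2, v3⟩ := SHEET h1' hS
  have v1 : UF n v K2 γ ρ2 := by
    refine ⟨v1.K1, v1.r0, v1.r1, fun x hx => v1.gr x (by rw [inner_neg_left, hx, neg_zero]), fun x hx x0 hr => ?_⟩
    obtain ⟨L, L1, L2⟩ := v1.ex x (by rw [inner_neg_left, hx, neg_zero]) x0 hr
    exact ⟨L, L1, fun x' hx' => L2 x' (by rw [inner_neg_left, hx', neg_zero])⟩
  have rm : 0 < min ρ1 ρ2 := lt_min u1.r0 v1.r0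
  have u1 := u1.mono (le_max_left K1 K2) rm (min_le_left _ _)
  have v1 := v1.mono (le_max_right K1 K2) rm (min_le_right _ _)
  have hb := UFc (s := 1) u1 v1 (by simp)
  have ha := UFc (s := -1) u1 v1 (by simp)
  obtain ⟨K', ρ', B, k1, k2, k3, k4, k5, k6⟩ := GLUE hn (MKGF hn ha hb h.g0 h.g1) h.g0 h.g1
  set g : V → V := fun x => ((1/2)*(u x + 1*v x)) • (‖x‖⁻¹ • x) - ((1/2)*(u x + -1*v x)) • n with hg
  obtain ⟨r, s1, s2, U, φ, s3, s4, s5, s6, s7, s8, s9⟩ := PC (H := fun x => g (pr n x)) (by linarith only [h.g0]) (by linarith only [h.g1]) k1 k2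
    (by show g (pr n 0) = 0; rw [show pr n 0 = 0 by simp [pr]]; exact k4) k5 k6 x0 (lt_min h2 rm)
  refine ⟨{Y : V | ⟪n, Y⟫^2 = ‖pr n Y‖^2}, KPc hn, U, ball x0 r, s3, isOpen_ball, s4, mem_ball_self s1, φ, s6, ?_, s8, s9⟩
  have key : ∀ X ∈ ball x0 r, ((X - x0) + g (pr n (X - x0))) ∈ {Y : V | ⟪n, Y⟫^2 = ‖pr n Y‖^2} ↔ X ∈ T := by
    intro X hX
    rw [hT X (ball_subset_ball (s2.trans (min_le_left _ _)) hX)]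
    have zr : ‖X - x0‖ ≤ min ρ1 ρ2 := (mem_ball_iff_norm.1 hX).le.trans (s2.trans (min_le_right _ _))
    generalize X - x0 = z at *
    have z1 := zr.trans (min_le_left _ _); have z2 := zr.trans (min_le_right _ _)
    have w0 := n_pr hn z
    have w1 := pr_le hn z
    have zd := pr_dec n z
    have U3 := fun hz => u3 z hz z1
    have V3 := fun hz => v3 z hz z2
    obtain ⟨p1, p2⟩ := u2 _ w0 (w1.trans z1)
    obtain ⟨q1, q2⟩ := v2 (pr n z) (by rw [inner_neg_left, w0, neg_zero]) (w1.trans z2)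
    rw [pr_neg, inner_neg_left] at V3
    have u0 := u1.gr 0 (inner_zero_right _) (by rw [norm_zero]; exact rm.le)
    have v0 := v1.gr 0 (inner_zero_right _) (by rw [norm_zero]; exact rm.le)
    rw [norm_zero, mul_zero] at u0 v0
    have u0 := abs_nonpos_iff.1 u0; have v0 := abs_nonpos_iff.1 v0
    have e0 : ⟪n, z + g (pr n z)⟫ = ⟪n, z⟫ - (1/2)*(u (pr n z) + -1*v (pr n z)) := by
      rw [hg, inner_add_right, inner_sub_right, inner_smul_right, inner_smul_right, inner_smul_right, w0, real_inner_self_eq_norm_sq, hn]; ring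
    have e1 : ‖pr n (z + g (pr n z))‖ = ‖pr n z‖ + (1/2)*(u (pr n z) + 1*v (pr n z)) := by
      have : pr n (z + g (pr n z)) = pr n z + ((1/2)*(u (pr n z) + 1*v (pr n z))) • (‖pr n z‖⁻¹ • pr n z) := by
        have q : ⟪n, ((1/2)*(u (pr n z) + 1*v (pr n z))) • (‖pr n z‖⁻¹ • pr n z)⟫ = 0 := by rw [inner_smul_right, inner_smul_right, w0]; ring
        rw [pr_add, hg, pr_sub, pr_n hn, sub_zero, pr_of q]
      rw [this]
      generalize pr n z = w at *
      rcases eq_or_ne w 0 with e | e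
      · rw [e, u0, v0]; simp
      have W := norm_pos_iff.2 e
      have : w + ((1/2)*(u w + 1*v w)) • (‖w‖⁻¹ • w) = (‖w‖ + (1/2)*(u w + 1*v w)) • (‖w‖⁻¹ • w) := by
        rw [add_smul, smul_inv_smul₀ W.ne']
      rw [this, nsm_eq (by linarith only [p1, q1]), nsm_eq (by positivity), inv_mul_cancel₀ W.ne', mul_one]
    show ⟪n, z + g (pr n z)⟫^2 = ‖pr n (z + g (pr n z))‖^2 ↔ _
    rw [sq_eq_sq_iff_eq_or_eq_neg, e0, e1]
    generalize pr n z = w at *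
    constructor
    · rintro (hh | hh)
      · rw [show ‖w‖ + u w = ⟪n, z⟫ by linarith only [hh], ← zd] at p2; exact p2
      · rw [show ‖w‖ + v w = -⟪n, z⟫ by linarith only [hh], neg_smul_neg, ← zd] at q2; exact q2
    · intro hz
      rcases le_total 0 ⟪n, z⟫ with hh | hh
      · left; have := U3 hz hh; linarith only [this]
      · right; have := V3 hz (by linarith only [hh]); linarith only [this]
  ext X
  constructor
  · rintro ⟨Y, ⟨hY, hU⟩, rfl⟩
    rw [s5] at hU
    obtain ⟨X, hX, rfl⟩ := hU
    rw [s7 X hX]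
    exact ⟨(key X hX).1 hY, hX⟩
  · rintro ⟨hX, hb⟩
    exact ⟨_, ⟨(key X hb).2 hX, by rw [s5]; exact mem_image_of_mem _ hb⟩, s7 X hb⟩
lemma LOC {α : ℝ} (hα : 0 < α) {μ : Measure V} (hf : IsLocallyFiniteMeasure μ) (h : HolderAsympUniform α 3 μ) {x : V} (hx : x ∈ msupp μ) :
    ∃ (m : Measure V) (S : Set V) (C R d : ℝ), 0 < d ∧ HA m S C (min α 1) R ∧ ∀ z : V, ‖z‖ ≤ d → (z ∈ S ↔ x + z ∈ msupp μ) := by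
  have cl : IsClosed (msupp μ) := by
    refine isClosed_of_closure_subset fun y hy r hr => ?_
    obtain ⟨z, hz, hd⟩ := Metric.mem_closure_iff.1 hy (r/2) (by linarith)
    exact (hz (r/2) (by linarith)).trans_le (measure_mono (closedBall_subset_closedBall' (by rw [dist_comm]; linarith)))
  have nul : μ (msupp μ)ᶜ = 0 := by
    refine measure_null_of_locally_null _ fun y hy => ?_
    have hy : ¬ ∀ r : ℝ, 0 < r → 0 < μ (closedBall y r) := hy
    push Not at hy
    obtain ⟨r, r0, hr⟩ := hy
    exact ⟨_, mem_nhdsWithin_of_mem_nhds (closedBall_mem_nhds y r0), nonpos_iff_eq_zero.1 hr⟩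
  obtain ⟨C0, r0, rp, H⟩ := h (msupp μ ∩ closedBall x 1) inter_subset_left ((isCompact_closedBall x 1).inter_left cl)
  have op := om_pos
  set a := min α 1 with ha
  have a0 : 0 < a := lt_min hα one_pos
  have a1 : a ≤ 1 := min_le_right _ _
  set C1 := max C0 1
  have c1 : 1 ≤ C1 := le_max_right _ _
  have H : ∀ y ∈ msupp μ, dist y x ≤ 1 → ∀ t, 0 < t → t ≤ r0 → t ≤ 1 → |μ.real (closedBall y t) - om*t^3| ≤ om*t^3*(C1*t^a) := by
    intro y hy hd t t0 tr t1
    have := H y ⟨hy, mem_closedBall.2 hd⟩ t t0 tr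
    have p : 0 < om*t^3 := by positivity
    have e : μ.real (closedBall y t) - om*t^3 = om*t^3*((μ (closedBall y t)).toReal/(om*t^3) - 1) := by
      rw [mul_sub, mul_div_cancel₀ _ p.ne', mul_one]; rfl
    rw [e, abs_mul, abs_of_pos p]
    refine mul_le_mul_of_nonneg_left (this.trans ?_) p.le
    have q := pow_lo t0 t1 (min_le_left α 1)
    exact mul_le_mul (le_max_left _ _) q (by positivity) (by positivity)
  clear_value C1
  obtain ⟨d, q1, d0, q2⟩ := ((rp_t a0 (2*C1) one_pos).and (Ioc_mem_nhdsGT (show 0 < min (r0/2) (1/2) from lt_min (by linarith) (by norm_num)))).exists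
  have d1 := q2.trans (min_le_left _ _); have d2 := q2.trans (min_le_right _ _)
  have fin : ∀ p t, μ (closedBall p t) ≠ ∞ := fun p t => (isCompact_closedBall p t).measure_lt_top.ne
  have hp : ∀ t, 0 < t → t ≤ 2*d → C1*t^a ≤ 1 := fun t t0 ht => by
    have := mul_le_mul_of_nonneg_left (rp_s a0.le a1 (by norm_num : (1:ℝ) ≤ 2) t0.le d0.le ht) (by linarith : 0 ≤ C1)
    linarith
  have hu : ∀ y ∈ msupp μ, dist y x ≤ d → ∀ t, 0 < t → t ≤ 2*d → μ.real (closedBall y t) ≤ 2*om*t^3 := by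
    intro y hy hd t t0 td
    have := (abs_le.1 (H y hy (by linarith) t t0 (by linarith) (by linarith))).2
    have := mul_le_mul_of_nonneg_left (hp t t0 td) (show 0 ≤ om*t^3 by positivity)
    linarith
  have A : AU (μ.restrict (closedBall x d)) (msupp μ ∩ closedBall x d) 0 (-1) := by
    refine ⟨⟨by rw [Measure.restrict_apply_univ]; exact (fin x d).lt_top⟩, cl.inter isClosed_closedBall, ?_, fun p t t0 => ?_, fun p _ hp => absurd (norm_nonneg p) (by linarith)⟩
    · rw [Measure.restrict_apply (cl.inter isClosed_closedBall).isOpen_compl.measurableSet]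
      refine measure_mono_null (fun y hy => ?_) nul
      exact fun hm => hy.1 ⟨hm, hy.2⟩
    · rw [measureReal_restrict_apply measurableSet_closedBall]
      have t3 : 0 ≤ om*t^3 := by positivity
      rcases le_total d t with ht | ht
      · have b1 := hu x hx (by rw [dist_self]; exact d0.le) d d0 (by linarith)
        have b2 := measureReal_mono (μ := μ) (inter_subset_right (s := closedBall p t) (t := closedBall x d)) (fin x d)
        have b3 : om*d^3 ≤ om*t^3 := by gcongr
        linarith
      · by_cases hq : ∃ q ∈ msupp μ, q ∈ closedBall p t ∩ closedBall x d
        · obtain ⟨q, qm, qp, qd⟩ := hq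
          have b1 := hu q qm qd (2*t) (by linarith) (by linarith)
          have b2 : μ.real (closedBall p t ∩ closedBall x d) ≤ μ.real (closedBall q (2*t)) :=
            measureReal_mono (inter_subset_left.trans (closedBall_subset_closedBall' (by rw [dist_comm]; linarith [mem_closedBall.1 qp]))) (fin _ _)
          linarith
        · have : μ (closedBall p t ∩ closedBall x d) = 0 := measure_mono_null (fun q hm => fun hs => hq ⟨q, hs, hm⟩) nul
          rw [Measure.real, this]; simp; positivity
  have A2 := A.rs (y := x) (l := 1) (L' := -1 - ‖x‖) one_pos le_rfl le_rfl (by linarith)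
  have ev : ∀ p t, (rs x 1 (μ.restrict (closedBall x d))).real (closedBall p t) = μ.real (closedBall (x + p) t ∩ closedBall x d) := fun p t => by
    rw [rs_real one_pos, measureReal_restrict_apply measurableSet_closedBall]; simp
  have eS : ∀ z, z ∈ rS x 1 (msupp μ ∩ closedBall x d) ↔ x + z ∈ msupp μ ∧ ‖z‖ ≤ d := fun z => by
    show x + (1:ℝ) • z ∈ msupp μ ∩ closedBall x d ↔ _
    rw [one_smul, mem_inter_iff, mem_closedBall_iff_norm, add_sub_cancel_left]
  have dp : 0 < (d/2)^a := by positivity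
  refine ⟨_, _, 1 + om*C1 + 16*om/(d/2)^a, d/2, d, d0, ⟨⟨A2.fin, A2.cl, A2.nul, A2.up, fun p _ hp => absurd (norm_nonneg p) (by linarith)⟩, ?_, a0, a1, ?_, by linarith, by linarith, fun p hp hR t t0 => ?_⟩,
    fun z hz => (eS z).trans ⟨fun h => h.1, fun h => ⟨h, hz⟩⟩⟩
  · rw [eS, add_zero, norm_zero]; exact ⟨hx, d0.le⟩
  · have : 0 ≤ om*C1 + 16*om/(d/2)^a := by positivity
    linarith
  · have up := A2.up p t t0
    have nn : 0 ≤ (rs x 1 (μ.restrict (closedBall x d))).real (closedBall p t) := measureReal_nonneg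
    have t3 : 0 < om*t^3 := by positivity
    have ta : 0 < t^a := by positivity
    rcases le_total t (d/2) with ht | ht
    · have e : closedBall (x + p) t ∩ closedBall x d = closedBall (x + p) t :=
        inter_eq_left.2 (closedBall_subset_closedBall' (by rw [dist_eq_norm, add_sub_cancel_left]; linarith))
      rw [ev, e]
      refine (H (x + p) ((eS p).1 hp).1 (by rw [dist_eq_norm, add_sub_cancel_left]; linarith) t t0 (by linarith) (by linarith)).trans ?_
      have : 0 ≤ (1 + 16*om/(d/2)^a)*(t^3*t^a) := by positivity
      linarith
    · have b1 : |(rs x 1 (μ.restrict (closedBall x d))).real (closedBall p t) - om*t^3| ≤ 16*om*t^3 := abs_le.2 ⟨by linarith, by linarith⟩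
      refine b1.trans ?_
      have b2 : (d/2)^a ≤ t^a := by gcongr
      have b3 : 16*om ≤ 16*om/(d/2)^a*t^a := by
        rw [div_mul_eq_mul_div, le_div_iff₀ dp]; exact mul_le_mul_of_nonneg_left b2 (by linarith only [op])
      have b4 := mul_le_mul_of_nonneg_right b3 (show 0 ≤ t^3 by positivity)
      have : 0 ≤ (1 + om*C1)*(t^3*t^a) := by positivity
      linarith only [b4, this]
lemma MAIN (α : ℝ) (hα : 0 < α) :
    ∃ β : ℝ, 0 < β ∧
      ∀ μ : Measure (E 4), IsLocallyFiniteMeasure μ → HolderAsympUniform α 3 μ →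
      ∀ x ∈ msupp μ,
        ¬ Tendsto (fun r : ℝ => thetaP 3 (msupp μ) x r)
            (nhdsWithin 0 (Set.Ioi 0)) (nhds 0) →
        ∃ Cone : Set (E 4), IsKPCone (le_refl 4) 0 Cone ∧
        ∃ U U' : Set (E 4), IsOpen U ∧ IsOpen U' ∧ (0 : E 4) ∈ U ∧ x ∈ U' ∧
        ∃ φ : E 4 → E 4, IsC1HolderDiffeoOn β U U' φ ∧
          φ '' (Cone ∩ U) = msupp μ ∩ U' ∧ φ 0 = x ∧
          fderiv ℝ φ 0 = ContinuousLinearMap.id ℝ (E 4) := by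
  have a0 : 0 < min α 1 := lt_min hα one_pos
  refine ⟨min α 1/300/2, by positivity, fun μ hf h x hx hnf => ?_⟩
  obtain ⟨m, S, C, R, d, d0, hA, hS⟩ := LOC hα hf h hx
  have nf : ¬ FlatAt S 0 := fun hF => hnf (thetaP_flat hx fun ε hε => by
    obtain ⟨σ0, s0, H⟩ := hF ε hε
    refine ⟨min σ0 d, lt_min s0 d0, fun σ sp hs => ?_⟩
    have sd := hs.trans (min_le_right _ _)
    obtain ⟨n, n1, n2, n3⟩ := H σ sp (hs.trans (min_le_left _ _))
    refine ⟨n, n1, fun z hz hzs => ?_, fun w hw hws => ?_⟩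
    · have := n2 (z - x) ((hS _ (hzs.trans sd)).2 (by rwa [add_sub_cancel])) (by rwa [sub_zero])
      rwa [sub_zero] at this
    · obtain ⟨z, z1, z2, z3⟩ := n3 w hw hws
      rw [sub_zero] at z2; rw [zero_add] at z3
      exact ⟨x + z, (hS z (z2.trans sd)).1 z1, by rwa [add_sub_cancel_left], by rwa [add_sub_add_left_eq_sub]⟩)
  obtain ⟨s0, s1, s2⟩ := NF hA nf
  obtain ⟨n, K, ρ, hT⟩ := MKTG hA s1 s2
  exact CONC hT hA.zero d0 fun X hX => by
    rw [hS _ (mem_ball_iff_norm.1 hX).le, add_sub_cancel]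
end
/-- Theorem 1.7 / Theorem 4.1, the main theorem: near a nonflat point of
the support of an `(α,3)`-Hölder asymptotically uniform measure on `ℝ⁴`, the support is
`C^{1,β}` diffeomorphic to a neighborhood of the singular point of a KP cone, via a map
sending `0` to the point with identity differential at `0`. -/
theorem nonflat_point_parametrization (α : ℝ) (hα : 0 < α) :
    ∃ β : ℝ, 0 < β ∧
      ∀ μ : Measure (E 4), IsLocallyFiniteMeasure μ → HolderAsympUniform α 3 μ →
      ∀ x ∈ msupp μ,
        ¬ Tendsto (fun r : ℝ => thetaP 3 (msupp μ) x r)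
            (nhdsWithin 0 (Set.Ioi 0)) (nhds 0) →
        ∃ Cone : Set (E 4), IsKPCone (le_refl 4) 0 Cone ∧
        ∃ U U' : Set (E 4), IsOpen U ∧ IsOpen U' ∧ (0 : E 4) ∈ U ∧ x ∈ U' ∧
        ∃ φ : E 4 → E 4, IsC1HolderDiffeoOn β U U' φ ∧
          φ '' (Cone ∩ U) = msupp μ ∩ U' ∧ φ 0 = x ∧
          fderiv ℝ φ 0 = ContinuousLinearMap.id ℝ (E 4) := MAIN α hα
end
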